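/- Let g ≥ 1 and n ≥ 1 be integers. There exists a polynomial P ∈ ℤ[X] such that for every finite field F_q, the number of 2g-tuples (x_1,y_1,…,x_g,y_g) ∈ GL(n,F_q)^{2g} satisfying [x_1,y_1][x_2,y_2]⋯[x_g,y_g] = I_n equals |GL(n,F_q)| · P(q); that is, the number of homomorphisms from the fundamental group of a closed genus-g surface to GL(n,F_q), divided by |GL(n,F_q)|, is a polynomial in q with integer coefficients. -/

import Mathlib

noncomputable section
open scoped BigOperators
open Module
set_option linter.all false

namespace HallGL

section cls
variable (F : Type) [Field F] [Fintype F]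

/-- similarity of endomorphisms of coordinate spaces -/
def simSetoid : Setoid (Σ n : ℕ, Module.End F (Fin n → F)) where
  r a b := ∃ e : (Fin a.1 → F) ≃ₗ[F] (Fin b.1 → F), ∀ v, e (a.2 v) = b.2 (e v)
  iseqv := by
    refine ⟨fun a => ⟨LinearEquiv.refl F _, fun v => rfl⟩, ?_, ?_⟩
    · rintro a b ⟨e, he⟩
      refine ⟨e.symm, fun v => ?_⟩
      apply e.injective
      rw [he]; simp
    · rintro a b c ⟨e, he⟩ ⟨f, hf⟩
      refine ⟨e.trans f, fun v => ?_⟩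
      simp [he, hf]

/-- isomorphism classes of finite dimensional spaces with an endomorphism -/
def X : Type := Quotient (simSetoid F)

variable {F}

/-- degree of a class -/
def deg (x : X F) : ℕ := Quotient.lift (fun a : (Σ n : ℕ, Module.End F (Fin n → F)) => a.1)
  (by
    rintro a b ⟨e, he⟩
    have := e.finrank_eq
    simpa using this) x

variable {V W U : Type} [AddCommGroup V] [Module F V] [Finite V]
  [AddCommGroup W] [Module F W] [Finite W] [AddCommGroup U] [Module F U] [Finite U]

/-- class of an endomorphism -/
def cls (φ : Module.End F V) : X F :=
  Quotient.mk (simSetoid F) ⟨finrank F V, (finBasis F V).equivFun.conj φ⟩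

theorem cls_eq_iff (φ : Module.End F V) (ψ : Module.End F W) :
    cls φ = cls ψ ↔ ∃ e : V ≃ₗ[F] W, ∀ v, e (φ v) = ψ (e v) := by
  constructor
  · intro h
    obtain ⟨e, he⟩ := Quotient.exact h
    refine ⟨((finBasis F V).equivFun.trans e).trans (finBasis F W).equivFun.symm, fun v => ?_⟩
    generalize (finBasis F V).equivFun = eV at e he
    generalize (finBasis F W).equivFun = eW at e he
    have := he (eV v)
    apply eW.injective
    simp only [LinearEquiv.conj_apply_apply, LinearEquiv.symm_apply_apply] at this
    simp only [LinearEquiv.trans_apply, LinearEquiv.apply_symm_apply, this]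
  · rintro ⟨e, he⟩
    apply Quotient.sound
    refine ⟨((finBasis F V).equivFun.symm.trans e).trans (finBasis F W).equivFun, fun v => ?_⟩
    simp [LinearEquiv.conj_apply, he]

theorem deg_cls (φ : Module.End F V) : deg (cls φ) = finrank F V := rfl

theorem exists_rep (x : X F) : ∃ φ : Module.End F (Fin (deg x) → F), cls φ = x := by
  induction x using Quotient.inductionOn with
  | h a =>
    refine ⟨a.2, ?_⟩
    apply Quotient.sound
    refine ⟨(finBasis F (Fin a.1 → F)).equivFun.symm, fun v => ?_⟩
    have h : ∀ v : Fin (finrank F (Fin a.1 → F)) → F,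
        (finBasis F (Fin a.1 → F)).equivFun.symm ((finBasis F (Fin a.1 → F)).equivFun.conj a.2 v) =
          a.2 ((finBasis F (Fin a.1 → F)).equivFun.symm v) := fun v => by
      rw [LinearEquiv.conj_apply_apply, LinearEquiv.symm_apply_apply]
    exact h v

/-- representative -/
def rep (x : X F) : Module.End F (Fin (deg x) → F) := Classical.choose (exists_rep x)

theorem cls_rep (x : X F) : cls (rep x) = x := Classical.choose_spec (exists_rep x)

/-- if `finrank = deg`, there is a representative on that space -/
theorem exists_rep_on (x : X F) (h : deg x = finrank F V) : ∃ φ : Module.End F V, cls φ = x := by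
  obtain ⟨ψ, hψ⟩ := exists_rep x
  have e : V ≃ₗ[F] (Fin (deg x) → F) := LinearEquiv.ofFinrankEq _ _ (by simp [h])
  refine ⟨e.symm.conj ψ, ?_⟩
  refine Eq.trans ?_ hψ
  rw [cls_eq_iff]
  exact ⟨e, fun v => by simp [LinearEquiv.conj_apply]⟩

theorem cls_conj (e : V ≃ₗ[F] W) (φ : Module.End F V) : cls (e.conj φ) = cls φ := by
  rw [eq_comm, cls_eq_iff]
  exact ⟨e, fun v => by simp [LinearEquiv.conj_apply]⟩

instance (S : Submodule F V) : Finite (V ⧸ S) := Finite.of_surjective _ S.mkQ_surjective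

/-- stable subspaces -/
abbrev St (φ : Module.End F V) : Type := {W : Submodule F V // W ≤ W.comap φ}

instance (φ : Module.End F V) : Finite (St φ) := by unfold St; infer_instance
instance (φ : Module.End F V) : Fintype (St φ) := Fintype.ofFinite _
instance : Finite (V →ₗ[F] W) := DFunLike.finite _
instance : Fintype (V →ₗ[F] W) := Fintype.ofFinite _

def sub (φ : Module.End F V) (W : St φ) : X F := cls (φ.restrict (p := W.1) (q := W.1) W.2)
def quo (φ : Module.End F V) (W : St φ) : X F := cls (W.1.mapQ W.1 φ W.2)

theorem sub_eq (φ : Module.End F V) (S : St φ) (ψ : Module.End F W) (f : W →ₗ[F] V)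
    (hf : Function.Injective f) (hc : ∀ w, f (ψ w) = φ (f w)) (hr : LinearMap.range f = S.1) :
    sub φ S = cls ψ := by
  rw [eq_comm, sub, cls_eq_iff]
  refine ⟨(LinearEquiv.ofInjective f hf).trans (LinearEquiv.ofEq _ _ hr), fun v => ?_⟩
  apply Subtype.ext
  simp [hc]

theorem quo_eq (φ : Module.End F V) (S : St φ) (ψ : Module.End F W) (f : V →ₗ[F] W)
    (hf : Function.Surjective f) (hc : ∀ w, f (φ w) = ψ (f w)) (hr : LinearMap.ker f = S.1) :
    quo φ S = cls ψ := by
  rw [quo, cls_eq_iff]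
  refine ⟨(Submodule.quotEquivOfEq _ _ hr.symm).trans (f.quotKerEquivOfSurjective hf), fun v => ?_⟩
  induction v using Submodule.Quotient.induction_on with
  | _ v => simp [hc]

/-- transport of stable subspaces -/
def StEquiv (φ : Module.End F V) (ψ : Module.End F W) (e : V ≃ₗ[F] W) (he : ∀ v, e (φ v) = ψ (e v)) :
    St φ ≃ St ψ where
  toFun S := ⟨S.1.map e.toLinearMap, by
    rintro _ ⟨v, hv, rfl⟩
    exact ⟨φ v, S.2 hv, he v⟩⟩
  invFun S := ⟨S.1.comap e.toLinearMap, by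
    intro v hv
    have := S.2 hv
    simp only [Submodule.mem_comap] at this ⊢
    simpa [he] using this⟩
  left_inv S := Subtype.ext (Submodule.comap_map_eq_of_injective e.injective _)
  right_inv S := Subtype.ext (Submodule.map_comap_eq_of_surjective e.surjective _)

theorem sub_StEquiv (φ : Module.End F V) (ψ : Module.End F W) (e : V ≃ₗ[F] W)
    (he : ∀ v, e (φ v) = ψ (e v)) (S : St φ) : sub ψ (StEquiv φ ψ e he S) = sub φ S := by
  rw [sub_eq ψ _ (φ.restrict (p := S.1) (q := S.1) S.2) (e.toLinearMap ∘ₗ S.1.subtype)]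
  · rfl
  · exact e.injective.comp Subtype.val_injective
  · intro w; simp [he]
  · rw [LinearMap.range_comp, Submodule.range_subtype]; rfl

theorem quo_StEquiv (φ : Module.End F V) (ψ : Module.End F W) (e : V ≃ₗ[F] W)
    (he : ∀ v, e (φ v) = ψ (e v)) (S : St φ) : quo ψ (StEquiv φ ψ e he S) = quo φ S := by
  rw [quo_eq φ S (Submodule.mapQ _ _ ψ (StEquiv φ ψ e he S).2)
    ((StEquiv φ ψ e he S).1.mkQ ∘ₗ e.toLinearMap)]
  · rfl
  · exact (Submodule.mkQ_surjective _).comp e.surjective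
  · intro w; simp [he]
  · rw [LinearMap.ker_comp, Submodule.ker_mkQ]
    exact Submodule.comap_map_eq_of_injective e.injective _

end cls
end HallGL

namespace HallGL

section hall
variable {F : Type} [Field F] [Fintype F]
variable {V W U : Type} [AddCommGroup V] [Module F V] [Finite V]
  [AddCommGroup W] [Module F W] [Finite W] [AddCommGroup U] [Module F U] [Finite U]

/-- Hall algebra (functions on classes) -/
def Hall (F : Type) [Field F] [Fintype F] (R : Type) : Type := X F → R

variable {R : Type} [CommRing R]

instance : AddCommGroup (Hall F R) := inferInstanceAs (AddCommGroup (X F → R))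

/-- Hall product -/
def hmul (a b : Hall F R) : Hall F R := fun x => ∑ S : St (rep x), a (sub _ S) * b (quo _ S)

theorem hmul_cls (a b : Hall F R) (φ : Module.End F V) :
    hmul a b (cls φ) = ∑ S : St φ, a (sub φ S) * b (quo φ S) := by
  obtain ⟨e, he⟩ := (cls_eq_iff φ (rep (cls φ))).1 (cls_rep _).symm
  rw [hmul]
  symm
  apply Fintype.sum_equiv (StEquiv φ _ e he)
  intro S
  rw [sub_StEquiv, quo_StEquiv]

theorem hall_ext {a b : Hall F R} (h : ∀ (n : ℕ) (φ : Module.End F (Fin n → F)), a (cls φ) = b (cls φ)) :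
    a = b := by
  funext x
  rw [← cls_rep x]
  exact h _ _

/-- unit -/
def hone : Hall F R := fun x => if deg x = 0 then 1 else 0

theorem deg_sub (φ : Module.End F V) (S : St φ) : deg (sub φ S) = finrank F S.1 := rfl
theorem deg_quo (φ : Module.End F V) (S : St φ) : deg (quo φ S) = finrank F (V ⧸ S.1) := rfl
theorem deg_sub_add_quo (φ : Module.End F V) (S : St φ) :
    deg (sub φ S) + deg (quo φ S) = finrank F V := by
  rw [deg_sub, deg_quo, add_comm]; exact Submodule.finrank_quotient_add_finrank S.1

def Stbot (φ : Module.End F V) : St φ := ⟨⊥, by simp⟩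
def Sttop (φ : Module.End F V) : St φ := ⟨⊤, by simp⟩

theorem quo_bot (φ : Module.End F V) : quo φ (Stbot φ) = cls φ :=
  quo_eq φ _ φ LinearMap.id (fun x => ⟨x, rfl⟩) (fun _ => rfl) (LinearMap.ker_id)
theorem sub_top (φ : Module.End F V) : sub φ (Sttop φ) = cls φ :=
  sub_eq φ _ φ LinearMap.id (fun x y h => h) (fun _ => rfl) (LinearMap.range_id)

theorem hone_hmul (a : Hall F R) : hmul hone a = a := by
  apply hall_ext
  intro n φ
  rw [hmul_cls, Finset.sum_eq_single (Stbot φ)]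
  · rw [quo_bot, hone, if_pos, one_mul]
    rw [deg_sub]; exact finrank_bot F _
  · intro S _ hS
    rw [hone, if_neg, zero_mul]
    rw [deg_sub]
    intro h
    exact hS (Subtype.ext (Submodule.finrank_eq_zero.1 h))
  · simp

/-- stable subspaces inside one -/
def StSub (φ : Module.End F V) (W : St φ) :
    St (φ.restrict (p := W.1) (q := W.1) W.2) ≃ {U : St φ // U.1 ≤ W.1} where
  toFun S := ⟨⟨S.1.map W.1.subtype, by
    rintro _ ⟨v, hv, rfl⟩
    exact ⟨_, S.2 hv, rfl⟩⟩, by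
    rintro _ ⟨v, hv, rfl⟩
    exact v.2⟩
  invFun U := ⟨U.1.1.comap W.1.subtype, fun v hv => U.1.2 hv⟩
  left_inv S := Subtype.ext (Submodule.comap_map_eq_of_injective W.1.injective_subtype _)
  right_inv U := Subtype.ext (Subtype.ext (by
    show Submodule.map _ (Submodule.comap _ _) = _
    rw [Submodule.map_comap_subtype]
    exact inf_eq_right.2 U.2))

def StQuo (φ : Module.End F V) (U : St φ) :
    St (U.1.mapQ U.1 φ U.2) ≃ {W : St φ // U.1 ≤ W.1} where
  toFun S := ⟨⟨S.1.comap U.1.mkQ, fun v hv => S.2 hv⟩, by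
    intro v hv
    show U.1.mkQ v ∈ S.1
    rw [(Submodule.Quotient.mk_eq_zero U.1).2 hv |> (fun h => (h : U.1.mkQ v = 0))]
    exact S.1.zero_mem⟩
  invFun W := ⟨W.1.1.map U.1.mkQ, by
    rintro _ ⟨v, hv, rfl⟩
    exact ⟨φ v, W.1.2 hv, rfl⟩⟩
  left_inv S := Subtype.ext (Submodule.map_comap_eq_of_surjective U.1.mkQ_surjective _)
  right_inv W := Subtype.ext (Subtype.ext (by
    show Submodule.comap _ (Submodule.map _ _) = _
    rw [Submodule.comap_map_mkQ]
    exact sup_eq_right.2 W.2))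

theorem sub_StSub (φ : Module.End F V) (W : St φ) (S) :
    sub φ (StSub φ W S).1 = sub _ S := by
  refine sub_eq φ _ _ (W.1.subtype ∘ₗ S.1.subtype)
    (W.1.injective_subtype.comp S.1.injective_subtype) (fun _ => rfl) ?_
  rw [LinearMap.range_comp, Submodule.range_subtype]; rfl

theorem quo_StQuo (φ : Module.End F V) (U : St φ) (S) :
    quo φ (StQuo φ U S).1 = quo _ S := by
  refine quo_eq φ _ _ (S.1.mkQ ∘ₗ U.1.mkQ)
    (S.1.mkQ_surjective.comp U.1.mkQ_surjective) (fun _ => rfl) ?_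
  rw [LinearMap.ker_comp, Submodule.ker_mkQ]; rfl

theorem mid_eq (φ : Module.End F V) (U W : St φ) (h : U.1 ≤ W.1) :
    quo _ ((StSub φ W).symm ⟨U, h⟩) = sub _ ((StQuo φ U).symm ⟨W, h⟩) := by
  have hle : ((StSub φ W).symm ⟨U, h⟩).1 ≤ U.1.comap W.1.subtype := le_refl _
  refine (sub_eq _ _ _ (Submodule.mapQ _ _ W.1.subtype hle) ?_ ?_ ?_).symm
  · rw [← LinearMap.ker_eq_bot, Submodule.ker_mapQ]
    show Submodule.map _ ((StSub φ W).symm ⟨U, h⟩).1 = ⊥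
    rw [Submodule.mkQ_map_self]
  · intro w
    induction w using Submodule.Quotient.induction_on with
    | _ v => rfl
  · rw [Submodule.range_mapQ, Submodule.range_subtype]; rfl

theorem hmul_assoc (a b c : Hall F R) : hmul (hmul a b) c = hmul a (hmul b c) := by
  classical
  apply hall_ext
  intro n φ
  rw [hmul_cls, hmul_cls]
  have h1 : ∀ S : St φ, hmul a b (sub φ S) * c (quo φ S) =
      ∑ U : {U : St φ // U.1 ≤ S.1}, a (sub φ U.1) * b (quo _ ((StSub φ S).symm U)) * c (quo φ S) := by
    intro S
    rw [sub, hmul_cls, Finset.sum_mul]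
    refine Fintype.sum_equiv (StSub φ S) _ _ (fun T => ?_)
    rw [sub_StSub, Equiv.symm_apply_apply]
  have h2 : ∀ U : St φ, a (sub φ U) * hmul b c (quo φ U)  =
      ∑ S : {S : St φ // U.1 ≤ S.1}, a (sub φ U) * b (sub _ ((StQuo φ U).symm S)) * c (quo φ S.1) := by
    intro U
    rw [quo, hmul_cls, Finset.mul_sum]
    refine Fintype.sum_equiv (StQuo φ U) _ _ (fun T => ?_)
    rw [quo_StQuo, Equiv.symm_apply_apply, mul_assoc]
  simp_rw [h1, h2]
  rw [← Fintype.sum_sigma' (fun (S : St φ) (U : {U : St φ // U.1 ≤ S.1}) => a (sub φ U.1) * b (quo _ ((StSub φ S).symm U)) * c (quo φ S)),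
    ← Fintype.sum_sigma' (fun (U : St φ) (S : {S : St φ // U.1 ≤ S.1}) => a (sub φ U) * b (sub _ ((StQuo φ U).symm S)) * c (quo φ S.1))]
  refine Fintype.sum_equiv ⟨fun x => ⟨x.2.1, x.1, x.2.2⟩, fun x => ⟨x.2.1, x.1, x.2.2⟩, fun _ => rfl, fun _ => rfl⟩ _ _ ?_
  rintro ⟨S, U, h⟩
  rw [mid_eq]; rfl

/-- Frobenius functional on a primary cyclic module -/
theorem exists_frob (p : Polynomial F) (hp : Irreducible p) (e : ℕ) :
    ∃ l : (Polynomial F ⧸ Ideal.span {p ^ e}) →ₗ[F] F, ∀ a, a ≠ 0 → ∃ b, l (a * b) ≠ 0 := by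
  classical
  rcases Nat.eq_zero_or_pos e with rfl | he
  · refine ⟨0, fun a ha => absurd ?_ ha⟩
    obtain ⟨a, rfl⟩ := Ideal.Quotient.mk_surjective a
    rw [Ideal.Quotient.eq_zero_iff_mem]; simp
  set I := Ideal.span {p ^ e}
  have hne : (Ideal.Quotient.mk I (p ^ (e-1))) ≠ 0 := by
    rw [Ne, Ideal.Quotient.eq_zero_iff_mem, Ideal.mem_span_singleton,
      pow_dvd_pow_iff hp.ne_zero hp.not_isUnit]
    omega
  obtain ⟨l, hl⟩ : ∃ l : Module.Dual F (Polynomial F ⧸ I), l (Ideal.Quotient.mk I (p ^ (e-1))) ≠ 0 := by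
    by_contra hcon
    push Not at hcon
    exact hne ((Module.forall_dual_apply_eq_zero_iff F _).1 hcon)
  refine ⟨l, fun a ha => ?_⟩
  obtain ⟨a, rfl⟩ := Ideal.Quotient.mk_surjective a
  rw [Ne, Ideal.Quotient.eq_zero_iff_mem, Ideal.mem_span_singleton] at ha
  obtain ⟨k, hk, hd⟩ := (dvd_prime_pow hp.prime _).1 (EuclideanDomain.gcd_dvd_right a (p ^ e))
  have hke : k < e := by
    by_contra h
    have : k = e := by omega
    subst this
    exact ha (hd.symm.dvd.trans (EuclideanDomain.gcd_dvd_left _ _))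
  have : ∃ b c, a * b + p ^ e * c = p ^ (e - 1) := by
    obtain ⟨c, hc⟩ := (hd.dvd).trans (pow_dvd_pow p (show k ≤ e - 1 by omega))
    refine ⟨EuclideanDomain.gcdA a (p^e) * c, EuclideanDomain.gcdB a (p^e) * c, ?_⟩
    rw [hc, EuclideanDomain.gcd_eq_gcd_ab]; ring
  obtain ⟨b, c, hbc⟩ := this
  refine ⟨Ideal.Quotient.mk I b, ?_⟩
  rw [← map_mul]
  convert hl using 2
  rw [Ideal.Quotient.eq, ← hbc, Ideal.mem_span_singleton]
  exact ⟨-c, by ring⟩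

open Polynomial in
theorem exists_selfdual (φ : Module.End F V) :
    ∃ e : V ≃ₗ[F] Module.Dual F V, ∀ v, e (φ v) = φ.dualMap (e v) := by
  classical
  have hfin : Module.Finite F V := inferInstance
  have htor : Module.IsTorsion F[X] (AEval' φ) := by
    intro x
    refine ⟨⟨minpoly F φ, mem_nonZeroDivisors_of_ne_zero (minpoly.ne_zero (Algebra.IsIntegral.isIntegral φ))⟩, ?_⟩
    show minpoly F φ • x = 0
    obtain ⟨v, rfl⟩ := (AEval'.of φ).surjective x
    have := AEval.of_aeval_smul (R := F) (M := V) φ (minpoly F φ) v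
    rw [minpoly.aeval, zero_smul, map_zero] at this
    exact this.symm
  obtain ⟨ι, hι, p, hp, k, ⟨E⟩⟩ := Module.equiv_directSum_of_isTorsion htor
  choose l hl using fun i => exists_frob (p i) (hp i) (k i)
  let c : V →ₗ[F] (DirectSum ι (fun i => F[X] ⧸ Ideal.span {p i ^ k i})) :=
    (E.restrictScalars F).toLinearMap ∘ₗ (AEval'.of φ).toLinearMap
  have hcinj : Function.Bijective c := (E.bijective).comp (AEval'.of φ).bijective
  have hcX : ∀ v i, c (φ v) i = Ideal.Quotient.mk _ (Polynomial.X) * c v i := by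
    intro v i
    have : c (φ v) = (Polynomial.X : F[X]) • c v := by
      show E (AEval'.of φ (φ v)) = (Polynomial.X : F[X]) • E (AEval'.of φ v)
      rw [← AEval'.X_smul_of, map_smul]
    rw [this]
    rfl
  have hsm : ∀ (t : F) v i, c (t • v) i = t • c v i := by
    intro t v i; rw [map_smul]; rfl
  let B : V →ₗ[F] V →ₗ[F] F := LinearMap.mk₂ F (fun v w => ∑ i, l i (c v i * c w i))
    (by intro a b w; simp [add_mul, Finset.sum_add_distrib])
    (by intro t a w; simp only [hsm]; simp only [smul_mul_assoc, mul_smul_comm, map_smul, Finset.smul_sum])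
    (by intro a b w; simp [mul_add, Finset.sum_add_distrib])
    (by intro t a w; simp only [hsm]; simp only [smul_mul_assoc, mul_smul_comm, map_smul, Finset.smul_sum])
  have hB : Function.Injective B := by
    rw [injective_iff_map_eq_zero]
    intro v hv
    by_contra hne
    have : c v ≠ 0 := fun h => hne (hcinj.1 (h.trans (map_zero c).symm))
    obtain ⟨i, hi⟩ : ∃ i, c v i ≠ 0 := by
      by_contra hcon
      push Not at hcon
      exact this (DFinsupp.ext hcon)
    obtain ⟨b, hb⟩ := hl i _ hi
    obtain ⟨w, hw⟩ := hcinj.2 (DirectSum.of (fun i : ι => F[X] ⧸ Ideal.span {p i ^ k i}) i b)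
    have h0 := LinearMap.congr_fun hv w
    simp only [B, LinearMap.mk₂_apply, LinearMap.zero_apply] at h0
    rw [Finset.sum_eq_single i] at h0
    · rw [hw, DirectSum.of_eq_same] at h0; exact hb h0
    · intro j _ hj
      rw [hw, DirectSum.of_eq_of_ne _ _ _ hj]; simp
    · simp
  refine ⟨LinearMap.linearEquivOfInjective B hB (Subspace.dual_finrank_eq).symm, ?_⟩
  intro v
  ext w
  simp only [LinearMap.linearEquivOfInjective_apply, LinearMap.dualMap_apply]
  show ∑ i, l i (c (φ v) i * c w i) = ∑ i, l i (c v i * c (φ w) i)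
  refine Finset.sum_congr rfl (fun i _ => ?_)
  rw [hcX, hcX]
  congr 1; ring

theorem cls_dual (φ : Module.End F V) : cls (F := F) (V := Module.Dual F V) φ.dualMap = cls φ := by
  rw [eq_comm, cls_eq_iff]
  exact exists_selfdual φ

def StDual (φ : Module.End F V) : St φ ≃ St (V := Module.Dual F V) φ.dualMap where
  toFun S := ⟨S.1.dualAnnihilator, by
    intro f hf
    simp only [Submodule.mem_comap, Submodule.mem_dualAnnihilator] at hf ⊢
    intro w hw
    exact hf _ (S.2 hw)⟩
  invFun S := ⟨S.1.dualCoannihilator, by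
    intro f hf
    simp only [Submodule.mem_comap, Submodule.mem_dualCoannihilator] at hf ⊢
    intro w hw
    exact hf _ (S.2 hw)⟩
  left_inv S := Subtype.ext (Subspace.dualAnnihilator_dualCoannihilator_eq)
  right_inv S := Subtype.ext (Subspace.dualCoannihilator_dualAnnihilator_eq)

theorem sub_StDual (φ : Module.End F V) (S : St φ) : sub _ (StDual φ S) = quo φ S := by
  rw [quo, ← cls_dual]
  refine sub_eq _ _ _ (S.1.mkQ.dualMap) (LinearMap.dualMap_injective_of_surjective S.1.mkQ_surjective) ?_ ?_
  · intro w; ext v; rfl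
  · exact Submodule.range_dualMap_mkQ_eq _

theorem quo_StDual (φ : Module.End F V) (S : St φ) : quo _ (StDual φ S) = sub φ S := by
  rw [sub, ← cls_dual]
  refine quo_eq _ _ _ (S.1.dualRestrict) (Subspace.dualRestrict_surjective) ?_ ?_
  · intro w; ext v; rfl
  · exact Submodule.dualRestrict_ker_eq_dualAnnihilator _

theorem hmul_comm (a b : Hall F R) : hmul a b = hmul b a := by
  apply hall_ext
  intro n φ
  rw [← cls_dual, hmul_cls, cls_dual, hmul_cls]
  symm
  refine Fintype.sum_equiv (StDual φ) _ _ (fun S => ?_)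
  rw [sub_StDual, quo_StDual, mul_comm]

instance : CommRing (Hall F R) where
  __ := (inferInstance : AddCommGroup (Hall F R))
  mul := hmul
  one := hone
  mul_assoc := hmul_assoc
  one_mul := hone_hmul
  mul_one a := (hmul_comm a hone).trans (hone_hmul a)
  mul_comm := hmul_comm
  left_distrib a b c := by
    funext x
    show ∑ S : St (rep x), a (sub _ S) * (b (quo _ S) + c (quo _ S)) = hmul a b x + hmul a c x
    simp only [hmul, mul_add, Finset.sum_add_distrib]
  right_distrib a b c := by
    funext x
    show ∑ S : St (rep x), (a (sub _ S) + b (sub _ S)) * c (quo _ S) = hmul a c x + hmul b c x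
    simp only [hmul, add_mul, Finset.sum_add_distrib]
  zero_mul a := by
    funext x
    show ∑ S : St (rep x), 0 * a (quo _ S) = 0
    simp
  mul_zero a := by
    funext x
    show ∑ S : St (rep x), a (sub _ S) * 0 = 0
    simp

theorem mul_cls (a b : Hall F R) (φ : Module.End F V) :
    (a * b) (cls φ) = ∑ S : St φ, a (sub φ S) * b (quo φ S) := hmul_cls a b φ

theorem one_apply (x : X F) : (1 : Hall F R) x = if deg x = 0 then 1 else 0 := rfl
theorem add_apply (a b : Hall F R) (x : X F) : (a + b) x = a x + b x := rfl
theorem neg_apply (a : Hall F R) (x : X F) : (-a) x = -a x := rfl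
theorem sub_apply (a b : Hall F R) (x : X F) : (a - b) x = a x - b x := rfl
theorem zero_apply (x : X F) : (0 : Hall F R) x = 0 := rfl

end hall
end HallGL

namespace HallGL

section avg
variable {K : Type} [CommRing K] [Algebra ℂ K]

/-- average -/
def avg {s : Type} [Fintype s] (f : s → K) : K := ((Fintype.card s : ℂ)⁻¹) • ∑ i, f i

theorem avg_equiv {s t : Type} [Fintype s] [Fintype t] (e : s ≃ t) (f : s → K) (g : t → K)
    (h : ∀ x, f x = g (e x)) : avg f = avg g := by
  rw [avg, avg, Fintype.card_congr e, Fintype.sum_equiv e f g h]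

theorem avg_const {s : Type} [Fintype s] [Nonempty s] (c : K) : avg (fun _ : s => c) = c := by
  rw [avg, Finset.sum_const, Finset.card_univ, ← Nat.cast_smul_eq_nsmul ℂ, smul_smul, inv_mul_cancel₀, one_smul]
  exact_mod_cast Fintype.card_ne_zero

theorem avg_congr {s : Type} [Fintype s] {f g : s → K} (h : ∀ x, f x = g x) : avg f = avg g := by
  rw [funext h]

theorem avg_prod {s t : Type} [Fintype s] [Fintype t] (f : s × t → K) :
    avg f = avg (fun x => avg (fun y => f (x, y))) := by
  simp only [avg, Fintype.card_prod, Fintype.sum_prod_type, ← Finset.smul_sum, smul_smul]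
  congr 1
  push_cast
  rw [mul_inv]

theorem avg_mul_left {s : Type} [Fintype s] (c : K) (f : s → K) : avg (fun x => c * f x) = c * avg f := by
  simp only [avg, ← Finset.mul_sum, mul_smul_comm]

theorem avg_mul_right {s : Type} [Fintype s] (c : K) (f : s → K) : avg (fun x => f x * c) = avg f * c := by
  simp only [avg, ← Finset.sum_mul, smul_mul_assoc]

theorem avg_mul_avg {s t : Type} [Fintype s] [Fintype t] (f : s → K) (g : t → K) :
    avg (fun p : s × t => f p.1 * g p.2) = avg f * avg g := by
  rw [avg_prod]
  simp only [avg_mul_left, avg_mul_right]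

theorem avg_comm {s t : Type} [Fintype s] [Fintype t] (f : s → t → K) :
    avg (fun x => avg (fun y => f x y)) = avg (fun y => avg (fun x => f x y)) := by
  rw [← avg_prod (fun p : s × t => f p.1 p.2), ← avg_prod (fun p : t × s => f p.2 p.1)]
  exact avg_equiv (Equiv.prodComm s t) _ _ (fun _ => rfl)

theorem avg_sum {s t : Type} [Fintype s] (S : Finset t) (f : s → t → K) :
    avg (fun x => ∑ y ∈ S, f x y) = ∑ y ∈ S, avg (fun x => f x y) := by
  simp only [avg, Finset.smul_sum]
  rw [Finset.sum_comm]

theorem avg_add {s : Type} [Fintype s] (f g : s → K) : avg (fun x => f x + g x) = avg f + avg g := by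
  simp only [avg, Finset.sum_add_distrib, smul_add]

theorem avg_surj {A B : Type} [AddGroup A] [AddGroup B] [Fintype A] [Fintype B] (π : A →+ B)
    (hπ : Function.Surjective π) (f : B → K) : avg (fun a => f (π a)) = avg f := by
  classical
  choose σ hσ using hπ
  let e : A ≃ B × π.ker :=
    { toFun := fun a => (π a, ⟨-σ (π a) + a, by simp [AddMonoidHom.mem_ker, hσ]⟩)
      invFun := fun p => σ p.1 + p.2.1
      left_inv := fun a => by simp
      right_inv := fun p => by
        have h2 : π p.2.1 = 0 := p.2.2
        have : π (σ p.1 + p.2.1) = p.1 := by rw [map_add, hσ, h2, add_zero]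
        apply Prod.ext
        · exact this
        · apply Subtype.ext
          show -σ (π (σ p.1 + p.2.1)) + (σ p.1 + p.2.1) = p.2.1
          rw [this]; simp }
  rw [avg_equiv e (fun a => f (π a)) (fun p => f p.1) (fun _ => rfl), avg_prod]
  exact avg_congr (fun x => avg_const (f x))

end avg

section delta
variable {F : Type} [Field F] [Fintype F]
variable {V V1 V2 W W1 W2 U : Type} [AddCommGroup V] [Module F V] [Finite V]
  [AddCommGroup W] [Module F W] [Finite W] [AddCommGroup U] [Module F U] [Finite U]
  [AddCommGroup V1] [Module F V1] [Finite V1] [AddCommGroup V2] [Module F V2] [Finite V2]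
  [AddCommGroup W1] [Module F W1] [Finite W1] [AddCommGroup W2] [Module F W2] [Finite W2]
variable {K : Type} [CommRing K] [Algebra ℂ K]

/-- block upper triangular endomorphism -/
def blk (φ : Module.End F V1) (u : V2 →ₗ[F] V1) (ψ : Module.End F V2) : Module.End F (V1 × V2) :=
  LinearMap.prod (φ ∘ₗ LinearMap.fst F V1 V2 + u ∘ₗ LinearMap.snd F V1 V2) (ψ ∘ₗ LinearMap.snd F V1 V2)

@[simp] theorem blk_apply (φ : Module.End F V1) (u : V2 →ₗ[F] V1) (ψ : Module.End F V2) (v : V1 × V2) :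
    blk φ u ψ v = (φ v.1 + u v.2, ψ v.2) := rfl

/-- coproduct -/
def Delta (f : Hall F K) : Hall F (Hall F K) := fun x y =>
  avg (fun u : (Fin (deg y) → F) →ₗ[F] (Fin (deg x) → F) => f (cls (blk (rep x) u (rep y))))

theorem Delta_cls (f : Hall F K) (φ : Module.End F V1) (ψ : Module.End F V2) :
    Delta f (cls φ) (cls ψ) = avg (fun u : V2 →ₗ[F] V1 => f (cls (blk φ u ψ))) := by
  obtain ⟨e1, he1⟩ := (cls_eq_iff φ (rep (cls φ))).1 (cls_rep _).symm
  obtain ⟨e2, he2⟩ := (cls_eq_iff ψ (rep (cls ψ))).1 (cls_rep _).symm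
  symm
  refine avg_equiv (LinearEquiv.arrowCongr e2 e1).toEquiv _ _ (fun u => ?_)
  congr 1
  rw [cls_eq_iff]
  refine ⟨e1.prodCongr e2, fun v => ?_⟩
  simp [he1, he2, LinearEquiv.arrowCongr_apply]

open Classical in
/-- summand of the Hall product, extended by zero to all subspaces -/
def hf (c d : Hall F K) (φ : Module.End F V) (S : Submodule F V) : K :=
  if h : S ≤ S.comap φ then c (sub φ ⟨S, h⟩) * d (quo φ ⟨S, h⟩) else 0

instance : Fintype (Submodule F V) := Fintype.ofFinite _

open Classical in
theorem sum_St {R : Type} [AddCommMonoid R] (φ : Module.End F V) (f : St φ → R) :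
    ∑ S : St φ, f S = ∑ S : Submodule F V, if h : S ≤ S.comap φ then f ⟨S, h⟩ else 0 := by
  rw [← Finset.sum_filter_add_sum_filter_not Finset.univ (fun S : Submodule F V => S ≤ S.comap φ)]
  rw [Finset.sum_eq_zero (s := Finset.univ.filter (fun S : Submodule F V => ¬ S ≤ S.comap φ)), add_zero]
  · symm
    refine Finset.sum_bij (fun S hS => ⟨S, (Finset.mem_filter.1 hS).2⟩) (fun _ _ => Finset.mem_univ _)
      (fun a _ b _ h => congrArg Subtype.val h) (fun b _ => ⟨b.1, by simpa using b.2, rfl⟩) ?_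
    intro a ha
    rw [dif_pos]
  · intro S hS
    rw [dif_neg (Finset.mem_filter.1 hS).2]

theorem mul_cls_hf (c d : Hall F K) (φ : Module.End F V) :
    (c * d) (cls φ) = ∑ S : Submodule F V, hf c d φ S := by
  rw [mul_cls, sum_St]; rfl

theorem hf_map (c d : Hall F K) (φ : Module.End F V) (ψ : Module.End F W) (e : V ≃ₗ[F] W)
    (he : ∀ v, e (φ v) = ψ (e v)) (S : Submodule F V) :
    hf c d ψ (S.map e.toLinearMap) = hf c d φ S := by
  by_cases h : S ≤ S.comap φ
  · have h' : S.map e.toLinearMap ≤ (S.map e.toLinearMap).comap ψ := (StEquiv φ ψ e he ⟨S, h⟩).2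
    rw [hf, hf, dif_pos h, dif_pos h']
    rw [← sub_StEquiv φ ψ e he, ← quo_StEquiv φ ψ e he]; rfl
  · rw [hf, hf, dif_neg h, dif_neg]
    intro h'
    have := ((StEquiv φ ψ e he).symm ⟨_, h'⟩).2
    apply h
    have e2 : ((StEquiv φ ψ e he).symm ⟨_, h'⟩).1 = S := Submodule.comap_map_eq_of_injective e.injective _
    rwa [e2] at this

/-- shear -/
def sh (t : V2 →ₗ[F] V1) : (V1 × V2) ≃ₗ[F] (V1 × V2) :=
  LinearEquiv.ofLinear (blk LinearMap.id t LinearMap.id) (blk LinearMap.id (-t) LinearMap.id)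
    (by ext v <;> simp) (by ext v <;> simp)

@[simp] theorem sh_apply (t : V2 →ₗ[F] V1) (v : V1 × V2) : sh t v = (v.1 + t v.2, v.2) := rfl

theorem mem_sh_map (t : V2 →ₗ[F] V1) (A : Submodule F V1) (B : Submodule F V2) (v : V1 × V2) :
    v ∈ (A.prod B).map (sh t).toLinearMap ↔ v.1 - t v.2 ∈ A ∧ v.2 ∈ B := by
  constructor
  · rintro ⟨w, ⟨h1, h2⟩, rfl⟩
    simpa using ⟨h1, h2⟩
  · rintro ⟨h1, h2⟩
    exact ⟨(v.1 - t v.2, v.2), ⟨h1, h2⟩, by simp⟩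

theorem sh_comap (t : V2 →ₗ[F] V1) (A : Submodule F V1) (B : Submodule F V2) :
    ((A.prod B).map (sh t).toLinearMap).comap (LinearMap.inl F V1 V2) = A := by
  ext v; rw [Submodule.mem_comap, mem_sh_map]; simp

theorem sh_map_snd (t : V2 →ₗ[F] V1) (A : Submodule F V1) (B : Submodule F V2) :
    ((A.prod B).map (sh t).toLinearMap).map (LinearMap.snd F V1 V2) = B := by
  ext v; constructor
  · rintro ⟨w, hw, rfl⟩
    exact ((mem_sh_map t A B w).1 hw).2
  · intro hv
    exact ⟨(t v, v), (mem_sh_map _ _ _ _).2 (by simpa using hv), rfl⟩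

theorem exists_sh (S : Submodule F (V1 × V2)) : ∃ t : V2 →ₗ[F] V1,
    ((S.comap (LinearMap.inl F V1 V2)).prod (S.map (LinearMap.snd F V1 V2))).map (sh t).toLinearMap = S := by
  let p : S →ₗ[F] (S.map (LinearMap.snd F V1 V2)) := (LinearMap.snd F V1 V2).submoduleMap S
  have hp : LinearMap.range p = ⊤ := LinearMap.range_eq_top.2 (LinearMap.submoduleMap_surjective _ _)
  obtain ⟨s, hs⟩ := p.exists_rightInverse_of_surjective hp
  obtain ⟨t, ht⟩ := LinearMap.exists_extend (LinearMap.fst F V1 V2 ∘ₗ S.subtype ∘ₗ s)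
  have key : ∀ v2 ∈ S.map (LinearMap.snd F V1 V2), (t v2, v2) ∈ S := by
    intro v2 hv
    have h1 := LinearMap.congr_fun ht ⟨v2, hv⟩
    have h2 := congrArg Subtype.val (LinearMap.congr_fun hs ⟨v2, hv⟩)
    have h3 : ((s ⟨v2, hv⟩ : S) : V1 × V2) = (t v2, v2) := Prod.ext h1.symm h2
    rw [← h3]; exact (s ⟨v2, hv⟩).2
  refine ⟨t, ?_⟩
  ext v
  rw [mem_sh_map]
  constructor
  · rintro ⟨h1, h2⟩
    have := S.add_mem (show ((v.1 - t v.2, 0) : V1 × V2) ∈ S from h1) (key _ h2)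
    simpa using this
  · intro hv
    have h2 : v.2 ∈ S.map (LinearMap.snd F V1 V2) := ⟨v, hv, rfl⟩
    refine ⟨?_, h2⟩
    have := S.sub_mem hv (key _ h2)
    show ((v.1 - t v.2, 0) : V1 × V2) ∈ S
    simpa [Prod.sub_def] using this

theorem sh_eq_iff (t t0 : V2 →ₗ[F] V1) (A : Submodule F V1) (B : Submodule F V2) :
    (A.prod B).map (sh t).toLinearMap = (A.prod B).map (sh t0).toLinearMap ↔
      t - t0 ∈ Submodule.compatibleMaps B A := by
  constructor
  · intro h v hv
    have : ((t v, v) : V1 × V2) ∈ (A.prod B).map (sh t).toLinearMap := (mem_sh_map _ _ _ _).2 (by simpa using hv)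
    rw [h, mem_sh_map] at this
    simpa using this.1
  · intro h
    ext v
    rw [mem_sh_map, mem_sh_map]
    refine and_congr_left (fun hv => ?_)
    have h1 : t v.2 - t0 v.2 ∈ A := h hv
    constructor
    · intro h2
      have := A.add_mem h2 h1
      simpa using this
    · intro h2
      have := A.sub_mem h2 h1
      simpa using this

instance (B : Submodule F V2) (A : Submodule F V1) : Fintype (Submodule.compatibleMaps B A) := Fintype.ofFinite _

open Classical in
theorem sum_sh (h : Submodule F (V1 × V2) → K) (A : Submodule F V1) (B : Submodule F V2) :
    ∑ t : V2 →ₗ[F] V1, h ((A.prod B).map (sh t).toLinearMap) =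
    (Fintype.card (Submodule.compatibleMaps B A) : ℂ) •
     ∑ S : Submodule F (V1 × V2), if S.comap (LinearMap.inl F V1 V2) = A ∧ S.map (LinearMap.snd F V1 V2) = B
       then h S else 0 := by
  rw [← Finset.sum_fiberwise Finset.univ (fun t : V2 →ₗ[F] V1 => (A.prod B).map (sh t).toLinearMap), Finset.smul_sum]
  refine Finset.sum_congr rfl (fun S _ => ?_)
  rw [Finset.sum_congr rfl (fun t ht => by rw [(Finset.mem_filter.1 ht).2] :
    ∀ t ∈ Finset.univ.filter (fun t : V2 →ₗ[F] V1 => (A.prod B).map (sh t).toLinearMap = S), _ = h S)]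
  rw [Finset.sum_const]
  split_ifs with hS
  · rw [← Nat.cast_smul_eq_nsmul ℂ]
    congr 2
    obtain ⟨t0, ht0⟩ := exists_sh S
    rw [hS.1, hS.2] at ht0
    rw [Fintype.card_of_subtype (p := fun t => t ∈ Submodule.compatibleMaps B A)
      (Finset.univ.filter (fun t => t ∈ Submodule.compatibleMaps B A)) (by simp)]
    refine Finset.card_bij (fun t _ => t - t0) ?_ ?_ ?_
    · intro t ht
      rw [Finset.mem_filter] at ht ⊢
      refine ⟨Finset.mem_univ _, ?_⟩
      rw [← sh_eq_iff, ht.2, ht0]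
    · intro a _ b _ h; simpa using h
    · intro b hb
      refine ⟨b + t0, ?_, by simp⟩
      rw [Finset.mem_filter] at hb ⊢
      refine ⟨Finset.mem_univ _, ?_⟩
      rw [← ht0, sh_eq_iff]; simpa using hb.2
  · rw [smul_zero, Finset.card_eq_zero.2, zero_smul]
    rw [Finset.filter_eq_empty_iff]
    intro t _ ht
    apply hS
    rw [← ht]
    exact ⟨sh_comap _ _ _, sh_map_snd _ _ _⟩


/-- restriction of a compatible map -/
def resQ (B : Submodule F V2) (A : Submodule F V1) :
    Submodule.compatibleMaps B A →+ (B →ₗ[F] A) × ((V2 ⧸ B) →ₗ[F] (V1 ⧸ A)) where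
  toFun u := (u.1.restrict u.2, B.mapQ A u.1 u.2)
  map_zero' := by
    apply Prod.ext
    · ext; rfl
    · ext; rfl
  map_add' a b := by
    apply Prod.ext
    · ext; rfl
    · ext; rfl

theorem resQ_surj (B : Submodule F V2) (A : Submodule F V1) : Function.Surjective (resQ B A) := by
  rintro ⟨u1, u2⟩
  obtain ⟨p, hp⟩ := B.subtype.exists_leftInverse_of_injective B.ker_subtype
  obtain ⟨σ, hσ⟩ := A.mkQ.exists_rightInverse_of_surjective A.range_mkQ
  have hp' : ∀ b : B, p b = b := fun b => LinearMap.congr_fun hp b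
  have hσ' : ∀ b, A.mkQ (σ b) = b := fun b => LinearMap.congr_fun hσ b
  let u : V2 →ₗ[F] V1 := A.subtype ∘ₗ u1 ∘ₗ p + σ ∘ₗ u2 ∘ₗ B.mkQ
  have h0 : ∀ b : B, B.mkQ b.1 = 0 := fun b => (Submodule.Quotient.mk_eq_zero B).2 b.2
  have hu : ∀ b : B, u b.1 = u1 b := by
    intro b
    show (u1 (p b) : V1) + σ (u2 (B.mkQ b.1)) = _
    rw [h0, map_zero, map_zero, add_zero, hp']
  refine ⟨⟨u, fun b hb => ?_⟩, ?_⟩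
  · show u b ∈ A
    rw [hu ⟨b, hb⟩]; exact (u1 ⟨b, hb⟩).2
  · apply Prod.ext
    · ext b; exact hu b
    · ext v
      show A.mkQ ((u1 (p v) : V1) + σ (u2 (B.mkQ v))) = u2 (B.mkQ v)
      rw [map_add, hσ']
      have : A.mkQ (u1 (p v) : V1) = 0 := (Submodule.Quotient.mk_eq_zero A).2 (u1 (p v)).2
      rw [this, zero_add]

theorem prod_stable_iff (φ : Module.End F V1) (u : V2 →ₗ[F] V1) (ψ : Module.End F V2)
    (A : Submodule F V1) (B : Submodule F V2) :
    A.prod B ≤ (A.prod B).comap (blk φ u ψ) ↔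
      (A ≤ A.comap φ ∧ B ≤ B.comap ψ) ∧ u ∈ Submodule.compatibleMaps B A := by
  constructor
  · intro h
    refine ⟨⟨fun v hv => ?_, fun v hv => ?_⟩, fun v hv => ?_⟩
    · have := (h (show ((v, 0) : V1 × V2) ∈ A.prod B from ⟨hv, B.zero_mem⟩)).1
      simpa using this
    · have := (h (show ((0, v) : V1 × V2) ∈ A.prod B from ⟨A.zero_mem, hv⟩)).2
      simpa using this
    · have := (h (show ((0, v) : V1 × V2) ∈ A.prod B from ⟨A.zero_mem, hv⟩)).1
      simpa using this
  · rintro ⟨⟨h1, h2⟩, h3⟩ v ⟨hv1, hv2⟩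
    exact ⟨A.add_mem (h1 hv1) (h3 hv2), h2 hv2⟩

theorem hf_prod (c d : Hall F K) (φ : Module.End F V1) (u : V2 →ₗ[F] V1) (ψ : Module.End F V2)
    (A : Submodule F V1) (B : Submodule F V2) (hA : A ≤ A.comap φ) (hB : B ≤ B.comap ψ)
    (hu : u ∈ Submodule.compatibleMaps B A) :
    hf c d (blk φ u ψ) (A.prod B) =
      c (cls (blk (φ.restrict hA) (u.restrict hu) (ψ.restrict hB))) *
      d (cls (blk (A.mapQ A φ hA) (B.mapQ A u hu) (B.mapQ B ψ hB))) := by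
  have hs := (prod_stable_iff φ u ψ A B).2 ⟨⟨hA, hB⟩, hu⟩
  rw [hf, dif_pos hs]
  congr 2
  · refine sub_eq _ _ _ (A.subtype.prodMap B.subtype) ?_ ?_ ?_
    · exact Prod.map_injective.2 ⟨A.injective_subtype, B.injective_subtype⟩
    · intro w; rfl
    · rw [LinearMap.range_prodMap]; simp
  · refine quo_eq _ _ _ (A.mkQ.prodMap B.mkQ) ?_ ?_ ?_
    · exact Prod.map_surjective.2 ⟨A.mkQ_surjective, B.mkQ_surjective⟩
    · intro w; rfl
    · rw [LinearMap.ker_prodMap]; simp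

theorem avg_sh (c d : Hall F K) (φ : Module.End F V1) (ψ : Module.End F V2)
    (A : Submodule F V1) (B : Submodule F V2) :
    avg (fun u : V2 →ₗ[F] V1 => ∑ t : V2 →ₗ[F] V1, hf c d (blk φ u ψ) ((A.prod B).map (sh t).toLinearMap))
     = ∑ u : V2 →ₗ[F] V1, hf c d (blk φ u ψ) (A.prod B) := by
  rw [avg_sum]
  have : ∀ t : V2 →ₗ[F] V1, avg (fun u : V2 →ₗ[F] V1 => hf c d (blk φ u ψ) ((A.prod B).map (sh t).toLinearMap))
      = avg (fun u : V2 →ₗ[F] V1 => hf c d (blk φ u ψ) (A.prod B)) := by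
    intro t
    refine avg_equiv (Equiv.addRight (φ ∘ₗ t - t ∘ₗ ψ)) _ _ (fun u => ?_)
    refine hf_map c d _ _ (sh t) (fun v => ?_) _
    simp
    abel
  simp_rw [this]
  rw [Finset.sum_const, Finset.card_univ, avg, ← Nat.cast_smul_eq_nsmul ℂ, smul_smul, mul_inv_cancel₀, one_smul]
  exact_mod_cast Fintype.card_ne_zero

theorem Delta_mul (c d : Hall F K) : Delta (c * d) = Delta c * Delta d := by
  classical
  apply hall_ext
  intro n φ
  apply hall_ext
  intro m ψ
  rw [Delta_cls, mul_cls, sum_St]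
  simp_rw [mul_cls_hf]
  have h1 : ∀ (h : Submodule F ((Fin n → F) × (Fin m → F)) → K), ∑ S, h S =
      ∑ A : Submodule F (Fin n → F), ∑ B : Submodule F (Fin m → F),
       ((Fintype.card (Submodule.compatibleMaps B A) : ℂ))⁻¹ • ∑ t : (Fin m → F) →ₗ[F] (Fin n → F),
         h ((A.prod B).map (sh t).toLinearMap) := by
    intro h
    simp_rw [sum_sh, smul_smul]
    have hne : ∀ (A : Submodule F (Fin n → F)) (B : Submodule F (Fin m → F)),
        (Fintype.card (Submodule.compatibleMaps B A) : ℂ) ≠ 0 := by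
      intro A B; exact_mod_cast Fintype.card_ne_zero
    simp_rw [inv_mul_cancel₀ (hne _ _), one_smul]
    have : ∀ S, h S = ∑ A : Submodule F (Fin n → F), ∑ B : Submodule F (Fin m → F),
        if S.comap (LinearMap.inl F _ _) = A ∧ S.map (LinearMap.snd F _ _) = B then h S else 0 := by
      intro S
      simp_rw [ite_and]
      simp
    rw [Finset.sum_congr rfl (fun S _ => this S), Finset.sum_comm]
    refine Finset.sum_congr rfl (fun A _ => ?_)
    rw [Finset.sum_comm]
  rw [avg_congr (fun u => h1 _), avg_sum]
  rw [show (∑ S : Submodule F (Fin n → F), if h : S ≤ S.comap φ then Delta c (sub φ ⟨S, h⟩) * Delta d (quo φ ⟨S, h⟩) else 0) (cls ψ) =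
    ∑ S : Submodule F (Fin n → F), (if h : S ≤ S.comap φ then Delta c (sub φ ⟨S, h⟩) * Delta d (quo φ ⟨S, h⟩) else 0) (cls ψ) from
      Finset.sum_apply (cls ψ) _ _]
  refine Finset.sum_congr rfl (fun A _ => ?_)
  rw [avg_sum]
  have h2 : ∀ B : Submodule F (Fin m → F), avg (fun u => ((Fintype.card (Submodule.compatibleMaps B A) : ℂ))⁻¹ •
      ∑ t : (Fin m → F) →ₗ[F] (Fin n → F), hf c d (blk φ u ψ) ((A.prod B).map (sh t).toLinearMap)) =
      ((Fintype.card (Submodule.compatibleMaps B A) : ℂ))⁻¹ • ∑ u : (Fin m → F) →ₗ[F] (Fin n → F), hf c d (blk φ u ψ) (A.prod B) := by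
    intro B
    rw [← avg_sh]
    simp only [avg, ← Finset.smul_sum]
    rw [smul_comm]
  simp_rw [h2]
  by_cases hA : A ≤ A.comap φ
  · rw [dif_pos hA, mul_cls, sum_St]
    refine Finset.sum_congr rfl (fun B _ => ?_)
    by_cases hB : B ≤ B.comap ψ
    · rw [dif_pos hB, sub, quo, sub, quo, Delta_cls, Delta_cls, ← avg_mul_avg, ← avg_surj (resQ B A) (resQ_surj B A), avg]
      congr 1
      rw [← Finset.sum_filter_add_sum_filter_not Finset.univ (fun u => u ∈ Submodule.compatibleMaps B A),
        Finset.sum_eq_zero (s := Finset.univ.filter (fun u => ¬ u ∈ Submodule.compatibleMaps B A)), add_zero]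
      · refine Finset.sum_bij (fun u hu => ⟨u, (Finset.mem_filter.1 hu).2⟩) (fun _ _ => Finset.mem_univ _)
          (fun a _ b _ h => congrArg Subtype.val h) (fun b _ => ⟨b.1, by simpa using b.2, rfl⟩) ?_
        intro u hu
        exact hf_prod c d φ u ψ A B hA hB (Finset.mem_filter.1 hu).2
      · intro u hu
        rw [hf, dif_neg]
        rw [prod_stable_iff]
        exact fun h => (Finset.mem_filter.1 hu).2 h.2
    · rw [dif_neg hB, Finset.sum_eq_zero, smul_zero]
      intro u _
      rw [hf, dif_neg]
      rw [prod_stable_iff]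
      exact fun h => hB h.1.2
  · rw [dif_neg hA, zero_apply]
    refine Finset.sum_eq_zero (fun B _ => ?_)
    rw [Finset.sum_eq_zero, smul_zero]
    intro u _
    rw [hf, dif_neg]
    rw [prod_stable_iff]
    exact fun h => hA h.1.1

end delta
end HallGL

namespace HallGL

section int
variable {F : Type} [Field F] [Fintype F]
variable {V V1 V2 W W1 W2 U : Type} [AddCommGroup V] [Module F V] [Finite V]
  [AddCommGroup W] [Module F W] [Finite W] [AddCommGroup U] [Module F U] [Finite U]
  [AddCommGroup V1] [Module F V1] [Finite V1] [AddCommGroup V2] [Module F V2] [Finite V2]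
  [AddCommGroup W1] [Module F W1] [Finite W1] [AddCommGroup W2] [Module F W2] [Finite W2]
variable {K : Type} [CommRing K] [Algebra ℂ K]

instance : Finite (V ≃ₗ[F] W) := DFunLike.finite _
instance : Fintype (V ≃ₗ[F] W) := Fintype.ofFinite _

/-- order of the general linear group -/
def cG (F V : Type) [Field F] [Fintype F] [AddCommGroup V] [Module F V] [Finite V] : ℂ :=
  (Fintype.card (V ≃ₗ[F] V) : ℂ)

theorem cG_ne (F V : Type) [Field F] [Fintype F] [AddCommGroup V] [Module F V] [Finite V] : cG F V ≠ 0 := by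
  have : Nonempty (V ≃ₗ[F] V) := ⟨LinearEquiv.refl F V⟩
  rw [cG]; exact_mod_cast Fintype.card_ne_zero

/-- integral over endomorphisms of `V` -/
def INTV (V : Type) [AddCommGroup V] [Module F V] [Finite V] (f : X F → K) : K :=
  (cG F V)⁻¹ • ∑ φ : Module.End F V, f (cls φ)

/-- integral over degree n classes -/
def INT (n : ℕ) (f : X F → K) : K := INTV (Fin n → F) f

theorem INTV_congr (e : V ≃ₗ[F] W) (f : X F → K) : INTV V f = INTV W f := by
  have h1 : cG F V = cG F W := by
    rw [cG, cG]
    congr 1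
    exact Fintype.card_congr ⟨fun g => (e.symm.trans g).trans e, fun g => (e.trans g).trans e.symm,
      fun g => by ext; simp, fun g => by ext; simp⟩
  have h2 : ∑ φ : Module.End F V, f (cls φ) = ∑ φ : Module.End F W, f (cls φ) := by
    refine Fintype.sum_equiv e.conj.toEquiv _ _ (fun φ => ?_)
    show _ = f (cls (e.conj φ))
    rw [cls_conj]
  rw [INTV, INTV, h1, h2]

theorem INTV_eq (n : ℕ) (h : finrank F V = n) (f : X F → K) : INTV V f = INT n f :=
  INTV_congr (LinearEquiv.ofFinrankEq _ _ (by simp [h])) f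

variable (V1 V2) in
/-- the standard subspace -/
def S0 (F : Type) [Field F] [Fintype F] [Module F V1] [Module F V2] : Submodule F (V1 × V2) :=
  LinearMap.range (LinearMap.inl F V1 V2)

theorem mem_S0 (v : V1 × V2) : v ∈ S0 V1 V2 F ↔ v.2 = 0 := by
  rw [S0, LinearMap.range_inl]; rfl

theorem hf_S0 (a b : Hall F K) (φ : Module.End F V1) (u : V2 →ₗ[F] V1) (ψ : Module.End F V2) :
    hf a b (blk φ u ψ) (S0 V1 V2 F) = a (cls φ) * b (cls ψ) := by
  have h : S0 V1 V2 F ≤ (S0 V1 V2 F).comap (blk φ u ψ) := by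
    intro v hv
    rw [Submodule.mem_comap, mem_S0] at *
    simp [hv]
  rw [hf, dif_pos h]
  congr 2
  · refine sub_eq _ _ _ (LinearMap.inl F V1 V2) LinearMap.inl_injective (fun w => ?_) rfl
    simp
  · refine quo_eq _ _ _ (LinearMap.snd F V1 V2) LinearMap.snd_surjective (fun w => ?_) ?_
    · simp
    · exact (LinearMap.range_inl F V1 V2).symm

/-- block triangular invertible maps -/
def blkE (a : V1 ≃ₗ[F] V1) (u : V2 →ₗ[F] V1) (b : V2 ≃ₗ[F] V2) : (V1 × V2) ≃ₗ[F] (V1 × V2) :=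
  LinearEquiv.ofLinear (blk a.toLinearMap u b.toLinearMap)
    (blk a.symm.toLinearMap (-(a.symm.toLinearMap ∘ₗ u ∘ₗ b.symm.toLinearMap)) b.symm.toLinearMap)
    (by ext v <;> simp) (by ext v <;> simp)

@[simp] theorem blkE_apply (a : V1 ≃ₗ[F] V1) (u : V2 →ₗ[F] V1) (b : V2 ≃ₗ[F] V2) (v) :
    blkE a u b v = (a v.1 + u v.2, b v.2) := rfl

theorem blkE_bij : Function.Bijective (fun p : ((V1 ≃ₗ[F] V1) × (V2 ≃ₗ[F] V2)) × (V2 →ₗ[F] V1) =>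
    (⟨blkE p.1.1 p.2 p.1.2, by
      apply le_antisymm
      · rintro _ ⟨v, hv, rfl⟩
        rw [SetLike.mem_coe, mem_S0] at hv
        rw [mem_S0]
        simp [hv]
      · intro v hv
        rw [mem_S0] at hv
        refine ⟨(p.1.1.symm v.1, 0), (mem_S0 _).2 rfl, ?_⟩
        apply Prod.ext <;> simp [hv]⟩ :
      {g : (V1 × V2) ≃ₗ[F] (V1 × V2) // (S0 V1 V2 F).map g.toLinearMap = S0 V1 V2 F})) := by
  constructor
  · rintro ⟨⟨a, b⟩, u⟩ ⟨⟨a', b'⟩, u'⟩ h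
    have h1 : blkE a u b = blkE a' u' b' := congrArg Subtype.val h
    have h2 : ∀ v : V1 × V2, blkE a u b v = blkE a' u' b' v := fun v => by rw [h1]
    refine Prod.ext (Prod.ext ?_ ?_) ?_
    · ext v
      simpa using congrArg Prod.fst (h2 (v, 0))
    · ext v
      simpa using congrArg Prod.snd (h2 (0, v))
    · ext v
      simpa using congrArg Prod.fst (h2 (0, v))
  · rintro ⟨g, hg⟩
    have hz : ∀ v1 : V1, (g (v1, 0)).2 = 0 := by
      intro v1
      have : g (v1, 0) ∈ (S0 V1 V2 F).map g.toLinearMap := ⟨(v1, 0), (mem_S0 _).2 rfl, rfl⟩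
      rw [hg, mem_S0] at this
      exact this
    have hz' : ∀ v, v ∈ S0 V1 V2 F → g.symm v ∈ S0 V1 V2 F := by
      intro v hv
      rw [← hg] at hv
      obtain ⟨w, hw, rfl⟩ := hv
      simpa using hw
    have hsplit : ∀ v : V1 × V2, v = (v.1, 0) + (0, v.2) := fun v => by simp
    let a : V1 →ₗ[F] V1 := LinearMap.fst F V1 V2 ∘ₗ g.toLinearMap ∘ₗ LinearMap.inl F V1 V2
    let u : V2 →ₗ[F] V1 := LinearMap.fst F V1 V2 ∘ₗ g.toLinearMap ∘ₗ LinearMap.inr F V1 V2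
    let b : V2 →ₗ[F] V2 := LinearMap.snd F V1 V2 ∘ₗ g.toLinearMap ∘ₗ LinearMap.inr F V1 V2
    have ha : Function.Injective a := by
      rw [injective_iff_map_eq_zero]
      intro v hv
      have : g (v, 0) = 0 := Prod.ext hv (hz v)
      have := (g.map_eq_zero_iff).1 this
      exact congrArg Prod.fst this
    have hb : Function.Injective b := by
      rw [injective_iff_map_eq_zero]
      intro v hv
      have h1 : g (0, v) ∈ S0 V1 V2 F := (mem_S0 _).2 hv
      have := hz' _ h1
      rw [mem_S0] at this
      simpa using this
    refine ⟨⟨⟨LinearEquiv.ofInjectiveEndo a ha, LinearEquiv.ofInjectiveEndo b hb⟩, u⟩, ?_⟩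
    apply Subtype.ext
    apply LinearEquiv.ext
    intro v
    have e1 : g v = g (v.1, 0) + g (0, v.2) := by rw [← map_add, ← hsplit]
    show (_, _) = g v
    rw [e1]
    apply Prod.ext
    · rfl
    · show b v.2 = (g (v.1, 0)).2 + (g (0, v.2)).2
      rw [hz, zero_add]; rfl

theorem card_stab [Fintype {g : (V1 × V2) ≃ₗ[F] (V1 × V2) // (S0 V1 V2 F).map g.toLinearMap = S0 V1 V2 F}] :
   (Fintype.card {g : (V1 × V2) ≃ₗ[F] (V1 × V2) // (S0 V1 V2 F).map g.toLinearMap = S0 V1 V2 F} : ℂ) =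
     cG F V1 * cG F V2 * (Fintype.card (V2 →ₗ[F] V1) : ℂ) := by
  rw [← Fintype.card_of_bijective blkE_bij, Fintype.card_prod, Fintype.card_prod, cG, cG]
  push_cast; rfl

theorem finrank_S0 : finrank F (S0 V1 V2 F) = finrank F V1 :=
  LinearMap.finrank_range_of_inj LinearMap.inl_injective

theorem exists_map_S0 (S : Submodule F (V1 × V2)) (h : finrank F S = finrank F V1) :
    ∃ g : (V1 × V2) ≃ₗ[F] (V1 × V2), (S0 V1 V2 F).map g.toLinearMap = S := by
  obtain ⟨T, hT⟩ := S.exists_isCompl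
  have hf := Submodule.finrank_add_eq_of_isCompl hT
  have hp : finrank F (V1 × V2) = finrank F V1 + finrank F V2 := finrank_prod
  let e1 : V1 ≃ₗ[F] S := LinearEquiv.ofFinrankEq _ _ h.symm
  let e2 : V2 ≃ₗ[F] T := LinearEquiv.ofFinrankEq _ _ (by omega)
  refine ⟨(e1.prodCongr e2).trans (Submodule.prodEquivOfIsCompl S T hT), ?_⟩
  ext v
  constructor
  · rintro ⟨w, hw, rfl⟩
    rw [SetLike.mem_coe, mem_S0] at hw
    simp [hw]
  · intro hv
    refine ⟨(e1.symm ⟨v, hv⟩, 0), (mem_S0 _).2 rfl, ?_⟩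
    simp

open Classical in
theorem sum_grass (T : Submodule F (V1 × V2) → K)
    (hT : ∀ (g : (V1 × V2) ≃ₗ[F] (V1 × V2)), T ((S0 V1 V2 F).map g.toLinearMap) = T (S0 V1 V2 F)) :
    (cG F V1 * cG F V2 * (Fintype.card (V2 →ₗ[F] V1) : ℂ)) •
      ∑ S : Submodule F (V1 × V2), (if finrank F S = finrank F V1 then T S else 0) =
    cG F (V1 × V2) • T (S0 V1 V2 F) := by
  have h1 : cG F (V1 × V2) • T (S0 V1 V2 F) =
      ∑ g : (V1 × V2) ≃ₗ[F] (V1 × V2), T ((S0 V1 V2 F).map g.toLinearMap) := by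
    simp_rw [hT]
    rw [Finset.sum_const, Finset.card_univ, ← Nat.cast_smul_eq_nsmul ℂ]; rfl
  rw [h1, ← Finset.sum_fiberwise Finset.univ (fun g : (V1 × V2) ≃ₗ[F] (V1 × V2) => (S0 V1 V2 F).map g.toLinearMap),
    Finset.smul_sum]
  refine Finset.sum_congr rfl (fun S _ => ?_)
  rw [Finset.sum_congr rfl (fun g hg => by rw [(Finset.mem_filter.1 hg).2] :
    ∀ g ∈ Finset.univ.filter (fun g : (V1 × V2) ≃ₗ[F] (V1 × V2) => (S0 V1 V2 F).map g.toLinearMap = S), _ = T S)]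
  rw [Finset.sum_const]
  split_ifs with hS
  · rw [← Nat.cast_smul_eq_nsmul ℂ, ← card_stab]
    congr 2
    obtain ⟨g0, hg0⟩ := exists_map_S0 S hS
    rw [Fintype.card_subtype]
    refine Finset.card_bij (fun g _ => g.trans g0) ?_ ?_ ?_
    · intro g hg
      rw [Finset.mem_filter] at hg ⊢
      refine ⟨Finset.mem_univ _, ?_⟩
      rw [← hg0]
      conv_rhs => rw [← hg.2]
      rw [← Submodule.map_comp]; rfl
    · intro a _ b _ h
      ext v
      · exact congrArg Prod.fst (g0.injective (LinearEquiv.congr_fun h v))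
      · exact congrArg Prod.snd (g0.injective (LinearEquiv.congr_fun h v))
    · intro b hb
      refine ⟨b.trans g0.symm, ?_, by ext v <;> simp⟩
      rw [Finset.mem_filter] at hb ⊢
      refine ⟨Finset.mem_univ _, ?_⟩
      have : (S0 V1 V2 F).map (b.trans g0.symm).toLinearMap = ((S0 V1 V2 F).map b.toLinearMap).map g0.symm.toLinearMap := by
        rw [← Submodule.map_comp]; rfl
      rw [this, hb.2, ← hg0, ← Submodule.map_comp]
      simp
  · rw [smul_zero, Finset.card_eq_zero.2, zero_smul]
    rw [Finset.filter_eq_empty_iff]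
    intro g _ hg
    apply hS
    rw [← hg, ← finrank_S0 (V1 := V1) (V2 := V2) (F := F)]
    exact (LinearEquiv.finrank_eq (g.submoduleMap (S0 V1 V2 F))).symm

theorem blk_inj : Function.Injective (fun p : (Module.End F V1 × Module.End F V2) × (V2 →ₗ[F] V1) =>
    blk p.1.1 p.2 p.1.2) := by
  rintro ⟨⟨a, b⟩, u⟩ ⟨⟨a', b'⟩, u'⟩ h
  have h2 : ∀ v : V1 × V2, blk a u b v = blk a' u' b' v := fun v => LinearMap.congr_fun h v
  refine Prod.ext (Prod.ext ?_ ?_) ?_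
  · apply LinearMap.ext; intro v
    simpa using congrArg Prod.fst (h2 (v, 0))
  · apply LinearMap.ext; intro v
    simpa using congrArg Prod.snd (h2 (0, v))
  · apply LinearMap.ext; intro v
    simpa using congrArg Prod.fst (h2 (0, v))

theorem exists_blk (φ : Module.End F (V1 × V2)) (hs : S0 V1 V2 F ≤ (S0 V1 V2 F).comap φ) :
    ∃ p : (Module.End F V1 × Module.End F V2) × (V2 →ₗ[F] V1), blk p.1.1 p.2 p.1.2 = φ := by
  refine ⟨⟨⟨LinearMap.fst F V1 V2 ∘ₗ φ ∘ₗ LinearMap.inl F V1 V2, LinearMap.snd F V1 V2 ∘ₗ φ ∘ₗ LinearMap.inr F V1 V2⟩,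
    LinearMap.fst F V1 V2 ∘ₗ φ ∘ₗ LinearMap.inr F V1 V2⟩, ?_⟩
  have hz : ∀ v1 : V1, (φ (v1, 0)).2 = 0 := fun v1 =>
    (mem_S0 _).1 (hs ((mem_S0 _).2 rfl : ((v1, 0) : V1 × V2) ∈ S0 V1 V2 F))
  apply LinearMap.ext
  intro v
  have e1 : φ v = φ (v.1, 0) + φ (0, v.2) := by rw [← map_add]; simp
  rw [e1]
  apply Prod.ext
  · rfl
  · show (φ (0, v.2)).2 = (φ (v.1, 0)).2 + (φ (0, v.2)).2
    rw [hz, zero_add]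

theorem sum_blk (G : Module.End F (V1 × V2) → K)
    (h0 : ∀ φ, ¬ S0 V1 V2 F ≤ (S0 V1 V2 F).comap φ → G φ = 0) :
    ∑ φ : Module.End F (V1 × V2), G φ =
      ∑ φ : Module.End F V1, ∑ ψ : Module.End F V2, ∑ u : V2 →ₗ[F] V1, G (blk φ u ψ) := by
  rw [← Fintype.sum_prod_type' (fun (φ : Module.End F V1) (ψ : Module.End F V2) => ∑ u : V2 →ₗ[F] V1, G (blk φ u ψ)),
    ← Fintype.sum_prod_type' (fun (p : Module.End F V1 × Module.End F V2) (u : V2 →ₗ[F] V1) => G (blk p.1 u p.2))]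
  symm
  refine Fintype.sum_of_injective _ blk_inj _ G ?_ (fun _ => rfl)
  intro φ hφ
  exact h0 φ (fun hs => hφ (exists_blk φ hs))

theorem sum_S0 (f a b : Hall F K) :
    ∑ φ : Module.End F (V1 × V2), f (cls φ) * hf a b φ (S0 V1 V2 F) =
     (Fintype.card (V2 →ₗ[F] V1) : ℂ) • ∑ φ : Module.End F V1, ∑ ψ : Module.End F V2,
       Delta f (cls φ) (cls ψ) * (a (cls φ) * b (cls ψ)) := by
  have h : ∀ (φ : Module.End F V1) (ψ : Module.End F V2), (Fintype.card (V2 →ₗ[F] V1) : ℂ) •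
      (Delta f (cls φ) (cls ψ) * (a (cls φ) * b (cls ψ))) =
      ∑ u : V2 →ₗ[F] V1, f (cls (blk φ u ψ)) * hf a b (blk φ u ψ) (S0 V1 V2 F) := by
    intro φ ψ
    rw [Delta_cls, avg, ← smul_mul_assoc, smul_smul, mul_inv_cancel₀, one_smul, Finset.sum_mul]
    · simp_rw [hf_S0]
    · exact_mod_cast Fintype.card_ne_zero
  rw [sum_blk]
  · rw [Finset.smul_sum]
    refine Finset.sum_congr rfl (fun φ _ => ?_)
    rw [Finset.smul_sum]
    exact Finset.sum_congr rfl (fun ψ _ => (h φ ψ).symm)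
  · intro φ hs
    rw [hf, dif_neg hs, mul_zero]

/-- adjointness of product and coproduct -/
theorem INT_mul (n : ℕ) (f a b : Hall F K) :
    INT n (fun x => f x * (a * b) x) = ∑ p ∈ Finset.HasAntidiagonal.antidiagonal n,
      INT p.1 (fun x => INT p.2 (fun y => Delta f x y * (a x * b y))) := by
  classical
  have h0 : ∑ φ : Module.End F (Fin n → F), f (cls φ) * (a * b) (cls φ) =
      ∑ S : Submodule F (Fin n → F), ∑ φ : Module.End F (Fin n → F), f (cls φ) * hf a b φ S := by
    simp_rw [mul_cls_hf, Finset.mul_sum]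
    rw [Finset.sum_comm]
  have h1 : ∀ T : Submodule F (Fin n → F) → K, ∑ S, T S = ∑ p ∈ Finset.HasAntidiagonal.antidiagonal n,
      ∑ S : Submodule F (Fin n → F), if finrank F S = p.1 then T S else 0 := by
    intro T
    rw [Finset.sum_comm]
    refine Finset.sum_congr rfl (fun S _ => ?_)
    have hle : finrank F S ≤ n := by simpa using S.finrank_le
    rw [Finset.sum_eq_single (finrank F S, n - finrank F S)]
    · simp
    · rintro ⟨i, j⟩ hp hne
      rw [if_neg]
      rintro rfl
      apply hne
      rw [Finset.HasAntidiagonal.mem_antidiagonal] at hp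
      simp only at hp ⊢
      congr 1; omega
    · intro h
      exact absurd (Finset.HasAntidiagonal.mem_antidiagonal.2 (by simp only; omega)) h
  rw [INT, INTV, h0, h1, Finset.smul_sum]
  refine Finset.sum_congr rfl ?_
  rintro ⟨i, j⟩ hij
  rw [Finset.HasAntidiagonal.mem_antidiagonal] at hij
  simp only at hij ⊢
  let e : (Fin n → F) ≃ₗ[F] ((Fin i → F) × (Fin j → F)) := LinearEquiv.ofFinrankEq _ _ (by simp [hij])
  let T : Submodule F ((Fin i → F) × (Fin j → F)) → K := fun S =>
    ∑ φ : Module.End F ((Fin i → F) × (Fin j → F)), f (cls φ) * hf a b φ S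
  have hT : ∀ {V W : Type} [AddCommGroup V] [Module F V] [Finite V] [AddCommGroup W] [Module F W] [Finite W]
      (e : V ≃ₗ[F] W) (S : Submodule F V), ∑ φ : Module.End F W, f (cls φ) * hf a b φ (S.map e.toLinearMap) =
      ∑ φ : Module.End F V, f (cls φ) * hf a b φ S := by
    intro V W _ _ _ _ _ _ e S
    symm
    refine Fintype.sum_equiv e.conj.toEquiv _ _ (fun φ => ?_)
    show _ = f (cls (e.conj φ)) * hf a b (e.conj φ) _
    rw [cls_conj, hf_map a b φ (e.conj φ) e (fun v => by simp)]
  have h3 : ∑ S : Submodule F (Fin n → F), (if finrank F S = i then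
      ∑ φ : Module.End F (Fin n → F), f (cls φ) * hf a b φ S else 0) =
      ∑ S : Submodule F ((Fin i → F) × (Fin j → F)), if finrank F S = finrank F (Fin i → F) then T S else 0 := by
    refine Fintype.sum_equiv (Submodule.orderIsoMapComap e).toEquiv _ _ (fun S => ?_)
    show _ = if finrank F (S.map e.toLinearMap) = finrank F (Fin i → F) then T (S.map e.toLinearMap) else 0
    rw [← LinearEquiv.finrank_eq (e.submoduleMap S)]
    simp only [T, hT e S]
    rw [Module.finrank_fin_fun]
  have h4 := sum_grass T (fun g => hT g _)
  rw [h3]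
  have hc : cG F (Fin n → F) = cG F ((Fin i → F) × (Fin j → F)) := by
    rw [cG, cG]
    congr 1
    exact Fintype.card_congr ⟨fun g => (e.symm.trans g).trans e, fun g => (e.trans g).trans e.symm,
      fun g => by ext; simp, fun g => by apply LinearEquiv.ext; intro v; simp⟩
  have hcard : (Fintype.card ((Fin j → F) →ₗ[F] (Fin i → F)) : ℂ) ≠ 0 := by exact_mod_cast Fintype.card_ne_zero
  have h5 : T (S0 _ _ F) = _ := sum_S0 (V1 := Fin i → F) (V2 := Fin j → F) f a b
  rw [h5, smul_smul, mul_comm, ← smul_smul] at h4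
  rw [hc]
  have h6 : ∀ (A B k c : ℂ) (x y : K), A ≠ 0 → B ≠ 0 → k ≠ 0 → c ≠ 0 → (k • (A * B) • x) = (c * k) • y →
      c⁻¹ • x = A⁻¹ • B⁻¹ • y := by
    intro A B k c x y hA hB hk hcc h
    have : x = (k * (A * B))⁻¹ • (k • (A * B) • x) := by
      rw [smul_smul k, smul_smul, inv_mul_cancel₀, one_smul]
      exact mul_ne_zero hk (mul_ne_zero hA hB)
    rw [this, h, smul_smul, smul_smul, smul_smul]
    congr 1
    field_simp
  have h7 := h6 _ _ _ _ _ _ (cG_ne F (Fin i → F)) (cG_ne F (Fin j → F)) hcard (cG_ne F _) h4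
  rw [h7]
  simp only [INT, INTV, Finset.smul_sum]

end int
end HallGL

namespace HallGL

section pair
variable {F : Type} [Field F] [Fintype F]
variable {V V1 V2 W W1 W2 U : Type} [AddCommGroup V] [Module F V] [Finite V]
  [AddCommGroup W] [Module F W] [Finite W] [AddCommGroup U] [Module F U] [Finite U]
variable {K : Type} [CommRing K] [Algebra ℂ K]

theorem INT_congr {n : ℕ} {f g : X F → K} (h : ∀ x, deg x = n → f x = g x) : INT n f = INT n g := by
  rw [INT, INT, INTV, INTV]
  congr 1
  exact Finset.sum_congr rfl (fun φ _ => h _ (by rw [deg_cls]; simp))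

theorem INT_add (n : ℕ) (f g : X F → K) : INT n (fun x => f x + g x) = INT n f + INT n g := by
  simp only [INT, INTV, Finset.sum_add_distrib, smul_add]

theorem INT_mul_left (n : ℕ) (c : K) (f : X F → K) : INT n (fun x => c * f x) = c * INT n f := by
  simp only [INT, INTV, ← Finset.mul_sum, mul_smul_comm]

theorem INT_mul_right (n : ℕ) (c : K) (f : X F → K) : INT n (fun x => f x * c) = INT n f * c := by
  simp only [INT, INTV, ← Finset.sum_mul, smul_mul_assoc]

theorem INT_sum {ι : Type} (s : Finset ι) (n : ℕ) (f : ι → X F → K) :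
    INT n (fun x => ∑ i ∈ s, f i x) = ∑ i ∈ s, INT n (f i) := by
  simp only [INT, INTV]
  rw [Finset.sum_comm, Finset.smul_sum]

theorem INT_zero (n : ℕ) : INT n (fun _ : X F => (0 : K)) = 0 := by
  simp [INT, INTV]

theorem INT_neg (n : ℕ) (f : X F → K) : INT n (fun x => - f x) = - INT n f := by
  simp [INT, INTV]

/-- pairing -/
def pair (f h : Hall F K) : PowerSeries K := PowerSeries.mk (fun n => INT n (fun x => f x * h x))

theorem coeff_pair (f h : Hall F K) (n : ℕ) : PowerSeries.coeff n (pair f h) = INT n (fun x => f x * h x) :=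
  PowerSeries.coeff_mk _ _

theorem pair_comm (f h : Hall F K) : pair f h = pair h f := by
  ext n; simp only [coeff_pair, mul_comm]

/-- grouplike elements -/
structure Gl (g : Hall F K) : Prop where
  d : ∀ x y, Delta g x y = g x * g y
  z : ∀ x, deg x = 0 → g x = 1

theorem Gl.pair_mul {g : Hall F K} (hg : Gl g) (a b : Hall F K) : pair g (a * b) = pair g a * pair g b := by
  ext n
  rw [coeff_pair, INT_mul, PowerSeries.coeff_mul]
  refine Finset.sum_congr rfl (fun p _ => ?_)
  rw [coeff_pair, coeff_pair, ← INT_mul_right]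
  congr 1
  funext x
  rw [← INT_mul_left]
  congr 1
  funext y
  rw [hg.d]; ring

theorem deg_zero_eq {x y : X F} (hx : deg x = 0) (hy : deg y = 0) : x = y := by
  rw [← cls_rep x, ← cls_rep y, cls_eq_iff]
  have : Subsingleton (Fin (deg y) → F) := by rw [hy]; infer_instance
  exact ⟨LinearEquiv.ofFinrankEq _ _ (by simp [hx, hy]), fun v => Subsingleton.elim _ _⟩

instance finite_deg (n : ℕ) : Finite {x : X F // deg x = n} := by
  refine Finite.of_surjective (fun φ : Module.End F (Fin n → F) => (⟨cls φ, by rw [deg_cls]; simp⟩ : {x : X F // deg x = n})) ?_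
  rintro ⟨x, rfl⟩
  exact ⟨rep x, Subtype.ext (cls_rep x)⟩

/-- the zero class -/
def x0 (F : Type) [Field F] [Fintype F] : X F := cls (0 : Module.End F (Fin 0 → F))
theorem deg_x0 : deg (x0 F) = 0 := by rw [x0, deg_cls]; simp

theorem mul_deg_zero {R : Type} [CommRing R] (a b : Hall F R) (x : X F) (hx : deg x = 0) : (a * b) x = a x * b x := by
  rw [← cls_rep x]
  generalize rep x = φ at *
  have hs : Subsingleton (Fin (deg x) → F) := by rw [hx]; infer_instance
  rw [mul_cls, Finset.sum_eq_single (Sttop φ), sub_top]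
  · congr 2
    apply deg_zero_eq
    · rw [deg_quo]; exact finrank_zero_of_subsingleton
    · rw [deg_cls]; simp [hx]
  · intro S _ hS
    exact absurd (Subtype.ext (Subsingleton.elim _ _)) hS
  · simp

theorem Gl.one : Gl (1 : Hall F K) := by
  constructor
  · intro x y
    rw [← cls_rep x, ← cls_rep y, Delta_cls]
    simp only [one_apply, deg_cls, Module.finrank_prod]
    rw [avg_const]
    simp only [Nat.add_eq_zero_iff, Module.finrank_fin_fun]
    by_cases h1 : deg x = 0 <;> by_cases h2 : deg y = 0 <;> simp [h1, h2]
  · intro x hx; rw [one_apply, if_pos hx]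

theorem Gl.mul {g h : Hall F K} (hg : Gl g) (hh : Gl h) : Gl (g * h) := by
  constructor
  · intro x y
    rw [← cls_rep x, ← cls_rep y, Delta_mul, mul_cls, mul_cls]
    rw [show (∑ S : St (rep x), Delta g (sub (rep x) S) * Delta h (quo (rep x) S)) (cls (rep y)) =
      ∑ S : St (rep x), (Delta g (sub (rep x) S) * Delta h (quo (rep x) S)) (cls (rep y)) from Finset.sum_apply _ _ _]
    rw [Finset.sum_mul]
    refine Finset.sum_congr rfl (fun S _ => ?_)
    rw [mul_cls, mul_cls, Finset.mul_sum]
    refine Finset.sum_congr rfl (fun T _ => ?_)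
    rw [hg.d, hh.d]; ring
  · intro x hx
    rw [mul_deg_zero _ _ _ hx, hg.z _ hx, hh.z _ hx, one_mul]

theorem Gl.prod {ι : Type} (s : Finset ι) (g : ι → Hall F K) (h : ∀ i ∈ s, Gl (g i)) : Gl (∏ i ∈ s, g i) := by
  classical
  induction s using Finset.induction_on with
  | empty => exact Gl.one
  | insert i s hi ih =>
    rw [Finset.prod_insert hi]
    exact (h i (Finset.mem_insert_self _ _)).mul (ih (fun j hj => h j (Finset.mem_insert_of_mem hj)))

theorem cancel {R : Type} [CommRing R] (r a : Hall F R) (hr : ∀ c : R, c * r (x0 F) = 0 → c = 0) (h : a * r = 0) :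
    a = 0 := by
  have : ∀ n, ∀ x : X F, deg x = n → a x = 0 := by
    intro n
    induction n using Nat.strong_induction_on with
    | _ n ih =>
      intro x hx
      have h1 : (a * r) (cls (rep x)) = 0 := by rw [h]; rfl
      rw [mul_cls, Finset.sum_eq_single (Sttop (rep x)), sub_top, cls_rep] at h1
      · apply hr
        convert h1 using 3
        apply deg_zero_eq deg_x0
        rw [deg_quo]
        rw [Module.finrank_eq_zero_iff_of_free]
        exact Submodule.Quotient.subsingleton_iff.2 rfl
      · intro S _ hS
        rw [ih (deg (sub _ S)) _ _ rfl, zero_mul]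
        rw [deg_sub, ← hx]
        have : S.1 < ⊤ := lt_of_le_of_ne le_top (fun h => hS (Subtype.ext h))
        have := Submodule.finrank_lt this.ne
        simpa using this
      · simp
  funext x
  exact this _ x rfl

theorem Gl.of_mul {g r : Hall F K} (hr : Gl r) (h : Gl (g * r)) : Gl g := by
  constructor
  · let sq : Hall F K → Hall F (Hall F K) := fun a x y => a x * a y
    have hsq : ∀ a b, sq (a * b) = sq a * sq b := by
      intro a b
      funext x y
      rw [← cls_rep x, ← cls_rep y, mul_cls]
      rw [show (∑ S : St (rep x), sq a (sub (rep x) S) * sq b (quo (rep x) S)) (cls (rep y)) =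
        ∑ S : St (rep x), (sq a (sub (rep x) S) * sq b (quo (rep x) S)) (cls (rep y)) from Finset.sum_apply _ _ _]
      show (a * b) _ * (a * b) _ = _
      rw [mul_cls, mul_cls, Finset.sum_mul]
      refine Finset.sum_congr rfl (fun S _ => ?_)
      rw [mul_cls, Finset.mul_sum]
      refine Finset.sum_congr rfl (fun T _ => ?_)
      simp only [sq]; ring
    have h1 : Delta r = sq r := by funext x y; exact hr.d x y
    have h2 : Delta (g * r) = sq (g * r) := by funext x y; exact h.d x y
    rw [Delta_mul, hsq, h1] at h2
    have h3 : (Delta g - sq g) * sq r = 0 := by rw [sub_mul, h2, sub_self]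
    have h4 := cancel _ _ ?_ h3
    · intro x y
      have := congrFun (congrFun h4 x) y
      rw [sub_apply, sub_apply, zero_apply, zero_apply] at this
      exact sub_eq_zero.1 this
    · intro c hc
      refine cancel r c (fun t ht => ?_) ?_
      · rwa [hr.z _ deg_x0, mul_one] at ht
      · convert hc using 2
        funext y
        show _ = r (x0 F) * r y
        rw [hr.z _ deg_x0, one_mul]
  · intro x hx
    have := h.z x hx
    rwa [mul_deg_zero _ _ _ hx, hr.z _ hx, mul_one] at this

end pair
end HallGL

namespace HallGL

section reps
open Representation ComplexOrder
variable {G : Type} [Group G] [Fintype G]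

/-- characters -/
def IsChar (f : G → ℂ) : Prop := ∃ (n : ℕ) (ρ : Representation ℂ G (Fin n → ℂ)), f = ρ.character
/-- irreducible characters -/
def IsIrr (f : G → ℂ) : Prop := ∃ (n : ℕ) (ρ : Representation ℂ G (Fin n → ℂ)), ρ.IsIrreducible ∧ f = ρ.character

theorem exists_fin {V : Type*} [AddCommGroup V] [Module ℂ V] [FiniteDimensional ℂ V] (ρ : Representation ℂ G V) :
    ∃ (n : ℕ) (σ : Representation ℂ G (Fin n → ℂ)), Nonempty (ρ.Equiv σ) := by
  let e : V ≃ₗ[ℂ] (Fin (finrank ℂ V) → ℂ) := LinearEquiv.ofFinrankEq _ _ (by simp)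
  let σ : Representation ℂ G (Fin (finrank ℂ V) → ℂ) :=
    { toFun := fun g => e.conj (ρ g)
      map_one' := by simp [LinearEquiv.conj_apply]; ext; simp
      map_mul' := by intro a b; ext; simp [LinearEquiv.conj_apply] }
  refine ⟨_, σ, ⟨Representation.Equiv.mk e ?_⟩⟩
  intro g
  ext v
  simp [σ, LinearEquiv.conj_apply]

theorem isChar_of {V : Type*} [AddCommGroup V] [Module ℂ V] [FiniteDimensional ℂ V] (ρ : Representation ℂ G V) :
    IsChar ρ.character := by
  obtain ⟨n, σ, ⟨e⟩⟩ := exists_fin ρ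
  exact ⟨n, σ, char_iso e⟩

theorem IsIrr.isChar {f : G → ℂ} (h : IsIrr f) : IsChar f := by
  obtain ⟨n, ρ, _, h⟩ := h; exact ⟨n, ρ, h⟩

theorem IsChar.mul {f h : G → ℂ} (hf : IsChar f) (hh : IsChar h) : IsChar (fun g => f g * h g) := by
  obtain ⟨n, ρ, rfl⟩ := hf
  obtain ⟨m, σ, rfl⟩ := hh
  have := isChar_of (ρ.tprod σ)
  rwa [char_tensor] at this

theorem IsChar.comp {H : Type} [Group H] [Fintype H] {f : G → ℂ} (hf : IsChar f) (φ : H →* G) : IsChar (fun g => f (φ g)) := by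
  obtain ⟨n, ρ, rfl⟩ := hf
  exact ⟨n, ρ.comp φ, rfl⟩

theorem isChar_one : IsChar (fun _ : G => (1 : ℂ)) := by
  have := isChar_of (Representation.trivial ℂ G ℂ)
  convert this using 1
  funext g
  simp [Representation.character]

theorem isChar_hom (ψ : G →* ℂ) : IsChar (fun g => ψ g) := by
  let ρ : Representation ℂ G ℂ := (Algebra.lmul ℂ ℂ).toMonoidHom.comp ψ
  have := isChar_of ρ
  convert this using 1
  funext g
  simp [Representation.character, ρ]
  rw [LinearMap.trace_eq_matrix_trace ℂ (Module.Basis.singleton Unit ℂ)]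
  simp [Matrix.trace, LinearMap.toMatrix_apply]

theorem char_inv {n : ℕ} (ρ : Representation ℂ G (Fin n → ℂ)) (g : G) :
    ρ.character g⁻¹ = (starRingEnd ℂ) (ρ.character g) := by
  classical
  let M : G → Matrix (Fin n) (Fin n) ℂ := fun g => LinearMap.toMatrix' (ρ g)
  have hM : ∀ a b, M (a * b) = M a * M b := fun a b => by
    simp [M, LinearMap.toMatrix'_mul]
  have hM1 : M 1 = 1 := by simp [M, LinearMap.toMatrix'_one]
  have htr : ∀ a, ρ.character a = (M a).trace := fun a => by
    rw [Representation.character, LinearMap.trace_eq_matrix_trace ℂ (Pi.basisFun ℂ (Fin n))]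
    rfl
  let H : Matrix (Fin n) (Fin n) ℂ := ∑ a : G, (M a).conjTranspose * M a
  have hH : H.PosDef := by
    have : H = (M 1).conjTranspose * M 1 + ∑ a ∈ Finset.univ.erase (1 : G), (M a).conjTranspose * M a := by
      exact (Finset.add_sum_erase _ (fun a => (M a).conjTranspose * M a) (Finset.mem_univ (1:G))).symm
    rw [this, hM1]
    refine Matrix.PosDef.add_posSemidef ?_ ?_
    · simpa using Matrix.PosDef.one
    · exact Matrix.posSemidef_sum _ (fun a _ => Matrix.posSemidef_conjTranspose_mul_self _)
  have hinv : (M g).conjTranspose * H * M g = H := by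
    simp only [H, Finset.mul_sum, Finset.sum_mul]
    refine Fintype.sum_equiv (Equiv.mulRight g) _ _ (fun a => ?_)
    simp only [Equiv.coe_mulRight, hM, Matrix.conjTranspose_mul, Matrix.mul_assoc]
  have hu : IsUnit H := hH.isUnit
  have hgg : M g * M g⁻¹ = 1 := by rw [← hM, mul_inv_cancel, hM1]
  have h2 : H * M g⁻¹ = (M g).conjTranspose * H := by
    calc H * M g⁻¹ = ((M g).conjTranspose * H * M g) * M g⁻¹ := by rw [hinv]
      _ = (M g).conjTranspose * H * (M g * M g⁻¹) := by simp only [Matrix.mul_assoc]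
      _ = _ := by rw [hgg, mul_one]
  obtain ⟨u, hu⟩ := hu
  rw [← hu] at h2
  have h3 : M g⁻¹ = (↑u⁻¹ : Matrix (Fin n) (Fin n) ℂ) * ((M g).conjTranspose * u) := by
    rw [← h2, ← mul_assoc]; simp
  rw [htr, htr, h3, Matrix.trace_mul_comm, Matrix.mul_assoc]
  simp [Matrix.trace_conjTranspose]

theorem IsChar.conj {f : G → ℂ} (hf : IsChar f) : IsChar (fun g => (starRingEnd ℂ) (f g)) := by
  obtain ⟨n, ρ, rfl⟩ := hf
  have := isChar_of ρ.dual
  convert this using 1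
  funext g
  rw [char_dual, char_inv]

theorem IsChar.inv {f : G → ℂ} (hf : IsChar f) (g : G) : f g⁻¹ = (starRingEnd ℂ) (f g) := by
  obtain ⟨n, ρ, rfl⟩ := hf
  exact char_inv ρ g

theorem IsChar.cls {f : G → ℂ} (hf : IsChar f) (g h : G) : f (h * g * h⁻¹) = f g := by
  obtain ⟨n, ρ, rfl⟩ := hf
  exact Representation.char_conj ρ g h

theorem IsChar.avg {f : G → ℂ} (hf : IsChar f) : ∃ m : ℕ, avg f = m := by
  obtain ⟨n, ρ, rfl⟩ := hf
  have : Invertible (Nat.card G : ℂ) := invertibleOfNonzero (by simp [Fintype.card_ne_zero])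
  refine ⟨finrank ℂ (invariants ρ), ?_⟩
  rw [← card_inv_mul_sum_char_eq_finrank ρ, HallGL.avg]
  simp

theorem IsChar.one {f : G → ℂ} (hf : IsChar f) : ∃ m : ℕ, f 1 = m := by
  obtain ⟨n, ρ, rfl⟩ := hf
  exact ⟨_, char_one ρ⟩

theorem IsIrr.one {f : G → ℂ} (hf : IsIrr f) : ∃ m : ℕ, 0 < m ∧ f 1 = m := by
  obtain ⟨n, ρ, hi, rfl⟩ := hf
  refine ⟨_, ?_, char_one ρ⟩
  have h : Nontrivial (Subrepresentation ρ) := hi.toNontrivial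
  rcases Nat.eq_zero_or_pos n with h0 | h0
  · subst h0
    exfalso
    obtain ⟨a, b, hab⟩ := h
    apply hab
    ext v
    have : v = 0 := Subsingleton.elim _ _
    subst this
    exact ⟨fun _ => b.toSubmodule.zero_mem, fun _ => a.toSubmodule.zero_mem⟩
  · simpa using h0

theorem IsIrr.orth {f h : G → ℂ} (hf : IsIrr f) (hh : IsIrr h) :
    HallGL.avg (fun g => f g * (starRingEnd ℂ) (h g)) = if f = h then 1 else 0 := by
  classical
  obtain ⟨n, ρ, hi, rfl⟩ := hf
  obtain ⟨m, σ, hj, rfl⟩ := hh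
  have : Invertible (Nat.card G : ℂ) := invertibleOfNonzero (by simp [Fintype.card_ne_zero])
  have key := char_orthonormal ρ σ
  have h1 : HallGL.avg (fun g => ρ.character g * (starRingEnd ℂ) (σ.character g)) =
    (Nat.card G : ℂ)⁻¹ * ∑ g : G, ρ.character g * σ.character g⁻¹ := by
    simp [HallGL.avg, char_inv]
  rw [h1, key]
  by_cases he : Nonempty (σ.Equiv ρ)
  · rw [if_pos he, if_pos]
    obtain ⟨e⟩ := he
    exact (char_iso e).symm
  · rw [if_neg he]
    rw [if_neg]
    intro h2
    have key2 := char_orthonormal ρ ρ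
    rw [if_pos ⟨Representation.Equiv.refl ρ⟩] at key2
    rw [if_neg he, ← h2, key2] at key
    simp at key

theorem schur {n : ℕ} (ρ : Representation ℂ G (Fin n → ℂ)) (hi : ρ.IsIrreducible) (T : Module.End ℂ (Fin n → ℂ))
    (hT : ∀ g, T ∘ₗ ρ g = ρ g ∘ₗ T) : ∃ c : ℂ, T = c • 1 ∧ LinearMap.trace ℂ _ T = c * ρ.character 1 := by
  let f : IntertwiningMap ρ ρ := ⟨T, hT⟩
  obtain ⟨c, hc⟩ := (IsIrreducible.algebraMap_intertwiningMap_bijective_of_isAlgClosed (ρ := ρ)).2 f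
  have hT' : T = c • 1 := by
    have := congrArg (fun x : IntertwiningMap ρ ρ => x.toLinearMap) hc
    simp only [f] at this
    rw [← this]
    ext v
    simp [Algebra.algebraMap_eq_smul_one]
  refine ⟨c, hT', ?_⟩
  rw [hT', Representation.character, map_one, map_smul, smul_eq_mul]

end reps
end HallGL

namespace HallGL

section reps2
open Representation
variable {G : Type} [Group G] [Fintype G]

theorem Tzero (f : G → ℂ) (hcl : ∀ g h, f (h * g * h⁻¹) = f g)
    (h0 : ∀ χ : G → ℂ, IsIrr χ → ∑ g, f g * (starRingEnd ℂ) (χ g) = 0) (n : ℕ) :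
    ∀ (ρ : Representation ℂ G (Fin n → ℂ)) (v : Fin n → ℂ), ∑ g, f g • ρ g⁻¹ v = 0 := by
  induction n using Nat.strong_induction_on with
  | _ n ih =>
  intro ρ v
  have hne : NeZero (Nat.card G : ℂ) := ⟨by simp [Fintype.card_ne_zero]⟩
  by_cases hs : Subsingleton (Fin n → ℂ)
  · exact Subsingleton.elim _ _
  by_cases hi : ρ.IsIrreducible
  · let T : Module.End ℂ (Fin n → ℂ) := ∑ g, f g • ρ g⁻¹
    obtain ⟨c, hc, ht⟩ := schur ρ hi T (by
      intro h
      rw [← Module.End.mul_eq_comp, ← Module.End.mul_eq_comp, Finset.sum_mul, Finset.mul_sum]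
      refine Fintype.sum_equiv (MulAut.conj h⁻¹).toEquiv _ _ (fun g => ?_)
      simp only [MulEquiv.toEquiv_eq_coe, MulEquiv.coe_toEquiv, MulAut.conj_apply, hcl, smul_mul_assoc, mul_smul_comm, ← map_mul]
      congr 2; group)
    have h1 : LinearMap.trace ℂ _ T = 0 := by
      simp only [T, map_sum, map_smul]
      rw [← h0 ρ.character ⟨n, ρ, hi, rfl⟩]
      refine Finset.sum_congr rfl (fun g _ => ?_)
      rw [← char_inv]; rfl
    obtain ⟨m, hm, hm2⟩ := IsIrr.one ⟨n, ρ, hi, rfl⟩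
    rw [h1, hm2] at ht
    have hc0 : c = 0 := by
      rcases mul_eq_zero.1 ht.symm with h | h
      · exact h
      · simp at h; omega
    have : T v = 0 := by rw [hc, hc0]; simp
    simpa [T] using this
  · have hnt : Nontrivial (Fin n → ℂ) := not_subsingleton_iff_nontrivial.1 hs
    have : ∃ W : Subrepresentation ρ, W ≠ ⊥ ∧ W ≠ ⊤ := by
      by_contra hcon
      push Not at hcon
      apply hi
      have : Nontrivial (Subrepresentation ρ) := by
        refine ⟨⊥, ⊤, fun h => ?_⟩
        have := congrArg Subrepresentation.toSubmodule h
        exact bot_ne_top this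
      exact { eq_bot_or_eq_top := fun a => by
                by_cases h : a = ⊥
                · exact Or.inl h
                · exact Or.inr (hcon a h) }
    obtain ⟨W, hW1, hW2⟩ := this
    obtain ⟨W', hW'⟩ := exists_isCompl W
    have hsub : ∀ U : Subrepresentation ρ, U ≠ ⊤ → ∀ v ∈ U.toSubmodule, ∑ g, f g • ρ g⁻¹ v = 0 := by
      intro U hU v hv
      obtain ⟨m, σ, ⟨e⟩⟩ := exists_fin U.toRepresentation
      have hm : m < n := by
        have h1 : finrank ℂ U.toSubmodule = m := by
          rw [LinearEquiv.finrank_eq e.toLinearEquiv]; simp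
        have h2 : U.toSubmodule ≠ ⊤ := fun h => hU (Subrepresentation.toSubmodule_injective h)
        have := Submodule.finrank_lt h2
        rw [h1] at this; simpa using this
      have h3 := ih m hm σ (e.toLinearEquiv ⟨v, hv⟩)
      have h4 : ∀ g, σ g (e.toLinearEquiv ⟨v, hv⟩) = e.toLinearEquiv (U.toRepresentation g ⟨v, hv⟩) := by
        intro g
        exact (IntertwiningMap.isIntertwining _ _ e.toIntertwiningMap g (⟨v, hv⟩ : U.toSubmodule)).symm
      simp only [h4, ← map_smul, ← map_sum] at h3
      have h5 := e.toLinearEquiv.map_eq_zero_iff.1 h3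
      have h6 := congrArg Subtype.val h5
      simpa [Subrepresentation.toRepresentation] using h6
    have hv : v ∈ (W ⊔ W').toSubmodule := by
      rw [hW'.sup_eq_top]; exact Submodule.mem_top
    rw [Subrepresentation.toSubmodule_sup] at hv
    obtain ⟨a, ha, b, hb, rfl⟩ := Submodule.mem_sup.1 hv
    simp only [map_add, smul_add, Finset.sum_add_distrib]
    rw [hsub W hW2 a ha, hsub W' _ b hb, add_zero]
    intro h
    rw [h] at hW'
    exact hW1 (by have := hW'.inf_eq_bot; simpa using this)

/-- right regular representation -/
def regR : Representation ℂ G (G → ℂ) where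
  toFun g := LinearMap.funLeft ℂ ℂ (fun x => x * g)
  map_one' := by ext; simp [LinearMap.funLeft_apply]
  map_mul' := by intro a b; ext; simp [LinearMap.funLeft_apply, mul_assoc]

theorem complete (f : G → ℂ) (hcl : ∀ g h, f (h * g * h⁻¹) = f g)
    (h0 : ∀ χ : G → ℂ, IsIrr χ → ∑ g, f g * (starRingEnd ℂ) (χ g) = 0) : f = 0 := by
  classical
  obtain ⟨m, σ, ⟨e⟩⟩ := exists_fin (regR (G := G))
  let d : G → ℂ := fun x => if x = 1 then 1 else 0
  have h1 := Tzero f hcl h0 m σ (e.toLinearEquiv d)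
  have h4 : ∀ g, σ g (e.toLinearEquiv d) = e.toLinearEquiv (regR g d) := by
    intro g
    exact (IntertwiningMap.isIntertwining _ _ e.toIntertwiningMap g d).symm
  simp only [h4, ← map_smul, ← map_sum] at h1
  have h5 := e.toLinearEquiv.map_eq_zero_iff.1 h1
  funext g
  have h6 := congrFun h5 g
  simp only [Finset.sum_apply, Pi.smul_apply, smul_eq_mul, regR, MonoidHom.coe_mk, OneHom.coe_mk,
    LinearMap.funLeft_apply, d, mul_inv_eq_one] at h6
  simpa using h6

/-- inner product -/
def inn (f h : G → ℂ) : ℂ := avg (fun g => f g * (starRingEnd ℂ) (h g))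

theorem IsChar.inn {f h : G → ℂ} (hf : IsChar f) (hh : IsChar h) : ∃ m : ℕ, HallGL.inn f h = m :=
  (hf.mul hh.conj).avg

theorem inn_irr {f h : G → ℂ} (hf : IsIrr f) (hh : IsIrr h) : inn f h = if f = h then 1 else 0 := IsIrr.orth hf hh

theorem inn_sum {ι : Type} (s : Finset ι) (c : ι → ℂ) (f : ι → G → ℂ) (h : G → ℂ) :
    inn (∑ i ∈ s, c i • f i) h = ∑ i ∈ s, c i * inn (f i) h := by
  simp only [inn, Finset.sum_apply, Finset.sum_mul, avg_sum, Pi.smul_apply, smul_eq_mul]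
  refine Finset.sum_congr rfl (fun i _ => ?_)
  rw [← avg_mul_left]
  simp only [mul_assoc]

theorem irr_li : LinearIndependent ℂ (fun χ : {f : G → ℂ // IsIrr f} => χ.1) := by
  classical
  rw [linearIndependent_iff']
  intro s c h i hi
  have h1 : inn (∑ i ∈ s, c i • i.1) i.1 = 0 := by rw [h]; simp [inn, avg]
  rw [inn_sum, Finset.sum_eq_single i, inn_irr i.2 i.2, if_pos rfl, mul_one] at h1
  · exact h1
  · intro b _ hb
    rw [inn_irr b.2 i.2, if_neg (fun h => hb (Subtype.ext h)), mul_zero]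
  · intro h; exact absurd hi h

instance : Finite {f : G → ℂ // IsIrr f} := (irr_li (G := G)).finite
instance : Fintype {f : G → ℂ // IsIrr f} := Fintype.ofFinite _

theorem decomp (f : G → ℂ) (hcl : ∀ g h, f (h * g * h⁻¹) = f g) :
    f = ∑ χ : {f : G → ℂ // IsIrr f}, inn f χ.1 • χ.1 := by
  classical
  rw [← sub_eq_zero]
  apply complete
  · intro g h
    simp only [Pi.sub_apply, Finset.sum_apply, hcl, Pi.smul_apply]
    congr 1
    exact Finset.sum_congr rfl (fun χ _ => by rw [χ.2.isChar.cls])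
  · intro χ hχ
    have h1 : inn (∑ χ : {f : G → ℂ // IsIrr f}, inn f χ.1 • χ.1) χ = inn f χ := by
      rw [inn_sum, Finset.sum_eq_single ⟨χ, hχ⟩, inn_irr hχ hχ, if_pos rfl, mul_one]
      · intro b _ hb
        rw [inn_irr b.2 hχ, if_neg (fun h => hb (Subtype.ext h)), mul_zero]
      · simp
    simp only [Pi.sub_apply, sub_mul, Finset.sum_sub_distrib]
    rw [inn, inn, avg, avg] at h1
    rw [sub_eq_zero]
    have h2 : ((Fintype.card G : ℂ)⁻¹) ≠ 0 := by simp [Fintype.card_ne_zero]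
    exact (smul_right_injective ℂ h2 h1).symm

theorem card_le_irr {C : Type} [Finite C] (c : G → C) (hc : Function.Surjective c) (h : ∀ g k, c (k * g * k⁻¹) = c g) :
    Nat.card C ≤ Nat.card {f : G → ℂ // IsIrr f} := by
  classical
  have : Fintype C := Fintype.ofFinite C
  let L : (C → ℂ) →ₗ[ℂ] ({f : G → ℂ // IsIrr f} → ℂ) :=
    { toFun := fun φ χ => inn (fun g => φ (c g)) χ.1
      map_add' := by
        intro a b; funext χ
        simp only [inn, Pi.add_apply, add_mul, avg_add]
      map_smul' := by
        intro a b; funext χ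
        simp only [inn, Pi.smul_apply, smul_eq_mul, mul_assoc, avg_mul_left, RingHom.id_apply] }
  have hL : Function.Injective L := by
    rw [injective_iff_map_eq_zero]
    intro φ hφ
    have := complete (fun g => φ (c g)) (fun g k => by simp only [h]) (fun χ hχ => by
      have := congrFun hφ ⟨χ, hχ⟩
      simp only [L, LinearMap.coe_mk, AddHom.coe_mk, inn, avg, Pi.zero_apply] at this
      simpa [Fintype.card_ne_zero] using this)
    funext y
    obtain ⟨g, rfl⟩ := hc y
    exact congrFun this g
  have := LinearMap.finrank_le_finrank_of_injective hL
  simpa [Nat.card_eq_fintype_card] using this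

theorem conj_sum {χ : G → ℂ} (h : IsIrr χ) (y w : G) :
    ∑ x, χ (x * y * x⁻¹ * w) = (Fintype.card G / χ 1) * (χ y * χ w) := by
  obtain ⟨m, hm, hm2⟩ := h.one
  have hne : χ 1 ≠ 0 := by rw [hm2]; exact_mod_cast hm.ne'
  obtain ⟨n, ρ, hi, rfl⟩ := h
  obtain ⟨c, hc, ht⟩ := schur ρ hi (∑ x, ρ (x * y * x⁻¹)) (by
    intro h
    rw [← Module.End.mul_eq_comp, ← Module.End.mul_eq_comp, Finset.sum_mul, Finset.mul_sum]
    refine Fintype.sum_equiv (Equiv.mulLeft h⁻¹) _ _ (fun g => ?_)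
    simp only [← map_mul, Equiv.coe_mulLeft]
    congr 1; group)
  rw [map_sum] at ht
  have h1 : ∀ x, LinearMap.trace ℂ _ (ρ (x * y * x⁻¹)) = ρ.character y := fun x => Representation.char_conj ρ y x
  simp only [h1, Finset.sum_const, Finset.card_univ, nsmul_eq_mul] at ht
  have h2 : ∑ x, ρ.character (x * y * x⁻¹ * w) = c * ρ.character w := by
    have : ∀ x, ρ.character (x * y * x⁻¹ * w) = LinearMap.trace ℂ _ (ρ (x * y * x⁻¹) * ρ w) := by
      intro x; rw [← map_mul]; rfl
    simp only [this, ← map_sum, ← Finset.sum_mul, hc]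
    rw [smul_mul_assoc, one_mul, map_smul]; rfl
  rw [h2]
  field_simp
  rw [mul_comm (c * _), ← mul_assoc] 
  linear_combination (-(ρ.character w)) * ht

theorem conv_sum {χ : G → ℂ} (h : IsIrr χ) (z : G) :
    ∑ y, χ y * χ (y⁻¹ * z) = (Fintype.card G / χ 1) * χ z := by
  classical
  obtain ⟨m, hm, hm2⟩ := h.one
  have hne : χ 1 ≠ 0 := by rw [hm2]; exact_mod_cast hm.ne'
  have ho := h.orth h
  rw [if_pos rfl, avg] at ho
  have hcl := h.isChar.cls
  have hinv := h.isChar.inv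
  obtain ⟨n, ρ, hi, rfl⟩ := h
  obtain ⟨c, hc, ht⟩ := schur ρ hi (∑ y, ρ.character y • ρ y⁻¹) (by
    intro h
    rw [← Module.End.mul_eq_comp, ← Module.End.mul_eq_comp, Finset.sum_mul, Finset.mul_sum]
    refine Fintype.sum_equiv (MulAut.conj h⁻¹).toEquiv _ _ (fun g => ?_)
    simp only [MulEquiv.toEquiv_eq_coe, MulEquiv.coe_toEquiv, MulAut.conj_apply, hcl, smul_mul_assoc, mul_smul_comm, ← map_mul]
    congr 2; group)
  rw [map_sum] at ht
  have h1 : ∀ y, LinearMap.trace ℂ _ (ρ.character y • ρ y⁻¹) = ρ.character y * (starRingEnd ℂ) (ρ.character y) := fun x => by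
    rw [map_smul, smul_eq_mul, ← hinv]; rfl
  simp only [h1] at ht
  have h3 : ((Fintype.card G : ℂ)) ≠ 0 := by simp [Fintype.card_ne_zero]
  rw [ht, smul_eq_mul, inv_mul_eq_one₀ h3] at ho
  have h2 : ∑ y, ρ.character y * ρ.character (y⁻¹ * z) = c * ρ.character z := by
    have : ∀ y, ρ.character y * ρ.character (y⁻¹ * z) = LinearMap.trace ℂ _ ((ρ.character y • ρ y⁻¹) * ρ z) := by
      intro x; rw [smul_mul_assoc, ← map_mul, map_smul]; rfl
    simp only [this, ← map_sum, ← Finset.sum_mul, hc]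
    rw [smul_mul_assoc, one_mul, map_smul]; rfl
  rw [h2, ho]
  field_simp

theorem comm_sum {χ : G → ℂ} (h : IsIrr χ) (z : G) :
    ∑ p : G × G, χ (p.1 * p.2 * p.1⁻¹ * p.2⁻¹ * z) = (Fintype.card G / χ 1) ^ 2 * χ z := by
  rw [Fintype.sum_prod_type, Finset.sum_comm]
  simp only [mul_assoc _ _ z]
  simp only [conj_sum h, ← Finset.mul_sum, conv_sum h]
  ring

theorem comms_sum {χ : G → ℂ} (h : IsIrr χ) (g : ℕ) (z : G) :
    ∑ p : (Fin g → G) × (Fin g → G), χ ((List.ofFn fun i => p.1 i * p.2 i * (p.1 i)⁻¹ * (p.2 i)⁻¹).prod * z)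
      = (Fintype.card G / χ 1) ^ (2 * g) * χ z := by
  induction g generalizing z with
  | zero => simp
  | succ g ih =>
    let e : (G × G) × ((Fin g → G) × (Fin g → G)) ≃ (Fin (g+1) → G) × (Fin (g+1) → G) :=
      (Equiv.prodProdProdComm _ _ _ _).trans (Equiv.prodCongr (Fin.consEquiv (fun _ => G)) (Fin.consEquiv (fun _ => G)))
    rw [← Equiv.sum_comp e, Fintype.sum_prod_type, Finset.sum_comm]
    have : ∀ (p : (Fin g → G) × (Fin g → G)) (a : G × G),
      χ ((List.ofFn fun i => (e (a, p)).1 i * (e (a, p)).2 i * ((e (a, p)).1 i)⁻¹ * ((e (a, p)).2 i)⁻¹).prod * z) =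
      χ (a.1 * a.2 * a.1⁻¹ * a.2⁻¹ * ((List.ofFn fun i => p.1 i * p.2 i * (p.1 i)⁻¹ * (p.2 i)⁻¹).prod * z)) := by
      intro p a
      rw [List.ofFn_succ]
      simp [e, Fin.consEquiv, mul_assoc]
    simp only [this, comm_sum h, ← Finset.mul_sum, ih]
    ring

theorem frobenius (g : ℕ) (hg : 1 ≤ g) :
    (Nat.card {p : (Fin g → G) × (Fin g → G) //
            (List.ofFn fun i => p.1 i * p.2 i * (p.1 i)⁻¹ * (p.2 i)⁻¹).prod = 1} : ℂ)
     = Fintype.card G * ∑ χ : {f : G → ℂ // IsIrr f}, (Fintype.card G / χ.1 1) ^ (2 * g - 2) := by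
  classical
  have hG : ((Fintype.card G : ℂ)) ≠ 0 := by simp [Fintype.card_ne_zero]
  let δ : G → ℂ := fun x => if x = 1 then 1 else 0
  have hδ := decomp δ (by
    intro g h
    simp only [δ]
    congr 1
    rw [conj_eq_one_iff])
  have hin : ∀ χ : {f : G → ℂ // IsIrr f}, inn δ χ.1 = (Fintype.card G : ℂ)⁻¹ * χ.1 1 := by
    intro χ
    rw [inn, avg, Finset.sum_eq_single 1]
    · obtain ⟨m, hm, hm2⟩ := χ.2.one
      simp [δ, hm2]
    · intro b _ hb; simp [δ, hb]
    · simp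
  rw [Nat.card_eq_fintype_card, Fintype.card_subtype, Finset.card_filter]
  push_cast
  have : ∀ p : (Fin g → G) × (Fin g → G), (if (List.ofFn fun i => p.1 i * p.2 i * (p.1 i)⁻¹ * (p.2 i)⁻¹).prod = 1 then (1:ℂ) else 0)
    = ∑ χ : {f : G → ℂ // IsIrr f}, (Fintype.card G : ℂ)⁻¹ * χ.1 1 * χ.1 ((List.ofFn fun i => p.1 i * p.2 i * (p.1 i)⁻¹ * (p.2 i)⁻¹).prod * 1) := by
    intro p
    rw [mul_one]
    have := congrFun hδ ((List.ofFn fun i => p.1 i * p.2 i * (p.1 i)⁻¹ * (p.2 i)⁻¹).prod)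
    simp only [Finset.sum_apply, Pi.smul_apply, smul_eq_mul, hin] at this
    exact this
  simp only [this]
  rw [Finset.sum_comm, Finset.mul_sum]
  refine Finset.sum_congr rfl (fun χ _ => ?_)
  rw [← Finset.mul_sum, comms_sum χ.2]
  obtain ⟨m, hm, hm2⟩ := χ.2.one
  have hne : χ.1 1 ≠ 0 := by rw [hm2]; exact_mod_cast hm.ne'
  obtain ⟨k, rfl⟩ : ∃ k, g = k + 1 := ⟨g - 1, by omega⟩
  rw [show 2 * (k+1) - 2 = 2 * k by omega, show 2 * (k+1) = 2 * k + 2 by ring, pow_add]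
  field_simp

end reps2
end HallGL

namespace HallGL

section bridge
variable {F : Type} [Field F] [Fintype F]
variable {V W V1 V2 : Type} [AddCommGroup V] [Module F V] [Finite V] [AddCommGroup W] [Module F W] [Finite W]
  [AddCommGroup V1] [Module F V1] [Finite V1] [AddCommGroup V2] [Module F V2] [Finite V2]

/-- invertible classes -/
def Inv (x : X F) : Prop := Function.Bijective (rep x)

theorem Inv_of_eq (φ : Module.End F V) (ψ : Module.End F W) (h : cls φ = cls ψ) (hb : Function.Bijective φ) :
    Function.Bijective ψ := by
  rw [cls_eq_iff] at h
  obtain ⟨e, he⟩ := h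
  have : (ψ : W → W) = e ∘ φ ∘ e.symm := by
    funext w; simp [he]
  rw [this]
  exact e.bijective.comp (hb.comp e.symm.bijective)

theorem Inv_cls (φ : Module.End F V) : Inv (cls φ) ↔ Function.Bijective φ :=
  ⟨fun h => Inv_of_eq _ _ (cls_rep _) h, fun h => Inv_of_eq _ _ (cls_rep _).symm h⟩

theorem Inv_cls_equiv (g : V ≃ₗ[F] V) : Inv (cls g.toLinearMap) := (Inv_cls _).2 g.bijective

/-- class of an automorphism -/
def ce (g : V ≃ₗ[F] V) : X F := cls g.toLinearMap

theorem deg_ce (g : V ≃ₗ[F] V) : deg (ce g) = finrank F V := deg_cls _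
theorem Inv_ce (g : V ≃ₗ[F] V) : Inv (ce g) := (Inv_cls _).2 g.bijective

theorem exists_ce (x : X F) (h : Inv x) (hd : deg x = finrank F V) : ∃ g : V ≃ₗ[F] V, ce g = x := by
  obtain ⟨φ, rfl⟩ := exists_rep_on x hd
  exact ⟨LinearEquiv.ofBijective φ ((Inv_cls _).1 h), rfl⟩

theorem ce_conj (g h : V ≃ₗ[F] V) : ce (h * g * h⁻¹) = ce g := by
  rw [ce, ce, eq_comm, cls_eq_iff]
  exact ⟨h, fun v => by simp⟩

theorem ce_conj' (e : V ≃ₗ[F] W) (g : V ≃ₗ[F] V) : ce (e.symm.trans (g.trans e)) = ce g := by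
  rw [ce, ce, eq_comm, cls_eq_iff]
  exact ⟨e, fun v => by simp⟩

theorem INTV_inv {K : Type} [CommRing K] [Algebra ℂ K] (f : X F → K) (hf : ∀ x, ¬ Inv x → f x = 0) :
    INTV V f = avg (fun g : V ≃ₗ[F] V => f (ce g)) := by
  classical
  rw [INTV, avg, cG]
  congr 1
  symm
  refine Fintype.sum_of_injective (fun g : V ≃ₗ[F] V => g.toLinearMap) LinearEquiv.toLinearMap_injective _ _ ?_ ?_
  · intro φ hφ
    apply hf
    rw [Inv_cls]
    intro hb
    exact hφ ⟨LinearEquiv.ofBijective φ hb, rfl⟩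
  · intro g; rfl

/-- supported on invertible classes of degree n -/
def Supp (n : ℕ) (f : Hall F ℂ) : Prop := ∀ x, f x ≠ 0 → deg x = n ∧ Inv x

theorem Supp.eqz {n : ℕ} {f : Hall F ℂ} (h : Supp n f) {x : X F} (hx : deg x ≠ n) : f x = 0 := by
  by_contra h1; exact hx (h x h1).1

theorem Supp.eqz' {n : ℕ} {f : Hall F ℂ} (h : Supp n f) {x : X F} (hx : ¬ Inv x) : f x = 0 := by
  by_contra h1; exact hx (h x h1).2

abbrev Aut (F : Type) [Field F] [Fintype F] (n : ℕ) : Type := (Fin n → F) ≃ₗ[F] (Fin n → F)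

theorem Supp.ext {n : ℕ} {f h : Hall F ℂ} (hf : Supp n f) (hh : Supp n h) (he : ∀ g : Aut F n, f (ce g) = h (ce g)) :
    f = h := by
  funext x
  by_cases h1 : deg x = n ∧ Inv x
  · obtain ⟨g, rfl⟩ := exists_ce (V := Fin n → F) x h1.2 (by simp [h1.1])
    exact he g
  · rw [by_contra (fun h2 => h1 (hf x h2)), by_contra (fun h2 => h1 (hh x h2))]

open Classical in
/-- lift of a class function -/
def lift (n : ℕ) (f : Aut F n → ℂ) : Hall F ℂ := fun x => if h : ∃ g : Aut F n, ce g = x then f h.choose else 0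

theorem lift_ce (n : ℕ) (f : Aut F n → ℂ) (hf : ∀ g h, f (h * g * h⁻¹) = f g) (g : Aut F n) : lift n f (ce g) = f g := by
  have h : ∃ g' : Aut F n, ce g' = ce g := ⟨g, rfl⟩
  rw [lift, dif_pos h]
  have h2 := h.choose_spec
  generalize h.choose = g' at *
  rw [ce, ce, cls_eq_iff] at h2
  obtain ⟨e, he⟩ := h2
  rw [← hf g' e]
  congr 1
  ext1 v
  show e (g' (e.symm v)) = g v
  have := he (e.symm v)
  simpa using this

theorem Supp_lift (n : ℕ) (f : Aut F n → ℂ) : Supp n (lift n f) := by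
  intro x hx
  rw [lift] at hx
  split_ifs at hx with h
  · obtain ⟨g, rfl⟩ := h
    exact ⟨by rw [deg_ce]; simp, Inv_ce g⟩
  · exact absurd rfl hx

/-- restriction to the group -/
def res (V : Type) [AddCommGroup V] [Module F V] [Finite V] (f : Hall F ℂ) : (V ≃ₗ[F] V) → ℂ := fun g => f (ce g)

/-- irreducible characters of GL n as Hall algebra elements -/
def Irr (F : Type) [Field F] [Fintype F] (n : ℕ) : Set (Hall F ℂ) := {f | Supp n f ∧ IsIrr (res (Fin n → F) f)}

def irrEquiv (n : ℕ) : Irr F n ≃ {f : Aut F n → ℂ // IsIrr f} where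
  toFun f := ⟨res _ f.1, f.2.2⟩
  invFun f := ⟨lift n f.1, Supp_lift n _, by
    have : res (Fin n → F) (lift n f.1) = f.1 := by
      funext g; exact lift_ce n f.1 f.2.isChar.cls g
    rw [this]; exact f.2⟩
  left_inv f := by
    apply Subtype.ext
    apply Supp.ext (Supp_lift n _) f.2.1
    intro g
    exact lift_ce n (res _ f.1) f.2.2.isChar.cls g
  right_inv f := by
    apply Subtype.ext
    funext g
    exact lift_ce n f.1 f.2.isChar.cls g

instance (n : ℕ) : Finite (Irr F n) := Finite.of_equiv _ (irrEquiv n).symm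
instance (n : ℕ) : Fintype (Irr F n) := Fintype.ofFinite _

/-- complex conjugation -/
def cj (f : Hall F ℂ) : Hall F ℂ := fun x => (starRingEnd ℂ) (f x)

/-- hermitian inner product in degree n -/
def ip (n : ℕ) (f h : Hall F ℂ) : ℂ := INT n (fun x => f x * cj h x)

theorem ip_eq_inn {n : ℕ} {f h : Hall F ℂ} (hf : ∀ x, ¬ Inv x → f x * cj h x = 0) :
    ip n f h = inn (res (Fin n → F) f) (res _ h) := by
  rw [ip, INT, INTV_inv _ hf]; rfl

theorem ip_irr {n : ℕ} {f h : Hall F ℂ} (hf : f ∈ Irr F n) (hh : h ∈ Irr F n) [Decidable (f = h)] : ip n f h = if f = h then 1 else 0 := by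
  classical
  rw [ip_eq_inn (fun x hx => by rw [hf.1.eqz' hx, zero_mul]), inn_irr hf.2 hh.2]
  congr 1
  exact propext ⟨fun e => hf.1.ext hh.1 (fun g => congrFun e g), fun e => by rw [e]⟩

theorem ip_sum {n : ℕ} {ι : Type} (s : Finset ι) (c : ι → ℂ) (f : ι → Hall F ℂ) (h : Hall F ℂ) :
    ip n (fun x => ∑ i ∈ s, c i * f i x) h = ∑ i ∈ s, c i * ip n (f i) h := by
  simp only [ip]
  rw [← Finset.sum_congr rfl (fun i _ => INT_mul_left n (c i) _), ← INT_sum]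
  congr 1
  funext x
  rw [Finset.sum_mul]
  exact Finset.sum_congr rfl (fun i _ => by ring)

theorem cj_cj (f : Hall F ℂ) : cj (cj f) = f := by funext x; simp [cj]

theorem conj_INT (n : ℕ) (f : X F → ℂ) : (starRingEnd ℂ) (INT n f) = INT n (fun x => (starRingEnd ℂ) (f x)) := by
  simp [INT, INTV, cG, map_sum]

theorem ip_conj (n : ℕ) (f h : Hall F ℂ) : (starRingEnd ℂ) (ip n f h) = ip n h f := by
  rw [ip, ip, conj_INT]
  congr 1
  funext x
  simp [cj, mul_comm]

theorem decompH {n : ℕ} {f : Hall F ℂ} (hf : Supp n f) (x : X F) : f x = ∑ χ : Irr F n, ip n f χ.1 * χ.1 x := by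
  have : f = fun x => ∑ χ : Irr F n, ip n f χ.1 * χ.1 x := by
    apply hf.ext
    · intro x hx
      obtain ⟨χ, _, h⟩ := Finset.exists_ne_zero_of_sum_ne_zero hx
      exact χ.2.1 x (right_ne_zero_of_mul h)
    · intro g
      have h1 := congrFun (decomp (res (Fin n → F) f) (fun g h => by simp only [res, ce_conj])) g
      rw [Finset.sum_apply, ← Equiv.sum_comp (irrEquiv n)] at h1
      show res _ f g = _
      rw [h1]
      refine Finset.sum_congr rfl (fun χ _ => ?_)
      rw [ip_eq_inn (fun x hx => by rw [hf.eqz' hx, zero_mul])]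
      rfl
  exact congrFun this x

theorem Supp.mul {i j : ℕ} {a b : Hall F ℂ} (ha : Supp i a) (hb : Supp j b) : Supp (i + j) (a * b) := by
  intro x hx
  rw [← cls_rep x] at hx ⊢
  generalize rep x = φ at *
  rw [mul_cls] at hx
  obtain ⟨S, _, h⟩ := Finset.exists_ne_zero_of_sum_ne_zero hx
  have h1 := ha _ (left_ne_zero_of_mul h)
  have h2 := hb _ (right_ne_zero_of_mul h)
  refine ⟨?_, ?_⟩
  · rw [deg_cls, ← deg_sub_add_quo φ S, h1.1, h2.1]
  · rw [Inv_cls]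
    have i1 := (Inv_cls _).1 h1.2
    have i2 := (Inv_cls _).1 h2.2
    have : Function.Injective φ := by
      rw [injective_iff_map_eq_zero]
      intro v hv
      have h3 : S.1.mkQ v = 0 := by
        apply i2.1
        rw [map_zero]
        show S.1.mapQ S.1 φ S.2 (Submodule.Quotient.mk v) = 0
        rw [Submodule.mapQ_apply, hv]; rfl
      have h4 : v ∈ S.1 := by simpa using h3
      have h5 : (⟨v, h4⟩ : S.1) = 0 := by
        apply i1.1
        rw [map_zero]
        apply Subtype.ext
        exact hv
      exact congrArg Subtype.val h5
    exact ⟨this, Finite.surjective_of_injective this⟩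

end bridge
end HallGL

namespace HallGL

section parabolic
variable {F : Type} [Field F] [Fintype F]
variable {V W V1 V2 : Type} [AddCommGroup V] [Module F V] [Finite V] [AddCommGroup W] [Module F W] [Finite W]
  [AddCommGroup V1] [Module F V1] [Finite V1] [AddCommGroup V2] [Module F V2] [Finite V2]

/-- block triangular group -/
def Par (F V1 V2 : Type) [Field F] [Fintype F] [AddCommGroup V1] [Module F V1] [Finite V1] [AddCommGroup V2] [Module F V2] [Finite V2] : Type :=
  ((V1 ≃ₗ[F] V1) × (V2 ≃ₗ[F] V2)) × (V2 →ₗ[F] V1)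

instance : Fintype (Par F V1 V2) := inferInstanceAs (Fintype (((V1 ≃ₗ[F] V1) × (V2 ≃ₗ[F] V2)) × (V2 →ₗ[F] V1)))

instance : Mul (Par F V1 V2) := ⟨fun p q => ((p.1.1 * q.1.1, p.1.2 * q.1.2), p.1.1.toLinearMap ∘ₗ q.2 + p.2 ∘ₗ q.1.2.toLinearMap)⟩
instance : One (Par F V1 V2) := ⟨((1, 1), 0)⟩
instance : _root_.Inv (Par F V1 V2) := ⟨fun p => ((p.1.1⁻¹, p.1.2⁻¹), -((p.1.1⁻¹).toLinearMap ∘ₗ p.2 ∘ₗ (p.1.2⁻¹).toLinearMap))⟩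
theorem Par.mul_def (p q : Par F V1 V2) : p * q = ((p.1.1 * q.1.1, p.1.2 * q.1.2), p.1.1.toLinearMap ∘ₗ q.2 + p.2 ∘ₗ q.1.2.toLinearMap) := rfl
theorem Par.one_def : (1 : Par F V1 V2) = ((1, 1), 0) := rfl
theorem Par.inv_def (p : Par F V1 V2) : p⁻¹ = ((p.1.1⁻¹, p.1.2⁻¹), -((p.1.1⁻¹).toLinearMap ∘ₗ p.2 ∘ₗ (p.1.2⁻¹).toLinearMap)) := rfl

theorem Par.mul1 (p q : Par F V1 V2) : (p * q).1 = (p.1.1 * q.1.1, p.1.2 * q.1.2) := rfl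
theorem Par.mul2 (p q : Par F V1 V2) (v : V2) : (p * q).2 v = p.1.1 (q.2 v) + p.2 (q.1.2 v) := rfl
theorem Par.inv2 (p : Par F V1 V2) (v : V2) : (p⁻¹).2 v = -((p.1.1⁻¹) (p.2 (p.1.2⁻¹ v))) := rfl
theorem Par.one2 (v : V2) : (1 : Par F V1 V2).2 v = 0 := rfl
theorem Par.inv1 (p : Par F V1 V2) : (p⁻¹).1 = (p.1.1⁻¹, p.1.2⁻¹) := rfl
theorem Par.one1 : (1 : Par F V1 V2).1 = (1, 1) := rfl

instance : Group (Par F V1 V2) := Group.ofLeftAxioms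
  (by
    intro p q r
    refine Prod.ext (Prod.ext (mul_assoc _ _ _) (mul_assoc _ _ _)) ?_
    ext1 v
    simp only [Par.mul2, Par.mul1, map_add, add_assoc, LinearEquiv.mul_apply])
  (by
    intro p
    refine Prod.ext (Prod.ext (one_mul _) (one_mul _)) ?_
    ext1 v
    rw [Par.mul2, Par.one2, Par.one1, add_zero]; rfl)
  (by
    intro p
    refine Prod.ext (Prod.ext (inv_mul_cancel p.1.1) (inv_mul_cancel p.1.2)) ?_
    ext1 v
    rw [Par.mul2, Par.inv2, Par.inv1, Par.one2, ← LinearEquiv.mul_apply p.1.2⁻¹, inv_mul_cancel]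
    exact add_neg_cancel _)

def Par.fst : Par F V1 V2 →* (V1 ≃ₗ[F] V1) where
  toFun p := p.1.1
  map_one' := rfl
  map_mul' _ _ := rfl
def Par.snd : Par F V1 V2 →* (V2 ≃ₗ[F] V2) where
  toFun p := p.1.2
  map_one' := rfl
  map_mul' _ _ := rfl
def Par.emb : Par F V1 V2 →* ((V1 × V2) ≃ₗ[F] (V1 × V2)) where
  toFun p := blkE p.1.1 p.2 p.1.2
  map_one' := by
    ext1 v
    rw [blkE_apply]
    simp [Par.one_def]
  map_mul' p q := by
    ext1 v
    rw [LinearEquiv.mul_apply, blkE_apply, blkE_apply, blkE_apply]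
    simp [Par.mul_def, add_assoc]

theorem isChar_congr (e : V ≃ₗ[F] W) (f : Hall F ℂ) (h : IsChar (res V f)) : IsChar (res W f) := by
  let φ : (W ≃ₗ[F] W) →* (V ≃ₗ[F] V) :=
    { toFun := fun g => e.trans (g.trans e.symm)
      map_one' := by ext; simp
      map_mul' := by intro a b; ext; simp }
  have := h.comp φ
  convert this using 1
  funext g
  show f (ce g) = f (ce _)
  congr 1
  exact (ce_conj' e.symm g).symm

theorem Inv_blk (φ : Module.End F V1) (u : V2 →ₗ[F] V1) (ψ : Module.End F V2) (h : Inv (cls (blk φ u ψ))) :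
    Inv (cls φ) ∧ Inv (cls ψ) := by
  rw [Inv_cls] at h
  have h1 : Function.Injective φ := by
    rw [injective_iff_map_eq_zero]
    intro v hv
    have := h.1 (a₁ := (v, 0)) (a₂ := 0) (by simp [hv])
    exact congrArg Prod.fst this
  have h2 : Function.Surjective ψ := by
    intro w
    obtain ⟨v, hv⟩ := h.2 (0, w)
    exact ⟨v.2, congrArg Prod.snd hv⟩
  exact ⟨(Inv_cls _).2 ⟨h1, Finite.surjective_of_injective h1⟩, (Inv_cls _).2 ⟨Finite.injective_iff_surjective.2 h2, h2⟩⟩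

theorem Delta_supp {n : ℕ} {f : Hall F ℂ} (hf : Supp n f) (x y : X F) (h : Delta f x y ≠ 0) :
    deg x + deg y = n ∧ Inv x ∧ Inv y := by
  rw [← cls_rep x, ← cls_rep y, Delta_cls] at h
  rw [← cls_rep x, ← cls_rep y]
  generalize rep x = φ at *
  generalize rep y = ψ at *
  rw [avg] at h
  obtain ⟨u, _, h⟩ := Finset.exists_ne_zero_of_sum_ne_zero (right_ne_zero_of_smul h)
  have h1 := hf _ h
  refine ⟨?_, Inv_blk _ _ _ h1.2⟩
  rw [← h1.1]
  simp [deg_cls]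

theorem Supp.cj {n : ℕ} {f : Hall F ℂ} (hf : Supp n f) : Supp n (cj f) := by
  intro x hx
  apply hf x
  intro h
  simp [HallGL.cj, h] at hx

theorem INT_only {i : ℕ} {f : X F → ℂ} {n : ℕ} (h : ∀ x, f x ≠ 0 → deg x = i) (hn : n ≠ i) : INT n f = 0 := by
  rw [INT_congr (g := fun _ => 0), INT_zero]
  intro x hx
  by_contra h1
  exact hn (hx ▸ h x h1)

/-- the pairing with a product, only one bidegree -/
theorem ip_mul {i j : ℕ} {a b f : Hall F ℂ} (ha : Supp i a) (hb : Supp j b) :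
    INT (i + j) (fun x => f x * (a * b) x) = INT i (fun x => INT j (fun y => Delta f x y * (a x * b y))) := by
  rw [INT_mul, Finset.sum_eq_single (i, j)]
  · rintro ⟨i', j'⟩ h1 h2
    rw [Finset.HasAntidiagonal.mem_antidiagonal] at h1
    have h3 : i' ≠ i := by
      rintro rfl
      apply h2
      simp only at h1
      congr 1; omega
    refine INT_only (i := i) ?_ h3
    intro x hx
    by_contra h4
    apply hx
    simp [ha.eqz h4, INT_zero]
  · intro h
    exact absurd (by rw [Finset.HasAntidiagonal.mem_antidiagonal]) h

theorem ip_mul_nat {i j : ℕ} {a b f : Hall F ℂ} (ha : Supp i a) (hb : Supp j b)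
    (ha' : IsChar (res (Fin i → F) a)) (hb' : IsChar (res (Fin j → F) b)) (hf' : IsChar (res (Fin (i+j) → F) f)) :
    ∃ m : ℕ, INT (i + j) (fun x => f x * (a * b) x) = m := by
  rw [ip_mul ha hb]
  have hf2 : IsChar (res ((Fin i → F) × (Fin j → F)) f) := isChar_congr (LinearEquiv.ofFinrankEq _ _ (by simp)) f hf'
  have h1 := ((ha'.comp (Par.fst (F := F) (V1 := Fin i → F) (V2 := Fin j → F))).mul (hb'.comp (Par.snd (F := F) (V1 := Fin i → F) (V2 := Fin j → F)))).mul (hf2.comp Par.emb)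
  obtain ⟨m, hm⟩ := h1.avg
  refine ⟨m, ?_⟩
  rw [← hm, INT, INTV_inv]
  · simp only [INT]
    have h3 : ∀ g : Aut F i, INTV (Fin j → F) (fun y => Delta f (ce g) y * (a (ce g) * b y)) =
        avg (fun h : Aut F j => avg (fun u : (Fin j → F) →ₗ[F] (Fin i → F) => a (ce g) * b (ce h) * f (ce (blkE g u h)))) := by
      intro g
      rw [INTV_inv]
      · refine avg_congr (fun h => ?_)
        rw [ce, ce, Delta_cls, avg_mul_left, mul_comm]
        rfl
      · intro x hx
        rw [hb.eqz' hx]; ring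
    simp only [h3]
    rw [show avg (fun g : Aut F i => avg (fun h : Aut F j => avg (fun u : (Fin j → F) →ₗ[F] (Fin i → F) => a (ce g) * b (ce h) * f (ce (blkE g u h)))))
      = avg (fun p : Aut F i × Aut F j => avg (fun u : (Fin j → F) →ₗ[F] (Fin i → F) => a (ce p.1) * b (ce p.2) * f (ce (blkE p.1 u p.2)))) from (avg_prod (fun p : Aut F i × Aut F j => avg (fun u : (Fin j → F) →ₗ[F] (Fin i → F) => a (ce p.1) * b (ce p.2) * f (ce (blkE p.1 u p.2))))).symm]
    exact (avg_prod (fun p : (Aut F i × Aut F j) × ((Fin j → F) →ₗ[F] (Fin i → F)) => a (ce p.1.1) * b (ce p.1.2) * f (ce (blkE p.1.1 p.2 p.1.2)))).symm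
  · intro x hx
    simp [ha.eqz' hx, INT_zero]

end parabolic
end HallGL

namespace HallGL

section whit
variable {F : Type} [Field F] [Fintype F] (ψ : AddChar F ℂ)

/-- iterated Whittaker average -/
def Lam (f : Hall F ℂ) : (k : ℕ) → (V : Type) → [AddCommGroup V] → [Module F V] → [Finite V] → (V →ₗ[F] F) → Module.End F V → ℂ
  | 0, _, _, _, _, _, φ => f (cls φ)
  | (k+1), V, _, _, _, l, φ => avg (fun u : F →ₗ[F] V => ψ (l (u 1)) * Lam f k (V × F) (LinearMap.snd F V F) (blk φ u 1))

variable {V W V1 V2 : Type} [AddCommGroup V] [Module F V] [Finite V] [AddCommGroup W] [Module F W] [Finite W]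
  [AddCommGroup V1] [Module F V1] [Finite V1] [AddCommGroup V2] [Module F V2] [Finite V2]

theorem Lam_zero (f : Hall F ℂ) (l : V →ₗ[F] F) (φ : Module.End F V) : Lam ψ f 0 V l φ = f (cls φ) := rfl
theorem Lam_succ (f : Hall F ℂ) (k : ℕ) (l : V →ₗ[F] F) (φ : Module.End F V) :
    Lam ψ f (k+1) V l φ = avg (fun u : F →ₗ[F] V => ψ (l (u 1)) * Lam ψ f k (V × F) (LinearMap.snd F V F) (blk φ u 1)) := rfl

theorem Lam_congr (f : Hall F ℂ) (k : ℕ) : ∀ (V W : Type) [AddCommGroup V] [Module F V] [Finite V] [AddCommGroup W] [Module F W] [Finite W]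
    (e : V ≃ₗ[F] W) (l : V →ₗ[F] F) (m : W →ₗ[F] F) (φ : Module.End F V) (χ : Module.End F W)
    (hl : ∀ v, m (e v) = l v) (hφ : ∀ v, χ (e v) = e (φ v)), Lam ψ f k V l φ = Lam ψ f k W m χ := by
  induction k with
  | zero =>
    intro V W _ _ _ _ _ _ e l m φ χ hl hφ
    rw [Lam_zero, Lam_zero]
    congr 1
    rw [cls_eq_iff]
    exact ⟨e, fun v => (hφ v).symm⟩
  | succ k ih =>
    intro V W _ _ _ _ _ _ e l m φ χ hl hφ
    rw [Lam_succ, Lam_succ]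
    let E : (F →ₗ[F] V) ≃ (F →ₗ[F] W) := (LinearEquiv.congrRight e).toEquiv
    refine avg_equiv E _ _ (fun u => ?_)
    have hE : ∀ c, E u c = e (u c) := fun c => rfl
    rw [hE, hl]
    congr 1
    refine ih (V × F) (W × F) (LinearEquiv.prodCongr e (LinearEquiv.refl F F)) _ _ _ _ (fun v => rfl) (fun v => ?_)
    simp [hE, hφ]

theorem avg_equiv2 {A B C D : Type} [Fintype A] [Fintype B] [Fintype C] [Fintype D] (E : A × B ≃ C × D) (f : A → B → ℂ) (g : C → D → ℂ)
    (h : ∀ p, f p.1 p.2 = g (E p).1 (E p).2) : avg (fun a => avg (f a)) = avg (fun c => avg (g c)) := by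
  rw [← avg_prod (fun p : A × B => f p.1 p.2), ← avg_prod (fun p : C × D => g p.1 p.2)]
  exact avg_equiv E _ _ h

theorem Lam_Delta (f : Hall F ℂ) (χ : Module.End F V1) (k : ℕ) : ∀ (W : Type) [AddCommGroup W] [Module F W] [Finite W]
    (l : W →ₗ[F] F) (φ : Module.End F W),
    Lam ψ (Delta f (cls χ)) k W l φ = avg (fun u : W →ₗ[F] V1 => Lam ψ f k (V1 × W) (l ∘ₗ LinearMap.snd F V1 W) (blk χ u φ)) := by
  induction k with
  | zero =>
    intro W _ _ _ l φ
    simp only [Lam_zero]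
    rw [Delta_cls]
  | succ k ih =>
    intro W _ _ _ l φ
    simp only [Lam_succ, ih]
    let E : (F →ₗ[F] W) × ((W × F) →ₗ[F] V1) ≃ (W →ₗ[F] V1) × (F →ₗ[F] (V1 × W)) :=
      { toFun := fun p => (p.2 ∘ₗ LinearMap.inl F W F, (p.2 ∘ₗ LinearMap.inr F W F).prod p.1)
        invFun := fun p => (LinearMap.snd F V1 W ∘ₗ p.2, p.1.coprod (LinearMap.fst F V1 W ∘ₗ p.2))
        left_inv := by
          intro p
          refine Prod.ext ?_ ?_
          · ext; simp
          · ext <;> simp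
        right_inv := by
          intro p
          refine Prod.ext ?_ ?_
          · ext <;> simp
          · ext <;> simp }
    simp only [← avg_mul_left]
    refine avg_equiv2 E _ _ (fun p => ?_)
    congr 1
    refine Lam_congr ψ f k _ _ (LinearEquiv.prodAssoc F V1 W F).symm _ _ _ _ (fun v => rfl) (fun v => ?_)
    obtain ⟨v, w, c⟩ := v
    have : p.2 (w, c) = p.2 (w, 0) + p.2 (0, c) := by rw [← map_add]; simp
    simp [E, LinearEquiv.prodAssoc, this, add_assoc]

theorem Lam_add (f g : Hall F ℂ) (k : ℕ) : ∀ (V : Type) [AddCommGroup V] [Module F V] [Finite V] (l : V →ₗ[F] F) (φ : Module.End F V),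
    Lam ψ (f + g) k V l φ = Lam ψ f k V l φ + Lam ψ g k V l φ := by
  induction k with
  | zero => intros; rfl
  | succ k ih => intros; simp only [Lam_succ, ih, mul_add, avg_add]

theorem Lam_smul (c : ℂ) (f g : Hall F ℂ) (hg : ∀ x, g x = c * f x) (k : ℕ) : ∀ (V : Type) [AddCommGroup V] [Module F V] [Finite V] (l : V →ₗ[F] F) (φ : Module.End F V),
    Lam ψ g k V l φ = c * Lam ψ f k V l φ := by
  induction k with
  | zero => intros; exact hg _
  | succ k ih =>
    intro V _ _ _ l φ
    rw [Lam_succ, Lam_succ, ← avg_mul_left]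
    exact avg_congr (fun u => by rw [ih]; ring)

theorem Lam_ext (f g : Hall F ℂ) (n : ℕ) (h : ∀ x, deg x = n → f x = g x) (k : ℕ) : ∀ (V : Type) [AddCommGroup V] [Module F V] [Finite V] (l : V →ₗ[F] F) (φ : Module.End F V),
    finrank F V + k = n → Lam ψ f k V l φ = Lam ψ g k V l φ := by
  induction k with
  | zero => intro V _ _ _ l φ hV; exact h _ (by rw [deg_cls]; omega)
  | succ k ih =>
    intro V _ _ _ l φ hV
    simp only [Lam_succ]
    refine avg_congr (fun u => ?_)
    rw [ih]
    simp; omega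

/-- Affine extension group -/
structure Aff (H : Type) [Group H] (a : H →* (V ≃ₗ[F] V)) : Type where
  h : H
  u : F →ₗ[F] V

namespace Aff
variable {H : Type} [Group H] {a : H →* (V ≃ₗ[F] V)}
def eqv : Aff H a ≃ H × (F →ₗ[F] V) := ⟨fun p => (p.h, p.u), fun p => ⟨p.1, p.2⟩, fun _ => rfl, fun _ => rfl⟩
instance [Fintype H] : Fintype (Aff H a) := Fintype.ofEquiv _ eqv.symm
instance : Mul (Aff H a) := ⟨fun p q => ⟨p.h * q.h, (a p.h).toLinearMap ∘ₗ q.u + p.u⟩⟩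
instance : One (Aff H a) := ⟨⟨1, 0⟩⟩
instance : _root_.Inv (Aff H a) := ⟨fun p => ⟨p.h⁻¹, -((a p.h⁻¹).toLinearMap ∘ₗ p.u)⟩⟩
theorem mul_h (p q : Aff H a) : (p * q).h = p.h * q.h := rfl
theorem mul_u (p q : Aff H a) : (p * q).u = (a p.h).toLinearMap ∘ₗ q.u + p.u := rfl
theorem inv_h (p : Aff H a) : (p⁻¹).h = p.h⁻¹ := rfl
theorem inv_u (p : Aff H a) : (p⁻¹).u = -((a p.h⁻¹).toLinearMap ∘ₗ p.u) := rfl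
theorem one_h : (1 : Aff H a).h = 1 := rfl
theorem one_u : (1 : Aff H a).u = 0 := rfl
theorem ext' {p q : Aff H a} (h1 : p.h = q.h) (h2 : p.u = q.u) : p = q := by
  cases p; cases q; simp_all
instance : Group (Aff H a) := Group.ofLeftAxioms
  (by
    intro p q r
    refine ext' (mul_assoc _ _ _) ?_
    simp only [mul_u, mul_h, map_mul]
    ext
    simp [add_assoc])
  (by
    intro p
    refine ext' (one_mul _) ?_
    simp only [mul_u, one_h, one_u, map_one]
    ext
    simp)
  (by
    intro p
    refine ext' (inv_mul_cancel p.h) ?_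
    simp only [mul_u, inv_h, inv_u, one_u]
    ext
    simp)

def emb : Aff H a →* ((V × F) ≃ₗ[F] (V × F)) where
  toFun p := blkE (a p.h) p.u 1
  map_one' := by
    ext1 v
    rw [blkE_apply, one_h, one_u]
    simp
  map_mul' p q := by
    ext1 v
    rw [LinearEquiv.mul_apply, blkE_apply, blkE_apply, blkE_apply, mul_h, mul_u]
    simp [add_assoc]

end Aff

theorem Lam_nat (f : Hall F ℂ) (n : ℕ) (hf : IsChar (res (Fin n → F) f)) (k : ℕ) : ∀ (V : Type) [AddCommGroup V] [Module F V] [Finite V]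
    (l : V →ₗ[F] F) (H : Type) [Group H] [Fintype H] (a : H →* (V ≃ₗ[F] V)) (c : H →* ℂ) (hl : ∀ h v, l (a h v) = l v),
    finrank F V + k = n → ∃ m : ℕ, avg (fun h => c h * Lam ψ f k V l (a h).toLinearMap) = m := by
  induction k with
  | zero =>
    intro V _ _ _ l H _ _ a c hl hn
    have h1 : IsChar (res V f) := isChar_congr (LinearEquiv.ofFinrankEq _ _ (by simp; omega)) f hf
    exact ((isChar_hom c).mul (h1.comp a)).avg
  | succ k ih =>
    intro V _ _ _ l H _ _ a c hl hn
    let c' : Aff H a →* ℂ :=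
      { toFun := fun p => c p.h * ψ (l (p.u 1))
        map_one' := by simp [Aff.one_h, Aff.one_u]
        map_mul' := by
          intro p q
          simp only [Aff.mul_h, Aff.mul_u, map_mul, LinearMap.add_apply, LinearMap.comp_apply, map_add, LinearEquiv.coe_coe, hl, AddChar.map_add_eq_mul]
          ring }
    obtain ⟨m, hm⟩ := ih (V × F) (LinearMap.snd F V F) (Aff H a) Aff.emb c' (fun h v => rfl) (by simp; omega)
    refine ⟨m, ?_⟩
    rw [← hm]
    simp only [Lam_succ, ← avg_mul_left]
    rw [← avg_prod (fun p : H × (F →ₗ[F] V) => c p.1 * (ψ (l (p.2 1)) * Lam ψ f k (V × F) (LinearMap.snd F V F) (blk (a p.1).toLinearMap p.2 1)))]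
    refine avg_equiv Aff.eqv.symm _ _ (fun p => ?_)
    rw [← mul_assoc]
    rfl

theorem Lam_nat' (f : Hall F ℂ) (n : ℕ) (hf : IsChar (res (Fin n → F) f)) :
    ∃ m : ℕ, Lam ψ f n (Fin 0 → F) 0 1 = m := by
  obtain ⟨m, hm⟩ := Lam_nat ψ f n hf n (Fin 0 → F) 0 Unit 1 1 (fun _ _ => rfl) (by simp)
  refine ⟨m, ?_⟩
  rw [← hm]
  simp only [MonoidHom.one_apply, one_mul]
  rw [avg_const]
  rfl

end whit
end HallGL

namespace HallGL

section whit2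
variable {F : Type} [Field F] [Fintype F]
variable {V W V1 V2 : Type} [AddCommGroup V] [Module F V] [Finite V] [AddCommGroup W] [Module F W] [Finite W]
  [AddCommGroup V1] [Module F V1] [Finite V1] [AddCommGroup V2] [Module F V2] [Finite V2]

/-- field size -/
def qq (F : Type) [Field F] [Fintype F] : ℂ := (Fintype.card F : ℂ)

theorem qq_ne : qq F ≠ 0 := by
  rw [qq]; exact_mod_cast Fintype.card_ne_zero

theorem qq_pow_ne (n : ℕ) (hn : n ≠ 0) : qq F ^ n - 1 ≠ 0 := by
  rw [qq]
  have h1 : 1 < Fintype.card F := Fintype.one_lt_card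
  have : 1 < Fintype.card F ^ n := Nat.one_lt_pow hn h1
  rw [sub_ne_zero]
  exact_mod_cast this.ne'

def phi (Q : ℂ) (n : ℕ) : ℂ := ∏ i ∈ Finset.range n, (Q ^ (i+1) - 1)
theorem phi_succ (Q : ℂ) (n : ℕ) : phi Q (n+1) = phi Q n * (Q^(n+1) - 1) := Finset.prod_range_succ _ _
theorem phi_zero (Q : ℂ) : phi Q 0 = 1 := rfl
theorem phi_ne (n : ℕ) : phi (qq F) n ≠ 0 := Finset.prod_ne_zero_iff.2 (fun i _ => qq_pow_ne _ (by omega))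

theorem card_lin : (Fintype.card (V →ₗ[F] W) : ℂ) = qq F ^ (finrank F V * finrank F W) := by
  rw [qq, ← Nat.card_eq_fintype_card, Module.natCard_eq_pow_finrank (K := F), Module.finrank_linearMap, ← Nat.card_eq_fintype_card]
  push_cast; rfl

theorem prod_rev (Q : ℂ) (n : ℕ) : ∏ i : Fin n, (Q^n - Q^(i:ℕ)) = Q^(n.choose 2) * phi Q n := by
  rw [Fin.prod_univ_eq_prod_range (fun i => Q^n - Q^i) n]
  have : ∀ i ∈ Finset.range n, Q^n - Q^i = Q^i * (Q^(n-i) - 1) := by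
    intro i hi
    rw [Finset.mem_range] at hi
    rw [mul_sub, ← pow_add, mul_one]; congr 2; omega
  rw [Finset.prod_congr rfl this, Finset.prod_mul_distrib, Finset.prod_pow_eq_pow_sum, Finset.sum_range_id, ← Nat.choose_two_right]
  congr 1
  rw [phi, ← Finset.prod_range_reflect]
  refine Finset.prod_congr rfl (fun i hi => ?_)
  rw [Finset.mem_range] at hi
  congr 2; omega

open scoped MatrixGroups in
def glEquiv (n : ℕ) : GL (Fin n) F ≃* Aut F n :=
  (Matrix.GeneralLinearGroup.toLin).trans (LinearMap.GeneralLinearGroup.generalLinearEquiv F (Fin n → F))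

theorem cG_eq (n : ℕ) : cG F (Fin n → F) = qq F ^ (n.choose 2) * phi (qq F) n := by
  classical
  have h1 : Nat.card (Matrix.GeneralLinearGroup (Fin n) F) = ∏ i : Fin n, (Fintype.card F ^ n - Fintype.card F ^ (i : ℕ)) := Matrix.card_GL_field n
  rw [← prod_rev, cG]
  rw [← Nat.card_eq_fintype_card, ← Nat.card_congr (glEquiv n).toEquiv, h1, qq]
  push_cast
  refine Finset.prod_congr rfl (fun i _ => ?_)
  rw [Nat.cast_sub]
  · push_cast; rfl
  · exact Nat.pow_le_pow_right Fintype.card_pos i.2.le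

/-- identity class -/
def idc (F : Type) [Field F] [Fintype F] (n : ℕ) : X F := cls (1 : Module.End F (Fin n → F))
theorem deg_idc (n : ℕ) : deg (idc F n) = n := by rw [idc, deg_cls]; simp

theorem cls_eq_idc (φ : Module.End F V) (n : ℕ) : cls φ = idc F n ↔ finrank F V = n ∧ φ = 1 := by
  constructor
  · intro h
    have h1 : finrank F V = n := by rw [← deg_cls φ, h, deg_idc]
    refine ⟨h1, ?_⟩
    rw [idc, cls_eq_iff] at h
    obtain ⟨e, he⟩ := h
    ext v
    apply e.injective
    rw [he]; simp
  · rintro ⟨h1, rfl⟩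
    rw [idc, cls_eq_iff]
    exact ⟨LinearEquiv.ofFinrankEq _ _ (by simp [h1]), fun v => by simp⟩

open Classical in
/-- weighted regular character -/
def regc (c : ℂ) : Hall F ℂ := fun x => if x = idc F (deg x) then qq F ^ ((deg x).choose 2) * c ^ (deg x) else 0

theorem choose_add_two (a b : ℕ) : (a+b).choose 2 = a.choose 2 + b.choose 2 + a * b := by
  have h : ∀ n : ℕ, n.choose 2 * 2 = n * (n-1) := fun n => by
    rw [Nat.choose_two_right, Nat.div_mul_cancel (Nat.even_mul_pred_self n).two_dvd]
  have h1 := h (a+b); have h2 := h a; have h3 := h b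
  rcases a with _ | a
  · simp
  rcases b with _ | b
  · simp
  simp only [Nat.add_sub_cancel] at *
  rw [show a + 1 + (b+1) - 1 = a + b + 1 by omega] at h1
  nlinarith

theorem blk_one_iff (φ : Module.End F V1) (u : V2 →ₗ[F] V1) (χ : Module.End F V2) :
    blk φ u χ = 1 ↔ φ = 1 ∧ u = 0 ∧ χ = 1 := by
  constructor
  · intro h
    have h1 : ∀ v w, (φ v + u w, χ w) = (v, w) := fun v w => by
      have := LinearMap.congr_fun h (v, w); simpa using this
    refine ⟨?_, ?_, ?_⟩
    · ext v; have := (Prod.ext_iff.1 (h1 v 0)).1; simpa using this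
    · ext v; have := (Prod.ext_iff.1 (h1 0 v)).1; simpa using this
    · ext v; have := (Prod.ext_iff.1 (h1 0 v)).2; simpa using this
  · rintro ⟨rfl, rfl, rfl⟩
    ext <;> simp

theorem regc_cls [DecidableEq (Module.End F V)] (c : ℂ) (φ : Module.End F V) :
    regc c (cls φ) = if φ = 1 then qq F ^ ((finrank F V).choose 2) * c ^ (finrank F V) else 0 := by
  rw [regc, deg_cls]
  congr 1
  simp [cls_eq_idc]

theorem Gl_regc (c : ℂ) : Gl (regc c : Hall F ℂ) := by
  classical
  constructor
  · intro x y
    obtain ⟨n, φ, rfl⟩ : ∃ n, ∃ φ : Module.End F (Fin n → F), cls φ = x := ⟨_, rep x, cls_rep x⟩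
    obtain ⟨m, χ, rfl⟩ : ∃ n, ∃ φ : Module.End F (Fin n → F), cls φ = y := ⟨_, rep y, cls_rep y⟩
    rw [Delta_cls]
    simp only [regc_cls, blk_one_iff]
    rw [avg, smul_eq_mul]
    by_cases h1 : φ = 1
    · by_cases h2 : χ = 1
      · simp only [h1, h2, true_and, and_true, if_true]
        rw [Finset.sum_ite_eq' Finset.univ (0 : (Fin m → F) →ₗ[F] (Fin n → F)) (fun _ => qq F ^ ((finrank F ((Fin n → F) × (Fin m → F))).choose 2) * c ^ (finrank F ((Fin n → F) × (Fin m → F)))), if_pos (Finset.mem_univ _), card_lin]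
        simp only [Module.finrank_prod, Module.finrank_fin_fun, choose_add_two]
        have := qq_ne (F := F)
        field_simp
        ring
      · simp [h2]
    · simp [h1]
  · intro x hx
    have : x = idc F (deg x) := deg_zero_eq hx (by rw [deg_idc, hx])
    rw [regc, if_pos this, hx]; simp

theorem INT_regc (c : ℂ) (n : ℕ) (h : X F → ℂ) : INT n (fun x => h x * regc c x) = h (idc F n) * c ^ n / phi (qq F) n := by
  classical
  rw [INT, INTV, cG_eq, smul_eq_mul]
  simp only [regc_cls, mul_ite, mul_zero]
  rw [Finset.sum_ite_eq' Finset.univ (1 : Module.End F (Fin n → F)), if_pos (Finset.mem_univ _)]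
  simp only [Module.finrank_fin_fun]
  rw [← idc]
  have := qq_ne (F := F)
  have := phi_ne (F := F) n
  field_simp

variable (ψ : AddChar F ℂ)

theorem Lam_normal (f : Hall F ℂ) (k m : ℕ) (l : V →ₗ[F] F) (hl : l ≠ 0) (hV : finrank F V = m + 1) :
    Lam ψ f k V l 1 = Lam ψ f k ((Fin m → F) × F) (LinearMap.snd F _ F) 1 := by
  obtain ⟨w, hw⟩ : ∃ w, l w = 1 := by
    obtain ⟨v, hv⟩ : ∃ v, l v ≠ 0 := by
      by_contra h; push Not at h; exact hl (LinearMap.ext h)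
    exact ⟨(l v)⁻¹ • v, by simp [hv]⟩
  have hs : Function.Surjective l := fun c => ⟨c • w, by simp [hw]⟩
  have hk : finrank F (LinearMap.ker l) = m := by
    have := LinearMap.finrank_range_add_finrank_ker l
    rw [LinearMap.range_eq_top.2 hs, finrank_top, hV] at this
    simp at this; omega
  let e0 : (Fin m → F) ≃ₗ[F] LinearMap.ker l := LinearEquiv.ofFinrankEq _ _ (by simp [hk])
  let e1 : ((Fin m → F) × F) →ₗ[F] V := ((LinearMap.ker l).subtype ∘ₗ e0.toLinearMap).coprod (LinearMap.toSpanSingleton F V w)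
  have h1 : ∀ p, e1 p = (e0 p.1 : V) + p.2 • w := fun p => by simp [e1]
  have h2 : ∀ p, l (e1 p) = p.2 := fun p => by
    have h3 : l (e0 p.1 : V) = 0 := (e0 p.1).2
    rw [h1, map_add, h3]; simp [hw]
  have hi : Function.Injective e1 := by
    rw [injective_iff_map_eq_zero]
    rintro ⟨a, c⟩ hp
    have hc : c = 0 := by have := h2 (a, c); rw [hp] at this; simpa using this.symm
    subst hc
    rw [h1] at hp
    simp at hp
    rw [hp]; rfl
  have hb : Function.Bijective e1 := ⟨hi, (LinearMap.injective_iff_surjective_of_finrank_eq_finrank (by simp [hV])).1 hi⟩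
  symm
  exact Lam_congr ψ f k _ _ (LinearEquiv.ofBijective e1 hb) _ _ _ _ (fun v => h2 v) (fun v => by simp)

theorem orth_sum (hψ : ψ ≠ 0) (v : V) [Decidable (v = 0)] : ∑ l : V →ₗ[F] F, ψ (l v) = if v = 0 then qq F ^ finrank F V else 0 := by
  let χ : AddChar (V →ₗ[F] F) ℂ := ψ.compAddMonoidHom (LinearMap.applyₗ v : (V →ₗ[F] F) →ₗ[F] F).toAddMonoidHom
  have h1 : ∀ l, χ l = ψ (l v) := fun l => rfl
  simp only [← h1]
  split_ifs with h
  · subst h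
    simp only [h1, map_zero, AddChar.map_zero_eq_one, Finset.sum_const, Finset.card_univ, nsmul_eq_mul, mul_one]
    rw [card_lin]; simp
  · rw [AddChar.sum_eq_zero_iff_ne_zero]
    intro h0
    apply hψ
    obtain ⟨l, hl⟩ : ∃ l : V →ₗ[F] F, l v ≠ 0 := by
      by_contra hc; push Not at hc
      exact h ((Module.forall_dual_apply_eq_zero_iff F v).1 hc)
    ext c
    have := DFunLike.congr_fun h0 ((c * (l v)⁻¹) • l)
    rw [h1] at this
    simpa [hl] using this

theorem Lam_rec (hψ : ψ ≠ 0) (f : Hall F ℂ) (k : ℕ) :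
    ∑ l : V →ₗ[F] F, Lam ψ f (k+1) V l 1 = Lam ψ f k (V × F) (LinearMap.snd F V F) 1 := by
  classical
  simp only [Lam_succ, avg, smul_eq_mul]
  rw [← Finset.mul_sum, Finset.sum_comm]
  simp only [← Finset.sum_mul, orth_sum ψ hψ]
  rw [Finset.sum_eq_single (0 : F →ₗ[F] V)]
  · rw [if_pos (by simp), card_lin, (blk_one_iff _ _ _).2 ⟨rfl, rfl, rfl⟩]
    have := qq_ne (F := F)
    simp
    field_simp
  · intro u _ hu
    rw [if_neg, zero_mul]
    intro h; apply hu; ext; simpa using h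
  · simp

theorem Lam_rec' (hψ : ψ ≠ 0) (f : Hall F ℂ) (k m : ℕ) :
    Lam ψ f k ((Fin (m+1) → F) × F) (LinearMap.snd F _ F) 1 =
     Lam ψ f (k+1) (Fin (m+1) → F) 0 1 + (qq F ^ (m+1) - 1) * Lam ψ f (k+1) ((Fin m → F) × F) (LinearMap.snd F _ F) 1 := by
  classical
  rw [← Lam_rec ψ hψ, ← Finset.add_sum_erase _ _ (Finset.mem_univ (0 : (Fin (m+1) → F) →ₗ[F] F))]
  congr 1
  rw [Finset.sum_congr rfl (fun l hl => Lam_normal ψ f (k+1) m l (Finset.ne_of_mem_erase hl) (by simp)), Finset.sum_const, Finset.card_erase_of_mem (Finset.mem_univ _), nsmul_eq_mul, Finset.card_univ, Nat.cast_sub (Fintype.card_pos), card_lin]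
  simp

theorem Lam_rec0 (hψ : ψ ≠ 0) (f : Hall F ℂ) (k : ℕ) :
    Lam ψ f k ((Fin 0 → F) × F) (LinearMap.snd F _ F) 1 = Lam ψ f (k+1) (Fin 0 → F) 0 1 := by
  rw [← Lam_rec ψ hψ]
  rw [Finset.sum_eq_single 0]
  · intro l _ hl; exact absurd (LinearMap.ext (fun v => by rw [Subsingleton.elim v 0, map_zero, map_zero])) hl
  · simp

theorem chain (hψ : ψ ≠ 0) (f : Hall F ℂ) (k : ℕ) : ∀ m, ∑ i ∈ Finset.range (m+1), Lam ψ f (k + (m + 1) - i) (Fin i → F) 0 1 / phi (qq F) i =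
    Lam ψ f k ((Fin m → F) × F) (LinearMap.snd F _ F) 1 / phi (qq F) m := by
  intro m
  induction m generalizing k with
  | zero => simp [Lam_rec0 ψ hψ, phi_zero]
  | succ m ih =>
    rw [Finset.sum_range_succ]
    have h := ih (k+1)
    rw [show k + (m+1+1) - (m+1) = k+1 by omega]
    rw [show k + 1 + (m+1) = k + (m+1+1) by omega] at h
    rw [h, Lam_rec' ψ hψ, phi_succ]
    have h1 := phi_ne (F := F) m
    have h2 := qq_pow_ne (F := F) (m+1) (by omega)
    field_simp
    ring

theorem chain' (hψ : ψ ≠ 0) (f : Hall F ℂ) (n : ℕ) : ∑ p ∈ Finset.HasAntidiagonal.antidiagonal n, Lam ψ f p.2 (Fin p.1 → F) 0 1 / phi (qq F) p.1 =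
    f (idc F n) * qq F ^ n / phi (qq F) n := by
  rw [Finset.Nat.sum_antidiagonal_eq_sum_range_succ (fun i j => Lam ψ f j (Fin i → F) 0 1 / phi (qq F) i)]
  rcases n with _ | n
  · simp [phi_zero, Lam_zero, idc]
  · rw [Finset.sum_range_succ]
    have := chain ψ hψ f 0 n
    rw [zero_add] at this
    rw [this, Nat.sub_self, Lam_zero, Lam_zero, (cls_eq_idc (1 : Module.End F ((Fin n → F) × F)) (n+1)).2 ⟨by simp, rfl⟩, ← idc, phi_succ]
    have h1 := phi_ne (F := F) n
    have h2 := qq_pow_ne (F := F) (n+1) (by omega)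
    field_simp
    ring

open Classical in
/-- indicator -/
def dl (x : X F) : Hall F ℂ := fun y => if y = x then 1 else 0

theorem INT_dl_ne (x : X F) : INT (deg x) (dl x) ≠ 0 := by
  classical
  show (cG F (Fin (deg x) → F))⁻¹ • ∑ φ : Module.End F (Fin (deg x) → F), dl x (cls φ) ≠ 0
  rw [smul_eq_mul]
  refine mul_ne_zero (inv_ne_zero (cG_ne _ _)) ?_
  simp only [dl]
  rw [Finset.sum_boole]
  have : (Finset.univ.filter (fun φ : Module.End F (Fin (deg x) → F) => cls φ = x)).Nonempty :=
    ⟨rep x, by simp [cls_rep]⟩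
  exact_mod_cast (Finset.card_pos.2 this).ne'

def Tn (F : Type) [Field F] [Fintype F] (n : ℕ) : Finset (X F) := (show {x : X F | deg x = n}.Finite from finite_deg n).toFinset
theorem mem_Tn (n : ℕ) (x : X F) : x ∈ Tn F n ↔ deg x = n := by simp [Tn]

theorem dl_expand (n : ℕ) (f : Hall F ℂ) (y : X F) (hy : deg y = n) : f y = ∑ x ∈ Tn F n, f x * dl x y := by
  classical
  rw [Finset.sum_eq_single y]
  · simp [dl]
  · intro b _ hb; rw [dl, if_neg hb.symm, mul_zero]
  · intro h; exact absurd ((mem_Tn n y).2 hy) h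

theorem INT_expand (n : ℕ) (f : Hall F ℂ) : INT n f = ∑ x ∈ Tn F n, f x * INT n (dl x) := by
  rw [INT_congr (dl_expand n f), INT_sum]
  refine Finset.sum_congr rfl (fun x _ => ?_)
  exact INT_mul_left n (f x) (dl x)

theorem Lam_zero' (k : ℕ) (l : V →ₗ[F] F) (φ : Module.End F V) : Lam ψ (0 : Hall F ℂ) k V l φ = 0 := by
  have := Lam_smul ψ 0 (0 : Hall F ℂ) 0 (fun x => by rw [zero_apply, zero_mul]) k V l φ
  rw [this, zero_mul]

theorem Lam_sum {ι : Type} (s : Finset ι) (c : ι → ℂ) (f : ι → Hall F ℂ) (k : ℕ) (l : V →ₗ[F] F) (φ : Module.End F V) :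
    ∀ g : Hall F ℂ, (∀ x, g x = ∑ i ∈ s, c i * f i x) → Lam ψ g k V l φ = ∑ i ∈ s, c i * Lam ψ (f i) k V l φ := by
  classical
  induction s using Finset.induction_on with
  | empty =>
    intro g hg
    rw [show g = 0 from funext (fun x => by rw [hg]; rfl), Lam_zero']; rfl
  | insert i s hi ih =>
    intro g hg
    let g1 : Hall F ℂ := fun x => c i * f i x
    let g2 : Hall F ℂ := fun x => ∑ i ∈ s, c i * f i x
    have : g = g1 + g2 := by
      funext x; rw [hg, Finset.sum_insert hi]; rfl
    rw [this, Lam_add, ih g2 (fun _ => rfl), Lam_smul ψ (c i) (f i) g1 (fun _ => rfl), Finset.sum_insert hi]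

/-- Gelfand-Graev element -/
def GG : Hall F ℂ := fun x => Lam ψ (dl x) (deg x) (Fin 0 → F) 0 1 / INT (deg x) (dl x)

theorem INT_GG (n : ℕ) (f : Hall F ℂ) : INT n (fun x => GG ψ x * f x) = Lam ψ f n (Fin 0 → F) 0 1 := by
  let f' : Hall F ℂ := fun y => ∑ x ∈ Tn F n, f x * dl x y
  rw [Lam_ext ψ f f' n (dl_expand n f) n _ _ _ (by simp), Lam_sum ψ (Tn F n) f dl _ _ _ f' (fun _ => rfl)]
  refine (INT_expand n (fun x => GG ψ x * f x)).trans ?_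
  refine Finset.sum_congr rfl (fun x hx => ?_)
  rw [mem_Tn] at hx
  subst hx
  rw [GG]
  have := INT_dl_ne x
  field_simp

theorem INT_test {f h : Hall F ℂ} (H : ∀ n (g : Hall F ℂ), INT n (fun x => g x * f x) = INT n (fun x => g x * h x)) : f = h := by
  classical
  funext x
  have h1 : ∀ f : Hall F ℂ, INT (deg x) (fun y => dl x y * f y) = INT (deg x) (dl x) * f x := by
    intro f
    refine Eq.trans ?_ (INT_mul_right (deg x) (f x) (dl x))
    refine INT_congr (fun y _ => ?_)
    rw [dl]; split_ifs with h
    · rw [h]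
    · simp
  have := H (deg x) (dl x)
  rw [h1, h1] at this
  exact mul_left_cancel₀ (INT_dl_ne x) this

theorem W3 (hψ : ψ ≠ 0) : GG ψ * regc 1 = regc (qq F) := by
  rw [mul_comm]
  apply INT_test
  intro n f
  rw [INT_mul]
  refine Eq.trans ?_ (INT_regc (qq F) n f).symm
  rw [← chain' ψ hψ]
  refine Finset.sum_congr rfl (fun p _ => ?_)
  have h1 : ∀ x : X F, INT p.2 (fun y => Delta f x y * (regc 1 x * GG ψ y)) = Lam ψ (Delta f x) p.2 (Fin 0 → F) 0 1 * regc 1 x := by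
    intro x
    rw [← INT_GG]
    refine Eq.trans ?_ (INT_mul_right p.2 (regc 1 x) (fun y => GG ψ y * Delta f x y))
    congr 1; funext y; ring
  simp only [h1]
  refine (INT_regc 1 p.1 (fun x => Lam ψ (Delta f x) p.2 (Fin 0 → F) 0 1)).trans ?_
  simp only [one_pow, mul_one]
  congr 1
  rw [idc, Lam_Delta]
  rw [← avg_const (s := (Fin 0 → F) →ₗ[F] (Fin p.1 → F)) (Lam ψ f p.2 (Fin p.1 → F) 0 1)]
  refine avg_congr (fun u => ?_)
  symm
  refine Lam_congr ψ f _ _ _ (LinearEquiv.ofBijective (LinearMap.inl F (Fin p.1 → F) (Fin 0 → F)) ⟨LinearMap.inl_injective, ?_⟩) _ _ _ _ ?_ ?_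
  · rintro ⟨a, b⟩; exact ⟨a, by rw [Subsingleton.elim b 0]; rfl⟩
  · intro v; simp
  · intro v
    show (v + u 0, (0 : Fin 0 → F)) = (v, 0)
    rw [map_zero, add_zero]

theorem Gl_GG (hψ : ψ ≠ 0) : Gl (GG ψ) := by
  refine Gl.of_mul (Gl_regc 1) ?_
  rw [W3 ψ hψ]
  exact Gl_regc _

end whit2
end HallGL

namespace HallGL

section alg
variable {F : Type} [Field F] [Fintype F] {S R R' : Type} [CommSemiring S] [CommRing R] [Algebra S R] [CommRing R']

instance hallModule : Module S (Hall F R) := inferInstanceAs (Module S (X F → R))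
theorem smul_apply (c : S) (f : Hall F R) (x : X F) : (c • f) x = c • f x := rfl
theorem sum_apply' {ι : Type} (s : Finset ι) (f : ι → Hall F R) (x : X F) : (∑ i ∈ s, f i) x = ∑ i ∈ s, f i x := Finset.sum_apply _ _ _

theorem h_smul_mul (c : S) (a b : Hall F R) : (c • a) * b = c • (a * b) := by
  apply hall_ext
  intro n φ
  rw [smul_apply, mul_cls, mul_cls, Finset.smul_sum]
  refine Finset.sum_congr rfl (fun _ _ => ?_)
  rw [smul_apply, smul_mul_assoc]

instance hallAlgebra : Algebra S (Hall F R) := Algebra.ofModule h_smul_mul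
  (fun c a b => by rw [mul_comm, h_smul_mul, mul_comm])

/-- functoriality -/
def hmap (g : R →+* R') : Hall F R →+* Hall F R' where
  toFun f := fun x => g (f x)
  map_zero' := by funext x; exact map_zero g
  map_one' := by
    funext x
    show g ((1 : Hall F R) x) = (1 : Hall F R') x
    rw [one_apply, one_apply]; split_ifs <;> simp
  map_add' a b := by funext x; exact map_add g _ _
  map_mul' a b := by
    apply hall_ext
    intro n φ
    show g ((a * b) (cls φ)) = _
    rw [mul_cls, map_sum]
    refine Eq.trans ?_ (mul_cls (show Hall F R' from fun x => g (a x)) (show Hall F R' from fun x => g (b x)) φ).symm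
    exact Finset.sum_congr rfl (fun _ _ => map_mul g _ _)

theorem hmap_apply (g : R →+* R') (f : Hall F R) (x : X F) : hmap g f x = g (f x) := rfl

/-- external tensor -/
def tn (a b : Hall F R) : Hall F (Hall F R) := fun x y => a x * b y

theorem tn_apply (a b : Hall F R) (x y : X F) : tn a b x y = a x * b y := rfl

theorem tn_mul (a b c d : Hall F R) : tn a b * tn c d = tn (a * c) (b * d) := by
  apply hall_ext
  intro n φ
  apply hall_ext
  intro m χ
  rw [mul_cls, sum_apply', tn_apply, mul_cls, mul_cls, Finset.sum_mul]
  refine Finset.sum_congr rfl (fun S _ => ?_)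
  rw [mul_cls, Finset.mul_sum]
  refine Finset.sum_congr rfl (fun T _ => ?_)
  simp only [tn_apply]; ring

theorem tn_one : tn (1 : Hall F R) 1 = 1 := by
  funext x y
  rw [tn_apply, one_apply, one_apply, one_apply]
  split_ifs with h1 h2 h2
  · rw [one_apply, if_pos h2, one_mul]
  · rw [one_apply, if_neg h2, mul_zero]
  · rw [zero_apply, zero_mul]
  · rw [zero_apply, zero_mul]

theorem tn_pow (a b : Hall F R) (n : ℕ) : tn a b ^ n = tn (a ^ n) (b ^ n) := by
  induction n with
  | zero => simp [tn_one]
  | succ n ih => rw [pow_succ, ih, tn_mul, ← pow_succ, ← pow_succ]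
end alg

section del
variable {F : Type} [Field F] [Fintype F] {K : Type} [CommRing K] [Algebra ℂ K]

theorem Delta_one : Delta (1 : Hall F K) = 1 := by
  rw [← tn_one]
  funext x y
  exact Gl.one.d x y

theorem Delta_pow (f : Hall F K) (n : ℕ) : Delta (f ^ n) = Delta f ^ n := by
  induction n with
  | zero => simp [Delta_one]
  | succ n ih => rw [pow_succ, Delta_mul, ih, ← pow_succ]

theorem pair_tn {ι : Type} (s : Finset ι) (f a b : Hall F K) (u v : ι → Hall F K)
    (h : Delta f = ∑ i ∈ s, tn (u i) (v i)) :
    pair f (a * b) = ∑ i ∈ s, pair (u i) a * pair (v i) b := by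
  ext n
  rw [coeff_pair, INT_mul, map_sum]
  simp only [PowerSeries.coeff_mul]
  rw [Finset.sum_comm]
  refine Finset.sum_congr rfl (fun p _ => ?_)
  have h1 : ∀ x y, Delta f x y = ∑ i ∈ s, u i x * v i y := by
    intro x y
    rw [h, sum_apply', sum_apply']
    rfl
  have h2 : ∀ x, INT p.2 (fun y => Delta f x y * (a x * b y)) = ∑ i ∈ s, u i x * a x * PowerSeries.coeff p.2 (pair (v i) b) := by
    intro x
    simp only [coeff_pair, ← INT_mul_left]
    rw [← INT_sum]
    congr 1
    funext y
    rw [h1, Finset.sum_mul]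
    exact Finset.sum_congr rfl (fun i _ => by ring)
  simp only [h2]
  rw [INT_sum]
  refine Finset.sum_congr rfl (fun i _ => ?_)
  rw [coeff_pair (u i) a, ← INT_mul_right]

theorem pair_smul_left (c : ℂ) (f h : Hall F ℂ) : pair (c • f) h = c • pair f h := by
  ext n
  rw [PowerSeries.coeff_smul, coeff_pair, coeff_pair, smul_eq_mul, ← INT_mul_left]
  congr 1; funext x; rw [smul_apply, smul_eq_mul, mul_assoc]

theorem Delta_deg0 (f : Hall F K) (x y : X F) (hx : deg x = 0) : Delta f x y = f y := by
  obtain ⟨n, φ, rfl⟩ : ∃ n, ∃ φ : Module.End F (Fin n → F), cls φ = x := ⟨_, rep x, cls_rep x⟩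
  obtain ⟨m, χ, rfl⟩ : ∃ n, ∃ φ : Module.End F (Fin n → F), cls φ = y := ⟨_, rep y, cls_rep y⟩
  rw [Delta_cls]
  have : n = 0 := by rw [deg_cls] at hx; simpa using hx
  subst this
  rw [← avg_const (s := (Fin m → F) →ₗ[F] (Fin 0 → F)) (f (cls χ))]
  refine avg_congr (fun u => ?_)
  congr 1
  rw [eq_comm, cls_eq_iff]
  refine ⟨LinearEquiv.ofBijective (LinearMap.inr F (Fin 0 → F) (Fin m → F)) ⟨LinearMap.inr_injective, ?_⟩, ?_⟩
  · rintro ⟨a, b⟩; exact ⟨b, by rw [Subsingleton.elim a 0]; rfl⟩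
  · intro v
    show ((0 : Fin 0 → F), χ v) = _
    refine Prod.ext (Subsingleton.elim _ _) rfl

theorem Delta_deg0' (f : Hall F K) (x y : X F) (hy : deg y = 0) : Delta f x y = f x := by
  obtain ⟨n, φ, rfl⟩ : ∃ n, ∃ φ : Module.End F (Fin n → F), cls φ = x := ⟨_, rep x, cls_rep x⟩
  obtain ⟨m, χ, rfl⟩ : ∃ n, ∃ φ : Module.End F (Fin n → F), cls φ = y := ⟨_, rep y, cls_rep y⟩
  rw [Delta_cls]
  have : m = 0 := by rw [deg_cls] at hy; simpa using hy
  subst this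
  rw [← avg_const (s := (Fin 0 → F) →ₗ[F] (Fin n → F)) (f (cls φ))]
  refine avg_congr (fun u => ?_)
  congr 1
  rw [eq_comm, cls_eq_iff]
  refine ⟨LinearEquiv.ofBijective (LinearMap.inl F (Fin n → F) (Fin 0 → F)) ⟨LinearMap.inl_injective, ?_⟩, ?_⟩
  · rintro ⟨a, b⟩; exact ⟨a, by rw [Subsingleton.elim b 0]; rfl⟩
  · intro v
    show (φ v, (0 : Fin 0 → F)) = (φ v + u 0, χ 0)
    rw [map_zero, map_zero, add_zero]

theorem cj_eq (f : Hall F ℂ) : cj f = hmap (starRingEnd ℂ) f := rfl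
theorem cj_mul (a b : Hall F ℂ) : cj (a * b) = cj a * cj b := by rw [cj_eq, map_mul]; rfl
theorem cj_one : cj (1 : Hall F ℂ) = 1 := by rw [cj_eq, map_one]
theorem cj_pow (a : Hall F ℂ) (n : ℕ) : cj (a ^ n) = cj a ^ n := by rw [cj_eq, map_pow]; rfl

theorem Delta_cj (f : Hall F ℂ) (x y : X F) : Delta (cj f) x y = (starRingEnd ℂ) (Delta f x y) := by
  rw [Delta, Delta, avg, avg]
  simp [cj]

theorem Gl.cj {f : Hall F ℂ} (hf : Gl f) : Gl (cj f) :=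
  ⟨fun x y => by rw [Delta_cj, hf.d, map_mul]; rfl, fun x hx => by rw [HallGL.cj, hf.z x hx, map_one]⟩

/-- integration as a linear functional -/
def INTL (n : ℕ) (h : Hall F ℂ) : Hall F ℂ →ₗ[ℂ] ℂ where
  toFun f := INT n (fun x => f x * h x)
  map_add' f g := by
    rw [← INT_add]
    congr 1; funext x; rw [add_apply, add_mul]
  map_smul' c f := by
    rw [RingHom.id_apply, smul_eq_mul, ← INT_mul_left]
    congr 1; funext x; rw [smul_apply, smul_eq_mul, mul_assoc]

theorem INTL_apply (n : ℕ) (h f : Hall F ℂ) : INTL n h f = INT n (fun x => f x * h x) := rfl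
theorem ip_eq (n : ℕ) (f h : Hall F ℂ) : ip n f h = INTL n (cj h) f := rfl
theorem INTL_comm (n : ℕ) (h f : Hall F ℂ) : INTL n h f = INTL n f h := by
  rw [INTL_apply, INTL_apply]; congr 1; funext x; ring

theorem decompL {n : ℕ} {f : Hall F ℂ} (hf : Supp n f) : f = ∑ χ : Irr F n, ip n f χ.1 • χ.1 := by
  funext x
  rw [sum_apply']
  exact decompH hf x

theorem parseval {n : ℕ} {f : Hall F ℂ} (hf : Supp n f) (h : Hall F ℂ) :
    ip n f h = ∑ χ : Irr F n, ip n f χ.1 * ip n χ.1 h := by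
  conv_lhs => rw [decompL hf, ip_eq]
  simp [map_sum, ip_eq]

theorem pair_supp {k : ℕ} {a : Hall F ℂ} (ha : Supp k a) (f : Hall F ℂ) : pair f a = PowerSeries.monomial k (INTL k a f) := by
  ext n
  rw [coeff_pair, PowerSeries.coeff_monomial]
  split_ifs with h
  · subst h; rfl
  · exact INT_only (fun x hx => (ha x (right_ne_zero_of_mul hx)).1) h

theorem pair_cj {k : ℕ} {a : Hall F ℂ} (ha : Supp k a) (f : Hall F ℂ) : pair f (cj a) = PowerSeries.monomial k (ip k f a) :=
  pair_supp ha.cj f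

/-- nonnegative combinations of irreducibles -/
structure Pos (n : ℕ) (f : Hall F ℂ) : Prop where
  s : Supp n f
  n : ∀ χ : Irr F n, ∃ m : ℕ, ip n f χ.1 = m

theorem Irr.pos {n : ℕ} {f : Hall F ℂ} (hf : f ∈ Irr F n) : Pos n f := by
  classical
  refine ⟨hf.1, fun χ => ?_⟩
  rw [ip_irr hf χ.2]
  split_ifs
  · exact ⟨1, by simp⟩
  · exact ⟨0, by simp⟩

theorem nat_sum {ι : Type} (s : Finset ι) (f : ι → ℂ) (h : ∀ i ∈ s, ∃ m : ℕ, f i = m) : ∃ m : ℕ, ∑ i ∈ s, f i = m := by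
  choose! m hm using h
  exact ⟨∑ i ∈ s, m i, by rw [Finset.sum_congr rfl hm]; push_cast; rfl⟩

theorem nat_mul {a b : ℂ} (ha : ∃ m : ℕ, a = m) (hb : ∃ m : ℕ, b = m) : ∃ m : ℕ, a * b = m := by
  obtain ⟨m, rfl⟩ := ha; obtain ⟨k, rfl⟩ := hb
  exact ⟨m * k, by push_cast; rfl⟩

theorem ip_irr_mul {i j : ℕ} {a b χ : Hall F ℂ} (ha : a ∈ Irr F i) (hb : b ∈ Irr F j) (hχ : χ ∈ Irr F (i+j)) :
    ∃ m : ℕ, ip (i+j) (a * b) χ = m := by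
  have h1 : IsChar (res (Fin (i+j) → F) (cj χ)) := hχ.2.isChar.conj
  obtain ⟨m, hm⟩ := ip_mul_nat ha.1 hb.1 ha.2.isChar hb.2.isChar h1
  refine ⟨m, ?_⟩
  rw [← hm, ip]
  congr 1; funext x; ring

theorem Pos.mul {i j : ℕ} {a b : Hall F ℂ} (ha : Pos i a) (hb : Pos j b) : Pos (i+j) (a * b) := by
  refine ⟨ha.s.mul hb.s, fun χ => ?_⟩
  rw [decompL ha.s, decompL hb.s, Finset.sum_mul_sum]
  rw [ip_eq, map_sum]
  refine nat_sum _ _ (fun x _ => ?_)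
  rw [map_sum]
  refine nat_sum _ _ (fun y _ => ?_)
  rw [smul_mul_smul_comm, map_smul, smul_eq_mul]
  exact nat_mul (nat_mul (ha.n x) (hb.n y)) (ip_irr_mul x.2 y.2 χ.2)

theorem Pos.ip {n : ℕ} {f h : Hall F ℂ} (hf : Pos n f) (hh : Pos n h) : ∃ m : ℕ, ip n f h = m := by
  rw [parseval hf.s]
  refine nat_sum _ _ (fun χ _ => nat_mul (hf.n χ) ?_)
  obtain ⟨m, hm⟩ := hh.n χ
  exact ⟨m, by rw [← ip_conj, hm]; simp⟩

theorem Supp_one : Supp 0 (1 : Hall F ℂ) := by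
  intro x hx
  rw [one_apply] at hx
  have h0 : deg x = 0 := by by_contra h; rw [if_neg h] at hx; exact hx rfl
  refine ⟨h0, ?_⟩
  rw [Inv]
  have hs : Subsingleton (Fin (deg x) → F) := by rw [h0]; infer_instance
  exact ⟨fun a b _ => Subsingleton.elim _ _, fun a => ⟨a, Subsingleton.elim _ _⟩⟩

theorem INT_zero_deg (f : X F → ℂ) : INT 0 f = f (x0 F) := by
  rw [INT, INTV, cG_eq]
  simp only [phi_zero, Nat.choose_zero_succ, pow_zero, mul_one, inv_one, one_smul]
  rw [Fintype.sum_eq_single (0 : Module.End F (Fin 0 → F))]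
  · rfl
  · intro φ hφ; exact absurd (Subsingleton.elim _ _) hφ

theorem one_x0 : (1 : Hall F ℂ) (x0 F) = 1 := by rw [one_apply, if_pos deg_x0]

theorem irr0 {f : Hall F ℂ} (hf : f ∈ Irr F 0) : f = 1 := by
  classical
  obtain ⟨m, hm, h1⟩ := hf.2.one
  have h2 : f (x0 F) = m := by
    rw [← h1]
    show _ = f (ce 1)
    congr 1
    exact deg_zero_eq deg_x0 (by rw [deg_ce]; simp)
  have h3 := ip_irr hf hf
  rw [if_pos rfl, ip, INT_zero_deg, cj, h2] at h3
  have h4 : m = 1 := by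
    have h5 : m * m = 1 := by
      simp at h3
      exact_mod_cast h3
    exact Nat.eq_one_of_mul_eq_one_left h5
  refine hf.1.ext Supp_one (fun g => ?_)
  rw [deg_zero_eq (x := ce g) (y := x0 F) (by rw [deg_ce]; simp) deg_x0, h2, h4, one_x0]; simp

theorem one_irr : (1 : Hall F ℂ) ∈ Irr F 0 := by
  have h : Nonempty (Irr F 0) := by
    by_contra h
    rw [not_nonempty_iff] at h
    have := decompH (Supp_one (F := F)) (x0 F)
    rw [one_x0] at this
    simp at this
  obtain ⟨f, hf⟩ := h
  rw [← irr0 hf]; exact hf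

theorem Pos.one : Pos 0 (1 : Hall F ℂ) := Irr.pos one_irr

theorem Pos.pow {d : ℕ} {f : Hall F ℂ} (hf : Pos d f) (n : ℕ) : Pos (d * n) (f ^ n) := by
  induction n with
  | zero => simpa using Pos.one
  | succ n ih => rw [pow_succ, Nat.mul_succ]; exact ih.mul hf

theorem Pos.prod {ι : Type} (s : Finset ι) (d : ι → ℕ) (f : ι → Hall F ℂ) (h : ∀ i ∈ s, Pos (d i) (f i)) :
    Pos (∑ i ∈ s, d i) (∏ i ∈ s, f i) := by
  classical
  induction s using Finset.induction_on with
  | empty => simpa using Pos.one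
  | insert i s hi ih =>
    rw [Finset.prod_insert hi, Finset.sum_insert hi]
    exact (h i (Finset.mem_insert_self _ _)).mul (ih (fun j hj => h j (Finset.mem_insert_of_mem hj)))

/-- truncated coproduct -/
def DR (f : Hall F ℂ) (i j : ℕ) (x : X F) : Hall F ℂ := fun y => if deg y = j ∧ deg x = i then Delta f x y else 0
def DR2 (f : Hall F ℂ) (i j : ℕ) (b : Hall F ℂ) : Hall F ℂ := fun x => ip j (DR f i j x) b

/-- Expansion of the coproduct in irreducible characters -/
theorem Delta_expand {n : ℕ} {f : Hall F ℂ} (hf : Supp n f) (x y : X F) (hxy : deg x + deg y = n) :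
    Delta f x y = ∑ a : Irr F (deg x), ∑ b : Irr F (deg y), ip n f (a.1 * b.1) * (a.1 x * b.1 y) := by
  have h1 : ∀ x', Supp (deg y) (DR f (deg x) (deg y) x') := by
    intro x' y' h
    rw [DR] at h
    split_ifs at h with h2
    · exact ⟨h2.1, (Delta_supp hf x' y' h).2.2⟩
    · exact absurd rfl h
  have h2 : ∀ b : Irr F (deg y), Supp (deg x) (DR2 f (deg x) (deg y) b.1) := by
    intro b x' h
    by_contra h3
    apply h
    rw [DR2, ip, INT_congr (g := fun _ => 0), INT_zero]
    intro y' hy'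
    rw [DR]
    split_ifs with h4
    · have : Delta f x' y' = 0 := by
        by_contra h5
        exact h3 ⟨h4.2, (Delta_supp hf x' y' h5).2.1⟩
      rw [this, zero_mul]
    · rw [zero_mul]
  have h3 : Delta f x y = ∑ χ : Irr F (deg y), ip (deg y) (DR f (deg x) (deg y) x) χ.1 * χ.1 y := by
    rw [← decompH (h1 x) y, DR, if_pos ⟨rfl, rfl⟩]
  rw [h3, Finset.sum_comm]
  refine Finset.sum_congr rfl (fun b _ => ?_)
  have h4 : ip (deg y) (DR f (deg x) (deg y) x) b.1 = ∑ a : Irr F (deg x), ip (deg x) (DR2 f (deg x) (deg y) b.1) a.1 * a.1 x :=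
    decompH (h2 b) x
  rw [h4, Finset.sum_mul]
  refine Finset.sum_congr rfl (fun a _ => ?_)
  rw [mul_assoc]
  congr 1
  subst hxy
  rw [ip, ip, cj_mul, ip_mul a.2.1.cj b.2.1.cj]
  refine INT_congr (fun x' hx' => ?_)
  rw [DR2, ip, ← INT_mul_right]
  refine INT_congr (fun y' hy' => ?_)
  rw [DR, if_pos ⟨hy', hx'⟩]
  ring

end del
end HallGL

namespace HallGL

section gg
variable {F : Type} [Field F] [Fintype F]

theorem exists_psi (F : Type) [Field F] [Fintype F] : ∃ ψ : AddChar F ℂ, ψ ≠ 0 := by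
  obtain ⟨ψ, h⟩ := AddChar.exists_apply_ne_zero.2 (one_ne_zero : (1 : F) ≠ 0)
  exact ⟨ψ, fun h0 => h (by rw [h0]; simp)⟩

def psi (F : Type) [Field F] [Fintype F] : AddChar F ℂ := Classical.choose (exists_psi F)
theorem psi_ne : psi F ≠ 0 := Classical.choose_spec (exists_psi F)

/-- Gelfand-Graev element -/
def gg : Hall F ℂ := GG (psi F)
theorem gg_mul : (gg : Hall F ℂ) * regc 1 = regc (qq F) := W3 _ psi_ne
theorem Gl_gg : Gl (gg : Hall F ℂ) := Gl_GG _ psi_ne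

/-- Whittaker multiplicity -/
def wh (n : ℕ) : Hall F ℂ →ₗ[ℂ] ℂ := INTL n gg

theorem wh_nat {n : ℕ} {χ : Hall F ℂ} (hχ : χ ∈ Irr F n) : ∃ m : ℕ, wh n χ = m := by
  obtain ⟨m, hm⟩ := Lam_nat' (psi F) χ n hχ.2.isChar
  refine ⟨m, ?_⟩
  rw [← hm, ← INT_GG, wh, INTL_comm]; rfl

theorem cj_regc (c : ℝ) : cj (regc (c : ℂ) : Hall F ℂ) = regc (c : ℂ) := by
  funext x
  rw [cj, regc]
  split_ifs <;> simp [qq]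

theorem gg_real : cj (gg : Hall F ℂ) = gg := by
  have h1 : cj (gg : Hall F ℂ) * regc 1 = regc (qq F) := by
    have h2 := congrArg cj (gg_mul (F := F))
    rw [cj_mul] at h2
    have h3 := cj_regc (F := F) 1
    have h4 := cj_regc (F := F) (Fintype.card F : ℝ)
    simp only [Complex.ofReal_one, Complex.ofReal_natCast] at h3 h4
    rw [h3] at h2
    rw [h2]; exact h4
  have h5 : (cj (gg : Hall F ℂ) - gg) * regc 1 = 0 := by rw [sub_mul, h1, gg_mul, sub_self]
  have h6 := cancel _ _ (fun c hc => by rwa [(Gl_regc (F := F) 1).z _ deg_x0, mul_one] at hc) h5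
  exact sub_eq_zero.1 h6

theorem Gl.pair_one {g : Hall F ℂ} (hg : Gl g) : pair g 1 = 1 := by
  rw [pair_supp Supp_one, INTL_apply, INT_zero_deg, one_x0, hg.z _ deg_x0]
  simp

theorem pair_one_left (f : Hall F ℂ) (hf : Gl f) : pair 1 f = 1 := by rw [pair_comm, hf.pair_one]

theorem coeff_pair_regc (f : Hall F ℂ) (c : ℂ) (n : ℕ) : PowerSeries.coeff n (pair f (regc c)) = f (idc F n) * c ^ n / phi (qq F) n := by
  rw [coeff_pair]; exact INT_regc c n f

theorem regc_idc (c : ℂ) (n : ℕ) : regc c (idc F n) = qq F ^ (n.choose 2) * c ^ n := by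
  rw [regc, deg_idc, if_pos rfl]

theorem E_rec : pair (regc 1 : Hall F ℂ) (regc (qq F)) * (1 - PowerSeries.X) = pair (regc 1 : Hall F ℂ) (regc 1) := by
  ext n
  rw [mul_sub, mul_one, map_sub]
  rcases n with _ | n
  · rw [PowerSeries.coeff_zero_mul_X, coeff_pair_regc, coeff_pair_regc]; simp
  · rw [PowerSeries.coeff_succ_mul_X, coeff_pair_regc, coeff_pair_regc, coeff_pair_regc, regc_idc, regc_idc, phi_succ]
    have h1 := phi_ne (F := F) n
    have h2 := qq_pow_ne (F := F) (n+1) (by omega)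
    rw [show (n+1).choose 2 = n.choose 2 + n by rw [choose_add_two]; simp]
    field_simp
    ring

theorem pair_gg_reg : pair (gg : Hall F ℂ) (regc 1) * (1 - PowerSeries.X) = 1 := by
  have h1 := (Gl_regc (F := F) 1).pair_mul gg (regc 1)
  rw [gg_mul] at h1
  have h2 := E_rec (F := F)
  rw [h1, pair_comm _ gg] at h2
  have h3 : pair (regc 1 : Hall F ℂ) (regc 1) ≠ 0 := by
    intro h
    have := congrArg (PowerSeries.coeff 0) h
    rw [coeff_pair_regc, regc_idc] at this
    simp [phi_zero] at this
  apply mul_right_cancel₀ h3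
  rw [one_mul]
  conv_rhs => rw [← h2]
  ring

theorem gg_idc (n : ℕ) : (gg : Hall F ℂ) (idc F n) = phi (qq F) n := by
  have h : ∀ n, PowerSeries.coeff n (pair (gg : Hall F ℂ) (regc 1)) = 1 := by
    intro n
    have h1 := pair_gg_reg (F := F)
    rw [mul_sub, mul_one] at h1
    induction n with
    | zero =>
      have := congrArg (PowerSeries.coeff 0) h1
      rw [map_sub, PowerSeries.coeff_zero_mul_X] at this
      simpa using this
    | succ n ih =>
      have := congrArg (PowerSeries.coeff (n+1)) h1
      rw [map_sub, PowerSeries.coeff_succ_mul_X, ih, PowerSeries.coeff_one, if_neg (by omega)] at this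
      linear_combination this
  have h2 := h n
  rw [coeff_pair_regc] at h2
  have := phi_ne (F := F) n
  field_simp at h2
  simpa using h2

theorem pair_gg_gg (n : ℕ) : INTL n gg (gg : Hall F ℂ) = if n = 0 then 1 else qq F ^ n - qq F ^ (n-1) := by
  have h1 := Gl_gg (F := F).pair_mul gg (regc 1)
  rw [gg_mul] at h1
  have h2 : pair (gg : Hall F ℂ) (regc (qq F)) * (1 - PowerSeries.X) = pair (gg : Hall F ℂ) gg := by
    rw [h1, mul_assoc, pair_gg_reg, mul_one]
  have h3 := congrArg (PowerSeries.coeff n) h2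
  rw [mul_sub, mul_one, map_sub] at h3
  refine (coeff_pair gg gg n).symm.trans (h3.symm.trans ?_)
  rcases n with _ | n
  · rw [PowerSeries.coeff_zero_mul_X, coeff_pair_regc, gg_idc]; simp [phi_zero]
  · rw [PowerSeries.coeff_succ_mul_X, coeff_pair_regc, coeff_pair_regc, gg_idc, gg_idc, if_neg (by omega)]
    have h1 := phi_ne (F := F) n
    have h2 := phi_ne (F := F) (n+1)
    field_simp
    simp

theorem wh_mul {i j : ℕ} {a b : Hall F ℂ} (ha : Supp i a) (hb : Supp j b) : wh (i+j) (a * b) = wh i a * wh j b := by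
  have h := Gl_gg (F := F).pair_mul a b
  rw [pair_supp ha, pair_supp hb, pair_supp (ha.mul hb), PowerSeries.monomial_mul_monomial] at h
  have := congrArg (PowerSeries.coeff (i+j)) h
  rw [PowerSeries.coeff_monomial_same, PowerSeries.coeff_monomial_same] at this
  rw [wh, wh, wh, INTL_comm, this, INTL_comm i, INTL_comm j]

theorem wh_one : wh 0 (1 : Hall F ℂ) = 1 := by
  rw [wh, INTL_apply, INT_zero_deg, one_x0, Gl_gg.z _ deg_x0, one_mul]

theorem wh_pow {d : ℕ} {a : Hall F ℂ} (ha : Pos d a) (n : ℕ) : wh (d * n) (a ^ n) = wh d a ^ n := by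
  induction n with
  | zero => simpa using wh_one
  | succ n ih => rw [pow_succ, Nat.mul_succ, wh_mul (ha.pow n).s ha.s, ih, pow_succ]

/-! positivity -/
theorem nat_sum_ne {ι : Type} (s : Finset ι) (f : ι → ℂ) (h : ∀ i ∈ s, ∃ m : ℕ, f i = m) (i : ι) (hi : i ∈ s) (hne : f i ≠ 0) :
    ∑ i ∈ s, f i ≠ 0 := by
  choose! m hm using h
  rw [Finset.sum_congr rfl hm, ← Nat.cast_sum]
  rw [hm i hi] at hne
  have h1 : m i ≠ 0 := by exact_mod_cast hne
  have h2 : m i ≤ ∑ i ∈ s, m i := Finset.single_le_sum (fun _ _ => Nat.zero_le _) hi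
  have : ∑ i ∈ s, m i ≠ 0 := by omega
  exact_mod_cast this

theorem nat_one {ι : Type} [Fintype ι] (a b : ι → ℂ) (ha : ∀ i, ∃ m : ℕ, a i = m) (hb : ∀ i, ∃ m : ℕ, b i = m)
    (h : ∑ i, a i * b i = 1) : ∃ i, a i = 1 ∧ b i = 1 ∧ ∀ j, a j ≠ 0 → b j ≠ 0 → j = i := by
  classical
  choose m hm using ha
  choose k hk using hb
  simp only [hm, hk] at h ⊢
  have h' : ∑ i, m i * k i = 1 := by exact_mod_cast h
  obtain ⟨i, _, hi⟩ := Finset.exists_ne_zero_of_sum_ne_zero (by rw [h']; exact one_ne_zero : ∑ i, m i * k i ≠ 0)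
  have h1 : m i * k i + ∑ j ∈ Finset.univ.erase i, m j * k j = 1 := (Finset.add_sum_erase Finset.univ (fun j => m j * k j) (Finset.mem_univ i)).trans h'
  have h2 : m i * k i = 1 := by omega
  have h3 : ∑ j ∈ Finset.univ.erase i, m j * k j = 0 := by omega
  refine ⟨i, ?_, ?_, ?_⟩
  · exact_mod_cast Nat.eq_one_of_mul_eq_one_right h2
  · exact_mod_cast Nat.eq_one_of_mul_eq_one_left h2
  · intro j h4 h5
    by_contra hne
    rw [Finset.sum_eq_zero_iff] at h3
    have := h3 j (Finset.mem_erase.2 ⟨hne, Finset.mem_univ _⟩)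
    rcases Nat.mul_eq_zero.1 this with h | h
    · exact h4 (by exact_mod_cast h)
    · exact h5 (by exact_mod_cast h)

theorem ip_symm_ne {n : ℕ} {f h : Hall F ℂ} (hn : ip n f h ≠ 0) : ip n h f ≠ 0 := by
  rw [← ip_conj]; simpa using hn

theorem Pos.nat' {n : ℕ} {f χ : Hall F ℂ} (hf : Pos n f) (hχ : χ ∈ Irr F n) : ∃ m : ℕ, HallGL.ip n χ f = m := by
  obtain ⟨m, hm⟩ := hf.n ⟨χ, hχ⟩
  exact ⟨m, by rw [← ip_conj, hm]; simp⟩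

theorem Pos.ip_ne {n : ℕ} {f h χ : Hall F ℂ} (hf : Pos n f) (hh : Pos n h) (hχ : χ ∈ Irr F n) (h1 : HallGL.ip n f χ ≠ 0) (h2 : HallGL.ip n h χ ≠ 0) :
    HallGL.ip n f h ≠ 0 := by
  rw [parseval hf.s]
  exact nat_sum_ne _ _ (fun i _ => nat_mul (hf.n i) (hh.nat' i.2)) ⟨χ, hχ⟩ (Finset.mem_univ _) (mul_ne_zero h1 (ip_symm_ne h2))

theorem wh_expand {n : ℕ} {f : Hall F ℂ} (hf : Supp n f) : wh n f = ∑ χ : Irr F n, ip n f χ.1 * wh n χ.1 := by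
  conv_lhs => rw [decompL hf]
  simp [map_sum]

theorem Pos.wh_ne {n : ℕ} {f χ : Hall F ℂ} (hf : Pos n f) (hχ : χ ∈ Irr F n) (h1 : HallGL.ip n f χ ≠ 0) (h2 : wh n χ ≠ 0) : wh n f ≠ 0 := by
  rw [wh_expand hf.s]
  exact nat_sum_ne _ _ (fun i _ => nat_mul (hf.n i) (wh_nat i.2)) ⟨χ, hχ⟩ (Finset.mem_univ _) (mul_ne_zero h1 h2)

theorem ip_mul_expand {i j n : ℕ} {f g : Hall F ℂ} (hf : Pos i f) (hg : Pos j g) (h : Hall F ℂ) :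
    ip n (f * g) h = ∑ p : Irr F i × Irr F j, ip i f p.1.1 * ip j g p.2.1 * ip n (p.1.1 * p.2.1) h := by
  conv_lhs => rw [decompL hf.s, decompL hg.s, Finset.sum_mul_sum]
  rw [Fintype.sum_prod_type, ip_eq, map_sum]
  refine Finset.sum_congr rfl (fun x _ => ?_)
  rw [map_sum]
  refine Finset.sum_congr rfl (fun y _ => ?_)
  rw [smul_mul_smul_comm, map_smul, smul_eq_mul]; rfl

theorem Pos.mul_ne {i j : ℕ} {f g a b χ : Hall F ℂ} (hf : Pos i f) (hg : Pos j g) (ha : a ∈ Irr F i) (hb : b ∈ Irr F j) (hχ : χ ∈ Irr F (i+j))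
    (h1 : HallGL.ip i f a ≠ 0) (h2 : HallGL.ip j g b ≠ 0) (h3 : HallGL.ip (i+j) (a * b) χ ≠ 0) : HallGL.ip (i+j) (f * g) χ ≠ 0 := by
  rw [ip_mul_expand hf hg]
  refine nat_sum_ne _ _ (fun p _ => nat_mul (nat_mul (hf.n _) (hg.n _)) (ip_irr_mul p.1.2 p.2.2 hχ)) (⟨a, ha⟩, ⟨b, hb⟩) (Finset.mem_univ _) ?_
  exact mul_ne_zero (mul_ne_zero h1 h2) h3

theorem ip_deg {i j n : ℕ} {f g : Hall F ℂ} (hf : Supp i f) (hg : Supp j g) (h : ip n f g ≠ 0) : i = j ∧ i = n := by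
  have : ∃ x, deg x = n ∧ f x * cj g x ≠ 0 := by
    by_contra hc
    push Not at hc
    apply h
    rw [ip, INT_congr hc, INT_zero]
  obtain ⟨x, h1, h2⟩ := this
  have h3 := (hf x (left_ne_zero_of_mul h2)).1
  have h4 := (hg.cj x (right_ne_zero_of_mul h2)).1
  omega

theorem Delta_ext {K : Type} [CommRing K] [Algebra ℂ K] {f g : Hall F K} {x y : X F} (h : ∀ z, deg z = deg x + deg y → f z = g z) : Delta f x y = Delta g x y := by
  rw [Delta, Delta]
  refine avg_congr (fun u => h _ ?_)
  rw [deg_cls]; simp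

end gg
end HallGL

namespace HallGL

section prim
variable {F : Type} [Field F] [Fintype F]

structure Prim (d : ℕ) (ρ : Hall F ℂ) : Prop where
  irr : ρ ∈ Irr F d
  pos : 0 < d
  pr : ∀ i j, 0 < i → 0 < j → ∀ a ∈ Irr F i, ∀ b ∈ Irr F j, i + j = d → ip d ρ (a * b) = 0

theorem Prim.Delta {d : ℕ} {ρ : Hall F ℂ} (h : Prim d ρ) : HallGL.Delta ρ = tn ρ 1 + tn 1 ρ := by
  have key : ∀ x y, HallGL.Delta ρ x y = ρ x * (1 : Hall F ℂ) y + (1 : Hall F ℂ) x * ρ y := by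
    intro x y
    rw [one_apply, one_apply]
    have hd := h.pos
    by_cases hx : deg x = 0
    · rw [Delta_deg0 _ _ _ hx, if_pos hx, h.irr.1.eqz (by omega : deg x ≠ d)]; ring
    · by_cases hy : deg y = 0
      · rw [Delta_deg0' _ _ _ hy, if_pos hy, h.irr.1.eqz (by omega : deg y ≠ d)]; ring
      · rw [if_neg hx, if_neg hy]
        by_cases hxy : deg x + deg y = d
        · rw [Delta_expand h.irr.1 x y hxy]
          rw [mul_zero, zero_mul, add_zero]
          refine Finset.sum_eq_zero (fun a _ => Finset.sum_eq_zero (fun b _ => ?_))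
          rw [h.pr _ _ (by omega) (by omega) _ a.2 _ b.2 hxy, zero_mul]
        · rw [mul_zero, zero_mul, add_zero]
          by_contra hne
          exact hxy (Delta_supp h.irr.1 x y hne).1
  funext x y
  exact key x y

theorem Prim.Delta_pow {d : ℕ} {ρ : Hall F ℂ} (h : Prim d ρ) (N : ℕ) :
    HallGL.Delta (ρ ^ N) = ∑ p ∈ Finset.HasAntidiagonal.antidiagonal N, tn (((N.choose p.1 : ℕ) : ℂ) • ρ ^ p.1) (ρ ^ p.2) := by
  rw [HallGL.Delta_pow, h.Delta, (Commute.all _ _).add_pow']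
  refine Finset.sum_congr rfl (fun p _ => ?_)
  rw [tn_pow, tn_pow, tn_mul, one_pow, one_pow, mul_one, one_mul]
  funext x y
  have : ∀ (k : ℕ) (f : Hall F (Hall F ℂ)), (k • f) x y = k • (f x y) := by
    intro k f
    induction k with
    | zero => simp; rfl
    | succ k ih => rw [succ_nsmul, succ_nsmul, add_apply, add_apply, ih]
  rw [this, tn_apply, tn_apply, smul_apply]
  simp [mul_assoc]

theorem Prim.pair_pow {d : ℕ} {ρ : Hall F ℂ} (h : Prim d ρ) (N : ℕ) (a b : Hall F ℂ) :
    pair (ρ ^ N) (a * b) = ∑ p ∈ Finset.HasAntidiagonal.antidiagonal N, ((N.choose p.1 : ℕ) : ℂ) • (pair (ρ ^ p.1) a * pair (ρ ^ p.2) b) := by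
  rw [pair_tn _ _ a b _ _ (h.Delta_pow N)]
  refine Finset.sum_congr rfl (fun p _ => ?_)
  rw [pair_smul_left, smul_mul_assoc]

theorem Prim.ip_pow {d : ℕ} {ρ : Hall F ℂ} (h : Prim d ρ) (N : ℕ) {k l : ℕ} {a b : Hall F ℂ} (ha : Supp k a) (hb : Supp l b) :
    ip (k+l) (ρ ^ N) (a * b) = ∑ p ∈ Finset.HasAntidiagonal.antidiagonal N, ((N.choose p.1 : ℕ) : ℂ) * (ip k (ρ ^ p.1) a * ip l (ρ ^ p.2) b) := by
  have h1 := h.pair_pow N (cj a) (cj b)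
  rw [← cj_mul, pair_cj (ha.mul hb)] at h1
  have h2 := congrArg (PowerSeries.coeff (k+l)) h1
  rw [PowerSeries.coeff_monomial_same, map_sum] at h2
  rw [h2]
  refine Finset.sum_congr rfl (fun p _ => ?_)
  rw [PowerSeries.coeff_smul, pair_cj ha, pair_cj hb, PowerSeries.monomial_mul_monomial, PowerSeries.coeff_monomial_same, smul_eq_mul]

theorem Prim.ip_pow_ne {d : ℕ} {ρ : Hall F ℂ} (h : Prim d ρ) (N : ℕ) {k l : ℕ} {a b : Hall F ℂ} (ha : Supp k a) (hb : Supp l b)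
    (hne : ip (k+l) (ρ ^ N) (a * b) ≠ 0) : ∃ i j, i + j = N ∧ k = d * i ∧ l = d * j ∧ ip k (ρ ^ i) a ≠ 0 ∧ ip l (ρ ^ j) b ≠ 0 := by
  rw [h.ip_pow N ha hb] at hne
  obtain ⟨p, hp, h1⟩ := Finset.exists_ne_zero_of_sum_ne_zero hne
  have h2 := right_ne_zero_of_mul h1
  have h3 := left_ne_zero_of_mul h2
  have h4 := right_ne_zero_of_mul h2
  refine ⟨p.1, p.2, Finset.HasAntidiagonal.mem_antidiagonal.1 hp, ?_, ?_, h3, h4⟩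
  · exact ((ip_deg ((Irr.pos h.irr).pow _).s ha h3).1).symm
  · exact ((ip_deg ((Irr.pos h.irr).pow _).s hb h4).1).symm

def dlt (n : ℕ) (f : Hall F ℂ) : ℂ := f (idc F n) / phi (qq F) n

theorem irr_dlt_ne {n : ℕ} {χ : Hall F ℂ} (h : χ ∈ Irr F n) : dlt n χ ≠ 0 := by
  obtain ⟨m, hm, h1⟩ := h.2.one
  have h2 : χ (idc F n) = m := h1
  rw [dlt, h2]
  exact div_ne_zero (by exact_mod_cast hm.ne') (phi_ne n)

theorem pair_regc_supp {n : ℕ} {f : Hall F ℂ} (hf : Supp n f) (c : ℂ) : pair f (regc c) = PowerSeries.monomial n (c ^ n * dlt n f) := by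
  rw [pair_comm, pair_supp hf]
  congr 1
  rw [INTL_comm]
  refine (INT_regc c n f).trans ?_
  rw [dlt]; ring

theorem Prim.wh {d : ℕ} {ρ : Hall F ℂ} (h : Prim d ρ) : wh d ρ = (qq F ^ d - 1) * dlt d ρ := by
  have h1 := pair_tn (ι := Bool) Finset.univ ρ gg (regc 1) (fun b => bif b then ρ else 1) (fun b => bif b then 1 else ρ)
    (by rw [h.Delta]; simp)
  rw [gg_mul, Fintype.sum_bool] at h1
  simp only [cond_true, cond_false] at h1
  rw [pair_one_left _ (Gl_regc 1), pair_one_left _ Gl_gg, mul_one, one_mul, pair_regc_supp h.irr.1, pair_regc_supp h.irr.1,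
    pair_comm, pair_supp h.irr.1, ← map_add] at h1
  have h2 := congrArg (PowerSeries.coeff d) h1
  rw [PowerSeries.coeff_monomial_same, PowerSeries.coeff_monomial_same] at h2
  rw [HallGL.wh, INTL_comm]
  linear_combination -h2

theorem Prim.wh_ne {d : ℕ} {ρ : Hall F ℂ} (h : Prim d ρ) : HallGL.wh d ρ ≠ 0 := by
  rw [h.wh]
  exact mul_ne_zero (qq_pow_ne _ h.pos.ne') (irr_dlt_ne h.irr)

/-- cuspidals with Whittaker multiplicity one -/
structure Cusp (F : Type) [Field F] [Fintype F] where
  d : ℕ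
  ρ : Hall F ℂ
  prim : Prim d ρ
  w : HallGL.wh d ρ = 1

theorem irr_deg {n m : ℕ} {χ : Hall F ℂ} (h : χ ∈ Irr F n) (h' : χ ∈ Irr F m) : n = m := by
  classical
  have : ip n χ χ ≠ 0 := by rw [ip_irr h h, if_pos rfl]; exact one_ne_zero
  exact (ip_deg h.1 h'.1 this).1

theorem Cusp.ext' {c c' : Cusp F} (h : c.ρ = c'.ρ) : c = c' := by
  have h1 : c.d = c'.d := irr_deg c.prim.irr (h ▸ c'.prim.irr)
  cases c; cases c'
  simp only at h h1
  subst h; subst h1; rfl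

namespace Cusp
variable (c : Cusp F)

theorem ppow (N : ℕ) : Pos (c.d * N) (c.ρ ^ N) := (Irr.pos c.prim.irr).pow N

theorem exists_yk (N : ℕ) : ∃ χ : Irr F (c.d * N), ip (c.d * N) (c.ρ ^ N) χ.1 = 1 ∧ HallGL.wh (c.d * N) χ.1 = 1 ∧
    ∀ χ' : Irr F (c.d * N), ip (c.d * N) (c.ρ ^ N) χ'.1 ≠ 0 → HallGL.wh (c.d * N) χ'.1 ≠ 0 → χ' = χ := by
  apply nat_one
  · exact (c.ppow N).n
  · exact fun i => wh_nat i.2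
  · rw [← wh_expand (c.ppow N).s, wh_pow (Irr.pos c.prim.irr), c.w, one_pow]

def yk (N : ℕ) : Hall F ℂ := (Classical.choose (c.exists_yk N)).1
theorem yk_irr (N : ℕ) : c.yk N ∈ Irr F (c.d * N) := (Classical.choose (c.exists_yk N)).2
theorem ip_yk (N : ℕ) : ip (c.d * N) (c.ρ ^ N) (c.yk N) = 1 := (Classical.choose_spec (c.exists_yk N)).1
theorem wh_yk (N : ℕ) : HallGL.wh (c.d * N) (c.yk N) = 1 := (Classical.choose_spec (c.exists_yk N)).2.1
theorem yk_uniq (N : ℕ) {χ : Hall F ℂ} (hχ : χ ∈ Irr F (c.d * N)) (h1 : ip (c.d * N) (c.ρ ^ N) χ ≠ 0) (h2 : HallGL.wh (c.d * N) χ ≠ 0) :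
    χ = c.yk N := congrArg Subtype.val ((Classical.choose_spec (c.exists_yk N)).2.2 ⟨χ, hχ⟩ h1 h2)

theorem yk_zero : c.yk 0 = 1 := irr0 (c.yk_irr 0)
theorem yk_one : c.yk 1 = c.ρ := by
  classical
  symm
  apply c.yk_uniq 1
  · rw [mul_one]; exact c.prim.irr
  · rw [mul_one, pow_one, ip_irr c.prim.irr c.prim.irr, if_pos rfl]; exact one_ne_zero
  · rw [mul_one, c.w]; exact one_ne_zero

theorem claim1 {N k l : ℕ} {a b : Hall F ℂ} (ha : a ∈ Irr F k) (hb : b ∈ Irr F l) (h : ip (c.d * N) (c.yk N) (a * b) ≠ 0) :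
    ∃ i j, i + j = N ∧ k = c.d * i ∧ l = c.d * j ∧ a = c.yk i ∧ b = c.yk j := by
  have h0 := (ip_deg (c.yk_irr N).1 (ha.1.mul hb.1) h).1
  have hab : Pos (c.d * N) (a * b) := h0 ▸ (Irr.pos ha).mul (Irr.pos hb)
  have h1 : ip (c.d * N) (c.ρ ^ N) (a * b) ≠ 0 :=
    (c.ppow N).ip_ne hab (c.yk_irr N) (by rw [c.ip_yk]; exact one_ne_zero) (ip_symm_ne h)
  have h2 : HallGL.wh (c.d * N) (a * b) ≠ 0 :=
    hab.wh_ne (c.yk_irr N) (ip_symm_ne h) (by rw [c.wh_yk]; exact one_ne_zero)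
  rw [h0] at h1 h2
  rw [wh_mul ha.1 hb.1] at h2
  obtain ⟨i, j, hij, rfl, rfl, h3, h4⟩ := c.prim.ip_pow_ne N ha.1 hb.1 h1
  exact ⟨i, j, hij, rfl, rfl, c.yk_uniq i ha h3 (left_ne_zero_of_mul h2), c.yk_uniq j hb h4 (right_ne_zero_of_mul h2)⟩

theorem claim2 (i j : ℕ) : ip (c.d * (i + j)) (c.yk (i + j)) (c.yk i * c.yk j) = 1 := by
  have hp : Pos (c.d * i + c.d * j) (c.yk i * c.yk j) := (Irr.pos (c.yk_irr i)).mul (Irr.pos (c.yk_irr j))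
  have h1 := wh_mul (c.yk_irr i).1 (c.yk_irr j).1
  rw [c.wh_yk, c.wh_yk, one_mul, wh_expand hp.s] at h1
  obtain ⟨χ, h2, h3, h4⟩ := nat_one _ _ hp.n (fun χ => wh_nat χ.2) h1
  have h5 : ip (c.d * i + c.d * j) (c.ρ ^ (i + j)) χ.1 ≠ 0 := by
    rw [pow_add]
    exact (c.ppow i).mul_ne (c.ppow j) (c.yk_irr i) (c.yk_irr j) χ.2 (by rw [c.ip_yk]; exact one_ne_zero)
      (by rw [c.ip_yk]; exact one_ne_zero) (by rw [h2]; exact one_ne_zero)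
  obtain ⟨χ, hχ⟩ := χ
  simp only at h2 h3 h5
  rw [← mul_add] at h2 h3 h5 hχ
  have h6 := c.yk_uniq (i+j) hχ h5 (by rw [h3]; exact one_ne_zero)
  rw [← ip_conj, ← h6, h2]; simp

/-- the group-like family -/
def yy : Hall F ℂ := fun x => if c.d ∣ deg x then c.yk (deg x / c.d) x else 0

theorem yy_eq {N : ℕ} {x : X F} (h : deg x = c.d * N) : c.yy x = c.yk N x := by
  rw [yy, if_pos (h ▸ dvd_mul_right _ _), h, Nat.mul_div_cancel_left _ c.prim.pos]
theorem yy_ne {x : X F} (h : ¬ c.d ∣ deg x) : c.yy x = 0 := if_neg h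

theorem Gl_yy : Gl c.yy := by
  classical
  constructor
  · intro x y
    by_cases hs : c.d ∣ deg x + deg y
    · obtain ⟨N, hN⟩ := hs
      have e1 : Delta c.yy x y = Delta (c.yk N) x y := Delta_ext (fun z hz => c.yy_eq (hz.trans hN))
      rw [e1, Delta_expand (c.yk_irr N).1 x y hN]
      by_cases hx : c.d ∣ deg x
      · have hy : c.d ∣ deg y := (Nat.dvd_add_right hx).1 ⟨N, hN⟩
        obtain ⟨i, hi⟩ := hx
        obtain ⟨j, hj⟩ := hy
        have hij : N = i + j := by
          apply Nat.eq_of_mul_eq_mul_left c.prim.pos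
          rw [mul_add, ← hi, ← hj, hN]
        rw [c.yy_eq hi, c.yy_eq hj]
        rw [Finset.sum_eq_single (⟨c.yk i, hi ▸ c.yk_irr i⟩ : Irr F (deg x))]
        · rw [Finset.sum_eq_single (⟨c.yk j, hj ▸ c.yk_irr j⟩ : Irr F (deg y))]
          · rw [hij, c.claim2, one_mul]
          · intro b _ hb
            by_cases h0 : ip (c.d * N) (c.yk N) (c.yk i * b.1) = 0
            · rw [h0, zero_mul]
            · obtain ⟨i', j', h1, h2, h3, h4, h5⟩ := c.claim1 (c.yk_irr i) b.2 h0
              have : j = j' := Nat.eq_of_mul_eq_mul_left c.prim.pos (hj.symm.trans h3)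
              exact absurd (Subtype.ext (h5.trans (congrArg c.yk this.symm))) hb
          · intro h; exact absurd (Finset.mem_univ _) h
        · intro a _ ha
          refine Finset.sum_eq_zero (fun b _ => ?_)
          by_cases h0 : ip (c.d * N) (c.yk N) (a.1 * b.1) = 0
          · rw [h0, zero_mul]
          · obtain ⟨i', j', h1, h2, h3, h4, h5⟩ := c.claim1 a.2 b.2 h0
            have : i = i' := Nat.eq_of_mul_eq_mul_left c.prim.pos (hi.symm.trans h2)
            exact absurd (Subtype.ext (h4.trans (congrArg c.yk this.symm))) ha
        · intro h; exact absurd (Finset.mem_univ _) h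
      · rw [c.yy_ne hx, zero_mul]
        refine Finset.sum_eq_zero (fun a _ => Finset.sum_eq_zero (fun b _ => ?_))
        by_cases h0 : ip (c.d * N) (c.yk N) (a.1 * b.1) = 0
        · rw [h0, zero_mul]
        · obtain ⟨i', j', h1, h2, h3, h4, h5⟩ := c.claim1 a.2 b.2 h0
          exact absurd ⟨i', h2⟩ hx
    · have e1 : Delta c.yy x y = Delta (0 : Hall F ℂ) x y := Delta_ext (fun z hz => by
        rw [c.yy_ne (by rw [hz]; exact hs)]; rfl)
      have e2 : Delta (0 : Hall F ℂ) x y = 0 := avg_const (0 : ℂ)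
      rw [e1, e2]
      by_cases hx : c.d ∣ deg x
      · rw [c.yy_ne (x := y) (fun hy => hs (dvd_add hx hy)), mul_zero]
      · rw [c.yy_ne hx, zero_mul]
  · intro x hx
    rw [c.yy_eq (N := 0) (by simpa using hx), c.yk_zero, one_apply, if_pos hx]

theorem prim_ne_yk {d : ℕ} {ρ : Hall F ℂ} (h : Prim d ρ) {k : ℕ} (he : ρ = c.yk k) : k = 1 := by
  have h1 := h.irr
  rw [he] at h1
  have h2 := irr_deg h1 (c.yk_irr k)
  have h3 := h.pos
  have hd := c.prim.pos
  match k with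
  | 0 => simp at h2; omega
  | 1 => rfl
  | k+2 =>
    have h4 := c.claim2 1 (k+1)
    have h5 := h.pr (c.d * 1) (c.d * (k+1)) (by positivity) (by positivity) _ (c.yk_irr 1) _ (c.yk_irr (k+1)) (by rw [h2]; ring)
    rw [he, h2] at h5
    rw [show 1 + (k+1) = k + 2 by ring, h5] at h4
    exact absurd h4 zero_ne_one

theorem yk_inj {c' : Cusp F} {k l : ℕ} (hk : k ≠ 0) (h : c.yk k = c'.yk l) : c = c' := by
  classical
  have hp := c'.Gl_yy.cj
  have h1 : ∀ k, pair (HallGL.cj c'.yy) (c.ρ ^ k) = pair (HallGL.cj c'.yy) c.ρ ^ k := by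
    intro k
    induction k with
    | zero => rw [pow_zero, pow_zero, hp.pair_one]
    | succ k ih => rw [pow_succ, hp.pair_mul, ih, pow_succ]
  have h2 := h1 k
  have hdeg := irr_deg (c.yk_irr k) (h ▸ c'.yk_irr l)
  have h3 : pair (HallGL.cj c'.yy) (c.ρ ^ k) ≠ 0 := by
    intro h0
    have h4 := congrArg (PowerSeries.coeff (c.d * k)) h0
    rw [coeff_pair, map_zero] at h4
    have h5 : ip (c.d * k) (c.ρ ^ k) (c.yk k) = 0 := by
      rw [← h4, ip]
      refine INT_congr (fun x hx => ?_)
      rw [mul_comm]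
      congr 1
      rw [cj, cj, c'.yy_eq (hx.trans hdeg), h]
    rw [c.ip_yk] at h5
    exact one_ne_zero h5
  have h4 : pair (HallGL.cj c'.yy) c.ρ ≠ 0 := by
    intro h0
    rw [h0, zero_pow hk] at h2
    exact h3 h2
  rw [pair_supp c.prim.irr.1] at h4
  have h5 : INTL c.d c.ρ (HallGL.cj c'.yy) ≠ 0 := by
    intro h0; rw [h0, map_zero] at h4; exact h4 rfl
  rw [INTL_comm, ← ip_eq] at h5
  by_cases hdv : c'.d ∣ c.d
  · obtain ⟨j, hj⟩ := hdv
    have h6 : ip c.d c.ρ (c'.yk j) ≠ 0 := by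
      intro h0
      apply h5
      rw [← h0, ip, ip]
      refine INT_congr (fun x hx => ?_)
      rw [cj, cj, c'.yy_eq (hx.trans hj)]
    have h7 : c.ρ = c'.yk j := by
      by_contra hne
      rw [ip_irr c.prim.irr (hj ▸ c'.yk_irr j), if_neg hne] at h6
      exact h6 rfl
    have h8 := c'.prim_ne_yk c.prim h7
    rw [h8, c'.yk_one] at h7
    exact Cusp.ext' h7
  · exfalso
    apply h5
    rw [ip]
    rw [INT_congr (g := fun _ => 0), INT_zero]
    intro x hx
    rw [cj, c'.yy_ne (by rw [hx]; exact hdv)]; simp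

/-- degree -/
theorem pair_yy_gg : pair c.yy gg * (1 - PowerSeries.X ^ c.d) = 1 := by
  have hd := c.prim.pos
  have h1 : ∀ n, PowerSeries.coeff n (pair c.yy gg) = if c.d ∣ n then 1 else 0 := by
    intro n
    rw [coeff_pair]
    split_ifs with h
    · obtain ⟨k, rfl⟩ := h
      rw [← c.wh_yk k, HallGL.wh, INTL_apply]
      exact INT_congr (fun x hx => by rw [c.yy_eq hx])
    · rw [INT_congr (g := fun _ => 0), INT_zero]
      intro x hx
      rw [c.yy_ne (by rw [hx]; exact h), zero_mul]
  ext n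
  rw [mul_sub, mul_one, map_sub, PowerSeries.coeff_mul_X_pow', h1, PowerSeries.coeff_one]
  by_cases hn : c.d ≤ n
  · rw [if_pos hn, h1, if_neg (by omega : n ≠ 0)]
    obtain ⟨m, rfl⟩ := Nat.exists_eq_add_of_le hn
    rw [Nat.add_sub_cancel_left]
    simp
  · rw [if_neg hn]
    by_cases h0 : n = 0
    · simp [h0]
    · rw [if_neg h0, if_neg (fun h => hn (Nat.le_of_dvd (by omega) h)), sub_zero]

theorem dlt_yk (k : ℕ) : dlt (c.d * k) (c.yk k) = (qq F ^ c.d) ^ (k.choose 2) / phi (qq F ^ c.d) k := by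
  have hd := c.prim.pos
  have h1 := c.Gl_yy.pair_mul gg (regc 1)
  rw [gg_mul] at h1
  have h2 : pair c.yy (regc (qq F)) * (1 - PowerSeries.X ^ c.d) = pair c.yy (regc 1) := by
    rw [h1, mul_right_comm, c.pair_yy_gg, one_mul]
  have h3 : ∀ z k, PowerSeries.coeff (c.d * k) (pair c.yy (regc z)) = z ^ (c.d * k) * dlt (c.d * k) (c.yk k) := by
    intro z k
    rw [coeff_pair_regc, c.yy_eq (deg_idc _), dlt]; ring
  have h4 : ∀ k, dlt (c.d * (k+1)) (c.yk (k+1)) * ((qq F ^ c.d) ^ (k+1) - 1) = (qq F ^ c.d) ^ k * dlt (c.d * k) (c.yk k) := by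
    intro k
    have h5 := congrArg (PowerSeries.coeff (c.d * (k + 1))) h2
    rw [mul_sub, mul_one, map_sub, PowerSeries.coeff_mul_X_pow', if_pos (by rw [Nat.mul_succ]; omega),
      show c.d * (k+1) - c.d = c.d * k by rw [Nat.mul_succ]; omega, h3, h3, h3, one_pow, one_mul, pow_mul, pow_mul] at h5
    linear_combination h5
  induction k with
  | zero =>
    rw [c.yk_zero, phi_zero, dlt, mul_zero, phi_zero]
    rw [one_apply, if_pos (deg_idc 0)]; simp
  | succ k ih =>
    have h5 := h4 k
    have h6 : (qq F ^ c.d) ^ (k+1) - 1 ≠ 0 := by rw [← pow_mul]; exact qq_pow_ne _ (by positivity)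
    have h7 : phi (qq F ^ c.d) k ≠ 0 := Finset.prod_ne_zero_iff.2 (fun i _ => by rw [← pow_mul]; exact qq_pow_ne _ (by positivity))
    rw [ih] at h5
    rw [phi_succ, show (k+1).choose 2 = k.choose 2 + k by rw [choose_add_two]; simp, eq_div_iff (mul_ne_zero h7 h6), mul_comm (phi _ _), ← mul_assoc, h5, pow_add]
    field_simp
end Cusp
end prim
end HallGL

namespace HallGL

section alg
variable {R : Type} [CommRing R] {m : ℕ}

/-- Jacobi-Trudi type matrix -/
def jm (e : ℕ → R) (α : Fin m → ℕ) : Matrix (Fin m) (Fin m) R := Matrix.of fun j k => if (k : ℕ) ≤ α j then e (α j - k) else 0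

theorem jm_map {S : Type} [CommRing S] (g : R →+* S) (e : ℕ → R) (α : Fin m → ℕ) : g (jm e α).det = (jm (fun k => g (e k)) α).det := by
  rw [RingHom.map_det]
  congr 1
  ext j k
  simp only [jm, RingHom.mapMatrix_apply, Matrix.map_apply, Matrix.of_apply]
  split_ifs <;> simp

theorem jm_scale (z : R) (e : ℕ → R) (α : Fin m → ℕ) :
    (jm (fun k => z ^ k * e k) α).det * z ^ (∑ k : Fin m, (k : ℕ)) = z ^ (∑ j, α j) * (jm e α).det := by
  rw [← Finset.prod_pow_eq_pow_sum, ← Finset.prod_pow_eq_pow_sum, ← Matrix.det_mul_column, mul_comm, ← Matrix.det_mul_row]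
  congr 1
  ext j k
  simp only [jm, Matrix.of_apply]
  split_ifs with h
  · rw [← mul_assoc, ← pow_add]; congr 2; omega
  · simp

theorem geom_inv (t : R) : PowerSeries.mk (fun k => t ^ k) * (1 - PowerSeries.C t * PowerSeries.X) = 1 := by
  ext n
  rw [mul_sub, mul_one, map_sub, mul_left_comm, PowerSeries.coeff_C_mul]
  rcases n with _ | n
  · rw [PowerSeries.coeff_zero_mul_X]; simp
  · rw [PowerSeries.coeff_succ_mul_X, PowerSeries.coeff_mk, PowerSeries.coeff_mk, PowerSeries.coeff_one, if_neg (by omega)]; ring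

theorem coeff_lin_prod (s : Finset (Fin m)) (T : Fin m → R) (n : ℕ) (hn : s.card < n) :
    PowerSeries.coeff n (∏ i ∈ s, (1 - PowerSeries.C (T i) * PowerSeries.X)) = 0 := by
  have h : (∏ i ∈ s, (1 - PowerSeries.C (T i) * PowerSeries.X)) = ((∏ i ∈ s, (1 - Polynomial.C (T i) * Polynomial.X) : Polynomial R) : PowerSeries R) := by
    rw [← Polynomial.coeToPowerSeries.ringHom_apply, map_prod]
    refine Finset.prod_congr rfl (fun i _ => ?_)
    simp
  rw [h, Polynomial.coeff_coe]
  apply Polynomial.coeff_eq_zero_of_natDegree_lt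
  refine lt_of_le_of_lt (Polynomial.natDegree_prod_le _ _) (lt_of_le_of_lt ?_ hn)
  rw [Finset.card_eq_sum_ones]
  refine Finset.sum_le_sum (fun i _ => ?_)
  compute_degree

theorem jt_mul (T : Fin m → R) (Hs : PowerSeries R) (h : Hs * ∏ j, (1 - PowerSeries.C (T j) * PowerSeries.X) = 1) (α : Fin m → ℕ) :
    jm (fun n => PowerSeries.coeff n Hs) α *
      (Matrix.of fun (k l : Fin m) => PowerSeries.coeff (k : ℕ) (∏ i ∈ Finset.univ.erase l, (1 - PowerSeries.C (T i) * PowerSeries.X)))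
      = Matrix.of fun j l => T l ^ α j := by
  ext j l
  rw [Matrix.mul_apply, Matrix.of_apply]
  have h1 : Hs * (∏ i ∈ Finset.univ.erase l, (1 - PowerSeries.C (T i) * PowerSeries.X)) = PowerSeries.mk (fun k => T l ^ k) := by
    have h2 := geom_inv (T l)
    rw [← Finset.mul_prod_erase Finset.univ (fun j => 1 - PowerSeries.C (T j) * PowerSeries.X) (Finset.mem_univ l)] at h
    rw [mul_comm] at h2
    symm
    apply left_inv_eq_right_inv (a := 1 - PowerSeries.C (T l) * PowerSeries.X)
    · rw [mul_comm]; exact h2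
    · rw [mul_left_comm]; exact h
  have h3 := congrArg (PowerSeries.coeff (α j)) h1
  rw [PowerSeries.coeff_mk] at h3
  rw [← h3, mul_comm, PowerSeries.coeff_mul, Finset.Nat.sum_antidiagonal_eq_sum_range_succ_mk]
  set P := ∏ i ∈ Finset.univ.erase l, (1 - PowerSeries.C (T i) * PowerSeries.X) with hP
  have h4 : ∀ n, m ≤ n → PowerSeries.coeff n P = 0 := by
    intro n hn
    apply coeff_lin_prod
    rw [Finset.card_erase_of_mem (Finset.mem_univ _), Finset.card_univ, Fintype.card_fin]
    have := l.2
    omega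
  have e1 : ∀ k : Fin m, jm (fun n => PowerSeries.coeff n Hs) α j k * (Matrix.of fun (k l : Fin m) => PowerSeries.coeff (k : ℕ) (∏ i ∈ Finset.univ.erase l, (1 - PowerSeries.C (T i) * PowerSeries.X))) k l
      = (fun n : ℕ => if n ≤ α j then PowerSeries.coeff n P * PowerSeries.coeff (α j - n) Hs else 0) k := by
    intro k
    simp only [jm, Matrix.of_apply]
    split_ifs with hk
    · rw [mul_comm]
    · rw [zero_mul]
  rw [Finset.sum_congr rfl (fun k _ => e1 k), Fin.sum_univ_eq_sum_range (fun n : ℕ => if n ≤ α j then PowerSeries.coeff n P * PowerSeries.coeff (α j - n) Hs else 0) m]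
  rw [← Finset.sum_filter]
  apply Finset.sum_subset_zero_on_sdiff
  · intro n hn
    simp only [Finset.mem_filter, Finset.mem_range] at hn ⊢
    omega
  · intro n hn
    simp only [Finset.mem_sdiff, Finset.mem_filter, Finset.mem_range] at hn
    simp only
    rw [h4 n (by omega), zero_mul]
  · intro n hn; rfl

theorem jt (T : Fin m → R) (Hs : PowerSeries R) (h : Hs * ∏ j, (1 - PowerSeries.C (T j) * PowerSeries.X) = 1) (α : Fin m → ℕ) :
    (jm (fun n => PowerSeries.coeff n Hs) α).det * (Matrix.of fun (j l : Fin m) => T l ^ (j : ℕ)).det = (Matrix.of fun (j l : Fin m) => T l ^ α j).det := by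
  have h1 := congrArg Matrix.det (jt_mul T Hs h α)
  have h2 := congrArg Matrix.det (jt_mul T Hs h (fun j => (j : ℕ)))
  rw [Matrix.det_mul] at h1 h2
  have h0 : PowerSeries.coeff 0 Hs = 1 := by
    have := congrArg (PowerSeries.constantCoeff) h
    rw [map_mul, map_prod] at this
    simpa using this
  have h3 : (jm (fun n => PowerSeries.coeff n Hs) (fun j : Fin m => (j : ℕ))).det = 1 := by
    rw [Matrix.det_of_lowerTriangular]
    · apply Finset.prod_eq_one
      intro i _
      simp [jm, h0]
    · intro i j hij
      simp only [jm, Matrix.of_apply]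
      rw [if_neg]
      exact not_le.2 hij
  rw [h3, one_mul] at h2
  rw [← h1, ← h2]

end alg
end HallGL

namespace HallGL

section gen
variable {F : Type} [Field F] [Fintype F]

theorem INT_zero_degK {K : Type} [CommRing K] [Algebra ℂ K] (f : X F → K) : INT 0 f = f (x0 F) := by
  rw [INT, INTV, cG_eq]
  simp only [phi_zero, Nat.choose_zero_succ, pow_zero, mul_one, inv_one, one_smul]
  rw [Fintype.sum_eq_single (0 : Module.End F (Fin 0 → F))]
  · rfl
  · intro φ hφ; exact absurd (Subsingleton.elim _ _) hφ

theorem Gl.pair_oneK {K : Type} [CommRing K] [Algebra ℂ K] {g : Hall F K} (hg : Gl g) : pair g 1 = 1 := by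
  ext n
  rw [coeff_pair, PowerSeries.coeff_one]
  split_ifs with h
  · subst h
    rw [INT_zero_degK, hg.z _ deg_x0, one_apply, if_pos deg_x0, one_mul]
  · rw [INT_congr (g := fun _ => 0), INT_zero]
    intro x hx
    rw [one_apply, if_neg (by omega), mul_zero]

theorem Gl.pair_prodK {K : Type} [CommRing K] [Algebra ℂ K] {g : Hall F K} (hg : Gl g) {ι : Type} (s : Finset ι) (f : ι → Hall F K) :
    pair g (∏ i ∈ s, f i) = ∏ i ∈ s, pair g (f i) := by
  classical
  induction s using Finset.induction_on with
  | empty => rw [Finset.prod_empty, Finset.prod_empty, hg.pair_oneK]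
  | insert i s hi ih => rw [Finset.prod_insert hi, Finset.prod_insert hi, hg.pair_mul, ih]

theorem mul_agree {R : Type} [CommRing R] (N : ℕ) {a b a' b' : Hall F R} (h1 : ∀ x, deg x ≤ N → a x = a' x) (h2 : ∀ x, deg x ≤ N → b x = b' x)
    (x : X F) (hx : deg x ≤ N) : (a * b) x = (a' * b') x := by
  obtain ⟨n, φ, rfl⟩ : ∃ n, ∃ φ : Module.End F (Fin n → F), cls φ = x := ⟨_, rep x, cls_rep x⟩
  rw [mul_cls, mul_cls]
  refine Finset.sum_congr rfl (fun S _ => ?_)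
  have := deg_sub_add_quo φ S
  rw [deg_cls] at hx
  rw [h1 _ (by omega), h2 _ (by omega)]

theorem prod_agree {R : Type} [CommRing R] (N : ℕ) {ι : Type} (s : Finset ι) {f g : ι → Hall F R} (h : ∀ i ∈ s, ∀ x, deg x ≤ N → f i x = g i x)
    (x : X F) (hx : deg x ≤ N) : (∏ i ∈ s, f i) x = (∏ i ∈ s, g i) x := by
  classical
  induction s using Finset.induction_on generalizing x with
  | empty => rfl
  | insert i s hi ih =>
    rw [Finset.prod_insert hi, Finset.prod_insert hi]
    exact mul_agree N (h i (Finset.mem_insert_self _ _)) (fun y hy => ih (fun j hj => h j (Finset.mem_insert_of_mem hj)) y hy) x hx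

variable {I : Type} [Fintype I] [DecidableEq I]

theorem INT_C (n : ℕ) (f : X F → ℂ) : INT n (fun x => (MvPolynomial.C (f x) : MvPolynomial I ℂ)) = MvPolynomial.C (INT n f) := by
  simp only [INT, INTV, MvPolynomial.smul_eq_C_mul, smul_eq_mul, map_mul, map_sum]

theorem Delta_C (f : Hall F ℂ) (x y : X F) : Delta (hmap (MvPolynomial.C : ℂ →+* MvPolynomial I ℂ) f) x y = MvPolynomial.C (Delta f x y) := by
  rw [Delta, Delta, avg, avg]
  simp only [MvPolynomial.smul_eq_C_mul, smul_eq_mul, map_mul, map_sum]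
  rfl

theorem Gl.C {f : Hall F ℂ} (hf : Gl f) : Gl (hmap (MvPolynomial.C : ℂ →+* MvPolynomial I ℂ) f) :=
  ⟨fun x y => by rw [Delta_C, hf.d, map_mul]; rfl, fun x hx => by rw [hmap_apply, hf.z x hx, map_one]⟩

variable (c : I → Cusp F)

def Yp (p : I) : Hall F (MvPolynomial I ℂ) := fun x => MvPolynomial.C ((c p).yy x) * MvPolynomial.X p ^ (deg x / (c p).d)

theorem Gl_Yp (p : I) : Gl (Yp c p) := by
  constructor
  · intro x y
    have h1 : Delta (Yp c p) x y = MvPolynomial.C (Delta (c p).yy x y) * MvPolynomial.X p ^ ((deg x + deg y) / (c p).d) := by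
      rw [← Delta_C, Delta, Delta, ← avg_mul_right]
      refine avg_congr (fun u => ?_)
      rw [Yp, hmap_apply, deg_cls]
      simp
    rw [h1, (c p).Gl_yy.d, Yp, Yp, map_mul]
    by_cases hx : (c p).d ∣ deg x
    · rw [Nat.add_div_of_dvd_right hx, pow_add]; ring
    · rw [(c p).yy_ne hx]; simp
  · intro x hx
    rw [Yp, (c p).Gl_yy.z x hx, hx]; simp

def GGG : Hall F (MvPolynomial I ℂ) := ∏ p, Yp c p
theorem Gl_GGG : Gl (GGG c) := Gl.prod _ _ (fun p _ => Gl_Yp c p)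

def uu (a : I → ℕ) : Hall F ℂ := ∏ p, (c p).yk (a p)

theorem uu_pos (a : I → ℕ) : Pos (∑ p, (c p).d * a p) (uu c a) := Pos.prod _ _ _ (fun p _ => Irr.pos ((c p).yk_irr (a p)))

theorem wh_uu (a : I → ℕ) : wh (∑ p, (c p).d * a p) (uu c a) = 1 := by
  have : ∀ s : Finset I, wh (∑ p ∈ s, (c p).d * a p) (∏ p ∈ s, (c p).yk (a p)) = 1 := by
    intro s
    induction s using Finset.induction_on with
    | empty => exact wh_one
    | insert i s hi ih =>
      rw [Finset.prod_insert hi, Finset.sum_insert hi, wh_mul ((c i).yk_irr _).1 (Pos.prod _ _ _ (fun p _ => Irr.pos ((c p).yk_irr (a p)))).s, ih, (c i).wh_yk, one_mul]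
  exact this _

theorem monomial_eq_prod (a : I → ℕ) : ∏ p, (MvPolynomial.X p ^ a p : MvPolynomial I ℂ) = MvPolynomial.monomial (Finsupp.equivFunOnFinite.symm a) 1 := by
  rw [MvPolynomial.monomial_eq, Finsupp.prod_fintype _ _ (fun _ => pow_zero _)]
  simp

theorem GGG_apply (N : ℕ) (x : X F) (hx : deg x ≤ N) :
    GGG c x = ∑ a : I → Fin (N+1), MvPolynomial.monomial (Finsupp.equivFunOnFinite.symm (fun p => (a p : ℕ))) (uu c (fun p => a p) x) := by
  have h1 : ∀ p ∈ Finset.univ, ∀ x, deg x ≤ N → Yp c p x = (∑ k : Fin (N+1), (MvPolynomial.X p ^ (k : ℕ) : MvPolynomial I ℂ) • hmap (MvPolynomial.C : ℂ →+* MvPolynomial I ℂ) ((c p).yk k)) x := by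
    intro p _ x hx
    rw [sum_apply', Yp]
    have hd := (c p).prim.pos
    by_cases hdv : (c p).d ∣ deg x
    · obtain ⟨k, hk⟩ := hdv
      have hkN : k < N + 1 := by
        have : k ≤ (c p).d * k := Nat.le_mul_of_pos_left _ hd
        omega
      rw [Finset.sum_eq_single (⟨k, hkN⟩ : Fin (N+1))]
      · rw [smul_apply, hmap_apply, (c p).yy_eq hk, hk, Nat.mul_div_cancel_left _ hd, smul_eq_mul, mul_comm]
      · intro j _ hj
        rw [smul_apply, hmap_apply, ((c p).yk_irr j).1.eqz, map_zero, smul_zero]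
        rw [hk]
        intro h
        exact hj (Fin.ext (Nat.eq_of_mul_eq_mul_left hd h).symm)
      · intro h; exact absurd (Finset.mem_univ _) h
    · rw [(c p).yy_ne hdv, map_zero, zero_mul]
      symm
      refine Finset.sum_eq_zero (fun k _ => ?_)
      rw [smul_apply, hmap_apply, ((c p).yk_irr k).1.eqz, map_zero, smul_zero]
      intro h
      exact hdv ⟨_, h⟩
  rw [GGG, prod_agree N _ h1 x hx, Finset.prod_univ_sum, Fintype.piFinset_univ, sum_apply']
  refine Finset.sum_congr rfl (fun a _ => ?_)
  rw [Finset.prod_smul, ← map_prod, smul_apply, hmap_apply, monomial_eq_prod, smul_eq_mul, mul_comm, MvPolynomial.C_mul_monomial, mul_one]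
  rfl

/-- conjugated embedding -/
def cC : ℂ →+* MvPolynomial I ℂ := (MvPolynomial.C : ℂ →+* MvPolynomial I ℂ).comp (starRingEnd ℂ)

theorem hmap_cC (h : Hall F ℂ) : hmap (cC : ℂ →+* MvPolynomial I ℂ) h = hmap MvPolynomial.C (cj h) := rfl

def EE : Hall F ℂ →+* PowerSeries (MvPolynomial I ℂ) where
  toFun h := pair (GGG c) (hmap (cC : ℂ →+* MvPolynomial I ℂ) h)
  map_one' := by rw [map_one, (Gl_GGG c).pair_oneK]
  map_mul' a b := by rw [map_mul, (Gl_GGG c).pair_mul]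
  map_zero' := by
    ext n : 1
    rw [coeff_pair, map_zero, map_zero]
    refine (INT_congr (g := fun _ => 0) (fun x _ => ?_)).trans (INT_zero (F := F) n)
    exact mul_zero _
  map_add' a b := by
    ext n : 1
    rw [coeff_pair, map_add, map_add, coeff_pair, coeff_pair, ← INT_add]
    congr 1; funext x; exact mul_add _ _ _

theorem EE_apply (h : Hall F ℂ) : EE c h = pair (GGG c) (hmap cC h) := rfl

def FG (n : ℕ) (h : Hall F ℂ) : MvPolynomial I ℂ := PowerSeries.coeff n (EE c h)

theorem FG_eq (n : ℕ) (h : Hall F ℂ) : FG c n h = ∑ a : I → Fin (n+1), MvPolynomial.monomial (Finsupp.equivFunOnFinite.symm (fun p => (a p : ℕ))) (ip n (uu c (fun p => a p)) h) := by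
  rw [FG, EE_apply, coeff_pair]
  have h1 : INT n (fun x => GGG c x * hmap cC h x) = INT n (fun x => ∑ a : I → Fin (n+1),
      MvPolynomial.monomial (Finsupp.equivFunOnFinite.symm (fun p => (a p : ℕ))) 1 * MvPolynomial.C (uu c (fun p => a p) x * cj h x)) := by
    refine INT_congr (fun x hx => ?_)
    rw [GGG_apply c n x hx.le, Finset.sum_mul]
    refine Finset.sum_congr rfl (fun a _ => ?_)
    rw [hmap_cC, hmap_apply, mul_comm, MvPolynomial.C_mul_monomial, mul_comm _ (MvPolynomial.C _), MvPolynomial.C_mul_monomial, mul_one, mul_comm]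
  rw [h1, INT_sum]
  refine Finset.sum_congr rfl (fun a _ => ?_)
  rw [INT_mul_left, INT_C, mul_comm, MvPolynomial.C_mul_monomial, mul_one]
  rfl

theorem coeff_FG (n : ℕ) (h : Hall F ℂ) (b : I →₀ ℕ) : MvPolynomial.coeff b (FG c n h) = ip n (uu c b) h := by
  rw [FG_eq, MvPolynomial.coeff_sum]
  simp only [MvPolynomial.coeff_monomial]
  by_cases hb : ∀ p, b p < n + 1
  · rw [Finset.sum_eq_single (fun p => (⟨b p, hb p⟩ : Fin (n+1)))]
    · rw [if_pos]
      ext p; simp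
    · intro a _ ha
      rw [if_neg]
      intro he
      apply ha
      funext p
      apply Fin.ext
      have := DFunLike.congr_fun he p
      simpa using this
    · intro h; exact absurd (Finset.mem_univ _) h
  · rw [Finset.sum_eq_zero]
    · symm
      by_contra hne
      push Not at hb
      obtain ⟨p, hp⟩ := hb
      have h2 : ∃ x, deg x = n ∧ uu c b x ≠ 0 := by
        by_contra hc
        push Not at hc
        apply hne
        rw [ip, INT_congr (g := fun _ => 0), INT_zero]
        intro x hx
        rw [hc x hx, zero_mul]
      obtain ⟨x, hx, hx'⟩ := h2
      have h3 := ((uu_pos c b).s x hx').1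
      have h4 : (c p).d * b p ≤ ∑ p, (c p).d * b p := Finset.single_le_sum (f := fun p => (c p).d * b p) (fun _ _ => Nat.zero_le _) (Finset.mem_univ p)
      have h5 : b p ≤ (c p).d * b p := Nat.le_mul_of_pos_left _ (c p).prim.pos
      omega
    · intro a _
      rw [if_neg]
      intro he
      apply hb
      intro p
      rw [← he]; simp
      exact Nat.lt_succ_iff.1 (a p).2

open Classical in
theorem pair_Yp (p : I) (σ : Cusp F) : pair (Yp c p) (hmap cC σ.yy) =
    if c p = σ then PowerSeries.expand σ.d σ.prim.pos.ne' (PowerSeries.mk (fun k => (MvPolynomial.X p : MvPolynomial I ℂ) ^ k)) else 1 := by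
  classical
  ext n : 1
  have h1 : PowerSeries.coeff n (pair (Yp c p) (hmap cC σ.yy)) = MvPolynomial.C (ip n (c p).yy σ.yy) * MvPolynomial.X p ^ (n / (c p).d) := by
    rw [coeff_pair, ip, ← INT_C, ← INT_mul_right]
    refine INT_congr (fun x hx => ?_)
    rw [Yp, hmap_cC, hmap_apply, hx, map_mul]; ring
  rw [h1]
  have h0 : ∀ k : ℕ, ip ((c p).d * k) (c p).yy (c p).yy = 1 := by
    intro k
    have := ip_irr ((c p).yk_irr k) ((c p).yk_irr k)
    rw [if_pos rfl] at this
    rw [← this, ip, ip]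
    refine INT_congr (fun x hx => ?_)
    rw [cj, cj, (c p).yy_eq hx]
  split_ifs with hc
  · subst hc
    by_cases hdv : (c p).d ∣ n
    · obtain ⟨k, rfl⟩ := hdv
      rw [PowerSeries.coeff_expand_mul, PowerSeries.coeff_mk, Nat.mul_div_cancel_left _ (c p).prim.pos, h0]
      simp
    · rw [PowerSeries.coeff_expand_of_not_dvd _ _ _ hdv, ip, INT_congr (g := fun _ => 0), INT_zero]
      · simp
      · intro x hx
        rw [(c p).yy_ne (by rw [hx]; exact hdv), zero_mul]
  · rw [PowerSeries.coeff_one]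
    split_ifs with hn
    · subst hn
      have h2 : ip 0 (c p).yy σ.yy = 1 := by
        rw [ip, INT_zero_deg, cj, (c p).Gl_yy.z _ deg_x0, σ.Gl_yy.z _ deg_x0]; simp
      rw [h2]; simp
    · have h2 : ip n (c p).yy σ.yy = 0 := by
        by_cases hdv : (c p).d ∣ n ∧ σ.d ∣ n
        · obtain ⟨⟨k, hk⟩, ⟨l, hl⟩⟩ := hdv
          have h3 : ip n (c p).yy σ.yy = ip n ((c p).yk k) (σ.yk l) := by
            rw [ip, ip]
            refine INT_congr (fun x hx => ?_)
            rw [cj, cj, (c p).yy_eq (hx.trans hk), σ.yy_eq (hx.trans hl)]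
          rw [h3, ip_irr (hk ▸ (c p).yk_irr k) (hl ▸ σ.yk_irr l), if_neg]
          intro he
          exact hc ((c p).yk_inj (by rintro rfl; simp at hk; exact hn hk) he)
        · rw [ip, INT_congr (g := fun _ => 0), INT_zero]
          intro x hx
          rw [cj]
          by_cases h4 : (c p).d ∣ n
          · rw [σ.yy_ne (by rw [hx]; exact fun h5 => hdv ⟨h4, h5⟩)]; simp
          · rw [(c p).yy_ne (by rw [hx]; exact h4), zero_mul]
      rw [h2]; simp

open Classical in
theorem EE_yk (σ : Cusp F) (k : ℕ) : EE c (σ.yk k) = PowerSeries.monomial (σ.d * k)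
    (PowerSeries.coeff k (∏ p ∈ Finset.univ.filter (fun p => c p = σ), PowerSeries.mk (fun k => (MvPolynomial.X p : MvPolynomial I ℂ) ^ k))) := by
  have h1 : pair (GGG c) (hmap cC σ.yy) = PowerSeries.expand σ.d σ.prim.pos.ne' (∏ p ∈ Finset.univ.filter (fun p => c p = σ), PowerSeries.mk (fun k => (MvPolynomial.X p : MvPolynomial I ℂ) ^ k)) := by
    have h2 : Gl (hmap cC σ.yy : Hall F (MvPolynomial I ℂ)) := by rw [hmap_cC]; exact σ.Gl_yy.cj.C
    rw [pair_comm, GGG, h2.pair_prodK, map_prod, Finset.prod_filter]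
    refine Finset.prod_congr rfl (fun p _ => ?_)
    rw [pair_comm, pair_Yp]
  ext n : 1
  rw [PowerSeries.coeff_monomial, EE_apply, coeff_pair]
  split_ifs with hn
  · subst hn
    rw [← PowerSeries.coeff_expand_mul σ.d σ.prim.pos.ne', ← h1, coeff_pair]
    refine INT_congr (fun x hx => ?_)
    rw [hmap_apply, hmap_apply, σ.yy_eq hx]
  · rw [INT_congr (g := fun _ => 0), INT_zero]
    intro x hx
    rw [hmap_apply, (σ.yk_irr k).1.eqz (by rw [hx]; exact hn), map_zero, mul_zero]

end gen
end HallGL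

namespace HallGL

section f3
variable {F : Type} [Field F] [Fintype F]

theorem list_pos (l : List (Cusp F)) : Pos (l.map (fun x => x.d)).sum (l.map (fun x => x.ρ)).prod := by
  induction l with
  | nil => exact Pos.one
  | cons a l ih => simpa using (Irr.pos a.prim.irr).mul ih

theorem list_le (l : List (Cusp F)) : l.length ≤ (l.map (fun x => x.d)).sum := by
  induction l with
  | nil => simp
  | cons a l ih =>
    have := a.prim.pos
    simp only [List.length_cons, List.map_cons, List.sum_cons]; omega

theorem list_mem_le (l : List (Cusp F)) : ∀ x ∈ l, x.d ≤ (l.map (fun x => x.d)).sum := by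
  intro x hx
  exact List.single_le_sum (fun _ _ => Nat.zero_le _) _ (List.mem_map_of_mem hx)

theorem not_prim {n : ℕ} (hn : 0 < n) {χ : Hall F ℂ} (hχ : χ ∈ Irr F n) (h : ¬ Prim n χ) :
    ∃ i j, 0 < i ∧ 0 < j ∧ i + j = n ∧ ∃ a ∈ Irr F i, ∃ b ∈ Irr F j, ip n (a * b) χ ≠ 0 := by
  by_contra hc
  push Not at hc
  apply h
  refine ⟨hχ, hn, fun i j hi hj a ha b hb hij => ?_⟩
  by_contra hne
  exact ip_symm_ne hne (hc i j hi hj hij a ha b hb)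

theorem constit (n : ℕ) : ∀ (hw : ∀ d ≤ n, ∀ ρ : Hall F ℂ, Prim d ρ → wh d ρ = 1) (χ : Hall F ℂ) (hχ : χ ∈ Irr F n),
    ∃ l : List (Cusp F), (l.map (fun x => x.d)).sum = n ∧ ip n (l.map (fun x => x.ρ)).prod χ ≠ 0 := by
  classical
  induction n using Nat.strong_induction_on with
  | _ n ih =>
    intro hw χ hχ
    rcases Nat.eq_zero_or_pos n with rfl | hn
    · refine ⟨[], rfl, ?_⟩
      have h1 := irr0 hχ
      subst h1
      have := ip_irr hχ hχ
      rw [if_pos rfl] at this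
      simp only [List.map_nil, List.prod_nil]
      rw [this]; exact one_ne_zero
    · by_cases hp : Prim n χ
      · refine ⟨[⟨n, χ, hp, hw n le_rfl χ hp⟩], by simp, ?_⟩
        have := ip_irr hχ hχ
        rw [if_pos rfl] at this
        simp only [List.map_cons, List.map_nil, List.prod_cons, List.prod_nil, mul_one]
        rw [this]; exact one_ne_zero
      · obtain ⟨i, j, hi, hj, rfl, a, ha, b, hb, h⟩ := not_prim hn hχ hp
        obtain ⟨l1, h1, h1'⟩ := ih i (by omega) (fun d hd => hw d (by omega)) a ha
        obtain ⟨l2, h2, h2'⟩ := ih j (by omega) (fun d hd => hw d (by omega)) b hb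
        refine ⟨l1 ++ l2, by simp [h1, h2], ?_⟩
        rw [List.map_append, List.prod_append]
        subst h1 h2
        exact (list_pos l1).mul_ne (list_pos l2) ha hb hχ h1' h2' h

theorem constit' {n : ℕ} (hn : 0 < n) (hw : ∀ d < n, ∀ ρ : Hall F ℂ, Prim d ρ → wh d ρ = 1) {χ : Hall F ℂ} (hχ : χ ∈ Irr F n) (hp : ¬ Prim n χ) :
    ∃ l : List (Cusp F), (∀ x ∈ l, x.d < n) ∧ (l.map (fun x => x.d)).sum = n ∧ ip n (l.map (fun x => x.ρ)).prod χ ≠ 0 := by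
  obtain ⟨i, j, hi, hj, rfl, a, ha, b, hb, h⟩ := not_prim hn hχ hp
  obtain ⟨l1, h1, h1'⟩ := constit i (fun d hd => hw d (by omega)) a ha
  obtain ⟨l2, h2, h2'⟩ := constit j (fun d hd => hw d (by omega)) b hb
  refine ⟨l1 ++ l2, ?_, by simp [h1, h2], ?_⟩
  · intro x hx
    rcases List.mem_append.1 hx with hx | hx
    · have := list_mem_le l1 x hx; omega
    · have := list_mem_le l2 x hx; omega
  rw [List.map_append, List.prod_append]
  subst h1 h2
  exact (list_pos l1).mul_ne (list_pos l2) ha hb hχ h1' h2' h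

theorem list_fin_prod {A : Type} [CommMonoid A] (l : List A) : ∀ n, l.length ≤ n → ∏ j : Fin n, (l[(j : ℕ)]?).getD 1 = l.prod := by
  induction l with
  | nil => intro n _; simp
  | cons a l ih =>
    intro n hn
    obtain ⟨k, rfl⟩ : ∃ k, n = k + 1 := ⟨n - 1, by simp at hn; omega⟩
    rw [Fin.prod_univ_succ, List.prod_cons]
    simp only [Fin.val_zero, Fin.val_succ, List.getElem?_cons_zero, Option.getD_some, List.getElem?_cons_succ]
    rw [ih k (by simpa using hn)]

open Classical in
/-- the product of a list of cusps as a `uu` -/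
theorem list_uu {ι : Type} [Fintype ι] [DecidableEq ι] (c : ι → Cusp F) (hc : Function.Injective c) (l : List (Cusp F)) (n : ℕ) (hl : l.length ≤ n)
    (hm : ∀ x ∈ l, ∃ i, c i = x) :
    uu (fun p : Fin n × ι => c p.2) (fun p => if l[(p.1 : ℕ)]? = some (c p.2) then 1 else 0) = (l.map (fun x => x.ρ)).prod := by
  rw [uu, Fintype.prod_prod_type, ← list_fin_prod (l.map (fun x => x.ρ)) n (by simpa using hl)]
  refine Finset.prod_congr rfl (fun j _ => ?_)
  dsimp only
  obtain ⟨o, h⟩ : ∃ o, l[(j : ℕ)]? = o := ⟨_, rfl⟩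
  rcases o with _ | x
  · simp [h, Cusp.yk_zero]
  · obtain ⟨i, rfl⟩ := hm x (List.mem_of_getElem? h)
    rw [Finset.prod_eq_single i]
    · simp [h, Cusp.yk_one]
    · intro k _ hk
      rw [if_neg, Cusp.yk_zero]
      intro he
      exact hk (hc (Option.some.inj (h.symm.trans he))).symm
    · intro h; exact absurd (Finset.mem_univ _) h

end f3
end HallGL

namespace HallGL

section alt
variable {ι : Type} [Fintype ι] [DecidableEq ι] {m : ℕ}

/-- block-preserving permutations -/
def BP (σ : Equiv.Perm (Fin m × ι)) : Prop := ∀ p, (σ p).2 = p.2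

/-- alternants -/
def aa (α : Fin m × ι → ℕ) : MvPolynomial (Fin m × ι) ℂ :=
  (Matrix.blockDiagonal (fun i => Matrix.of fun (j l : Fin m) => (MvPolynomial.X (l, i) : MvPolynomial (Fin m × ι) ℂ) ^ α (j, i))).det

open Classical in
theorem det_block {R : Type} [CommRing R] (M : ι → Matrix (Fin m) (Fin m) R) :
    (Matrix.blockDiagonal M).det = ∑ σ : Equiv.Perm (Fin m × ι), if BP σ then ((Equiv.Perm.sign σ : ℤ) : R) * ∏ p, M p.2 (σ p).1 p.1 else 0 := by
  rw [Matrix.det_apply']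
  refine Finset.sum_congr rfl (fun σ _ => ?_)
  split_ifs with h
  · congr 1
    refine Finset.prod_congr rfl (fun p _ => ?_)
    rw [Matrix.blockDiagonal_apply, if_pos (h p), h p]
  · unfold BP at h
    push Not at h
    obtain ⟨p, hp⟩ := h
    rw [Finset.prod_eq_zero (Finset.mem_univ p), mul_zero]
    rw [Matrix.blockDiagonal_apply, if_neg hp]

open Classical in
theorem aa_eq (α : Fin m × ι → ℕ) : aa α = ∑ σ : Equiv.Perm (Fin m × ι), if BP σ then
    MvPolynomial.monomial (Finsupp.equivFunOnFinite.symm (fun p => α (σ p))) ((Equiv.Perm.sign σ : ℤ) : ℂ) else 0 := by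
  rw [aa, det_block]
  refine Finset.sum_congr rfl (fun σ _ => ?_)
  split_ifs with h
  · have : ∀ p : Fin m × ι, (Matrix.of fun (j l : Fin m) => (MvPolynomial.X (l, p.2) : MvPolynomial (Fin m × ι) ℂ) ^ α (j, p.2)) (σ p).1 p.1 = MvPolynomial.X p ^ α (σ p) := by
      intro p
      rw [Matrix.of_apply]
      have h2 : ((σ p).1, p.2) = σ p := Prod.ext rfl (h p).symm
      rw [h2]
    rw [Finset.prod_congr rfl (fun p _ => this p), monomial_eq_prod]
    rw [← map_intCast (MvPolynomial.C : ℂ →+* MvPolynomial (Fin m × ι) ℂ), MvPolynomial.C_mul_monomial, mul_one]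
  · rfl

def SM (α : Fin m × ι → ℕ) : Prop := ∀ i, StrictMono (fun j => α (j, i))

theorem SM_uniq {α β : Fin m × ι → ℕ} (ha : SM α) (hb : SM β) {σ : Equiv.Perm (Fin m × ι)} (hσ : BP σ) (h : ∀ p, α (σ p) = β p) : σ = 1 := by
  have key : ∀ i j, (σ (j, i)).1 = j := by
    intro i
    have hm : StrictMono (fun j => (σ (j, i)).1) := by
      intro j k hjk
      have h1 := hb i hjk
      dsimp only at h1
      rw [← h, ← h] at h1
      have h2 : ∀ j, σ (j, i) = ((σ (j,i)).1, i) := fun j => Prod.ext rfl (hσ (j, i))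
      rw [h2 j, h2 k] at h1
      exact (ha i).lt_iff_lt.1 h1
    have h3 : (fun j => (σ (j, i)).1) = id := by
      refine (StrictMono.range_inj hm strictMono_id).1 ?_
      rw [Set.range_id, Set.range_eq_univ]
      exact Finite.injective_iff_surjective.1 hm.injective
    exact fun j => congrFun h3 j
  ext p : 1
  exact Prod.ext (key p.2 p.1) (hσ p)

open Classical in
theorem coeff_aa {α β : Fin m × ι → ℕ} (ha : SM α) (hb : SM β) :
    MvPolynomial.coeff (Finsupp.equivFunOnFinite.symm β) (aa α) = if α = β then 1 else 0 := by
  rw [aa_eq, MvPolynomial.coeff_sum, Finset.sum_eq_single 1]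
  · rw [if_pos (show BP (1 : Equiv.Perm (Fin m × ι)) from fun _ => rfl), MvPolynomial.coeff_monomial]
    simp
  · intro σ _ hσ
    split_ifs with h1
    · rw [MvPolynomial.coeff_monomial, if_neg]
      intro h2
      apply hσ
      refine SM_uniq ha hb h1 (fun p => ?_)
      have := DFunLike.congr_fun h2 p
      simpa using this
    · simp
  · intro h; exact absurd (Finset.mem_univ _) h

end alt

section schur
variable {F : Type} [Field F] [Fintype F]
variable {ι : Type} [Fintype ι] [DecidableEq ι] {m : ℕ} (c : ι → Cusp F)

/-- the family indexed by pairs -/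
def c2 (m : ℕ) : Fin m × ι → Cusp F := fun p => c p.2

/-- Schur-type elements -/
def SS (α : Fin m × ι → ℕ) : Hall F ℂ := (Matrix.blockDiagonal (fun i => jm (c i).yk (fun j => α (j, i)))).det

open Classical in
theorem SS_eq (α : Fin m × ι → ℕ) : SS c α = ∑ σ : Equiv.Perm (Fin m × ι), if BP σ ∧ (∀ p, ((σ p).1 : ℕ) ≤ α p) then
    ((Equiv.Perm.sign σ : ℤ) : ℂ) • uu (c2 c m) (fun p => α p - (σ p).1) else 0 := by
  rw [SS, ← Matrix.det_transpose, Matrix.blockDiagonal_transpose, det_block]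
  refine Finset.sum_congr rfl (fun σ _ => ?_)
  by_cases h : BP σ
  · rw [if_pos h]
    split_ifs with h2
    · rw [uu, Int.cast_smul_eq_zsmul, zsmul_eq_mul]
      congr 1
      refine Finset.prod_congr rfl (fun p _ => ?_)
      rw [Matrix.transpose_apply, jm, Matrix.of_apply, if_pos (h2.2 p)]; rfl
    · have : ¬ (∀ p, ((σ p).1 : ℕ) ≤ α p) := fun h3 => h2 ⟨h, h3⟩
      push Not at this
      obtain ⟨p, hp⟩ := this
      rw [Finset.prod_eq_zero (Finset.mem_univ p), mul_zero]
      rw [Matrix.transpose_apply, jm, Matrix.of_apply, if_neg (by simpa using hp)]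
  · rw [if_neg h, if_neg (fun h2 => h h2.1)]

/-- the delta vector -/
def dv (m : ℕ) (ι : Type) : Fin m × ι → ℕ := fun p => p.1

theorem ip_sum_left {A : Type} (s : Finset A) (n : ℕ) (f : A → Hall F ℂ) (h : Hall F ℂ) : ip n (∑ a ∈ s, f a) h = ∑ a ∈ s, ip n (f a) h := by
  simp only [ip_eq, map_sum]

theorem ip_SS (α : Fin m × ι → ℕ) (n : ℕ) (h : Hall F ℂ) :
    ip n (SS c α) h = MvPolynomial.coeff (Finsupp.equivFunOnFinite.symm α) (aa (dv m ι) * FG (c2 c m) n h) := by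
  classical
  rw [SS_eq, ip_sum_left, aa_eq, Finset.sum_mul, MvPolynomial.coeff_sum]
  refine Finset.sum_congr rfl (fun σ _ => ?_)
  by_cases h1 : BP σ
  · rw [if_pos h1, MvPolynomial.coeff_monomial_mul']
    by_cases h2 : ∀ p, ((σ p).1 : ℕ) ≤ α p
    · rw [if_pos ⟨h1, h2⟩, if_pos, coeff_FG, ip_eq, map_smul, smul_eq_mul, ip_eq]
      · rfl
      · intro p; exact h2 p
    · rw [if_neg (fun h => h2 h.2), if_neg, ip_eq, map_zero]
      intro h3; exact h2 (fun p => h3 p)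
  · rw [if_neg h1, if_neg (fun h2 => h1 h2.1), zero_mul, MvPolynomial.coeff_zero, ip_eq, map_zero]

theorem EE_SS (hc : Function.Injective c) (α : Fin m × ι → ℕ) (n : ℕ) (hn : n + ∑ p : Fin m × ι, (c p.2).d * p.1 = ∑ p : Fin m × ι, (c p.2).d * α p) :
    EE (c2 c m) (SS c α) = PowerSeries.X ^ n * PowerSeries.C (∏ i, (jm (fun k => PowerSeries.coeff k (∏ j : Fin m, PowerSeries.mk (fun k => (MvPolynomial.X (j, i) : MvPolynomial (Fin m × ι) ℂ) ^ k))) (fun j => α (j, i))).det) := by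
  classical
  have h1 : ∀ i k, EE (c2 c m) ((c i).yk k) = (PowerSeries.X ^ (c i).d) ^ k * PowerSeries.C (PowerSeries.coeff k (∏ j : Fin m, PowerSeries.mk (fun k => (MvPolynomial.X (j, i) : MvPolynomial (Fin m × ι) ℂ) ^ k))) := by
    intro i k
    rw [EE_yk, ← pow_mul, mul_comm (PowerSeries.X ^ _), ← PowerSeries.monomial_eq_C_mul_X_pow]
    congr 2
    have h2 : Finset.univ.filter (fun p : Fin m × ι => c2 c m p = c i) = Finset.univ.map ⟨fun j : Fin m => (j, i), fun a b h => (Prod.ext_iff.1 h).1⟩ := by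
      ext ⟨j, i'⟩
      rw [Finset.mem_filter, Finset.mem_map]
      constructor
      · rintro ⟨_, h⟩
        have h' : i' = i := hc h
        subst h'
        exact ⟨j, Finset.mem_univ _, rfl⟩
      · rintro ⟨k, _, h⟩
        have h' : i = i' := (Prod.ext_iff.1 h).2
        subst h'
        exact ⟨Finset.mem_univ _, rfl⟩
    rw [h2, Finset.prod_map]
    rfl
  rw [SS, Matrix.det_blockDiagonal, map_prod]
  have h3 : ∀ i, EE (c2 c m) (jm (c i).yk (fun j => α (j, i))).det * PowerSeries.X ^ (∑ j : Fin m, (c i).d * (j : ℕ)) =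
      PowerSeries.X ^ (∑ j : Fin m, (c i).d * α (j, i)) * PowerSeries.C (jm (fun k => PowerSeries.coeff k (∏ j : Fin m, PowerSeries.mk (fun k => (MvPolynomial.X (j, i) : MvPolynomial (Fin m × ι) ℂ) ^ k))) (fun j => α (j, i))).det := by
    intro i
    rw [jm_map, jm_map, ← Finset.mul_sum, ← Finset.mul_sum, pow_mul, pow_mul, ← jm_scale]
    simp only [h1]
  have h4 := Finset.prod_congr (rfl : (Finset.univ : Finset ι) = _) (fun i _ => h3 i)
  rw [Finset.prod_mul_distrib, Finset.prod_mul_distrib, Finset.prod_pow_eq_pow_sum, Finset.prod_pow_eq_pow_sum, ← map_prod PowerSeries.C] at h4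
  rw [Fintype.sum_prod_type_right, Fintype.sum_prod_type_right] at hn
  rw [← hn, pow_add] at h4
  have hX : (PowerSeries.X : PowerSeries (MvPolynomial (Fin m × ι) ℂ)) ^ (∑ i, ∑ j : Fin m, (c i).d * (j : ℕ)) ≠ 0 := pow_ne_zero _ PowerSeries.X_ne_zero
  refine mul_right_cancel₀ hX (h4.trans ?_)
  ring

theorem FG_SS (hc : Function.Injective c) (α : Fin m × ι → ℕ) (n : ℕ) (hn : n + ∑ p : Fin m × ι, (c p.2).d * p.1 = ∑ p : Fin m × ι, (c p.2).d * α p) :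
    aa (dv m ι) * FG (c2 c m) n (SS c α) = aa α := by
  rw [FG, EE_SS c hc α n hn, PowerSeries.coeff_X_pow_mul', if_pos le_rfl, Nat.sub_self, PowerSeries.coeff_zero_C, aa, aa, Matrix.det_blockDiagonal, Matrix.det_blockDiagonal, ← Finset.prod_mul_distrib]
  refine Finset.prod_congr rfl (fun i _ => ?_)
  rw [mul_comm]
  refine jt (fun j => (MvPolynomial.X (j, i) : MvPolynomial (Fin m × ι) ℂ)) _ ?_ (fun j => α (j, i))
  rw [← Finset.prod_mul_distrib]
  exact Finset.prod_eq_one (fun j _ => geom_inv _)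

open Classical in
theorem ip_SS_SS (hc : Function.Injective c) {α β : Fin m × ι → ℕ} (ha : SM α) (hb : SM β) (n : ℕ) (hn : n + ∑ p : Fin m × ι, (c p.2).d * p.1 = ∑ p : Fin m × ι, (c p.2).d * α p) :
    ip n (SS c β) (SS c α) = if α = β then 1 else 0 := by
  rw [ip_SS, FG_SS c hc α n hn, coeff_aa ha hb]

theorem uu_supp (a : Fin m × ι → ℕ) : Supp (∑ p : Fin m × ι, (c p.2).d * a p) (uu (c2 c m) a) := (uu_pos (c2 c m) a).s

theorem SS_term {α : Fin m × ι → ℕ} {n : ℕ} (hn : n + ∑ p : Fin m × ι, (c p.2).d * p.1 = ∑ p : Fin m × ι, (c p.2).d * α p)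
    {σ : Equiv.Perm (Fin m × ι)} (h : BP σ ∧ (∀ p, ((σ p).1 : ℕ) ≤ α p)) : ∑ p, (c2 c m p).d * (α p - (σ p).1) = n := by
  have h1 : ∑ p, (c2 c m p).d * (α p - (σ p).1) + ∑ p : Fin m × ι, (c (σ p).2).d * (σ p).1 = ∑ p : Fin m × ι, (c p.2).d * α p := by
    rw [← Finset.sum_add_distrib]
    refine Finset.sum_congr rfl (fun p _ => ?_)
    rw [h.1 p, c2, ← mul_add, Nat.sub_add_cancel (h.2 p)]
  rw [Equiv.sum_comp σ (fun p => (c p.2).d * (p.1 : ℕ))] at h1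
  omega

theorem SS_supp {α : Fin m × ι → ℕ} {n : ℕ} (hn : n + ∑ p : Fin m × ι, (c p.2).d * p.1 = ∑ p : Fin m × ι, (c p.2).d * α p) : Supp n (SS c α) := by
  classical
  intro x hx
  rw [SS_eq, sum_apply'] at hx
  obtain ⟨σ, _, hσ⟩ := Finset.exists_ne_zero_of_sum_ne_zero hx
  split_ifs at hσ with h
  · rw [smul_apply, smul_eq_mul] at hσ
    have := (uu_pos (c2 c m) (fun p => α p - (σ p).1)).s
    rw [SS_term c hn h] at this
    exact this x (right_ne_zero_of_mul hσ)
  · exact absurd rfl hσ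

theorem SS_int {α : Fin m × ι → ℕ} {n : ℕ} (hn : n + ∑ p : Fin m × ι, (c p.2).d * p.1 = ∑ p : Fin m × ι, (c p.2).d * α p)
    {χ : Hall F ℂ} (hχ : χ ∈ Irr F n) : ∃ k : ℤ, ip n (SS c α) χ = k := by
  classical
  rw [SS_eq, ip_sum_left]
  have : ∀ σ : Equiv.Perm (Fin m × ι), ∃ k : ℤ, ip n (if BP σ ∧ (∀ p, ((σ p).1 : ℕ) ≤ α p) then
    ((Equiv.Perm.sign σ : ℤ) : ℂ) • uu (c2 c m) (fun p => α p - (σ p).1) else 0) χ = k := by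
    intro σ
    split_ifs with h
    · have h1 := (uu_pos (c2 c m) (fun p => α p - (σ p).1)).n
      rw [SS_term c hn h] at h1
      obtain ⟨k, hk⟩ := h1 ⟨χ, hχ⟩
      refine ⟨(Equiv.Perm.sign σ : ℤ) * k, ?_⟩
      rw [ip_eq, map_smul, ← ip_eq]
      rw [hk]; push_cast; rfl
    · exact ⟨0, by rw [ip_eq, map_zero]; simp⟩
  choose k hk using this
  exact ⟨∑ σ, k σ, by push_cast; exact Finset.sum_congr rfl (fun σ _ => hk σ)⟩

end schur
end HallGL

namespace HallGL

section schur2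
variable {F : Type} [Field F] [Fintype F]
variable {ι : Type} [Fintype ι] [DecidableEq ι] {m : ℕ} (c : ι → Cusp F)

theorem int_sq_one {A : Type} [Fintype A] (k : A → ℤ) (h : ∑ a, k a ^ 2 = 1) : ∃ a, (k a = 1 ∨ k a = -1) ∧ ∀ b, b ≠ a → k b = 0 := by
  classical
  obtain ⟨a, ha⟩ : ∃ a, k a ≠ 0 := by
    by_contra hc
    push Not at hc
    simp [hc] at h
  have h1 : 1 ≤ k a ^ 2 := by
    have : 0 < k a ^ 2 := by positivity
    omega
  rw [← Finset.add_sum_erase _ _ (Finset.mem_univ a)] at h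
  have h2 : ∀ b ∈ Finset.univ.erase a, 0 ≤ k b ^ 2 := fun b _ => sq_nonneg _
  have h3 := Finset.sum_nonneg h2
  have h4 : ∑ b ∈ Finset.univ.erase a, k b ^ 2 = 0 := by omega
  refine ⟨a, ?_, ?_⟩
  · have h5 : k a ^ 2 = 1 := by omega
    exact (sq_eq_one_iff.1 h5)
  · intro b hb
    have := (Finset.sum_eq_zero_iff_of_nonneg h2).1 h4 b (Finset.mem_erase.2 ⟨hb, Finset.mem_univ _⟩)
    exact pow_eq_zero_iff (two_ne_zero) |>.1 this

theorem norm_one {n : ℕ} {f : Hall F ℂ} (hf : Supp n f) (hi : ∀ χ ∈ Irr F n, ∃ k : ℤ, ip n f χ = k) (h1 : ip n f f = 1) :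
    ∃ χ ∈ Irr F n, (f = χ ∨ f = -χ) := by
  have h2 : ∀ χ : Irr F n, ∃ k : ℤ, ip n f χ.1 = k := fun χ => hi χ.1 χ.2
  choose k hk using h2
  have h3 : f = ∑ χ : Irr F n, (k χ : ℂ) • χ.1 := by
    conv_lhs => rw [decompL hf]
    exact Finset.sum_congr rfl (fun χ _ => by rw [hk])
  have h4 : ip n f f = ((∑ χ : Irr F n, k χ ^ 2 : ℤ) : ℂ) := by
    rw [parseval hf]
    push_cast
    refine Finset.sum_congr rfl (fun χ _ => ?_)
    rw [← ip_conj n f χ.1, hk]; simp [sq]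
  rw [h1] at h4
  obtain ⟨χ, h5, h6⟩ := int_sq_one k (by exact_mod_cast h4.symm)
  refine ⟨χ.1, χ.2, ?_⟩
  rw [Finset.sum_eq_single χ] at h3
  · rcases h5 with h5 | h5
    · left; rw [h3, h5]; simp
    · right; rw [h3, h5]; simp
  · intro b _ hb; rw [h6 b hb]; simp
  · intro h; exact absurd (Finset.mem_univ _) h

theorem SS_irr (hc : Function.Injective c) {α : Fin m × ι → ℕ} (ha : SM α) {n : ℕ} (hn : n + ∑ p : Fin m × ι, (c p.2).d * p.1 = ∑ p : Fin m × ι, (c p.2).d * α p) :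
    ∃ χ ∈ Irr F n, (SS c α = χ ∨ SS c α = -χ) := by
  classical
  refine norm_one (SS_supp c hn) (fun χ hχ => SS_int c hn hχ) ?_
  rw [ip_SS_SS c hc ha ha n hn, if_pos rfl]

theorem SS_perm (b : Fin m × ι → ℕ) (τ : ι → Equiv.Perm (Fin m)) : SS c (fun p => b (τ p.2 p.1, p.2)) =
    (∏ i, (((Equiv.Perm.sign (τ i) : ℤ) : Hall F ℂ))) * SS c b := by
  rw [SS, SS, Matrix.det_blockDiagonal, Matrix.det_blockDiagonal, ← Finset.prod_mul_distrib]
  refine Finset.prod_congr rfl (fun i _ => ?_)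
  rw [← Matrix.det_permute]
  rfl

theorem SS_zero (b : Fin m × ι → ℕ) {i : ι} {j k : Fin m} (hjk : j ≠ k) (h : b (j, i) = b (k, i)) : SS c b = 0 := by
  rw [SS, Matrix.det_blockDiagonal]
  refine Finset.prod_eq_zero (Finset.mem_univ i) ?_
  refine Matrix.det_zero_of_row_eq hjk ?_
  funext l
  rw [jm, Matrix.of_apply, Matrix.of_apply, h]

theorem SM_dv : SM (dv m ι) := fun i j k h => h

theorem aa_dv_ne : aa (dv m ι) ≠ 0 := by
  classical
  intro h
  have := coeff_aa (SM_dv (m := m) (ι := ι)) SM_dv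
  rw [h, if_pos rfl] at this
  simp at this

theorem SS_deg {α : Fin m × ι → ℕ} {n : ℕ} {χ : Hall F ℂ} (hχ : χ ∈ Irr F n) (h : ip n (SS c α) χ ≠ 0) :
    n + ∑ p : Fin m × ι, (c p.2).d * p.1 = ∑ p : Fin m × ι, (c p.2).d * α p := by
  classical
  rw [SS_eq, ip_sum_left] at h
  obtain ⟨σ, _, hσ⟩ := Finset.exists_ne_zero_of_sum_ne_zero h
  split_ifs at hσ with h1
  · have h2 : ip n (uu (c2 c m) (fun p => α p - (σ p).1)) χ ≠ 0 := by
      intro h3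
      apply hσ
      rw [ip_eq, map_smul, ← ip_eq, h3, smul_zero]
    obtain ⟨h3, h3'⟩ := ip_deg (uu_pos (c2 c m) (fun p => α p - (σ p).1)).s hχ.1 h2
    have h1' : ∑ p, (c2 c m p).d * (α p - (σ p).1) + ∑ p : Fin m × ι, (c (σ p).2).d * (σ p).1 = ∑ p : Fin m × ι, (c p.2).d * α p := by
      rw [← Finset.sum_add_distrib]
      refine Finset.sum_congr rfl (fun p _ => ?_)
      rw [h1.1 p, c2, ← mul_add, Nat.sub_add_cancel (h1.2 p)]
    rw [Equiv.sum_comp σ (fun p => (c p.2).d * (p.1 : ℕ))] at h1'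
    omega
  · rw [ip_eq, map_zero] at hσ; exact absurd rfl hσ

theorem SS_complete {n : ℕ} {χ : Hall F ℂ} (hχ : χ ∈ Irr F n) {a : Fin m × ι → ℕ} (h : ip n (uu (c2 c m) a) χ ≠ 0) :
    ∃ α : Fin m × ι → ℕ, SM α ∧ ip n (SS c α) χ ≠ 0 := by
  have h1 : FG (c2 c m) n χ ≠ 0 := by
    intro h2
    have := coeff_FG (c2 c m) n χ (Finsupp.equivFunOnFinite.symm a)
    rw [h2] at this
    exact h this.symm
  obtain ⟨b, hb⟩ := MvPolynomial.ne_zero_iff.1 (mul_ne_zero aa_dv_ne h1)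
  obtain ⟨b, rfl⟩ := Finsupp.equivFunOnFinite.symm.surjective b
  rw [← ip_SS] at hb
  have h0 : SS c b ≠ 0 := by
    intro h2; rw [h2, ip_eq, map_zero] at hb; exact hb rfl
  refine ⟨fun p => b (Tuple.sort (fun j => b (j, p.2)) p.1, p.2), ?_, ?_⟩
  · intro i
    refine (Tuple.monotone_sort (fun j => b (j, i))).strictMono_of_injective ?_
    refine Function.Injective.comp ?_ (Equiv.injective _)
    intro j k hjk
    by_contra hne
    exact h0 (SS_zero c b hne hjk)
  · rw [SS_perm c b (fun i => Tuple.sort (fun j => b (j, i)))]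
    have : ∀ z : ℤ, ip n ((z : Hall F ℂ) * SS c b) χ = z * ip n (SS c b) χ := by
      intro z
      rw [← zsmul_eq_mul, ip_eq, map_zsmul, zsmul_eq_mul]; rfl
    rw [← Int.cast_prod, this]
    refine mul_ne_zero ?_ hb
    rw [Int.cast_ne_zero]
    exact Finset.prod_ne_zero_iff.2 (fun i _ => Units.ne_zero _)

/-- the index set -/
def DD (m n : ℕ) (d : ι → ℕ) : Set (Fin m × ι → ℕ) := {α | SM α ∧ n + ∑ p : Fin m × ι, d p.2 * p.1 = ∑ p : Fin m × ι, d p.2 * α p}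

theorem exists_DD (hc : Function.Injective c) {n : ℕ} (α : DD m n (fun i => (c i).d)) : ∃ χ ∈ Irr F n, (SS c α.1 = χ ∨ SS c α.1 = -χ) :=
  SS_irr c hc α.2.1 α.2.2

/-- the irreducible attached to an index -/
def ch (hc : Function.Injective c) {n : ℕ} (α : DD m n (fun i => (c i).d)) : Irr F n := ⟨_, (Classical.choose_spec (exists_DD c hc α)).1⟩

theorem ch_spec (hc : Function.Injective c) {n : ℕ} (α : DD m n (fun i => (c i).d)) : SS c α.1 = (ch c hc α).1 ∨ SS c α.1 = -(ch c hc α).1 :=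
  (Classical.choose_spec (exists_DD c hc α)).2

theorem ch_inj (hc : Function.Injective c) {n : ℕ} : Function.Injective (ch c hc (m := m) (n := n)) := by
  classical
  intro α β h
  by_contra hne
  have h1 := ip_SS_SS c hc α.2.1 β.2.1 n α.2.2
  rw [if_neg (fun h => hne (Subtype.ext h))] at h1
  have h2 := ip_SS_SS c hc α.2.1 α.2.1 n α.2.2
  rw [if_pos rfl] at h2
  have h3 : SS c β.1 = SS c α.1 ∨ SS c β.1 = - SS c α.1 := by
    have e1 := ch_spec c hc α
    have e2 := ch_spec c hc β
    rw [← h] at e2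
    rcases e1 with e1 | e1 <;> rcases e2 with e2 | e2 <;> rw [e1, e2] <;> simp
  rcases h3 with h3 | h3
  · rw [h3, h2] at h1; exact one_ne_zero h1
  · rw [h3, ip_eq, map_neg, ← ip_eq, h2] at h1; simp at h1

theorem ch_surj (hc : Function.Injective c) {n : ℕ} {χ : Hall F ℂ} (hχ : χ ∈ Irr F n) {a : Fin m × ι → ℕ} (h : ip n (uu (c2 c m) a) χ ≠ 0) :
    ∃ α : DD m n (fun i => (c i).d), (ch c hc α).1 = χ := by
  classical
  obtain ⟨α, ha, h1⟩ := SS_complete c hχ h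
  refine ⟨⟨α, ha, SS_deg c hχ h1⟩, ?_⟩
  by_contra hne
  have h2 := ip_irr (ch c hc ⟨α, ha, SS_deg c hχ h1⟩).2 hχ
  rw [if_neg hne] at h2
  rcases ch_spec c hc ⟨α, ha, SS_deg c hχ h1⟩ with e | e
  · exact h1 (e ▸ h2)
  · apply h1
    rw [show SS c α = _ from e, ip_eq, map_neg, ← ip_eq, h2, neg_zero]

theorem DD_finite (m n : ℕ) {d : ι → ℕ} (hd : ∀ i, 0 < d i) : (DD m n d).Finite := by
  refine Set.Finite.subset (Set.Finite.pi' (t := fun _ => Set.Iic (n + ∑ p : Fin m × ι, d p.2 * p.1)) (fun _ => Set.finite_Iic _)) ?_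
  rintro α ⟨_, h⟩ p
  rw [Set.mem_Iic, h]
  refine le_trans (Nat.le_mul_of_pos_left _ (hd p.2)) ?_
  exact Finset.single_le_sum (f := fun p : Fin m × ι => d p.2 * α p) (fun _ _ => Nat.zero_le _) (Finset.mem_univ p)

end schur2
end HallGL

namespace HallGL

section hook
variable {m : ℕ}

def aQ (Q : ℂ) (k : ℕ) : ℂ := Q ^ (k.choose 2) / phi Q k

theorem choose_succ_two (b : ℕ) : (b+1).choose 2 = b.choose 2 + b := by rw [choose_add_two]; simp

theorem phi_ne' {Q : ℂ} (h1 : ∀ k, Q ^ (k+1) - 1 ≠ 0) (n : ℕ) : phi Q n ≠ 0 := Finset.prod_ne_zero_iff.2 (fun i _ => h1 i)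

theorem aQ_entry {Q : ℂ} (h0 : Q ≠ 0) (h1 : ∀ k, Q ^ (k+1) - 1 ≠ 0) (b k : ℕ) :
    (if k ≤ b then aQ Q (b - k) else 0) = aQ Q b * ((∏ i ∈ Finset.range k, (-Q ^ (i+1))) * ∏ i ∈ Finset.range k, ((Q ^ b)⁻¹ - (Q ^ i)⁻¹)) := by
  induction k with
  | zero => simp
  | succ k ih =>
    rw [Finset.prod_range_succ, Finset.prod_range_succ]
    have e : aQ Q b * ((∏ i ∈ Finset.range k, (-Q ^ (i+1))) * (-Q ^ (k+1)) * ((∏ i ∈ Finset.range k, ((Q ^ b)⁻¹ - (Q ^ i)⁻¹)) * ((Q ^ b)⁻¹ - (Q ^ k)⁻¹)))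
      = (if k ≤ b then aQ Q (b - k) else 0) * (-Q ^ (k+1) * ((Q ^ b)⁻¹ - (Q ^ k)⁻¹)) := by rw [ih]; ring
    rw [e]
    by_cases h : k + 1 ≤ b
    · obtain ⟨a, rfl⟩ := Nat.exists_eq_add_of_le h
      rw [if_pos h, if_pos (by omega), show k + 1 + a - (k+1) = a by omega, show k + 1 + a - k = a + 1 by omega, aQ, aQ, phi_succ, choose_succ_two]
      have := phi_ne' h1 a
      have := h1 a
      field_simp
      ring
    · rw [if_neg h]
      by_cases h2 : k ≤ b
      · have : k = b := by omega
        subst this; simp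
      · rw [if_neg h2, zero_mul]

theorem prod_range_fin {A : Type} [CommMonoid A] (f : ℕ → A) (j : Fin m) : ∏ i ∈ Finset.range (j : ℕ), f i = ∏ i ∈ Finset.Iio j, f (i : ℕ) := by
  symm
  refine Finset.prod_bij (fun i _ => (i : ℕ)) ?_ ?_ ?_ ?_
  · intro i hi; exact Finset.mem_range.2 (Fin.lt_def.1 (Finset.mem_Iio.1 hi))
  · intro a _ b _ h; exact Fin.ext h
  · intro b hb
    have hb' := Finset.mem_range.1 hb
    exact ⟨⟨b, hb'.trans j.2⟩, Finset.mem_Iio.2 hb', rfl⟩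
  · intros; rfl

theorem det_aQ {Q : ℂ} (h0 : Q ≠ 0) (h1 : ∀ k, Q ^ (k+1) - 1 ≠ 0) (β : Fin m → ℕ) :
    (jm (aQ Q) β).det = ∏ j, (aQ Q (β j) * ∏ i ∈ Finset.Iio j, (-Q ^ ((i : ℕ)+1) * ((Q ^ β j)⁻¹ - (Q ^ β i)⁻¹))) := by
  let p : Fin m → Polynomial ℂ := fun k => ∏ i ∈ Finset.range (k : ℕ), (Polynomial.X - Polynomial.C ((Q ^ i)⁻¹))
  have hv := Matrix.det_eval_matrixOfPolynomials_eq_det_vandermonde (fun j => (Q ^ β j)⁻¹) p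
    (fun k => by
      have := Polynomial.natDegree_prod_of_monic (Finset.range (k : ℕ)) (fun i => Polynomial.X - Polynomial.C ((Q ^ i)⁻¹)) (fun i _ => Polynomial.monic_X_sub_C _)
      rw [this]; simp)
    (fun k => Polynomial.monic_prod_of_monic _ _ (fun i _ => Polynomial.monic_X_sub_C _))
  have h2 : jm (aQ Q) β = Matrix.of (fun j k => aQ Q (β j) * (Matrix.of (fun (j k : Fin m) => (∏ i ∈ Finset.range (k : ℕ), (-Q ^ (i+1))) * (Matrix.of (fun (i j : Fin m) => (p j).eval ((Q ^ β i)⁻¹))) j k)) j k) := by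
    ext j k
    rw [jm, Matrix.of_apply, aQ_entry h0 h1, Matrix.of_apply, Matrix.of_apply, Matrix.of_apply]
    simp only [p, Polynomial.eval_prod, Polynomial.eval_sub, Polynomial.eval_X, Polynomial.eval_C]
  rw [h2, Matrix.det_mul_column, Matrix.det_mul_row, ← hv, Matrix.det_vandermonde]
  have h3 : ∏ i : Fin m, ∏ j ∈ Finset.Ioi i, ((Q ^ β j)⁻¹ - (Q ^ β i)⁻¹) = ∏ j : Fin m, ∏ i ∈ Finset.Iio j, ((Q ^ β j)⁻¹ - (Q ^ β i)⁻¹) := by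
    refine Finset.prod_comm' ?_
    intro i j
    simp
  rw [h3, ← Finset.prod_mul_distrib, ← Finset.prod_mul_distrib]
  refine Finset.prod_congr rfl (fun j _ => ?_)
  rw [prod_range_fin (fun i => -Q ^ (i+1)), ← Finset.prod_mul_distrib]

theorem sm_le {β : Fin m → ℕ} (hβ : StrictMono β) : ∀ j : Fin m, (j : ℕ) ≤ β j := by
  have : ∀ k (hk : k < m), k ≤ β ⟨k, hk⟩ := by
    intro k
    induction k with
    | zero => intro _; exact Nat.zero_le _
    | succ k ih =>
      intro hk
      have h1 := ih (by omega)
      have h2 : β ⟨k, by omega⟩ < β ⟨k+1, hk⟩ := hβ (by simp [Fin.lt_def])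
      omega
  exact fun j => this j j.2

/-- hook polynomial -/
def HH (β : Fin m → ℕ) : Polynomial ℤ := ∏ j, ∏ k ∈ Finset.Icc 1 (β j) \ (Finset.Iio j).image (fun i => β j - β i), (Polynomial.X ^ k - 1)

theorem pow_tele {Q : ℂ} (h0 : Q ≠ 0) (b j : ℕ) (hj : j ≤ b) : Q ^ (b.choose 2) * ∏ i ∈ Finset.range j, (Q ^ (i+1) * (Q ^ b)⁻¹) = Q ^ ((b - j).choose 2) := by
  induction j with
  | zero => simp
  | succ j ih =>
    rw [Finset.prod_range_succ, ← mul_assoc, ih (by omega)]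
    obtain ⟨a, rfl⟩ := Nat.exists_eq_add_of_le hj
    rw [show j + 1 + a - j = a + 1 by omega, show j + 1 + a - (j+1) = a by omega, choose_succ_two]
    field_simp
    ring

theorem hook {Q : ℂ} (h0 : Q ≠ 0) (h1 : ∀ k, Q ^ (k+1) - 1 ≠ 0) {β : Fin m → ℕ} (hβ : StrictMono β) :
    (jm (aQ Q) β).det * Polynomial.aeval Q (HH β) = Q ^ (∑ j : Fin m, (β j - j).choose 2) := by
  rw [det_aQ h0 h1, HH, map_prod, ← Finset.prod_mul_distrib, ← Finset.prod_pow_eq_pow_sum]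
  refine Finset.prod_congr rfl (fun j _ => ?_)
  rw [map_prod]
  have h2 : (∏ k ∈ Finset.Icc 1 (β j) \ (Finset.Iio j).image (fun i => β j - β i), (Polynomial.aeval Q) (Polynomial.X ^ k - 1 : Polynomial ℤ)) * ∏ i ∈ Finset.Iio j, (Q ^ (β j - β i) - 1) = phi Q (β j) := by
    have h3 : (Finset.Iio j).image (fun i => β j - β i) ⊆ Finset.Icc 1 (β j) := by
      intro k hk
      obtain ⟨i, hi, rfl⟩ := Finset.mem_image.1 hk
      have := hβ (Finset.mem_Iio.1 hi)
      rw [Finset.mem_Icc]; omega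
    have h4 : ∏ i ∈ Finset.Iio j, (Q ^ (β j - β i) - 1) = ∏ k ∈ (Finset.Iio j).image (fun i => β j - β i), (Q ^ k - 1) := by
      rw [Finset.prod_image]
      intro a ha b hb hab
      have e1 := hβ (Finset.mem_Iio.1 ha)
      have e2 := hβ (Finset.mem_Iio.1 hb)
      dsimp only at hab
      exact hβ.injective (by omega)
    rw [h4]
    simp only [map_sub, map_pow, Polynomial.aeval_X, map_one]
    rw [Finset.prod_sdiff h3, phi, Finset.range_eq_Ico, Finset.prod_Ico_add' (fun k => Q ^ k - 1) 0 (β j) 1]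
    rfl
  have h5 : ∏ i ∈ Finset.Iio j, (-Q ^ ((i : ℕ)+1) * ((Q ^ β j)⁻¹ - (Q ^ β i)⁻¹)) = (∏ i ∈ Finset.Iio j, (Q ^ ((i : ℕ)+1) * (Q ^ β j)⁻¹)) * ∏ i ∈ Finset.Iio j, (Q ^ (β j - β i) - 1) := by
    rw [← Finset.prod_mul_distrib]
    refine Finset.prod_congr rfl (fun i hi => ?_)
    obtain ⟨a, ha⟩ := Nat.exists_eq_add_of_le (hβ (Finset.mem_Iio.1 hi)).le
    rw [ha, Nat.add_sub_cancel_left]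
    field_simp
    ring
  rw [h5, ← pow_tele h0 (β j) j (sm_le hβ j), prod_range_fin (fun i => Q ^ (i+1) * (Q ^ β j)⁻¹), aQ]
  have h6 := phi_ne' h1 (β j)
  field_simp
  rw [← h2]
  ring

end hook

section dltSS
variable {F : Type} [Field F] [Fintype F]
variable {ι : Type} [Fintype ι] [DecidableEq ι] {m : ℕ} (c : ι → Cusp F)

def RR : Hall F ℂ →+* PowerSeries ℂ where
  toFun h := pair (regc 1) h
  map_one' := (Gl_regc 1).pair_one
  map_mul' a b := by rw [(Gl_regc 1).pair_mul]
  map_zero' := by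
    ext n : 1
    rw [coeff_pair, map_zero]
    refine (INT_congr (g := fun _ => 0) (fun x _ => ?_)).trans (INT_zero (F := F) n)
    exact mul_zero _
  map_add' a b := by
    ext n : 1
    rw [coeff_pair, map_add, coeff_pair, coeff_pair, ← INT_add]
    congr 1; funext x; exact mul_add _ _ _

theorem RR_supp {n : ℕ} {f : Hall F ℂ} (hf : Supp n f) : RR f = PowerSeries.monomial n (dlt n f) := by
  have : RR f = pair (regc 1) f := rfl
  rw [this, pair_comm, pair_regc_supp hf, one_pow, one_mul]

theorem dlt_SS {α : Fin m × ι → ℕ} {n : ℕ} (hn : n + ∑ p : Fin m × ι, (c p.2).d * p.1 = ∑ p : Fin m × ι, (c p.2).d * α p) :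
    dlt n (SS c α) = ∏ i, (jm (aQ (qq F ^ (c i).d)) (fun j => α (j, i))).det := by
  have h1 : ∀ i k, RR ((c i).yk k) = (PowerSeries.X ^ (c i).d) ^ k * PowerSeries.C (aQ (qq F ^ (c i).d) k) := by
    intro i k
    rw [RR_supp ((c i).yk_irr k).1, (c i).dlt_yk, ← pow_mul PowerSeries.X, mul_comm (PowerSeries.X ^ _), ← PowerSeries.monomial_eq_C_mul_X_pow]
    rfl
  have h0 : RR (SS c α) = PowerSeries.X ^ n * PowerSeries.C (∏ i, (jm (aQ (qq F ^ (c i).d)) (fun j => α (j, i))).det) := by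
    rw [SS, Matrix.det_blockDiagonal, map_prod]
    have h3 : ∀ i, RR (jm (c i).yk (fun j => α (j, i))).det * PowerSeries.X ^ (∑ j : Fin m, (c i).d * (j : ℕ)) =
        PowerSeries.X ^ (∑ j : Fin m, (c i).d * α (j, i)) * PowerSeries.C (jm (aQ (qq F ^ (c i).d)) (fun j => α (j, i))).det := by
      intro i
      rw [jm_map, jm_map, ← Finset.mul_sum, ← Finset.mul_sum, pow_mul, pow_mul, ← jm_scale]
      simp only [h1]
    have h4 := Finset.prod_congr (rfl : (Finset.univ : Finset ι) = _) (fun i _ => h3 i)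
    rw [Finset.prod_mul_distrib, Finset.prod_mul_distrib, Finset.prod_pow_eq_pow_sum, Finset.prod_pow_eq_pow_sum, ← map_prod PowerSeries.C] at h4
    have hn' := hn
    rw [Fintype.sum_prod_type_right, Fintype.sum_prod_type_right] at hn'
    rw [← hn', pow_add] at h4
    have hX : (PowerSeries.X : PowerSeries ℂ) ^ (∑ i, ∑ j : Fin m, (c i).d * (j : ℕ)) ≠ 0 := pow_ne_zero _ PowerSeries.X_ne_zero
    refine mul_right_cancel₀ hX (h4.trans ?_)
    ring
  rw [RR_supp (SS_supp c hn), mul_comm, ← PowerSeries.monomial_eq_C_mul_X_pow] at h0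
  have := congrArg (PowerSeries.coeff n) h0
  rwa [PowerSeries.coeff_monomial_same, PowerSeries.coeff_monomial_same] at this

theorem dlt_hook {α : Fin m × ι → ℕ} (ha : SM α) {n : ℕ} (hn : n + ∑ p : Fin m × ι, (c p.2).d * p.1 = ∑ p : Fin m × ι, (c p.2).d * α p) :
    dlt n (SS c α) * ∏ i, Polynomial.aeval (qq F ^ (c i).d) (HH (fun j => α (j, i))) = ∏ i, (qq F ^ (c i).d) ^ (∑ j : Fin m, (α (j, i) - j).choose 2) := by
  rw [dlt_SS c hn, ← Finset.prod_mul_distrib]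
  refine Finset.prod_congr rfl (fun i _ => hook (pow_ne_zero _ qq_ne) (fun k => ?_) (ha i))
  rw [← pow_mul]; exact qq_pow_ne _ (Nat.mul_ne_zero (c i).prim.pos.ne' (by omega))

end dltSS
end HallGL

namespace HallGL

section H1
variable {F : Type} [Field F] [Fintype F]

theorem INT_real (n : ℕ) (r : X F → ℝ) : INT n (fun x => ((r x : ℝ) : ℂ)) =
    (((Fintype.card ((Fin n → F) ≃ₗ[F] (Fin n → F)) : ℝ)⁻¹ * ∑ φ : Module.End F (Fin n → F), r (cls φ) : ℝ) : ℂ) := by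
  rw [INT, INTV, cG, smul_eq_mul]; push_cast; rfl

/-- Whittaker multiplicity as a natural number -/
def wn {n : ℕ} (χ : Irr F n) : ℕ := Classical.choose (wh_nat χ.2)
theorem wn_spec {n : ℕ} (χ : Irr F n) : wh n χ.1 = wn χ := Classical.choose_spec (wh_nat χ.2)

theorem qq_card : qq F = (Fintype.card F : ℂ) := rfl

theorem wn_sum {n : ℕ} (hn : 0 < n) : ∑ χ : Irr F n, wn χ ^ 2 + Fintype.card F ^ (n-1) ≤ Fintype.card F ^ n := by
  classical
  let f : Hall F ℂ := fun x => if deg x = n ∧ Inv x then gg x else 0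
  have hf : Supp n f := by
    intro x hx
    by_contra h
    exact hx (if_neg h)
  have hre : ∀ x, (starRingEnd ℂ) ((gg : Hall F ℂ) x) = gg x := fun x => congrFun gg_real x
  have h1 : ∀ χ : Irr F n, ip n χ.1 f = wn χ := by
    intro χ
    rw [← wn_spec, wh, INTL_apply, ip]
    congr 1; funext x
    by_cases h : χ.1 x = 0
    · rw [h, zero_mul, zero_mul]
    · rw [cj]
      show _ * (starRingEnd ℂ) (if deg x = n ∧ Inv x then gg x else 0) = _
      rw [if_pos (χ.2.1 x h), hre]
  have h2 : ip n f f = ((∑ χ : Irr F n, wn χ ^ 2 : ℕ) : ℂ) := by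
    rw [parseval hf]
    push_cast
    refine Finset.sum_congr rfl (fun χ _ => ?_)
    rw [← ip_conj n χ.1 f, h1]; simp [sq]
  have h3 := pair_gg_gg (F := F) n
  rw [if_neg hn.ne', INTL_apply] at h3
  have h4 : ip n f f = INT n (fun x => ((Complex.normSq (f x) : ℝ) : ℂ)) := by
    rw [ip]; congr 1; funext x; rw [cj, Complex.mul_conj]
  have h5 : INT n (fun x => (gg : Hall F ℂ) x * gg x) = INT n (fun x => ((Complex.normSq ((gg : Hall F ℂ) x) : ℝ) : ℂ)) := by
    congr 1; funext x; rw [← Complex.mul_conj, hre]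
  rw [h2, INT_real] at h4
  rw [h5, INT_real] at h3
  have h6 : ((∑ χ : Irr F n, wn χ ^ 2 : ℕ) : ℝ) ≤ (Fintype.card F : ℝ) ^ n - (Fintype.card F : ℝ) ^ (n-1) := by
    have e1 : ((∑ χ : Irr F n, wn χ ^ 2 : ℕ) : ℝ) = (Fintype.card ((Fin n → F) ≃ₗ[F] (Fin n → F)) : ℝ)⁻¹ * ∑ φ : Module.End F (Fin n → F), Complex.normSq (f (cls φ)) := by
      exact_mod_cast h4
    have e2 : (Fintype.card F : ℝ) ^ n - (Fintype.card F : ℝ) ^ (n-1) = (Fintype.card ((Fin n → F) ≃ₗ[F] (Fin n → F)) : ℝ)⁻¹ * ∑ φ : Module.End F (Fin n → F), Complex.normSq ((gg : Hall F ℂ) (cls φ)) := by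
      rw [qq_card] at h3
      exact_mod_cast h3.symm
    rw [e1, e2]
    refine mul_le_mul_of_nonneg_left (Finset.sum_le_sum fun φ _ => ?_) (by positivity)
    show Complex.normSq (if deg (cls φ) = n ∧ Inv (cls φ) then gg (cls φ) else 0) ≤ _
    split_ifs
    · exact le_rfl
    · rw [map_zero]; exact Complex.normSq_nonneg _
  have h7 : ((∑ χ : Irr F n, wn χ ^ 2 + Fintype.card F ^ (n-1) : ℕ) : ℝ) ≤ ((Fintype.card F ^ n : ℕ) : ℝ) := by
    push_cast at h6 ⊢; linarith
  exact_mod_cast h7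

variable {ι : Type} [Fintype ι] [DecidableEq ι] (c : ι → Cusp F)

theorem EE_yk_inj (hc : Function.Injective c) (i : ι) (k : ℕ) : EE c ((c i).yk k) = PowerSeries.monomial ((c i).d * k) (MvPolynomial.X i ^ k) := by
  classical
  rw [EE_yk]
  congr 1
  have : Finset.univ.filter (fun p => c p = c i) = {i} := by
    ext p; simp [hc.eq_iff]
  rw [this, Finset.prod_singleton, PowerSeries.coeff_mk]

theorem prod_monomial {R : Type} [CommRing R] (s : Finset ι) (e : ι → ℕ) (f : ι → R) : ∏ i ∈ s, PowerSeries.monomial (e i) (f i) = PowerSeries.monomial (∑ i ∈ s, e i) (∏ i ∈ s, f i) := by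
  induction s using Finset.induction_on with
  | empty => simp
  | insert a s ha ih => rw [Finset.prod_insert ha, Finset.prod_insert ha, Finset.sum_insert ha, ih, PowerSeries.monomial_mul_monomial]

theorem ip_uu_uu (hc : Function.Injective c) {n : ℕ} (a b : ι → ℕ) (hb : ∑ i, (c i).d * b i = n) : ip n (uu c a) (uu c b) = if a = b then 1 else 0 := by
  have h := coeff_FG c n (uu c b) (Finsupp.equivFunOnFinite.symm a)
  have h2 : FG c n (uu c b) = MvPolynomial.monomial (Finsupp.equivFunOnFinite.symm b) 1 := by
    rw [FG, uu, map_prod, Finset.prod_congr rfl (fun i _ => EE_yk_inj c hc i (b i)), prod_monomial, hb, PowerSeries.coeff_monomial, if_pos rfl, monomial_eq_prod]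
  rw [h2, MvPolynomial.coeff_monomial] at h
  simp only [Finsupp.coe_equivFunOnFinite_symm, EmbeddingLike.apply_eq_iff_eq] at h
  rw [← h]
  simp only [eq_comm]

theorem uu_irr (hc : Function.Injective c) {n : ℕ} {b : ι → ℕ} (hb : ∑ i, (c i).d * b i = n) : uu c b ∈ Irr F n := by
  have hp := uu_pos c b
  have hw := wh_uu c b
  rw [hb] at hp hw
  obtain ⟨χ, hχ, h | h⟩ := norm_one hp.s (fun χ hχ => by obtain ⟨m, hm⟩ := hp.n ⟨χ, hχ⟩; exact ⟨m, by rw [hm]; simp⟩) (by rw [ip_uu_uu c hc b b hb, if_pos rfl])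
  · rw [h]; exact hχ
  · exfalso
    obtain ⟨m, hm⟩ := wh_nat hχ
    rw [h, map_neg, hm] at hw
    have : (m : ℂ) + 1 = 0 := by rw [← hw]; ring
    exact Nat.cast_add_one_ne_zero m this

theorem uu_inj (hc : Function.Injective c) {n : ℕ} {a b : ι → ℕ} (hb : ∑ i, (c i).d * b i = n) (h : uu c a = uu c b) : a = b := by
  by_contra hab
  have h1 := ip_uu_uu c hc a b hb
  have h2 := ip_uu_uu c hc b b hb
  rw [h, h2, if_pos rfl, if_neg hab] at h1
  exact one_ne_zero h1

/-- multiplicity vectors of total weight n -/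
def KK {ι : Type} [Fintype ι] (n : ℕ) (d : ι → ℕ) : Set (ι → ℕ) := {k | ∑ i, d i * k i = n}

theorem KK_finite (n : ℕ) {d : ι → ℕ} (hd : ∀ i, 0 < d i) : (KK n d).Finite := by
  refine Set.Finite.subset (Set.Finite.pi' (t := fun _ => Set.Iic n) (fun _ => Set.finite_Iic _)) ?_
  rintro α h p
  rw [Set.mem_Iic, ← h]
  refine le_trans (Nat.le_mul_of_pos_left _ (hd p)) ?_
  exact Finset.single_le_sum (f := fun p => d p * α p) (fun _ _ => Nat.zero_le _) (Finset.mem_univ p)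

theorem wh_sub_sum {n : ℕ} (hn : 0 < n) {A : Type} [Fintype A] (u : A → Irr F n) (hu : Function.Injective u) : ∑ a, wn (u a) ^ 2 + Fintype.card F ^ (n-1) ≤ Fintype.card F ^ n := by
  classical
  refine le_trans (Nat.add_le_add_right ?_ _) (wn_sum hn)
  rw [← Finset.sum_image (f := fun χ => wn χ ^ 2) (s := Finset.univ) (g := u) (fun a _ b _ h => hu h)]
  exact Finset.sum_le_sum_of_subset (Finset.subset_univ _)

theorem uu_not_prim (hc : Function.Injective c) {n : ℕ} (hn : ∀ i, (c i).d < n) {b : ι → ℕ} (hb : ∑ i, (c i).d * b i = n) : ¬ Prim n (uu c b) := by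
  classical
  intro hp
  have hpos := hp.pos
  obtain ⟨i, hi⟩ : ∃ i, 0 < b i := by
    by_contra hcc
    push Not at hcc
    have : ∑ i, (c i).d * b i = 0 := Finset.sum_eq_zero (fun i _ => by rw [Nat.le_zero.1 (hcc i), mul_zero])
    omega
  have hsplit := Finset.add_sum_erase Finset.univ (fun i => (c i).d * b i) (Finset.mem_univ i)
  have hsp2 : (c i).yk (b i) * ∏ j ∈ Finset.univ.erase i, (c j).yk (b j) = uu c b := Finset.mul_prod_erase Finset.univ (fun i => (c i).yk (b i)) (Finset.mem_univ i)
  by_cases h : (c i).d * b i = n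
  · have h3 : uu c b = (c i).yk (b i) := by
      rw [← hsp2, Finset.prod_eq_one, mul_one]
      intro j hj
      have : (c j).d * b j ≤ 0 := by
        have h5 := Finset.single_le_sum (f := fun i => (c i).d * b i) (fun _ _ => Nat.zero_le _) hj
        omega
      have h4 : b j = 0 := by
        rcases Nat.mul_eq_zero.1 (Nat.le_zero.1 this) with h | h
        · exact absurd h (c j).prim.pos.ne'
        · exact h
      rw [h4, (c j).yk_zero]
    have h4 := (c i).prim_ne_yk hp h3
    rw [h4, mul_one] at h
    exact absurd h (hn i).ne
  · have hle := Finset.single_le_sum (f := fun i => (c i).d * b i) (fun _ _ => Nat.zero_le _) (Finset.mem_univ i)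
    have hpi : 0 < (c i).d * b i := Nat.mul_pos (c i).prim.pos hi
    set b' : ι → ℕ := Function.update b i 0 with hb'
    have h6 : uu c b' = ∏ j ∈ Finset.univ.erase i, (c j).yk (b j) := by
      rw [uu, ← Finset.mul_prod_erase Finset.univ _ (Finset.mem_univ i), hb', Function.update_self, (c i).yk_zero, one_mul]
      exact Finset.prod_congr rfl (fun j hj => by rw [Function.update_of_ne (Finset.ne_of_mem_erase hj)])
    have h7 : ∑ j, (c j).d * b' j = ∑ j ∈ Finset.univ.erase i, (c j).d * b j := by
      rw [← Finset.add_sum_erase Finset.univ _ (Finset.mem_univ i), hb', Function.update_self, mul_zero, zero_add]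
      exact Finset.sum_congr rfl (fun j hj => by rw [Function.update_of_ne (Finset.ne_of_mem_erase hj)])
    have h8 := hp.pr ((c i).d * b i) (∑ j, (c j).d * b' j) hpi (by omega) _ ((c i).yk_irr (b i)) _ (uu_irr c hc rfl) (by omega)
    rw [h6, hsp2, ip_uu_uu c hc b b hb, if_pos rfl] at h8
    exact one_ne_zero h8

theorem KK_card_le (hc : Function.Injective c) {n : ℕ} (hn : 0 < n) : (KK n (fun i => (c i).d)).ncard + Fintype.card F ^ (n-1) ≤ Fintype.card F ^ n := by
  classical
  have hfin := KK_finite n (d := fun i => (c i).d) (fun i => (c i).prim.pos)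
  haveI := hfin.fintype
  have h := wh_sub_sum hn (fun b : KK n (fun i => (c i).d) => (⟨uu c b.1, uu_irr c hc b.2⟩ : Irr F n)) (fun a b h => Subtype.ext (uu_inj c hc b.2 (congrArg Subtype.val h)))
  refine le_trans (Nat.add_le_add_right ?_ _) h
  rw [← Nat.card_coe_set_eq, Nat.card_eq_fintype_card, ← Finset.card_univ, Finset.card_eq_sum_ones]
  refine Finset.sum_le_sum (fun b _ => ?_)
  have h1 := wn_spec (⟨uu c b.1, uu_irr c hc b.2⟩ : Irr F n)
  have h2 := wh_uu c b.1
  rw [show ∑ i, (c i).d * b.1 i = n from b.2] at h2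
  rw [h2] at h1
  have : wn (⟨uu c b.1, uu_irr c hc b.2⟩ : Irr F n) = 1 := by exact_mod_cast h1.symm
  rw [this]; simp

end H1
end HallGL

namespace HallGL

section H2
variable {F : Type} [Field F] [Fintype F]

/-- monic irreducible polynomials different from X -/
def Pol (F : Type) [Field F] [Fintype F] : Type := {p : Polynomial F // p.Monic ∧ Irreducible p ∧ p.coeff 0 ≠ 0}

def Pol.d (p : Pol F) : ℕ := p.1.natDegree

theorem Pol.d_pos (p : Pol F) : 0 < p.d := p.2.2.1.natDegree_pos

instance Pol_finite (N : ℕ) : Finite {p : Pol F // p.d < N} := by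
  haveI : Finite (Polynomial.degreeLT F N) := Finite.of_equiv _ (Polynomial.degreeLTEquiv F N).symm.toEquiv
  refine Finite.of_injective (β := Polynomial.degreeLT F N) (fun p => ⟨p.1.1, ?_⟩) ?_
  · rw [Polynomial.mem_degreeLT, Polynomial.degree_eq_natDegree p.1.2.1.ne_zero]
    exact_mod_cast p.2
  · intro p q h
    exact Subtype.ext (Subtype.ext (congrArg (fun x : Polynomial.degreeLT F N => (x : Polynomial F)) h))

instance Pol_finite' (N : ℕ) : Finite {p : Pol F // p.d = N} :=
  Finite.of_injective (β := {p : Pol F // p.d < N+1}) (fun p => ⟨p.1, by have := p.2; omega⟩) (fun p q h => Subtype.ext (congrArg (fun x => x.1) h))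

theorem monic_fac {ι : Type} [Fintype ι] [DecidableEq ι] (p : ι → Pol F) : ∀ (n : ℕ) (f : Polynomial F), f.natDegree = n → f.Monic → f.coeff 0 ≠ 0 →
    (∀ g : Polynomial F, g.Monic → Irreducible g → g ∣ f → ∃ i, (p i).1 = g) → ∃ k : ι → ℕ, f = ∏ i, (p i).1 ^ k i := by
  intro n
  induction n using Nat.strong_induction_on with
  | _ n ih =>
    intro f hn hm h0 hg
    by_cases hn0 : n = 0
    · refine ⟨0, ?_⟩
      simp only [Pi.zero_apply, pow_zero, Finset.prod_const_one]
      exact hm.natDegree_eq_zero.1 (hn.trans hn0)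
    · obtain ⟨g, h1, h2, h3⟩ := Polynomial.exists_monic_irreducible_factor f (by
        intro hu
        exact hn0 (hn ▸ Polynomial.natDegree_eq_zero_of_isUnit hu))
      obtain ⟨i, hi⟩ := hg g h1 h2 h3
      obtain ⟨r, hr⟩ := h3
      have hrm : r.Monic := h1.of_mul_monic_left (hr ▸ hm)
      have hdeg : n = g.natDegree + r.natDegree := by rw [← hn, hr, h1.natDegree_mul hrm]
      have hgp := h2.natDegree_pos
      obtain ⟨k, hk⟩ := ih r.natDegree (by omega) r rfl hrm (by
        intro h; apply h0; rw [hr, Polynomial.mul_coeff_zero, h, mul_zero]) (fun g' a b c => hg g' a b (hr ▸ Dvd.dvd.mul_left c g))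
      refine ⟨fun j => k j + if j = i then 1 else 0, ?_⟩
      simp only [pow_add, Finset.prod_mul_distrib]
      rw [← hk, hr, mul_comm, ← hi]
      congr 1
      rw [Finset.prod_eq_single i] <;> simp +contextual

theorem poly_count {ι : Type} [Fintype ι] [DecidableEq ι] (p : ι → Pol F) (n : ℕ) (hn : 0 < n) (hp : ∀ g : Pol F, g.d < n → ∃ i, p i = g) :
    Fintype.card F ^ n ≤ Nat.card {g : Pol F // g.d = n} + (KK n (fun i => (p i).d)).ncard + Fintype.card F ^ (n-1) := by
  classical
  obtain ⟨m, rfl⟩ : ∃ m, n = m + 1 := ⟨n-1, by omega⟩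
  haveI : Finite (KK (m+1) (fun i => (p i).d)) := KK_finite _ (fun i => (p i).d_pos)
  let Ψ : ({g : Pol F // g.d = m+1} ⊕ KK (m+1) (fun i => (p i).d)) ⊕ (Fin m → F) → (Fin (m+1) → F) :=
    Sum.elim (Sum.elim (fun g i => g.1.1.coeff i) (fun k i => (∏ j, (p j).1 ^ k.1 j).coeff i)) (fun b => Fin.cons 0 b)
  have hs : Function.Surjective Ψ := by
    intro a
    by_cases h0 : a 0 = 0
    · exact ⟨Sum.inr (Fin.tail a), by show Fin.cons 0 (Fin.tail a) = a; rw [← h0, Fin.cons_self_tail]⟩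
    · set f : Polynomial F := Polynomial.X ^ (m+1) + ∑ i : Fin (m+1), Polynomial.C (a i) * Polynomial.X ^ (i : ℕ) with hf
      have hl : (∑ i : Fin (m+1), Polynomial.C (a i) * Polynomial.X ^ (i : ℕ)).degree < ((m+1 : ℕ) : WithBot ℕ) := Polynomial.degree_sum_fin_lt a
      have hm : f.Monic := Polynomial.monic_X_pow_add hl
      have hd : f.natDegree = m+1 := by
        rw [hf, Polynomial.natDegree_add_eq_left_of_degree_lt (by rw [Polynomial.degree_X_pow]; exact hl), Polynomial.natDegree_X_pow]
      have hco : ∀ i : Fin (m+1), f.coeff i = a i := by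
        intro i
        rw [hf, Polynomial.coeff_add, Polynomial.coeff_X_pow, if_neg (by have := i.2; omega), zero_add, Polynomial.finsetSum_coeff, Finset.sum_eq_single i]
        · simp
        · intro b _ hb
          rw [Polynomial.coeff_C_mul_X_pow, if_neg (fun h => hb (Fin.ext h.symm))]
        · simp
      have hz : f.coeff 0 ≠ 0 := by have := hco 0; simp only [Fin.val_zero] at this; rwa [this]
      by_cases hi : Irreducible f
      · exact ⟨Sum.inl (Sum.inl ⟨⟨f, hm, hi, hz⟩, hd⟩), funext hco⟩
      · obtain ⟨k, hk⟩ := monic_fac p _ f rfl hm hz (by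
          intro g h1 h2 h3
          have hg0 : g.coeff 0 ≠ 0 := by
            obtain ⟨r, hr⟩ := h3
            intro h; apply hz; rw [hr, Polynomial.mul_coeff_zero, h, zero_mul]
          have hlt : g.natDegree < m+1 := by
            rcases lt_or_eq_of_le (hd ▸ Polynomial.natDegree_le_of_dvd h3 hm.ne_zero) with h | h
            · exact h
            · exfalso
              apply hi
              have := Polynomial.eq_of_dvd_of_natDegree_le_of_leadingCoeff h3 (by omega) (by rw [h1.leadingCoeff, hm.leadingCoeff])
              exact this ▸ h2
          obtain ⟨i, hi⟩ := hp ⟨g, h1, h2, hg0⟩ hlt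
          exact ⟨i, congrArg Subtype.val hi⟩)
        refine ⟨Sum.inl (Sum.inr ⟨k, ?_⟩), ?_⟩
        · show ∑ i, (p i).d * k i = m+1
          rw [← hd, hk, Polynomial.natDegree_prod_of_monic _ _ (fun i _ => (p i).2.1.pow _)]
          refine Finset.sum_congr rfl (fun i _ => ?_)
          rw [Polynomial.natDegree_pow, mul_comm]; rfl
        · show (fun i : Fin (m+1) => (∏ j, (p j).1 ^ k j).coeff i) = a
          rw [← hk]; exact funext hco
  have := Nat.card_le_card_of_surjective Ψ hs
  rw [Nat.card_sum, Nat.card_sum, Nat.card_coe_set_eq] at this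
  simpa using this

end H2
end HallGL

namespace HallGL

section H3
variable {F : Type} [Field F] [Fintype F]

theorem sm_gap {m : ℕ} {β : Fin m → ℕ} (hβ : StrictMono β) : Monotone (fun j : Fin m => β j - j) := by
  have key : ∀ k (i : Fin m) (h : i + k < m), β i + k ≤ β ⟨i + k, h⟩ := by
    intro k i
    induction k with
    | zero => intro h; exact le_rfl
    | succ k ih =>
      intro h
      have h1 := ih (by omega)
      have h2 : β ⟨i + k, by omega⟩ < β ⟨i + (k+1), h⟩ := hβ (by simp [Fin.lt_def])
      omega
  intro i j hij
  have hij' : (i : ℕ) ≤ j := hij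
  have h1 := key (j - i) i (by have := j.2; omega)
  have h2 : (⟨(i : ℕ) + (j - i), by have := j.2; omega⟩ : Fin m) = j := Fin.ext (by simp; omega)
  rw [h2] at h1
  show β i - i ≤ β j - j
  omega

theorem lam_aux {m : ℕ} {l u : Fin m → ℕ} (hl : Monotone l) (hu : Monotone u) (h : ∀ k, ∑ j, min k (l j) = ∑ j, min k (u j)) (j : Fin m) : ¬ l j < u j := by
  intro hlt
  have key : ∀ (v : Fin m → ℕ) k, ∑ j, min (k+1) (v j) = ∑ j, min k (v j) + ∑ j, (if k < v j then 1 else 0) := by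
    intro v k
    rw [← Finset.sum_add_distrib]
    refine Finset.sum_congr rfl (fun j _ => ?_)
    split_ifs <;> omega
  obtain ⟨k, hk⟩ : ∃ k, u j = k + 1 := ⟨u j - 1, by omega⟩
  have h1 := key l k
  have h2 := key u k
  have h3 : ∑ j, (if k < l j then 1 else 0) < ∑ j, (if k < u j then 1 else 0) := by
    refine Finset.sum_lt_sum (fun i _ => ?_) ⟨j, Finset.mem_univ _, ?_⟩
    · rcases le_total i j with hij | hij
      · have := hl hij
        rw [if_neg (by omega)]; exact Nat.zero_le _
      · have := hu hij
        rw [if_pos (show k < u i by omega)]; split_ifs <;> simp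
    · rw [if_neg (by omega), if_pos (by omega)]; simp
  rw [h (k+1), h k] at h1
  omega

theorem lam_uniq {m : ℕ} {l u : Fin m → ℕ} (hl : Monotone l) (hu : Monotone u) (h : ∀ k, ∑ j, min k (l j) = ∑ j, min k (u j)) : l = u := by
  funext j
  have h1 := lam_aux hl hu h j
  have h2 := lam_aux hu hl (fun k => (h k).symm) j
  omega

open Polynomial in
/-- cyclic module -/
abbrev Cyc (f : F[X]) : Type := F[X] ⧸ Ideal.span {f}

open Polynomial

theorem Cyc_finrank {f : F[X]} (hf : f.Monic) : finrank F (Cyc f) = f.natDegree := by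
  exact finrank_quotient_span_eq_natDegree

instance Cyc_fd {f : F[X]} [hf : Fact f.Monic] : FiniteDimensional F (Cyc f) := hf.out.finite_quotient

theorem Cyc_card {f : F[X]} (hf : f.Monic) : Nat.card (Cyc f) = Fintype.card F ^ f.natDegree := by
  haveI := Fact.mk hf
  rw [Module.natCard_eq_pow_finrank (K := F), Cyc_finrank hf, Nat.card_eq_fintype_card]

theorem ker_coprime {f g : F[X]} (h : IsCoprime g f) : Nat.card {v : Cyc f // g • v = 0} = 1 := by
  rw [Nat.card_eq_one_iff_unique]
  obtain ⟨a, b, hab⟩ := h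
  have key : ∀ v : Cyc f, g • v = 0 → v = 0 := by
    intro v hv
    have h1 : f • v = 0 := by
      obtain ⟨w, rfl⟩ := Ideal.Quotient.mk_surjective v
      show Ideal.Quotient.mk _ (f * w) = 0
      rw [Ideal.Quotient.eq_zero_iff_mem]
      exact Ideal.mem_span_singleton.2 ⟨w, rfl⟩
    calc v = (a * g + b * f) • v := by rw [hab, one_smul]
      _ = 0 := by rw [add_smul, mul_smul, mul_smul, hv, h1, smul_zero, smul_zero, add_zero]
  exact ⟨⟨fun a b => Subtype.ext ((key _ a.2).trans (key _ b.2).symm)⟩, ⟨⟨0, smul_zero _⟩⟩⟩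

theorem ker_pow {p : F[X]} (hp : p.Monic) (k l : ℕ) : Nat.card {v : Cyc (p ^ l) // p ^ k • v = 0} = Fintype.card F ^ (p.natDegree * min k l) := by
  set k' := min k l with hk'
  let T : F[X] →ₗ[F[X]] Cyc (p ^ l) := (Submodule.mkQ (Ideal.span {p ^ l})).comp (LinearMap.lsmul F[X] F[X] (p ^ (l - k')))
  have hT : ∀ f, T f = Ideal.Quotient.mk _ (p ^ (l - k') * f) := fun f => rfl
  have hker : LinearMap.ker T = Ideal.span {p ^ k'} := by
    ext f
    rw [LinearMap.mem_ker, hT, Ideal.Quotient.eq_zero_iff_mem, Ideal.mem_span_singleton, Ideal.mem_span_singleton]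
    have : p ^ l = p ^ (l - k') * p ^ k' := by rw [← pow_add]; congr 1; omega
    rw [this]
    exact mul_dvd_mul_iff_left (hp.pow _).ne_zero
  have hran : ∀ v : Cyc (p ^ l), p ^ k • v = 0 ↔ v ∈ LinearMap.range T := by
    intro v
    obtain ⟨w, rfl⟩ := Ideal.Quotient.mk_surjective v
    have e1 : p ^ k • (Ideal.Quotient.mk (Ideal.span {p ^ l}) w) = Ideal.Quotient.mk (Ideal.span {p ^ l}) (p ^ k * w) := rfl
    rw [e1, Ideal.Quotient.eq_zero_iff_mem, Ideal.mem_span_singleton, LinearMap.mem_range]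
    constructor
    · intro h
      by_cases hkl : l ≤ k
      · refine ⟨w, ?_⟩
        rw [hT, show l - k' = 0 by omega, pow_zero, one_mul]
      · have : p ^ l = p ^ k * p ^ (l - k) := by rw [← pow_add]; congr 1; omega
        rw [this] at h
        obtain ⟨y, hy⟩ := (mul_dvd_mul_iff_left (hp.pow _).ne_zero).1 h
        refine ⟨y, ?_⟩
        rw [hT, show l - k' = l - k by omega, hy]
    · rintro ⟨y, hy⟩
      rw [hT, Ideal.Quotient.eq, Ideal.mem_span_singleton] at hy
      have h1 : p ^ l ∣ p ^ k * (p ^ (l - k') * y - w) := Dvd.dvd.mul_left hy _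
      have h2 : p ^ l ∣ p ^ k * (p ^ (l - k') * y) := by
        rw [← mul_assoc, ← pow_add]
        exact Dvd.dvd.mul_right (pow_dvd_pow _ (by omega)) _
      have := dvd_sub h2 h1
      rwa [← mul_sub, sub_sub_cancel] at this
  have e1 : Nat.card {v : Cyc (p ^ l) // p ^ k • v = 0} = Nat.card (LinearMap.range T) :=
    Nat.card_congr (Equiv.subtypeEquivRight hran)
  rw [e1, ← Nat.card_congr T.quotKerEquivRange.toEquiv, hker]
  have := Cyc_card (hp.pow k')
  rw [natDegree_pow, mul_comm] at this
  exact this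

end H3
end HallGL

namespace HallGL

section H4
variable {F : Type} [Field F] [Fintype F]
open Polynomial

/-- direct sum of cyclic modules -/
abbrev VV {K : Type} (f : K → F[X]) : Type := (p : K) → Cyc (f p)

theorem VV_finrank {K : Type} [Fintype K] (f : K → F[X]) (hf : ∀ p, (f p).Monic) : finrank F (VV f) = ∑ p, (f p).natDegree := by
  haveI : ∀ p, Fact (f p).Monic := fun p => ⟨hf p⟩
  rw [Module.finrank_pi_fintype]
  exact Finset.sum_congr rfl (fun p _ => Cyc_finrank (hf p))

theorem VV_fd {K : Type} [Fintype K] (f : K → F[X]) (hf : ∀ p, (f p).Monic) : FiniteDimensional F (VV f) := by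
  haveI : ∀ p, Fact (f p).Monic := fun p => ⟨hf p⟩
  infer_instance

theorem VV_ker {K : Type} [Fintype K] (f : K → F[X]) (g : F[X]) : Nat.card {v : VV f // g • v = 0} = ∏ p, Nat.card {v : Cyc (f p) // g • v = 0} := by
  rw [← Nat.card_pi]
  refine Nat.card_congr ((Equiv.subtypeEquivRight (fun v => ?_)).trans (Equiv.subtypePiEquivPi (p := fun p (v : Cyc (f p)) => g • v = 0)))
  rw [funext_iff]; rfl

def mx {K : Type} (f : K → F[X]) : Module.End F (VV f) := Algebra.lsmul F F (VV f) (Polynomial.X : F[X])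

theorem aeval_mx {K : Type} (f : K → F[X]) (g : F[X]) (v : VV f) : aeval (mx f) g v = g • v := by
  rw [mx, aeval_algHom_apply (Algebra.lsmul F F (VV f)) Polynomial.X g, aeval_X_left_apply]; rfl

theorem mx_inj {K : Type} [Fintype K] (f : K → F[X]) (h : ∀ p, IsCoprime Polynomial.X (f p)) : Function.Injective (mx f) := by
  have h1 := VV_ker f Polynomial.X
  rw [Finset.prod_eq_one (fun p _ => ker_coprime (h p))] at h1
  rw [injective_iff_map_eq_zero]
  intro v hv
  obtain ⟨hs, _⟩ := Nat.card_eq_one_iff_unique.1 h1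
  exact congrArg Subtype.val (hs.elim (⟨v, hv⟩ : {v : VV f // Polynomial.X • v = 0}) ⟨0, smul_zero _⟩)

def cnt {V : Type} [AddCommGroup V] [Module F V] (A : Module.End F V) (g : F[X]) : ℕ := Nat.card {v : V // aeval A g v = 0}

theorem cnt_conj {V W : Type} [AddCommGroup V] [Module F V] [AddCommGroup W] [Module F W] (e : V ≃ₗ[F] W) (A : Module.End F V) (g : F[X]) : cnt (e.conj A) g = cnt A g := by
  have h : aeval (e.conj A) g = e.conj (aeval A g) := by
    have := aeval_algHom_apply (e.conjAlgEquiv F).toAlgHom A g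
    exact this
  refine (Nat.card_congr (e.toEquiv.subtypeEquiv (fun v => ?_))).symm
  rw [h]
  show _ ↔ e (aeval A g (e.symm (e v))) = 0
  rw [e.symm_apply_apply, LinearEquiv.map_eq_zero_iff]

variable {ι : Type} [Fintype ι] [DecidableEq ι] {m : ℕ} 

def ff (p : ι → Pol F) (α : Fin m × ι → ℕ) (x : Fin m × ι) : F[X] := (p x.2).1 ^ (α x - x.1)

theorem Pol_coprime {p q : Pol F} (h : p ≠ q) : IsCoprime p.1 q.1 := by
  rw [p.2.2.1.coprime_iff_not_dvd]
  intro h1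
  apply h
  exact Subtype.ext (eq_of_monic_of_associated p.2.1 q.2.1 (p.2.2.1.associated_of_dvd q.2.2.1 h1))

theorem Pol_coprime_X (p : Pol F) : IsCoprime Polynomial.X p.1 := by
  rw [irreducible_X.coprime_iff_not_dvd, X_dvd_iff]
  exact p.2.2.2

theorem ff_ker (p : ι → Pol F) (hp : Function.Injective p) (α : Fin m × ι → ℕ) (i : ι) (k : ℕ) :
    Nat.card {v : VV (ff p α) // (p i).1 ^ k • v = 0} = Fintype.card F ^ ((p i).d * ∑ j, min k (α (j, i) - j)) := by
  rw [VV_ker, Fintype.prod_prod_type, Finset.mul_sum, ← Finset.prod_pow_eq_pow_sum]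
  refine Finset.prod_congr rfl (fun j _ => ?_)
  rw [Finset.prod_eq_single i]
  · exact ker_pow (p i).2.1 k _
  · intro i' _ hi
    exact ker_coprime (IsCoprime.pow (Pol_coprime (fun h => hi (hp h).symm)))
  · simp

theorem exists_aut (p : ι → Pol F) (hp : Function.Injective p) {n : ℕ} (α : DD m n (fun i => (p i).d)) : ∃ A : Aut F n, ∀ i k,
    cnt (A : Module.End F (Fin n → F)) ((p i).1 ^ k) = Fintype.card F ^ ((p i).d * ∑ j : Fin m, min k (α.1 (j, i) - j)) := by
  have hm : ∀ x, (ff p α.1 x).Monic := fun x => (p x.2).2.1.pow _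
  haveI := VV_fd _ hm
  have hr : finrank F (VV (ff p α.1)) = n := by
    rw [VV_finrank _ hm]
    have h1 : ∀ x, (ff p α.1 x).natDegree = (p x.2).d * (α.1 x - x.1) := fun x => by rw [ff, natDegree_pow, mul_comm]; rfl
    have h2 : n + ∑ x : Fin m × ι, (p x.2).d * x.1 = ∑ x : Fin m × ι, (p x.2).d * α.1 x := α.2.2
    have h3 : ∑ x : Fin m × ι, (p x.2).d * α.1 x = ∑ x : Fin m × ι, (ff p α.1 x).natDegree + ∑ x : Fin m × ι, (p x.2).d * x.1 := by
      rw [← Finset.sum_add_distrib]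
      refine Finset.sum_congr rfl (fun x _ => ?_)
      have : (x.1 : ℕ) ≤ α.1 x := sm_le (α.2.1 x.2) x.1
      rw [h1, ← mul_add, Nat.sub_add_cancel this]
    omega
  let e : VV (ff p α.1) ≃ₗ[F] (Fin n → F) := LinearEquiv.ofFinrankEq _ _ (by rw [hr]; simp)
  let M : VV (ff p α.1) ≃ₗ[F] VV (ff p α.1) := LinearEquiv.ofInjectiveEndo (mx _) (mx_inj _ (fun x => (Pol_coprime_X _).pow_right))
  refine ⟨(e.symm.trans M).trans e, fun i k => ?_⟩
  have h4 : (((e.symm.trans M).trans e : Aut F n) : Module.End F (Fin n → F)) = e.conj (mx (ff p α.1)) := by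
    ext; rfl
  rw [h4, cnt_conj, ← ff_ker p hp α.1 i k]
  exact Nat.card_congr (Equiv.subtypeEquivRight (fun v => by rw [aeval_mx]))

theorem DD_le_irr (p : ι → Pol F) (hp : Function.Injective p) (m n : ℕ) : (DD m n (fun i => (p i).d)).ncard ≤ Nat.card (Irr F n) := by
  classical
  let c0 : Aut F n → (ι → ℕ → ℕ) := fun A i k => cnt (A : Module.End F (Fin n → F)) ((p i).1 ^ k)
  let c : Aut F n → Set.range c0 := fun A => ⟨c0 A, A, rfl⟩
  have h1 := card_le_irr c (by rintro ⟨_, A, rfl⟩; exact ⟨A, rfl⟩) (by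
    intro A k
    refine Subtype.ext ?_
    funext i l
    exact cnt_conj k (A : Module.End F (Fin n → F)) _)
  rw [← Nat.card_congr (irrEquiv n)] at h1
  refine le_trans ?_ h1
  rw [← Nat.card_coe_set_eq]
  choose A hA using exists_aut (m := m) p hp (n := n)
  refine Nat.card_le_card_of_injective (fun α => c (A α)) ?_
  intro α β h
  have h2 : c0 (A α) = c0 (A β) := congrArg Subtype.val h
  have h3 : ∀ i, (fun j : Fin m => α.1 (j, i) - j) = (fun j : Fin m => β.1 (j, i) - j) := by
    intro i
    refine lam_uniq (sm_gap (α.2.1 i)) (sm_gap (β.2.1 i)) (fun k => ?_)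
    have h4 := congrFun (congrFun h2 i) k
    change cnt _ _ = cnt _ _ at h4
    rw [hA, hA] at h4
    exact Nat.eq_of_mul_eq_mul_left (p i).d_pos (Nat.pow_right_injective Fintype.one_lt_card h4)
  refine Subtype.ext (funext fun x => ?_)
  have h5 := congrFun (h3 x.2) x.1
  have h6 : (x.1 : ℕ) ≤ α.1 x := sm_le (α.2.1 x.2) x.1
  have h7 : (x.1 : ℕ) ≤ β.1 x := sm_le (β.2.1 x.2) x.1
  have h5 : α.1 x - x.1 = β.1 x - x.1 := h5
  omega

end H4
end HallGL

namespace HallGL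

section H5
theorem equiv_fib {A B : Type} [Finite A] [Finite B] (f : A → ℕ) (g : B → ℕ) (h : ∀ d, Nat.card {a // f a = d} = Nat.card {b // g b = d}) :
    ∃ e : A ≃ B, ∀ a, g (e a) = f a := by
  have h1 : ∀ d, Nonempty ({a // f a = d} ≃ {b // g b = d}) := fun d => ⟨(Finite.equivFinOfCardEq (h d)).trans (Finite.equivFinOfCardEq rfl).symm⟩
  let e0 : ∀ d, {a // f a = d} ≃ {b // g b = d} := fun d => (h1 d).some
  refine ⟨((Equiv.sigmaFiberEquiv f).symm.trans (Equiv.sigmaCongrRight e0)).trans (Equiv.sigmaFiberEquiv g), fun a => ?_⟩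
  exact (e0 (f a) ⟨a, rfl⟩).2

theorem KK_congr {ι κ : Type} [Fintype ι] [Fintype κ] (e : ι ≃ κ) (n : ℕ) (d : ι → ℕ) (d' : κ → ℕ) (h : ∀ i, d' (e i) = d i) :
    (KK n d).ncard = (KK n d').ncard := by
  rw [← Nat.card_coe_set_eq, ← Nat.card_coe_set_eq]
  refine Nat.card_congr ((Equiv.arrowCongr e (Equiv.refl ℕ)).subtypeEquiv (fun k => ?_))
  show ∑ i, d i * k i = n ↔ ∑ i, d' i * k (e.symm i) = n
  rw [← Equiv.sum_comp e (fun i => d' i * k (e.symm i))]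
  simp [h]

theorem DD_congr {ι κ : Type} [Fintype ι] [DecidableEq ι] [Fintype κ] [DecidableEq κ] (e : ι ≃ κ) (m n : ℕ) (d : ι → ℕ) (d' : κ → ℕ) (h : ∀ i, d' (e i) = d i) :
    (DD m n d).ncard = (DD m n d').ncard := by
  rw [← Nat.card_coe_set_eq, ← Nat.card_coe_set_eq]
  refine Nat.card_congr ((Equiv.arrowCongr ((Equiv.refl (Fin m)).prodCongr e) (Equiv.refl ℕ)).subtypeEquiv (fun α => ?_))
  show (SM α ∧ n + ∑ p : Fin m × ι, d p.2 * p.1 = ∑ p : Fin m × ι, d p.2 * α p) ↔ (SM (fun p : Fin m × κ => α (p.1, e.symm p.2)) ∧ n + ∑ p : Fin m × κ, d' p.2 * p.1 = ∑ p : Fin m × κ, d' p.2 * α (p.1, e.symm p.2))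
  rw [← Equiv.sum_comp ((Equiv.refl (Fin m)).prodCongr e) (fun p => d' p.2 * α (p.1, e.symm p.2)), ← Equiv.sum_comp ((Equiv.refl (Fin m)).prodCongr e) (fun p : Fin m × κ => d' p.2 * (p.1 : ℕ))]
  simp only [Equiv.prodCongr_apply, Prod.map_fst, Prod.map_snd, Equiv.coe_refl, id_eq, Equiv.symm_apply_apply, h, Prod.mk.eta]
  refine and_congr_left (fun _ => ⟨fun hs i => hs (e.symm i), fun hs i => by simpa using hs (e i)⟩)

theorem DD_ext {ι κ : Type} [Fintype ι] [DecidableEq ι] [Fintype κ] [DecidableEq κ] {m n : ℕ} (hm : 0 < m) (hn : 0 < n) (d : ι → ℕ) (hd : ∀ i, 0 < d i) :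
    (DD m n d).ncard + Nat.card κ ≤ (DD m n (Sum.elim d (fun _ : κ => n))).ncard := by
  classical
  haveI : Finite (DD m n d) := DD_finite m n hd
  haveI : Finite (DD m n (Sum.elim d (fun _ : κ => n))) := DD_finite m n (by rintro (i | i); exacts [hd i, hn])
  rw [← Nat.card_coe_set_eq, ← Nat.card_coe_set_eq, ← Nat.card_sum]
  let t : Fin m := ⟨m-1, by omega⟩
  let f1 : (Fin m × ι → ℕ) → Fin m × (ι ⊕ κ) → ℕ := fun α p => Sum.elim (fun i => α (p.1, i)) (fun _ => (p.1 : ℕ)) p.2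
  let f2 : κ → Fin m × (ι ⊕ κ) → ℕ := fun k p => (p.1 : ℕ) + if p = (t, Sum.inr k) then 1 else 0
  have h1 : ∀ α ∈ DD m n d, f1 α ∈ DD m n (Sum.elim d (fun _ : κ => n)) := by
    rintro α ⟨ha, hb⟩
    refine ⟨?_, ?_⟩
    · rintro (i | i)
      · exact ha i
      · exact fun a b h => h
    · rw [Fintype.sum_prod_type, Fintype.sum_prod_type] at hb ⊢
      simp only [Fintype.sum_sum_type, Sum.elim_inl, Sum.elim_inr, f1, Finset.sum_add_distrib]
      simp only at hb
      omega
  have h2 : ∀ k, f2 k ∈ DD m n (Sum.elim d (fun _ : κ => n)) := by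
    intro k
    refine ⟨?_, ?_⟩
    · intro i a b hab
      show (a : ℕ) + _ < (b : ℕ) + _
      have hab' : (a : ℕ) < b := hab
      have : a ≠ t := by intro h; have := b.2; rw [h] at hab'; simp only [t] at hab'; omega
      rw [if_neg (show ((a, i) : Fin m × (ι ⊕ κ)) ≠ (t, Sum.inr k) from fun h => this (congrArg Prod.fst h))]
      omega
    · simp only [f2, mul_add, Finset.sum_add_distrib, mul_ite, mul_one, mul_zero]
      rw [Finset.sum_ite_eq' Finset.univ, if_pos (Finset.mem_univ _), add_comm]; rfl
  refine Nat.card_le_card_of_injective (Sum.elim (fun α => (⟨f1 α.1, h1 _ α.2⟩ : DD m n (Sum.elim d (fun _ : κ => n)))) (fun k => ⟨f2 k, h2 k⟩)) ?_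
  have hne : ∀ α k, f1 α ≠ f2 k := by
    intro α k h
    have := congrFun h (t, Sum.inr k)
    simp [f1, f2] at this
  rintro (α | k) (β | l) h
  · congr 1
    refine Subtype.ext (funext fun p => ?_)
    exact congrFun (congrArg Subtype.val h) (p.1, Sum.inl p.2)
  · exact absurd (congrArg Subtype.val h) (hne _ _)
  · exact absurd (congrArg Subtype.val h).symm (hne _ _)
  · congr 1
    have h3 : f2 k = f2 l := congrArg Subtype.val h
    have := congrFun h3 (t, Sum.inr k)
    change (t : ℕ) + (if ((t, Sum.inr k) : Fin m × (ι ⊕ κ)) = (t, Sum.inr k) then 1 else 0) = (t : ℕ) + (if ((t, Sum.inr k) : Fin m × (ι ⊕ κ)) = (t, Sum.inr l) then 1 else 0) at this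
    by_contra hkl
    rw [if_pos rfl, if_neg (by simpa using hkl)] at this
    omega

variable {F : Type} [Field F] [Fintype F]

instance Prim_finite (d : ℕ) : Finite {ρ : Hall F ℂ // Prim d ρ} :=
  Finite.of_injective (β := Irr F d) (fun ρ => ⟨ρ.1, ρ.2.irr⟩) (fun a b h => Subtype.ext (congrArg (fun x => x.1) h))

instance CC_finite (N : ℕ) : Finite {c : Cusp F // c.d < N} :=
  Finite.of_injective (β := Σ d : Fin N, Irr F d) (fun c => ⟨⟨c.1.d, c.2⟩, c.1.ρ, c.1.prim.irr⟩) (by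
    intro a b h
    refine Subtype.ext (Cusp.ext' ?_)
    exact congrArg (fun x : Σ d : Fin N, Irr F d => x.2.1) h)

def Clm (F : Type) [Field F] [Fintype F] (d : ℕ) : Prop := (∀ ρ : Hall F ℂ, Prim d ρ → wh d ρ = 1) ∧ Nat.card {ρ : Hall F ℂ // Prim d ρ} = Nat.card {p : Pol F // p.d = d}

theorem cusp_fib (N : ℕ) (h : ∀ d < N, Clm F d) : ∃ e : {c : Cusp F // c.d < N} ≃ {p : Pol F // p.d < N}, ∀ c, (e c).1.d = c.1.d := by
  refine equiv_fib (fun c : {c : Cusp F // c.d < N} => c.1.d) (fun p : {p : Pol F // p.d < N} => p.1.d) (fun d => ?_)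
  by_cases hd : d < N
  · obtain ⟨h1, h2⟩ := h d hd
    have e1 : Nat.card {a : {c : Cusp F // c.d < N} // a.1.d = d} = Nat.card {ρ : Hall F ℂ // Prim d ρ} := by
      refine Nat.card_congr ⟨fun a => ⟨a.1.1.ρ, by
        have h5 := a.1.1.prim
        rwa [show a.1.1.d = d from a.2] at h5⟩, fun ρ => ⟨⟨⟨d, ρ.1, ρ.2, h1 _ ρ.2⟩, hd⟩, rfl⟩, ?_, fun ρ => rfl⟩
      intro a
      exact Subtype.ext (Subtype.ext (Cusp.ext' rfl))
    have e2 : Nat.card {a : {p : Pol F // p.d < N} // a.1.d = d} = Nat.card {p : Pol F // p.d = d} := by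
      exact Nat.card_congr ⟨fun a => ⟨a.1.1, a.2⟩, fun p => ⟨⟨p.1, by have := p.2; omega⟩, p.2⟩, fun a => rfl, fun p => rfl⟩
    rw [e1, e2, h2]
  · haveI : IsEmpty {a : {c : Cusp F // c.d < N} // a.1.d = d} := ⟨fun a => hd (a.2 ▸ a.1.2)⟩
    haveI : IsEmpty {a : {p : Pol F // p.d < N} // a.1.d = d} := ⟨fun a => hd (a.2 ▸ a.1.2)⟩
    rw [Nat.card_of_isEmpty, Nat.card_of_isEmpty]

theorem clm_all (n : ℕ) : Clm F n := by
  classical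
  induction n using Nat.strong_induction_on with
  | _ n ih =>
    by_cases hn0 : n = 0
    · subst hn0
      refine ⟨fun ρ h => absurd h.pos (lt_irrefl _), ?_⟩
      haveI : IsEmpty {ρ : Hall F ℂ // Prim 0 ρ} := ⟨fun ρ => absurd ρ.2.pos (lt_irrefl _)⟩
      haveI : IsEmpty {p : Pol F // p.d = 0} := ⟨fun p => p.1.d_pos.ne' p.2⟩
      rw [Nat.card_of_isEmpty, Nat.card_of_isEmpty]
    have hn : 0 < n := Nat.pos_of_ne_zero hn0
    obtain ⟨e, he⟩ := cusp_fib n ih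
    haveI : Fintype {c : Cusp F // c.d < n} := Fintype.ofFinite _
    haveI : Fintype {p : Pol F // p.d < n} := Fintype.ofFinite _
    haveI : Fintype {p : Pol F // p.d = n} := Fintype.ofFinite _
    haveI : Fintype {ρ : Hall F ℂ // Prim n ρ} := Fintype.ofFinite _
    let c : {c : Cusp F // c.d < n} → Cusp F := Subtype.val
    have hc : Function.Injective c := Subtype.val_injective
    let p : {p : Pol F // p.d < n} → Pol F := Subtype.val
    have hp : Function.Injective p := Subtype.val_injective
    have hK : (KK n (fun i => (c i).d)).ncard = (KK n (fun i => (p i).d)).ncard := KK_congr e n _ _ he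
    have hD : (DD n n (fun i => (c i).d)).ncard = (DD n n (fun i => (p i).d)).ncard := DD_congr e n n _ _ he
    -- nonprimitive characters
    have hnon : Nat.card {χ : Irr F n // ¬ Prim n χ.1} ≤ (DD n n (fun i => (c i).d)).ncard := by
      rw [← Nat.card_coe_set_eq]
      haveI : Finite (DD n n (fun i => (c i).d)) := DD_finite n n (fun i => (c i).prim.pos)
      have h1 : ∀ χ : {χ : Irr F n // ¬ Prim n χ.1}, ∃ α : DD n n (fun i => (c i).d), (ch c hc α).1 = χ.1.1 := by
        intro χ
        obtain ⟨l, h1, h2, h3⟩ := constit' hn (fun d hd => (ih d hd).1) χ.1.2 χ.2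
        have h4 := list_uu c hc l n (h2 ▸ list_le l) (fun x hx => ⟨⟨x, h1 x hx⟩, rfl⟩)
        exact ch_surj c hc χ.1.2 (m := n) (by
          intro h5
          exact h3 ((congrArg (fun f => ip n f χ.1.1) h4).symm.trans h5))
      choose A hA using h1
      refine Nat.card_le_card_of_injective A (fun a b h => ?_)
      exact Subtype.ext (Subtype.ext (by rw [← hA, ← hA, h]))
    have hsplit : Nat.card (Irr F n) = Nat.card {ρ : Hall F ℂ // Prim n ρ} + Nat.card {χ : Irr F n // ¬ Prim n χ.1} := by
      rw [← Nat.card_congr (Equiv.sumCompl (fun χ : Irr F n => Prim n χ.1)), Nat.card_sum]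
      congr 1
      exact Nat.card_congr ⟨fun x => ⟨x.1.1, x.2⟩, fun ρ => ⟨⟨ρ.1, ρ.2.irr⟩, ρ.2⟩, fun x => rfl, fun x => rfl⟩
    have hlow : Nat.card {p : Pol F // p.d = n} ≤ Nat.card {ρ : Hall F ℂ // Prim n ρ} := by
      have h1 := DD_ext (κ := {p : Pol F // p.d = n}) (m := n) hn hn (fun i => (p i).d) (fun i => (p i).d_pos)
      have h2 := DD_le_irr (Sum.elim p (fun x : {p : Pol F // p.d = n} => x.1)) (by
        rintro (a | a) (b | b) h
        · exact congrArg _ (hp h)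
        · exfalso
          have h3 : a.1 = b.1 := h
          have := a.2; rw [h3, b.2] at this; omega
        · exfalso
          have h3 : a.1 = b.1 := h
          have := b.2; rw [← h3, a.2] at this; omega
        · exact congrArg _ (Subtype.ext h)) n n
      have h3 : (fun i => (Sum.elim p (fun x : {p : Pol F // p.d = n} => x.1) i).d) = Sum.elim (fun i => (p i).d) (fun _ : {p : Pol F // p.d = n} => n) := by
        funext x; rcases x with x | x
        · rfl
        · exact x.2
      rw [h3] at h2
      omega
    have hup : ∑ ρ : {ρ : Hall F ℂ // Prim n ρ}, wn (⟨ρ.1, ρ.2.irr⟩ : Irr F n) ^ 2 ≤ Nat.card {p : Pol F // p.d = n} := by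
      haveI : Fintype (KK n (fun i => (c i).d)) := (KK_finite n (fun i => (c i).prim.pos)).fintype
      have h1 := wh_sub_sum hn (Sum.elim (fun ρ : {ρ : Hall F ℂ // Prim n ρ} => (⟨ρ.1, ρ.2.irr⟩ : Irr F n)) (fun b : KK n (fun i => (c i).d) => (⟨uu c b.1, uu_irr c hc b.2⟩ : Irr F n))) (by
        rintro (a | a) (b | b) h
        · exact congrArg _ (Subtype.ext (congrArg (fun x => x.1) h))
        · exfalso
          have h3 : a.1 = uu c b.1 := congrArg (fun x => x.1) h
          exact uu_not_prim c hc (fun i => i.2) b.2 (h3 ▸ a.2)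
        · exfalso
          have h3 : uu c a.1 = b.1 := congrArg (fun x => x.1) h
          exact uu_not_prim c hc (fun i => i.2) a.2 (h3 ▸ b.2)
        · exact congrArg _ (Subtype.ext (uu_inj c hc b.2 (congrArg (fun x => x.1) h))))
      rw [Fintype.sum_sum_type] at h1
      simp only [Sum.elim_inl, Sum.elim_inr] at h1
      have h2 : ∑ b : KK n (fun i => (c i).d), wn (⟨uu c b.1, uu_irr c hc b.2⟩ : Irr F n) ^ 2 = (KK n (fun i => (c i).d)).ncard := by
        rw [← Nat.card_coe_set_eq, Nat.card_eq_fintype_card, ← Finset.card_univ, Finset.card_eq_sum_ones]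
        refine Finset.sum_congr rfl (fun b _ => ?_)
        have h1 := wn_spec (⟨uu c b.1, uu_irr c hc b.2⟩ : Irr F n)
        have h2 := wh_uu c b.1
        rw [show ∑ i, (c i).d * b.1 i = n from b.2] at h2
        rw [h2] at h1
        have : wn (⟨uu c b.1, uu_irr c hc b.2⟩ : Irr F n) = 1 := by exact_mod_cast h1.symm
        rw [this]; simp
      have h3 := poly_count p n hn (fun g hg => ⟨⟨g, hg⟩, rfl⟩)
      rw [h2] at h1
      omega
    have hge : ∀ ρ : {ρ : Hall F ℂ // Prim n ρ}, 1 ≤ wn (⟨ρ.1, ρ.2.irr⟩ : Irr F n) := by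
      intro ρ
      have h1 := wn_spec (⟨ρ.1, ρ.2.irr⟩ : Irr F n)
      have h2 := ρ.2.wh_ne
      rw [h1] at h2
      exact Nat.one_le_iff_ne_zero.2 (fun h => h2 (by rw [h]; simp))
    have hge2 : ∑ ρ : {ρ : Hall F ℂ // Prim n ρ}, 1 ≤ ∑ ρ : {ρ : Hall F ℂ // Prim n ρ}, wn (⟨ρ.1, ρ.2.irr⟩ : Irr F n) ^ 2 :=
      Finset.sum_le_sum (fun ρ _ => Nat.one_le_pow _ _ (hge ρ))
    have hcard : ∑ ρ : {ρ : Hall F ℂ // Prim n ρ}, 1 = Nat.card {ρ : Hall F ℂ // Prim n ρ} := by simp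
    refine ⟨?_, by omega⟩
    intro ρ hρ
    have h5 := (Finset.sum_eq_sum_iff_of_le (fun (ρ : {ρ : Hall F ℂ // Prim n ρ}) _ => Nat.one_le_pow 2 _ (hge ρ))).1 (by omega) ⟨ρ, hρ⟩ (Finset.mem_univ _)
    have h6 : wn (⟨ρ, hρ.irr⟩ : Irr F n) = 1 := by
      have : wn (⟨ρ, hρ.irr⟩ : Irr F n) ^ 2 = 1 := h5.symm
      exact (Nat.pow_eq_one.1 this).resolve_right (by norm_num)
    have h7 := wn_spec (⟨ρ, hρ.irr⟩ : Irr F n)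
    rw [h6] at h7
    simpa using h7

/-- zeta identity -/
theorem KK_card (N : ℕ) [Fintype {c : Cusp F // c.d < N}] {n : ℕ} (hn : 0 < n) (hN : n < N) :
    (KK n (fun c : {c : Cusp F // c.d < N} => c.1.d)).ncard + Fintype.card F ^ (n-1) = Fintype.card F ^ n := by
  classical
  refine le_antisymm (KK_card_le (fun c : {c : Cusp F // c.d < N} => c.1) Subtype.val_injective hn) ?_
  obtain ⟨e, he⟩ := cusp_fib N (fun d _ => clm_all (F := F) d)
  haveI : Fintype {p : Pol F // p.d < N} := Fintype.ofFinite _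
  haveI : Fintype {p : Pol F // p.d < n} := Fintype.ofFinite _
  haveI : Fintype {p : Pol F // p.d = n} := Fintype.ofFinite _
  rw [KK_congr e n _ (fun p : {p : Pol F // p.d < N} => p.1.d) he]
  have h1 := poly_count (fun p : {p : Pol F // p.d < n} => p.1) n hn (fun g hg => ⟨⟨g, hg⟩, rfl⟩)
  refine le_trans h1 (Nat.add_le_add_right ?_ _)
  haveI : Finite (KK n (fun p : {p : Pol F // p.d < N} => p.1.d)) := KK_finite n (fun i => i.1.d_pos)
  haveI : Finite (KK n (fun p : {p : Pol F // p.d < n} => p.1.d)) := KK_finite n (fun i => i.1.d_pos)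
  rw [← Nat.card_coe_set_eq, ← Nat.card_coe_set_eq, ← Nat.card_sum]
  let u : {p : Pol F // p.d < n} → {p : Pol F // p.d < N} := fun x => ⟨x.1, x.2.trans hN⟩
  have hu : Function.Injective u := fun a b h => Subtype.ext (congrArg (fun x => x.1) h)
  let f1 : {p : Pol F // p.d = n} → ({p : Pol F // p.d < N} → ℕ) := fun g x => if x.1 = g.1 then 1 else 0
  let f2 : ({p : Pol F // p.d < n} → ℕ) → ({p : Pol F // p.d < N} → ℕ) := fun k x => if h : x.1.d < n then k ⟨x.1, h⟩ else 0
  have g1 : ∀ g, f1 g ∈ KK n (fun p : {p : Pol F // p.d < N} => p.1.d) := by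
    intro g
    show ∑ x : {p : Pol F // p.d < N}, x.1.d * (if x.1 = g.1 then 1 else 0) = n
    rw [Finset.sum_eq_single (⟨g.1, (show g.1.d < N by rw [g.2]; exact hN)⟩ : {p : Pol F // p.d < N})]
    · rw [if_pos rfl, mul_one]; exact g.2
    · intro b _ hb; rw [if_neg (fun h => hb (Subtype.ext h)), mul_zero]
    · intro h; exact absurd (Finset.mem_univ _) h
  have g2 : ∀ k ∈ KK n (fun p : {p : Pol F // p.d < n} => p.1.d), f2 k ∈ KK n (fun p : {p : Pol F // p.d < N} => p.1.d) := by
    intro k hk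
    rw [← show _ = n from hk]
    show ∑ x : {p : Pol F // p.d < N}, x.1.d * f2 k x = _
    symm
    refine Finset.sum_of_injOn u (hu.injOn) (by simp) ?_ ?_
    · intro x _ hx
      have : ¬ x.1.d < n := fun h => hx ⟨⟨x.1, h⟩, by simp, rfl⟩
      simp only [f2, dif_neg this, mul_zero]
    · intro x _
      simp only [f2, u, dif_pos x.2]
  refine Nat.card_le_card_of_injective (Sum.elim (fun g => (⟨f1 g, g1 g⟩ : KK n (fun p : {p : Pol F // p.d < N} => p.1.d))) (fun k => ⟨f2 k.1, g2 _ k.2⟩)) ?_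
  have hne : ∀ g k, f1 g ≠ f2 k := by
    intro g k h
    have := congrFun h ⟨g.1, (show g.1.d < N by rw [g.2]; exact hN)⟩
    simp only [f1, f2, if_pos rfl] at this
    rw [dif_neg (by rw [g.2]; exact lt_irrefl _)] at this
    exact one_ne_zero this
  rintro (a | a) (b | b) h
  · have h3 : f1 a = f1 b := congrArg Subtype.val h
    have := congrFun h3 ⟨a.1, (show a.1.d < N by rw [a.2]; exact hN)⟩
    simp only [f1, if_pos rfl] at this
    by_contra hab
    rw [if_neg (fun h => hab (congrArg _ (Subtype.ext h)))] at this
    exact one_ne_zero this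
  · exact absurd (congrArg Subtype.val h) (hne _ _)
  · exact absurd (congrArg Subtype.val h).symm (hne _ _)
  · have h3 : f2 a.1 = f2 b.1 := congrArg Subtype.val h
    congr 1
    refine Subtype.ext (funext fun x => ?_)
    have := congrFun h3 (u x)
    simp only [f2, u, dif_pos x.2] at this
    exact this

end H5
end HallGL

namespace HallGL

section I1
open PowerSeries

def tpi (N : ℕ) : PowerSeries ℤ →+* PowerSeries ℤ ⧸ Ideal.span {(PowerSeries.X : PowerSeries ℤ) ^ N} := Ideal.Quotient.mk _

theorem tpi_dvd {N : ℕ} {a b : PowerSeries ℤ} : tpi N a = tpi N b ↔ (PowerSeries.X : PowerSeries ℤ) ^ N ∣ a - b := by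
  rw [tpi, Ideal.Quotient.eq, Ideal.mem_span_singleton]

theorem tpi_iff {N : ℕ} {a b : PowerSeries ℤ} : tpi N a = tpi N b ↔ ∀ k < N, coeff k a = coeff k b := by
  rw [tpi_dvd, X_pow_dvd_iff]
  simp only [map_sub, sub_eq_zero]

/-- degree systems satisfying the zeta identity -/
structure Zs (n : ℕ) where
  ι : Type
  [ft : Fintype ι]
  d : ι → ℕ
  hd : ∀ i, 0 < d i
  q : ℤ
  z : ∀ k, 0 < k → k ≤ n → ((KK k d).ncard : ℤ) = q ^ k - q ^ (k-1)

attribute [instance] Zs.ft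

variable {n : ℕ}

theorem expand_mk_one (d : ℕ) (hd : d ≠ 0) : (expand d hd (PowerSeries.mk 1 : PowerSeries ℤ)) * (1 - PowerSeries.X ^ d) = 1 := by
  have := congrArg (expand d hd) (mk_one_mul_one_sub_eq_one (S := ℤ))
  rw [map_mul, map_sub, map_one, expand_X] at this
  exact this

theorem coeff_KK {ι : Type} [Fintype ι] (d : ι → ℕ) (hd : ∀ i, 0 < d i) (k : ℕ) :
    coeff k (∏ i, expand (d i) (hd i).ne' (PowerSeries.mk 1 : PowerSeries ℤ)) = ((KK k d).ncard : ℤ) := by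
  classical
  rw [coeff_prod]
  have h1 : ∀ l : ι →₀ ℕ, (∏ i, coeff (l i) (expand (d i) (hd i).ne' (PowerSeries.mk 1 : PowerSeries ℤ))) = if ∀ i, d i ∣ l i then 1 else 0 := by
    intro l
    simp only [coeff_expand, coeff_mk, Pi.one_apply]
    rw [Finset.prod_ite_zero]
    simp
  simp only [h1]
  rw [Finset.sum_boole]
  congr 1
  rw [← Set.ncard_coe_finset]
  symm
  refine Set.ncard_congr (fun a _ => Finsupp.equivFunOnFinite.symm (fun i => d i * a i)) ?_ ?_ ?_
  · intro a ha
    simp only [Finset.coe_filter, Finset.mem_finsuppAntidiag, Set.mem_ofPred_eq]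
    refine ⟨⟨ha, by simp⟩, fun i => ⟨a i, rfl⟩⟩
  · intro a b _ _ h
    funext i
    have := DFunLike.congr_fun h i
    simp only [Finsupp.coe_equivFunOnFinite_symm] at this
    exact Nat.eq_of_mul_eq_mul_left (hd i) this
  · intro l hl
    simp only [Finset.coe_filter, Finset.mem_finsuppAntidiag, Set.mem_ofPred_eq] at hl
    choose a ha using hl.2
    refine ⟨a, ?_, ?_⟩
    · show ∑ i, d i * a i = k
      rw [← hl.1.1]; exact Finset.sum_congr rfl (fun i _ => (ha i).symm)
    · ext i; simp [ha]

theorem zeta (s : Zs n) : tpi (n+1) ((∏ i, (1 - PowerSeries.X ^ s.d i)) * (1 - PowerSeries.X)) = tpi (n+1) (1 - PowerSeries.C s.q * PowerSeries.X) := by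
  classical
  set G := ∏ i, expand (s.d i) (s.hd i).ne' (PowerSeries.mk 1 : PowerSeries ℤ) with hG
  have h1 : (∏ i, (1 - (PowerSeries.X : PowerSeries ℤ) ^ s.d i)) * G = 1 := by
    rw [hG, ← Finset.prod_mul_distrib]
    exact Finset.prod_eq_one (fun i _ => by rw [mul_comm, expand_mk_one])
  have h0 : (KK 0 s.d).ncard = 1 := by
    rw [Set.ncard_eq_one]
    refine ⟨0, ?_⟩
    ext k
    simp only [KK, Set.mem_ofPred_eq, Set.mem_singleton_iff, Finset.sum_eq_zero_iff, Finset.mem_univ, true_implies, mul_eq_zero, (s.hd _).ne', false_or]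
    exact ⟨fun h => funext h, fun h => congrFun h⟩
  have h2 : tpi (n+1) (1 - PowerSeries.X) = tpi (n+1) (G * (1 - PowerSeries.C s.q * PowerSeries.X)) := by
    rw [tpi_iff]
    intro k hk
    have e : G * (1 - PowerSeries.C s.q * PowerSeries.X) = G - PowerSeries.C s.q * (G * PowerSeries.X) := by ring
    rw [e, map_sub, map_sub, coeff_C_mul]
    rcases k with _ | k
    · rw [coeff_zero_mul_X, hG, coeff_KK _ s.hd, h0]; simp
    · rw [coeff_succ_mul_X, hG, coeff_KK _ s.hd, coeff_KK _ s.hd, s.z (k+1) (by omega) (by omega), coeff_one, coeff_X]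
      rcases k with _ | k
      · rw [h0]; simp
      · rw [s.z (k+1) (by omega) (by omega)]
        simp
        ring
  rw [map_mul, h2, ← map_mul, ← mul_assoc, h1, one_mul]

/-- Adams-type substitution -/
def Th (q : ℤ) (d : ℕ) (hd : d ≠ 0) : PowerSeries (Polynomial ℤ) →+* PowerSeries ℤ :=
  (expand d hd : PowerSeries ℤ →ₐ[ℤ] PowerSeries ℤ).toRingHom.comp (PowerSeries.map (Polynomial.evalRingHom (q ^ d)))

theorem Th_apply (q : ℤ) (d : ℕ) (hd : d ≠ 0) (f) : Th q d hd f = expand d hd (PowerSeries.map (Polynomial.evalRingHom (q ^ d)) f) := rfl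

def Ev (q : ℤ) : PowerSeries (Polynomial ℤ) →+* PowerSeries ℤ := PowerSeries.map (Polynomial.evalRingHom q)

def Es (s : Zs n) (f : PowerSeries (Polynomial ℤ)) : PowerSeries ℤ := ∏ i, Th s.q (s.d i) (s.hd i).ne' f

theorem Es_mul (s : Zs n) (f g) : Es s (f * g) = Es s f * Es s g := by
  simp only [Es, map_mul, Finset.prod_mul_distrib]
theorem Es_one (s : Zs n) : Es s 1 = 1 := by simp [Es]

def Good (n : ℕ) (f : PowerSeries (Polynomial ℤ)) : Prop :=
  ∃ A : PowerSeries (Polynomial ℤ), constantCoeff A = 1 ∧ ∀ s : Zs n, tpi (n+1) (Es s f) = tpi (n+1) (Ev s.q A)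

theorem exists_inv (A : PowerSeries (Polynomial ℤ)) (h : constantCoeff A = 1) : ∃ B, A * B = 1 ∧ constantCoeff B = 1 :=
  ⟨invOfUnit A 1, mul_invOfUnit A 1 (by rw [h]; simp), by simp⟩

theorem Good.mul {f g : PowerSeries (Polynomial ℤ)} (hf : Good n f) (hg : Good n g) : Good n (f * g) := by
  obtain ⟨A, hA, h1⟩ := hf
  obtain ⟨B, hB, h2⟩ := hg
  exact ⟨A * B, by rw [map_mul, hA, hB, one_mul], fun s => by rw [Es_mul, map_mul, h1, h2, map_mul, map_mul]⟩

theorem Good.inv {f g : PowerSeries (Polynomial ℤ)} (hf : Good n f) (h : f * g = 1) : Good n g := by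
  obtain ⟨A, hA, h1⟩ := hf
  obtain ⟨B, hB, hB1⟩ := exists_inv A hA
  refine ⟨B, hB1, fun s => ?_⟩
  have h2 : tpi (n+1) (Es s f) * tpi (n+1) (Es s g) = 1 := by rw [← map_mul, ← Es_mul, h, Es_one, map_one]
  have h3 : tpi (n+1) (Ev s.q A) * tpi (n+1) (Ev s.q B) = 1 := by rw [← map_mul, ← map_mul, hB, map_one, map_one]
  rw [h1] at h2
  calc _ = (tpi (n+1) (Ev s.q A) * tpi (n+1) (Ev s.q B)) * tpi (n+1) (Es s g) := by rw [h3, one_mul]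
    _ = (tpi (n+1) (Ev s.q A) * tpi (n+1) (Es s g)) * tpi (n+1) (Ev s.q B) := by ring
    _ = _ := by rw [h2, one_mul]

theorem Good.triv {f : PowerSeries (Polynomial ℤ)} (h : (PowerSeries.X : PowerSeries (Polynomial ℤ)) ^ (n+1) ∣ f - 1) : Good n f := by
  refine ⟨1, by simp, fun s => ?_⟩
  rw [map_one, map_one, Es, map_prod]
  refine Finset.prod_eq_one (fun i _ => ?_)
  rw [← map_one (tpi (n+1)), tpi_dvd]
  have h1 := map_dvd (Th s.q (s.d i) (s.hd i).ne') h
  rw [map_sub, map_one, map_pow, Th_apply, PowerSeries.map_X, expand_X, ← pow_mul] at h1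
  refine dvd_trans (pow_dvd_pow _ ?_) h1
  exact Nat.le_mul_of_pos_left _ (s.hd i)

theorem Good.basic (a b : ℕ) (hb : 0 < b) : Good n (1 - PowerSeries.C (Polynomial.X ^ a) * PowerSeries.X ^ b) := by
  obtain ⟨B, hB, hB1⟩ := exists_inv (1 - PowerSeries.C (Polynomial.X ^ a) * PowerSeries.X ^ b) (by simp [hb.ne'])
  refine ⟨(1 - PowerSeries.C (Polynomial.X ^ (a+1)) * PowerSeries.X ^ b) * B, by simp [hb.ne', hB1], fun s => ?_⟩
  let σ : PowerSeries ℤ →+* PowerSeries ℤ := (expand b hb.ne' : PowerSeries ℤ →ₐ[ℤ] PowerSeries ℤ).toRingHom.comp (rescale (s.q ^ a))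
  have hσX : σ PowerSeries.X = PowerSeries.C (s.q ^ a) * PowerSeries.X ^ b := by
    show expand b hb.ne' (rescale (s.q ^ a) PowerSeries.X) = _
    rw [rescale_X, map_mul, expand_X, expand_C]
  have hσC : ∀ r, σ (PowerSeries.C r) = PowerSeries.C r := by
    intro r
    show expand b hb.ne' (rescale (s.q ^ a) (PowerSeries.C r)) = _
    have : rescale (s.q ^ a) (PowerSeries.C r) = PowerSeries.C r := by
      ext k; rw [coeff_rescale, coeff_C]; split_ifs with h
      · simp [h]
      · simp
    rw [this, expand_C]
  have hσ : ∀ x y, tpi (n+1) x = tpi (n+1) y → tpi (n+1) (σ x) = tpi (n+1) (σ y) := by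
    intro x y h
    rw [tpi_dvd] at h ⊢
    have h1 := map_dvd σ h
    rw [map_sub, map_pow, hσX, mul_pow, ← pow_mul] at h1
    refine dvd_trans (Dvd.dvd.mul_left (pow_dvd_pow _ ?_) _) h1
    exact Nat.le_mul_of_pos_left _ hb
  have h2 := hσ _ _ (zeta s)
  rw [map_mul σ, map_prod, map_sub, map_one, map_sub, map_one, map_mul σ, hσC, hσX] at h2
  have h3 : Es s (1 - PowerSeries.C (Polynomial.X ^ a) * PowerSeries.X ^ b) = ∏ i, σ (1 - PowerSeries.X ^ s.d i) := by
    refine Finset.prod_congr rfl (fun i _ => ?_)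
    rw [Th_apply, map_sub, map_one, map_mul, PowerSeries.map_C, map_pow (PowerSeries.map _), PowerSeries.map_X, map_sub, map_one, map_mul, expand_C, map_pow (expand _ _), expand_X,
      map_sub, map_one, map_pow σ, hσX, mul_pow]
    congr 2
    · rw [← map_pow]; congr 1; simp [← pow_mul, mul_comm]
    · rw [← pow_mul, ← pow_mul, mul_comm]
  have h4 : ∀ a, Ev s.q (1 - PowerSeries.C (Polynomial.X ^ a) * PowerSeries.X ^ b) = 1 - PowerSeries.C (s.q ^ a) * PowerSeries.X ^ b := by
    intro a
    rw [Ev, map_sub, map_one, map_mul, PowerSeries.map_C, map_pow (PowerSeries.map _), PowerSeries.map_X]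
    simp
  rw [← h3, map_mul, ← h4 a] at h2
  have h5 : Ev s.q (1 - PowerSeries.C (Polynomial.X ^ a) * PowerSeries.X ^ b) * Ev s.q B = 1 := by rw [← map_mul, hB, map_one]
  have h6 : 1 - PowerSeries.C s.q * (PowerSeries.C (s.q ^ a) * PowerSeries.X ^ b) = Ev s.q (1 - PowerSeries.C (Polynomial.X ^ (a+1)) * PowerSeries.X ^ b) := by
    rw [h4, ← mul_assoc, ← map_mul, pow_succ']
  rw [h6] at h2
  rw [map_mul (Ev s.q), map_mul, ← h2, mul_assoc, ← map_mul, h5, map_one, mul_one]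

def GS (n b : ℕ) (hb : 0 < b) : AddSubgroup (Polynomial ℤ) where
  carrier := {f | ∃ H, Good n H ∧ (PowerSeries.X : PowerSeries (Polynomial ℤ)) ^ (b+1) ∣ H - (1 + PowerSeries.C f * PowerSeries.X ^ b)}
  zero_mem' := ⟨1, Good.triv (by simp), by simp⟩
  add_mem' := by
    rintro f g ⟨H, hH, h1⟩ ⟨K, hK, h2⟩
    refine ⟨H * K, hH.mul hK, ?_⟩
    have : H * K - (1 + PowerSeries.C (f + g) * PowerSeries.X ^ b) = (H - (1 + PowerSeries.C f * PowerSeries.X ^ b)) * K + (1 + PowerSeries.C f * PowerSeries.X ^ b) * (K - (1 + PowerSeries.C g * PowerSeries.X ^ b)) + PowerSeries.C (f * g) * (PowerSeries.X ^ b * PowerSeries.X ^ b) := by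
      rw [map_add, map_mul]; ring
    rw [this]
    refine dvd_add (dvd_add (Dvd.dvd.mul_right h1 _) (Dvd.dvd.mul_left h2 _)) (Dvd.dvd.mul_left ?_ _)
    rw [← pow_add]; exact pow_dvd_pow _ (by omega)
  neg_mem' := by
    rintro f ⟨H, hH, h1⟩
    have hc : constantCoeff H = 1 := by
      have := X_pow_dvd_iff.1 h1 0 (by omega)
      rw [map_sub, sub_eq_zero, coeff_zero_eq_constantCoeff] at this
      rw [this]; simp [hb.ne']
    obtain ⟨K, hK, _⟩ := exists_inv H hc
    refine ⟨K, hH.inv hK, ?_⟩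
    have : K - (1 + PowerSeries.C (-f) * PowerSeries.X ^ b) = (H * K - 1) * (1 - PowerSeries.C f * PowerSeries.X ^ b) - K * (H - (1 + PowerSeries.C f * PowerSeries.X ^ b)) * (1 - PowerSeries.C f * PowerSeries.X ^ b) + K * PowerSeries.C (f * f) * (PowerSeries.X ^ b * PowerSeries.X ^ b) := by
      rw [map_neg, map_mul]; ring
    rw [this, hK, sub_self, zero_mul, zero_sub]
    refine dvd_add (dvd_neg.2 (Dvd.dvd.mul_right (Dvd.dvd.mul_left h1 _) _)) (Dvd.dvd.mul_left ?_ _)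
    rw [← pow_add]; exact pow_dvd_pow _ (by omega)

theorem GS_top (n b : ℕ) (hb : 0 < b) (f : Polynomial ℤ) : f ∈ GS n b hb := by
  induction f using Polynomial.induction_on' with
  | add p q hp hq => exact add_mem hp hq
  | monomial a c =>
    have h1 : (-(Polynomial.X ^ a) : Polynomial ℤ) ∈ GS n b hb := ⟨_, Good.basic a b hb, by rw [map_neg]; ring_nf; simp⟩
    have h2 := zsmul_mem h1 (-c)
    have : (-c) • (-(Polynomial.X ^ a) : Polynomial ℤ) = Polynomial.monomial a c := by
      rw [← Polynomial.C_mul_X_pow_eq_monomial]; simp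
    rwa [this] at h2

theorem good_all {f : PowerSeries (Polynomial ℤ)} (h : constantCoeff f = 1) : Good n f := by
  have key : ∀ k b, n + 1 - b ≤ k → 0 < b → ∀ f : PowerSeries (Polynomial ℤ), (PowerSeries.X : PowerSeries (Polynomial ℤ)) ^ b ∣ f - 1 → Good n f := by
    intro k
    induction k with
    | zero => intro b hk hb f hf; exact Good.triv (dvd_trans (pow_dvd_pow _ (by omega)) hf)
    | succ k ih =>
      intro b hk hb f hf
      obtain ⟨H, hH, h1⟩ := GS_top n b hb (coeff b f)
      have hc : constantCoeff H = 1 := by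
        have := X_pow_dvd_iff.1 h1 0 (by omega)
        rw [map_sub, sub_eq_zero, coeff_zero_eq_constantCoeff] at this
        rw [this]; simp [hb.ne']
      obtain ⟨K, hK, _⟩ := exists_inv H hc
      have h2 : (PowerSeries.X : PowerSeries (Polynomial ℤ)) ^ (b+1) ∣ f - H := by
        have h3 : (PowerSeries.X : PowerSeries (Polynomial ℤ)) ^ (b+1) ∣ f - (1 + PowerSeries.C (coeff b f) * PowerSeries.X ^ b) := by
          rw [X_pow_dvd_iff]
          intro m hm
          rw [map_sub, map_add, coeff_C_mul, coeff_X_pow]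
          by_cases hmb : m = b
          · subst hmb; rw [coeff_one, if_neg hb.ne']; simp
          · have := X_pow_dvd_iff.1 hf m (by omega)
            rw [map_sub] at this
            rw [if_neg hmb, mul_zero, add_zero, this]
        have := dvd_sub h3 h1
        rwa [sub_sub_sub_cancel_right] at this
      have h4 : Good n (f * K) := by
        refine ih (b+1) (by omega) (by omega) _ ?_
        have : f * K - 1 = (f - H) * K := by rw [sub_mul, hK]
        rw [this]; exact Dvd.dvd.mul_right h2 _
      have h5 := h4.mul hH
      rwa [mul_assoc, mul_comm K, hK, mul_one] at h5
  refine key (n+1) 1 (by omega) one_pos f ?_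
  rw [pow_one, X_dvd_iff, map_sub, h, map_one, sub_self]

end I1
end HallGL

namespace HallGL

section I2
open PowerSeries

def wt {m : ℕ} (β : Fin m → ℕ) : ℕ := ∑ j, (β j - j)
def ew {m : ℕ} (β : Fin m → ℕ) : ℕ := ∑ j : Fin m, (β j - j).choose 2

variable {n : ℕ}

theorem dd_wt {ι : Type} [Fintype ι] {m : ℕ} {d : ι → ℕ} {α : Fin m × ι → ℕ} (hα : SM α) :
    (n + ∑ p : Fin m × ι, d p.2 * p.1 = ∑ p : Fin m × ι, d p.2 * α p) ↔ ∑ i, d i * wt (fun j => α (j, i)) = n := by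
  have h : ∑ p : Fin m × ι, d p.2 * α p = ∑ i, d i * wt (fun j => α (j, i)) + ∑ p : Fin m × ι, d p.2 * p.1 := by
    have : ∑ i, d i * wt (fun j => α (j, i)) = ∑ p : Fin m × ι, d p.2 * (α p - p.1) := by
      rw [Fintype.sum_prod_type_right]
      refine Finset.sum_congr rfl (fun i _ => ?_)
      rw [wt, Finset.mul_sum]
    rw [this, ← Finset.sum_add_distrib]
    refine Finset.sum_congr rfl (fun p _ => ?_)
    rw [← mul_add, Nat.sub_add_cancel (sm_le (hα p.2) p.1)]
  rw [h]; omega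

theorem choose_le_aux (a n : ℕ) (h : a ≤ n) : 2 * a.choose 2 ≤ a * (n - 1) := by
  rw [Nat.choose_two_right, Nat.mul_div_cancel' (Nat.even_mul_pred_self a).two_dvd]
  exact Nat.mul_le_mul_left _ (by omega)

theorem lam_le {ι : Type} [Fintype ι] {m : ℕ} {d : ι → ℕ} (hd : ∀ i, 0 < d i) {β : ι → Fin m → ℕ} (h : ∑ i, d i * wt (β i) = n) (i : ι) (j : Fin m) :
    β i j - j ≤ n := by
  have h1 : d i * wt (β i) ≤ n := by
    rw [← h]; exact Finset.single_le_sum (f := fun i => d i * wt (β i)) (fun _ _ => Nat.zero_le _) (Finset.mem_univ i)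
  have h2 : β i j - j ≤ wt (β i) := Finset.single_le_sum (f := fun j : Fin m => β i j - j) (fun _ _ => Nat.zero_le _) (Finset.mem_univ j)
  have h3 := Nat.le_mul_of_pos_left (wt (β i)) (hd i)
  omega

theorem ew_le {ι : Type} [Fintype ι] {m : ℕ} {d : ι → ℕ} (hd : ∀ i, 0 < d i) {β : ι → Fin m → ℕ} (h : ∑ i, d i * wt (β i) = n) :
    ∑ i, d i * ew (β i) ≤ n.choose 2 := by
  have h1 : 2 * ∑ i, d i * ew (β i) ≤ n * (n-1) := by
    calc 2 * ∑ i, d i * ew (β i) = ∑ i, d i * (2 * ew (β i)) := by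
          rw [Finset.mul_sum]; exact Finset.sum_congr rfl (fun i _ => by ring)
      _ ≤ ∑ i, d i * (wt (β i) * (n-1)) := by
          refine Finset.sum_le_sum (fun i _ => Nat.mul_le_mul_left _ ?_)
          rw [ew, wt, Finset.mul_sum, Finset.sum_mul]
          exact Finset.sum_le_sum (fun j _ => choose_le_aux _ _ (lam_le hd h i j))
      _ = _ := by
          have : ∑ i, d i * (wt (β i) * (n-1)) = (∑ i, d i * wt (β i)) * (n-1) := by
            rw [Finset.sum_mul]; exact Finset.sum_congr rfl (fun i _ => by ring)
          rw [this, h]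
  rw [Nat.choose_two_right, Nat.le_div_iff_mul_le (by norm_num)]
  linarith

def Bt (n : ℕ) : Type := {β : Fin n → Fin (2*n+1) // StrictMono (fun j => (β j : ℕ))}
instance : Finite (Bt n) := inferInstanceAs (Finite {β : Fin n → Fin (2*n+1) // StrictMono (fun j => (β j : ℕ))})
instance : Fintype (Bt n) := Fintype.ofFinite _

def Bt.f (b : Bt n) : Fin n → ℕ := fun j => b.1 j
theorem Bt.sm (b : Bt n) : StrictMono b.f := b.2
theorem Bt.ext {b b' : Bt n} (h : b.f = b'.f) : b = b' := Subtype.ext (funext fun j => Fin.ext (congrFun h j))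

theorem Bt.ew_le (b : Bt n) : ew b.f ≤ n * wt b.f := by
  rw [ew, wt, Finset.mul_sum]
  refine Finset.sum_le_sum (fun j _ => ?_)
  have h1 : b.f j - j ≤ 2 * n := by
    have : b.f j < 2 * n + 1 := (b.1 j).2
    omega
  have := choose_le_aux (b.f j - j) (2*n+1) (by omega)
  rw [Nat.add_sub_cancel] at this
  nlinarith

def Wt (s : ℕ) (b : Bt n) : Polynomial ℤ := Polynomial.X ^ (s * (n * wt b.f - ew b.f)) * HH b.f ^ s

def Fs (n s : ℕ) : PowerSeries (Polynomial ℤ) := ∑ b : Bt n, monomial (wt b.f) (Wt s b)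

theorem HH_id : HH (fun j : Fin n => (j : ℕ)) = 1 := by
  rw [HH]
  refine Finset.prod_eq_one (fun j _ => ?_)
  rw [Finset.sdiff_eq_empty_iff_subset.2, Finset.prod_empty]
  intro k hk
  rw [Finset.mem_Icc] at hk
  rw [Finset.mem_image]
  refine ⟨⟨j - k, by omega⟩, ?_, ?_⟩
  · rw [Finset.mem_Iio, Fin.lt_def]; dsimp only; omega
  · dsimp only; omega

theorem Fs_const (s : ℕ) : constantCoeff (Fs n s) = 1 := by
  classical
  rw [Fs, map_sum]
  let b0 : Bt n := ⟨fun j => ⟨j, by omega⟩, fun i j h => h⟩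
  have hb0 : b0.f = fun j : Fin n => (j : ℕ) := rfl
  rw [Finset.sum_eq_single b0]
  · rw [← coeff_zero_eq_constantCoeff, coeff_monomial, Wt, hb0, HH_id]
    simp [wt, ew]
  · intro b _ hb
    rw [← coeff_zero_eq_constantCoeff, coeff_monomial, if_neg]
    intro h
    apply hb
    apply Bt.ext
    funext j
    have h1 := sm_le b.sm j
    have h2 : b.f j - j = 0 := (Finset.sum_eq_zero_iff.1 h.symm) j (Finset.mem_univ _)
    rw [hb0]; dsimp only; omega
  · intro h; exact absurd (Finset.mem_univ _) h

theorem Th_monomial (q : ℤ) (d : ℕ) (hd : d ≠ 0) (k : ℕ) (a : Polynomial ℤ) : Th q d hd (monomial k a) = monomial (d * k) (a.eval (q ^ d)) := by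
  have : PowerSeries.map (Polynomial.evalRingHom (q ^ d)) (monomial k a) = monomial k (a.eval (q ^ d)) := by
    ext l
    rw [coeff_map, coeff_monomial, coeff_monomial]
    split_ifs <;> simp
  rw [Th_apply, this, expand_monomial]

theorem Es_coeff (z : Zs n) (s : ℕ) [Fintype (DD n n z.d)] : coeff n (Es z (Fs n s)) =
    z.q ^ (s * (n * n - n.choose 2)) * ∑ α : DD n n z.d, (z.q ^ (n.choose 2 - ∑ i, z.d i * ew (fun j => α.1 (j, i))) *
      ∏ i, (HH (fun j => α.1 (j, i))).eval (z.q ^ z.d i)) ^ s := by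
  classical
  have h1 : Es z (Fs n s) = ∑ f : z.ι → Bt n, monomial (∑ i, z.d i * wt (f i).f) (∏ i, (Wt s (f i)).eval (z.q ^ z.d i)) := by
    rw [Es]
    simp only [Fs, map_sum, Th_monomial]
    rw [Finset.prod_univ_sum]
    simp only [Fintype.piFinset_univ, prod_monomial]
  rw [h1, map_sum]
  simp only [coeff_monomial]
  rw [← Finset.sum_filter, Finset.mul_sum]
  refine Finset.sum_bij (fun f hf => ⟨fun p => (f p.2).f p.1, fun i => (f i).sm, (dd_wt (fun i => (f i).sm)).2 (Finset.mem_filter.1 hf).2.symm⟩) ?_ ?_ ?_ ?_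
  · intro f hf; exact Finset.mem_univ _
  · intro f hf f' hf' h
    funext i
    apply Bt.ext
    funext j
    exact congrFun (Subtype.ext_iff.1 h) (j, i)
  · intro α _
    have hw := (dd_wt α.2.1).1 α.2.2
    refine ⟨fun i => ⟨fun j => ⟨α.1 (j, i), ?_⟩, α.2.1 i⟩, ?_, ?_⟩
    · have := lam_le z.hd hw i j
      have := j.2
      omega
    · exact Finset.mem_filter.2 ⟨Finset.mem_univ _, hw.symm⟩
    · rfl
  · intro f hf
    have hf := (Finset.mem_filter.1 hf).2.symm
    show _ = z.q ^ (s * (n * n - n.choose 2)) * (z.q ^ (n.choose 2 - ∑ i, z.d i * ew (f i).f) * ∏ i, (HH (f i).f).eval (z.q ^ z.d i)) ^ s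
    have hE := ew_le z.hd hf
    simp only [Wt, Polynomial.eval_mul, Polynomial.eval_pow, Polynomial.eval_X]
    rw [Finset.prod_mul_distrib, Finset.prod_pow, mul_pow, ← mul_assoc]
    congr 1
    simp only [← pow_mul]
    rw [Finset.prod_pow_eq_pow_sum, ← pow_add]
    congr 1
    have hC : n.choose 2 ≤ n * n := by
      have := choose_le_aux n n le_rfl
      have h2 : n * (n-1) ≤ n * n := Nat.mul_le_mul_left _ (by omega)
      omega
    have h3 : ∑ i, z.d i * (s * (n * wt (f i).f - ew (f i).f)) + s * ∑ i, z.d i * ew (f i).f = s * (n * n) := by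
      conv_rhs => rw [← hf]
      rw [Finset.mul_sum, ← Finset.sum_add_distrib, Finset.mul_sum, Finset.mul_sum, hf]
      refine Finset.sum_congr rfl (fun i _ => ?_)
      have h4 := Nat.sub_add_cancel (f i).ew_le
      calc _ = z.d i * s * ((n * wt (f i).f - ew (f i).f) + ew (f i).f) := by ring
        _ = _ := by rw [h4]; ring
    have h5 : s * (n * n - n.choose 2) + s * (n.choose 2 - ∑ i, z.d i * ew (f i).f) + s * ∑ i, z.d i * ew (f i).f = s * (n * n) := by
      rw [← mul_add, ← mul_add]; congr 1; omega
    rw [mul_comm (n.choose 2 - _) s]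
    omega

end I2
end HallGL

namespace HallGL

section I3

variable {n : ℕ}

/-- divisibility from values at primes -/
theorem X_pow_dvd_of (A : Polynomial ℤ) (K : ℕ) (h : ∀ p : ℕ, p.Prime → ((p : ℤ) ^ K) ∣ A.eval (p : ℤ)) : Polynomial.X ^ K ∣ A := by
  induction K with
  | zero => simp
  | succ K ih =>
    obtain ⟨B, hB⟩ := ih (fun p hp => dvd_trans (pow_dvd_pow _ (by omega)) (h p hp))
    have h1 : ∀ p : ℕ, p.Prime → (p : ℤ) ∣ B.coeff 0 := by
      intro p hp
      have h2 := h p hp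
      rw [hB, Polynomial.eval_mul, Polynomial.eval_pow, Polynomial.eval_X, pow_succ] at h2
      have h3 : (p : ℤ) ∣ B.eval (p : ℤ) := Int.dvd_of_mul_dvd_mul_left (pow_ne_zero _ (by exact_mod_cast hp.ne_zero)) h2
      have h4 : (p : ℤ) - 0 ∣ B.eval (p : ℤ) - B.eval 0 := Polynomial.sub_dvd_eval_sub _ _ _
      rw [sub_zero] at h4
      rw [Polynomial.coeff_zero_eq_eval_zero]
      exact (dvd_sub_right h3).1 h4
    have h0 : B.coeff 0 = 0 := by
      obtain ⟨p, hp1, hp⟩ := Nat.exists_infinite_primes ((B.coeff 0).natAbs + 1)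
      refine Int.eq_zero_of_dvd_of_natAbs_lt_natAbs (h1 p hp) ?_
      rw [Int.natAbs_natCast]; omega
    obtain ⟨C, hC⟩ := Polynomial.X_dvd_iff.2 h0
    exact ⟨C, by rw [hB, hC]; ring⟩

variable (F : Type) [Field F] [Fintype F]

instance cc_ft (N : ℕ) : Fintype {c : Cusp F // c.d < N} := Fintype.ofFinite _

instance cc_dec (N : ℕ) : DecidableEq {c : Cusp F // c.d < N} := Classical.decEq _

def cv (N : ℕ) : {c : Cusp F // c.d < N} → Cusp F := fun c => c.1
theorem cv_inj (N : ℕ) : Function.Injective (cv F N) := Subtype.val_injective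

def zF (n : ℕ) : Zs n where
  ι := {c : Cusp F // c.d < n+1}
  ft := cc_ft F (n+1)
  d := fun i => (cv F (n+1) i).d
  hd := fun i => i.1.prim.pos
  q := (Fintype.card F : ℤ)
  z := by
    intro k hk hkn
    have := KK_card (F := F) (n+1) hk (by omega : k < n+1)
    rw [eq_sub_iff_add_eq]
    exact_mod_cast this

def chE (n : ℕ) : DD n n (zF F n).d → Irr F n := ch (cv F (n+1)) (cv_inj F (n+1))

theorem chE_bij (n : ℕ) : Function.Bijective (chE F n) := by
  refine ⟨ch_inj _ _, fun χ => ?_⟩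
  obtain ⟨l, hl, hne⟩ := constit n (fun d _ => (clm_all (F := F) d).1) χ.1 χ.2
  have h1 := list_uu (cv F (n+1)) (cv_inj F (n+1)) l n (by rw [← hl]; exact list_le l) (fun x hx => ⟨⟨x, by
    have := list_mem_le l x hx
    omega⟩, rfl⟩)
  rw [← h1] at hne
  obtain ⟨α, hα⟩ := ch_surj (cv F (n+1)) (cv_inj F (n+1)) χ.2 (m := n) hne
  exact ⟨α, Subtype.ext hα⟩

theorem dlt_neg' (n : ℕ) (f : Hall F ℂ) : dlt n (-f) = - dlt n f := by
  rw [dlt, dlt, ← neg_div]; rfl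

theorem chE_val (n s : ℕ) (hs : Even s) (α : DD n n (zF F n).d) :
    ((Fintype.card (Aut F n) : ℂ) / (irrEquiv n (chE F n α)).1 1) ^ s =
      ((((zF F n).q ^ (n.choose 2 - ∑ i, (zF F n).d i * ew (fun j => α.1 (j, i))) *
      ∏ i, (HH (fun j => α.1 (j, i))).eval ((zF F n).q ^ (zF F n).d i)) ^ s : ℤ) : ℂ) := by
  set χ := chE F n α with hχ
  have hv : (irrEquiv n χ).1 1 = χ.1 (idc F n) := rfl
  have hG : (Fintype.card (Aut F n) : ℂ) = qq F ^ (n.choose 2) * phi (qq F) n := cG_eq n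
  have hd : χ.1 (idc F n) = dlt n χ.1 * phi (qq F) n := by rw [dlt, div_mul_cancel₀ _ (phi_ne n)]
  have hd0 := irr_dlt_ne χ.2
  have hk := dlt_hook (cv F (n+1)) α.2.1 α.2.2
  have hq : ((zF F n).q : ℂ) = qq F := by show (((Fintype.card F : ℤ)) : ℂ) = (Fintype.card F : ℂ); push_cast; rfl
  have hE : ∑ i, (zF F n).d i * ew (fun j => α.1 (j, i)) ≤ n.choose 2 := ew_le (zF F n).hd ((dd_wt α.2.1).1 α.2.2)
  set E := ∑ i, (zF F n).d i * ew (fun j => α.1 (j, i)) with hEd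
  have hR : ∏ i, (qq F ^ (cv F (n+1) i).d) ^ (∑ j : Fin n, (α.1 (j, i) - j).choose 2) = qq F ^ E := by
    simp only [← pow_mul]
    rw [Finset.prod_pow_eq_pow_sum]
    rfl
  obtain ⟨H, hH⟩ : ∃ H : ℂ, H = ∏ i, Polynomial.aeval (qq F ^ (cv F (n+1) i).d) (HH (fun j => α.1 (j, i))) := ⟨_, rfl⟩
  obtain ⟨T, hk, hT⟩ : ∃ T : Hall F ℂ, dlt n T * H = qq F ^ E ∧ (T = χ.1 ∨ T = -χ.1) :=
    ⟨SS (cv F (n+1)) α.1, by rw [hH]; exact hk.trans hR, ch_spec (cv F (n+1)) (cv_inj F (n+1)) α⟩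
  have hH' : ((∏ i, (HH (fun j => α.1 (j, i))).eval ((zF F n).q ^ (zF F n).d i) : ℤ) : ℂ) = H := by
    rw [hH]
    push_cast
    refine Finset.prod_congr rfl (fun i _ => ?_)
    rw [← hq, ← Int.cast_pow, Polynomial.aeval_def, Polynomial.eval₂_eq_eval_map]
    have := Polynomial.eval_intCast_map (Int.castRingHom ℂ) (HH (fun j => α.1 (j, i))) ((zF F n).q ^ (zF F n).d i)
    exact this.symm
  rw [Int.cast_pow, Int.cast_mul, hH', Int.cast_pow, hq, hv, hd, hG, mul_div_mul_right _ _ (phi_ne n)]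
  have hs2 : (dlt n T) ^ s = (dlt n χ.1) ^ s := by
    rcases hT with h | h
    · rw [h]
    · rw [h, dlt_neg', hs.neg_pow]
  rw [div_pow, div_eq_iff (pow_ne_zero _ hd0), ← hs2, ← mul_pow]
  congr 1
  rw [mul_assoc, mul_comm H, hk, ← pow_add, Nat.sub_add_cancel hE]

theorem main_count (g n : ℕ) (hg : 1 ≤ g) : ∃ A : Polynomial ℤ, ∀ (F : Type) [Field F] [Fintype F], ∃ S : ℤ,
    (Nat.card {p : (Fin g → Aut F n) × (Fin g → Aut F n) //
            (List.ofFn fun i => p.1 i * p.2 i * (p.1 i)⁻¹ * (p.2 i)⁻¹).prod = 1} : ℤ) = (Nat.card (Aut F n) : ℤ) * S ∧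
    A.eval (Fintype.card F : ℤ) = (Fintype.card F : ℤ) ^ ((2*g-2) * (n * n - n.choose 2)) * S := by
  classical
  obtain ⟨A, hA, h⟩ := good_all (n := n) (Fs_const (n := n) (2*g-2))
  refine ⟨PowerSeries.coeff n A, fun F _ _ => ?_⟩
  have hfin : (DD n n (zF F n).d).Finite := DD_finite _ _ (zF F n).hd
  haveI : Fintype (DD n n (zF F n).d) := hfin.fintype
  have h1 := Es_coeff (zF F n) (2*g-2)
  have h2 := tpi_iff.1 (h (zF F n)) n (by omega)
  rw [h1] at h2
  refine ⟨∑ α : DD n n (zF F n).d, ((zF F n).q ^ (n.choose 2 - ∑ i, (zF F n).d i * ew (fun j => α.1 (j, i))) *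
      ∏ i, (HH (fun j => α.1 (j, i))).eval ((zF F n).q ^ (zF F n).d i)) ^ (2*g-2), ?_, ?_⟩
  rotate_left 1
  · have h3 : PowerSeries.coeff n (Ev (zF F n).q A) = (PowerSeries.coeff n A).eval (zF F n).q := by
      rw [Ev, PowerSeries.coeff_map]; rfl
    rw [h3] at h2
    exact h2.symm
  · have hf := frobenius (G := Aut F n) g hg
    rw [← Int.cast_inj (α := ℂ)]
    rw [Int.cast_natCast, hf, Int.cast_mul, Int.cast_natCast, Nat.card_eq_fintype_card]
    congr 1
    rw [Int.cast_sum, ← Equiv.sum_comp (irrEquiv n), ← Function.Bijective.sum_comp (chE_bij F n)]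
    refine Finset.sum_congr rfl (fun α _ => ?_)
    exact chE_val F n _ ⟨g-1, by omega⟩ α

theorem transport {G H : Type} [Group G] [Group H] (e : G ≃* H) (g : ℕ) :
    Nat.card {p : (Fin g → G) × (Fin g → G) // (List.ofFn fun i => p.1 i * p.2 i * (p.1 i)⁻¹ * (p.2 i)⁻¹).prod = 1} =
    Nat.card {p : (Fin g → H) × (Fin g → H) // (List.ofFn fun i => p.1 i * p.2 i * (p.1 i)⁻¹ * (p.2 i)⁻¹).prod = 1} := by
  refine Nat.card_congr (Equiv.subtypeEquiv (Equiv.prodCongr (Equiv.arrowCongr (Equiv.refl _) e.toEquiv) (Equiv.arrowCongr (Equiv.refl _) e.toEquiv)) ?_)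
  intro p
  have : (List.ofFn fun i => e (p.1 i) * e (p.2 i) * (e (p.1 i))⁻¹ * (e (p.2 i))⁻¹).prod = e (List.ofFn fun i => p.1 i * p.2 i * (p.1 i)⁻¹ * (p.2 i)⁻¹).prod := by
    rw [map_list_prod, List.map_ofFn]
    congr 2
    funext i
    simp
  show _ ↔ (List.ofFn fun i => e (p.1 i) * e (p.2 i) * (e (p.1 i))⁻¹ * (e (p.2 i))⁻¹).prod = 1
  rw [this, map_eq_one_iff e e.injective]

theorem final (g n : ℕ) (hg : 1 ≤ g) :
    ∃ P : Polynomial ℤ,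
      ∀ (F : Type) [Field F] [Fintype F],
        (Nat.card {p : (Fin g → GL (Fin n) F) × (Fin g → GL (Fin n) F) //
            (List.ofFn fun i => p.1 i * p.2 i * (p.1 i)⁻¹ * (p.2 i)⁻¹).prod = 1} : ℤ)
          = (Nat.card (GL (Fin n) F) : ℤ) * P.eval (Fintype.card F : ℤ) := by
  obtain ⟨A, hA⟩ := main_count g n hg
  have hdvd : Polynomial.X ^ ((2*g-2) * (n * n - n.choose 2)) ∣ A := by
    refine X_pow_dvd_of A _ (fun p hp => ?_)
    haveI := Fact.mk hp
    obtain ⟨S, _, h2⟩ := hA (ZMod p)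
    rw [ZMod.card] at h2
    exact ⟨S, h2⟩
  obtain ⟨P, hP⟩ := hdvd
  refine ⟨P, fun F _ _ => ?_⟩
  obtain ⟨S, h1, h2⟩ := hA F
  rw [hP, Polynomial.eval_mul, Polynomial.eval_pow, Polynomial.eval_X] at h2
  have h3 := mul_left_cancel₀ (pow_ne_zero _ (by exact_mod_cast Fintype.card_ne_zero)) h2
  rw [transport (glEquiv n) g, Nat.card_congr (glEquiv (F := F) n).toEquiv, h1, h3]

end I3
end HallGL

end

open scoped MatrixGroups

/-- For `g ≥ 1` and `n ≥ 1` there is a polynomial `P ∈ ℤ[X]` such that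
for every finite field `F_q` the number of `2g`-tuples in `GL(n,F_q)^{2g}` with
`[x₁,y₁]⋯[x_g,y_g] = Iₙ` (i.e. the number of homomorphisms from the fundamental group of
a closed genus-`g` surface to `GL(n,F_q)`) equals `|GL(n,F_q)| · P(q)`. -/
theorem statement15 (g n : ℕ) (hg : 1 ≤ g) (hn : 1 ≤ n) :
    ∃ P : Polynomial ℤ,
      ∀ (F : Type) [Field F] [Fintype F],
        (Nat.card {p : (Fin g → GL (Fin n) F) × (Fin g → GL (Fin n) F) //
            (List.ofFn fun i => p.1 i * p.2 i * (p.1 i)⁻¹ * (p.2 i)⁻¹).prod = 1} : ℤ)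
          = (Nat.card (GL (Fin n) F) : ℤ) * P.eval (Fintype.card F : ℤ) := by
  exact HallGL.final g n hg
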